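/- Let d ≥ 2 be an integer, let T be a positive integer with the diagonal moment property for degree d, and let s ≥ 2T+1 be an integer. Let h be an integer polynomial of degree d, let a₁,…,a_s be non-zero integers, and suppose a₁+⋯+a_s = 0 and b = 0. Then for every real δ > 0 there exist a real number c₂ = c₂(h; a₁,…,a_s; δ) > 0 and a positive integer N₂ = N₂(h; a₁,…,a_s; δ) such that for every integer N ≥ N₂ and every set A ⊆ 𝒫_N with |A| ≥ δ|𝒫_N|, one has |S(A)| ≥ c₂ N^{−d} (N/log N)^s. -/

import Mathlib

open Finset

/-- `T` has the diagonal moment property for degree `d`. -/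
def DiagonalMomentProperty (d T : ℕ) : Prop :=
  ∀ g : Polynomial ℤ, g.natDegree = d → ∀ ε : ℝ, 0 < ε →
    ∃ C : ℝ, 0 < C ∧ ∀ X : ℕ, 1 ≤ X →
      (((Fintype.piFinset fun _ : Fin (2 * T) => Finset.Icc 1 X).filter
          (fun x => (∑ i : Fin T, g.eval (x ⟨i.1, by have := i.isLt; omega⟩ : ℤ))
                  = ∑ i : Fin T, g.eval (x ⟨T + i.1, by have := i.isLt; omega⟩ : ℤ))).card : ℝ)
        ≤ C * (X : ℝ) ^ ((2 * T : ℝ) - (d : ℝ) + ε)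

/-- The set of primes `p ≤ N`. -/
def primesUpTo (N : ℕ) : Finset ℕ := (Finset.range (N + 1)).filter Nat.Prime

/-- `S(𝒜)`: tuples in `𝒜^s` with pairwise distinct coordinates solving
`a₁h(x₁)+⋯+a_sh(x_s) = 0`. -/
def solSet (s : ℕ) (a : Fin s → ℤ) (h : Polynomial ℤ) (A : Finset ℕ) :
    Finset (Fin s → ℕ) :=
  (Fintype.piFinset fun _ : Fin s => A).filter
    (fun x => (∀ i j : Fin s, i ≠ j → x i ≠ x j) ∧ ∑ i, a i * h.eval (x i : ℤ) = 0)

section Proof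

open scoped ComplexConjugate Polynomial Real
open Polynomial (eval_intCast_map sub_dvd_eval_sub taylor taylor_coeff hasseDeriv eval_eq_sum_range' coeff_sub coeff_eq_zero_of_natDegree_lt eval_sub taylor_eval eval_prod eval_X eval_C natDegree_taylor comp_C_mul_X_coeff coeff_map le_natDegree_of_ne_zero natDegree_map_le taylor_apply coeff_natDegree C_dvd_iff_dvd_coeff coeff_C_mul coeff_derivative natDegree_C_mul_le eval_mul leadingCoeff)
open Real (norm_eq_abs pi_pos rpow_natCast rpow_mul rpow_neg rpow_one mul_rpow log one_le_rpow log_le_log log_pos rpow_add rpow_le_rpow_of_exponent_le rpow_nonneg norm_of_nonneg rpow_le_rpow)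
open Complex (norm_real normSq_eq_norm_sq ofReal_sum ofReal_sub ofReal_mul ofReal_natCast)
open Filter (atTop eventually_ge_atTop eventually_atTop Tendsto)
open Nat (Coprime mod_lt mod_eq_of_lt le_floor cast_div_le floor_le le_ceil div_add_mod le_of_dvd totient)
open Int (castRingHom cast_natCast)

/-- additive character on the reals -/
noncomputable def ee (t : ℝ) : ℂ := Complex.exp ((2 * π * t : ℝ) * Complex.I)

/-- distance to the nearest integer -/
noncomputable def nn (t : ℝ) : ℝ := |t - round t|

lemma ee_add (s t : ℝ) : ee (s + t) = ee s * ee t := by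
  unfold ee; rw [← Complex.exp_add]; congr 1; push_cast; ring

lemma ee_zero : ee 0 = 1 := by simp [ee]

lemma norm_ee (t : ℝ) : ‖ee t‖ = 1 := by
  unfold ee; exact Complex.norm_exp_ofReal_mul_I _

lemma ee_neg_conj (t : ℝ) : ee (-t) = (starRingEnd ℂ) (ee t) := by
  unfold ee; rw [← Complex.exp_conj, map_mul, Complex.conj_ofReal, Complex.conj_I]; congr 1; push_cast; ring

lemma ee_sub (s t : ℝ) : ee (s - t) = ee s * (starRingEnd ℂ) (ee t) := by
  rw [sub_eq_add_neg, ee_add, ee_neg_conj]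

lemma ee_int (n : ℤ) : ee n = 1 := by
  unfold ee; rw [Complex.exp_eq_one_iff]; exact ⟨n, by push_cast; ring⟩

lemma ee_add_int (t : ℝ) (n : ℤ) : ee (t + n) = ee t := by rw [ee_add, ee_int, mul_one]

lemma ee_sub_int (t : ℝ) (n : ℤ) : ee (t - n) = ee t := by
  have := ee_add_int (t - n) n
  rw [← this]; simp

lemma ee_eq_of_sub_int {s t : ℝ} (n : ℤ) (h : s - t = n) : ee s = ee t := by
  have : s = t + n := by linarith
  rw [this, ee_add_int]

lemma ee_nat_mul (n : ℕ) (t : ℝ) : ee (n * t) = ee t ^ n := by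
  induction n with
  | zero => simp [ee_zero]
  | succ n ih => rw [pow_succ, ← ih, ← ee_add]; congr 1; push_cast; ring

lemma norm_ee_sub_one (t : ℝ) : ‖ee t - 1‖ = 2 * |Real.sin (π * t)| := by
  have h : ee t - 1 = Complex.I * ((2 * Real.sin (π * t) : ℝ) : ℂ) * ee (t / 2) := by
    unfold ee
    rw [Complex.exp_mul_I, Complex.exp_mul_I]
    rw [← Complex.ofReal_cos, ← Complex.ofReal_sin, ← Complex.ofReal_cos, ← Complex.ofReal_sin]
    have e1 : 2 * π * (t / 2) = π * t := by ring
    have e2 : 2 * π * t = 2 * (π * t) := by ring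
    rw [e1, e2, Real.cos_two_mul, Real.sin_two_mul]
    have hs := Real.sin_sq_add_cos_sq (π * t)
    generalize Real.sin (π * t) = S at *
    generalize Real.cos (π * t) = C at *
    have hC : ((C ^ 2 : ℝ) : ℂ) = ((1 - S ^ 2 : ℝ) : ℂ) := by congr 1; linarith
    push_cast at hC ⊢
    have hI := Complex.I_sq
    linear_combination 2 * hC - 2 * (S:ℂ)^2 * hI
  rw [h, norm_mul, norm_mul, norm_ee, Complex.norm_I, norm_real, norm_eq_abs, abs_mul]
  simp

lemma norm_ee_sub_one_le (t : ℝ) : ‖ee t - 1‖ ≤ 2 * π * |t| := by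
  rw [norm_ee_sub_one]
  have := Real.abs_sin_le_abs (x := π * t)
  rw [abs_mul, abs_of_pos pi_pos] at this
  linarith

lemma nn_nonneg (t : ℝ) : 0 ≤ nn t := abs_nonneg _
lemma nn_le_half (t : ℝ) : nn t ≤ 1 / 2 := abs_sub_round t
lemma nn_le_abs_sub (t : ℝ) (n : ℤ) : nn t ≤ |t - n| := round_le t n

lemma nn_exists (t : ℝ) : ∃ n : ℤ, nn t = |t - n| := ⟨round t, rfl⟩

lemma nn_add_int (t : ℝ) (n : ℤ) : nn (t + n) = nn t := by
  unfold nn; rw [round_add_intCast]; push_cast; ring_nf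

lemma nn_neg (t : ℝ) : nn (-t) = nn t := by
  apply le_antisymm
  · have := nn_le_abs_sub (-t) (-round t)
    refine this.trans (le_of_eq ?_)
    unfold nn; rw [← abs_neg]; congr 1; push_cast; ring
  · have := nn_le_abs_sub t (-round (-t))
    refine this.trans (le_of_eq ?_)
    unfold nn; rw [← abs_neg]; congr 1; push_cast; ring

lemma nn_add_le (s t : ℝ) : nn (s + t) ≤ nn s + nn t := by
  refine (nn_le_abs_sub (s + t) (round s + round t)).trans ?_
  unfold nn
  refine le_trans (le_of_eq ?_) (abs_add_le (s - round s) (t - round t))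
  congr 1; push_cast; ring

lemma nn_sub_le (s t : ℝ) : nn (s - t) ≤ nn s + nn t := by
  have := nn_add_le s (-t); rwa [nn_neg, ← sub_eq_add_neg] at this

lemma nn_nat_mul_le (n : ℕ) (t : ℝ) : nn (n * t) ≤ n * nn t := by
  induction n with
  | zero => simp [nn]
  | succ n ih =>
    have : ((n + 1 : ℕ) : ℝ) * t = n * t + t := by push_cast; ring
    rw [this]; refine (nn_add_le _ _).trans ?_; push_cast; linarith

lemma nn_eq_abs {t : ℝ} (h : |t| < 1 / 2) : nn t = |t| := by
  have : round t = 0 := by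
    rw [round_eq]; rw [abs_lt] at h
    rw [Int.floor_eq_iff]; constructor <;> push_cast <;> linarith
  simp [nn, this]

lemma norm_ee_sub_one_ge (t : ℝ) : 4 * nn t ≤ ‖ee t - 1‖ := by
  obtain ⟨n, hn⟩ := nn_exists t
  rw [← ee_sub_int t n, hn, norm_ee_sub_one]
  have h2 : |t - n| ≤ 1 / 2 := hn ▸ nn_le_half t
  have h3 := Real.mul_abs_le_abs_sin (x := π * (t - n)) (by
    rw [abs_mul, abs_of_pos pi_pos]; nlinarith [pi_pos])
  rw [abs_mul, abs_of_pos pi_pos] at h3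
  have h4 : 2 / π * (π * |t - n|) = 2 * |t - n| := by
    field_simp
  rw [h4] at h3; linarith

/-- geometric sum bound -/
lemma geom_bound (t : ℝ) (n : ℕ) (ht : 0 < nn t) :
    ‖∑ m ∈ range n, ee (m * t)‖ ≤ 1 / (2 * nn t) := by
  have h1 : ∑ m ∈ range n, ee (m * t) = ∑ m ∈ range n, ee t ^ m :=
    sum_congr rfl fun m _ => ee_nat_mul m t
  have h0 : 0 < ‖ee t - 1‖ := lt_of_lt_of_le (by linarith) (norm_ee_sub_one_ge t)
  have hne : ee t ≠ 1 := by intro h; rw [h] at h0; simp at h0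
  rw [h1, geom_sum_eq hne, norm_div, div_le_div_iff₀ h0 (by linarith)]
  have : ‖ee t ^ n - 1‖ ≤ 2 := by
    refine (norm_sub_le _ _).trans ?_
    rw [norm_pow, norm_ee]; norm_num
  have h4 := norm_ee_sub_one_ge t
  nlinarith [nn_nonneg t]

/-- averages -/
noncomputable def avg (n : ℕ) (f : ℕ → ℂ) : ℂ := (∑ y ∈ range n, f y) / n

lemma sum_range_mul {M : Type*} [AddCommMonoid M] (m n : ℕ) (f : ℕ → M) :
    ∑ y ∈ range (m * n), f y = ∑ i ∈ range n, ∑ y ∈ range m, f (m * i + y) := by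
  induction n with
  | zero => simp
  | succ n ih => rw [Nat.mul_succ, sum_range_add, ih, sum_range_succ]

lemma sum_range_mul_periodic (m n : ℕ) (f : ℕ → ℂ) (hf : Function.Periodic f m) :
    ∑ y ∈ range (m * n), f y = n * ∑ y ∈ range m, f y := by
  rw [sum_range_mul]
  have : ∀ i ∈ range n, ∑ y ∈ range m, f (m * i + y) = ∑ y ∈ range m, f y := by
    intro i _; apply sum_congr rfl; intro y _
    have := hf.nat_mul i y
    rw [← this]; congr 1; simp; ring
  rw [sum_congr rfl this]; simp

lemma avg_mul_periodic (m n : ℕ) (hn : n ≠ 0) (f : ℕ → ℂ) (hf : Function.Periodic f m) :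
    avg (m * n) f = avg m f := by
  unfold avg; rw [sum_range_mul_periodic m n f hf]
  have : (n : ℂ) ≠ 0 := mod_cast hn
  push_cast
  rw [mul_comm (m:ℂ), mul_div_mul_left _ _ this]

lemma norm_avg_le (n : ℕ) (f : ℕ → ℂ) (B : ℝ) (hB : 0 ≤ B) (hf : ∀ y, ‖f y‖ ≤ B) :
    ‖avg n f‖ ≤ B := by
  unfold avg
  rw [norm_div, Complex.norm_natCast]
  rcases Nat.eq_zero_or_pos n with h | h
  · simp [h, hB]
  · rw [div_le_iff₀ (mod_cast h)]
    refine (norm_sum_le _ _).trans ?_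
    refine (sum_le_sum fun y _ => hf y).trans ?_
    simp [mul_comm]

lemma periodic_mod {m : ℕ} {f : ℕ → ℂ} (hf : Function.Periodic f m) (y : ℕ) : f (y % m) = f y :=
  hf.map_mod_nat y

lemma avg_indep (m n : ℕ) (hm : m ≠ 0) (hn : n ≠ 0) (hc : Coprime m n) (f g : ℕ → ℂ)
    (hf : Function.Periodic f m) (hg : Function.Periodic g n) :
    avg (m * n) (fun y => f y * g y) = avg m f * avg n g := by
  unfold avg
  have key : ∑ y ∈ range (m * n), f y * g y = (∑ y ∈ range m, f y) * (∑ y ∈ range n, g y) := by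
    rw [sum_mul_sum, ← sum_product']
    refine sum_bij (fun y _ => (y % m, y % n)) ?_ ?_ ?_ ?_
    · intro y _; simp [mod_lt _ (Nat.pos_of_ne_zero hm), mod_lt _ (Nat.pos_of_ne_zero hn)]
    · intro x hx y hy h
      simp only [Prod.mk.injEq] at h
      have h1 : x ≡ y [MOD m * n] := (Nat.modEq_and_modEq_iff_modEq_mul hc).1 ⟨h.1, h.2⟩
      exact Nat.ModEq.eq_of_lt_of_lt h1 (mem_range.1 hx) (mem_range.1 hy)
    · rintro ⟨u, v⟩ huv
      simp only [mem_product, mem_range] at huv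
      refine ⟨(Nat.chineseRemainder hc u v : ℕ), ?_, ?_⟩
      · exact mem_range.2 (Nat.chineseRemainder_lt_mul hc u v hm hn)
      · have h2 := (Nat.chineseRemainder hc u v).2
        simp only [Prod.mk.injEq]
        exact ⟨by rw [h2.1]; exact mod_eq_of_lt huv.1, by rw [h2.2]; exact mod_eq_of_lt huv.2⟩
    · intro y _; simp [periodic_mod hf, periodic_mod hg]
  rw [key]; push_cast
  rw [mul_div_mul_comm]

lemma periodic_of_dvd {m n : ℕ} (h : m ∣ n) {f : ℕ → ℂ} (hf : Function.Periodic f m) :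
    Function.Periodic f n := by
  obtain ⟨k, rfl⟩ := h
  have := hf.nat_mul k
  intro x; have := this x; rw [← this]; congr 1; simp; ring

lemma periodic_mul {n : ℕ} {f g : ℕ → ℂ} (hf : Function.Periodic f n) (hg : Function.Periodic g n) :
    Function.Periodic (fun y => f y * g y) n := by
  intro y; simp [hf y, hg y]

lemma avg_eq_of_dvd {m n : ℕ} (h : m ∣ n) (hn : n ≠ 0) (f : ℕ → ℂ) (hf : Function.Periodic f m) :
    avg n f = avg m f := by
  obtain ⟨k, rfl⟩ := h
  exact avg_mul_periodic m k (by rintro rfl; simp at hn) f hf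

lemma poly_cast_real (F : ℤ[X]) (z : ℤ) : ((F.eval z : ℤ) : ℝ) = (F.map (castRingHom ℝ)).eval (z:ℝ) := by
  rw [eval_intCast_map]; simp

lemma ee_poly_periodic (F : ℤ[X]) (a : ℤ) (q : ℕ) (hq : q ≠ 0) :
    Function.Periodic (fun y : ℕ => ee (a * (F.eval (y : ℤ) : ℤ) / q)) q := by
  intro y
  have hd : ((y + q : ℕ) : ℤ) - y ∣ F.eval ((y + q : ℕ) : ℤ) - F.eval (y : ℤ) :=
    sub_dvd_eval_sub _ _ _
  obtain ⟨k, hk⟩ := hd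
  apply ee_eq_of_sub_int (a * k)
  have hq' : (q : ℝ) ≠ 0 := mod_cast hq
  have hk' : ((F.eval ((y + q : ℕ) : ℤ) : ℤ) : ℝ) - ((F.eval (y : ℤ) : ℤ) : ℝ) = q * k := by
    have : F.eval ((y + q : ℕ) : ℤ) - F.eval (y : ℤ) = q * k := by rw [hk]; push_cast; ring
    exact_mod_cast this
  rw [← sub_div, ← mul_sub, hk']; push_cast; field_simp

lemma vdc_aux (z : ℕ → ℂ) (hz : ∀ n, ‖z n‖ = 1) (X : ℕ) :
    ‖∑ x ∈ range X, z x‖ ^ 2 =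
      X + 2 * (∑ x ∈ range X, ∑ y ∈ range x, z x * (starRingEnd ℂ) (z y)).re := by
  induction X with
  | zero => simp
  | succ n ih =>
    rw [sum_range_succ, sum_range_succ (fun x => ∑ y ∈ range x, z x * (starRingEnd ℂ) (z y))]
    rw [← normSq_eq_norm_sq, Complex.normSq_add, normSq_eq_norm_sq, ih,
      normSq_eq_norm_sq, hz, ← mul_sum, ← map_sum, Complex.add_re]
    have : ((∑ x ∈ range n, z x) * (starRingEnd ℂ) (z n)).re
        = (z n * (starRingEnd ℂ) (∑ x ∈ range n, z x)).re := by
      rw [← Complex.conj_re]; simp [mul_comm]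
    rw [this]; push_cast; ring

lemma vdc_reindex (f : ℕ → ℕ → ℂ) (X : ℕ) :
    ∑ x ∈ range X, ∑ y ∈ range x, f x y =
      ∑ h ∈ Ico 1 X, ∑ y ∈ range (X - h), f (y + h) y := by
  rw [sum_sigma', sum_sigma']
  refine sum_bij' (fun p _ => ⟨p.1 - p.2, p.2⟩) (fun p _ => ⟨p.2 + p.1, p.2⟩) ?_ ?_ ?_ ?_ ?_
  · rintro ⟨x, y⟩ h; simp at h ⊢; omega
  · rintro ⟨x, y⟩ h; simp at h ⊢; omega
  · rintro ⟨x, y⟩ h; simp at h ⊢; omega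
  · rintro ⟨x, y⟩ h; simp at h ⊢
  · rintro ⟨x, y⟩ h; simp at h ⊢; congr 1; omega

lemma vdc (z : ℕ → ℂ) (hz : ∀ n, ‖z n‖ = 1) (X : ℕ) :
    ‖∑ x ∈ range X, z x‖ ^ 2 ≤
      X + 2 * ∑ h ∈ Ico 1 X, ‖∑ y ∈ range (X - h), z (y + h) * (starRingEnd ℂ) (z y)‖ := by
  rw [vdc_aux z hz, vdc_reindex]
  have := (Complex.re_le_norm _).trans (norm_sum_le (Ico 1 X)
    (fun h => ∑ y ∈ range (X - h), z (y + h) * (starRingEnd ℂ) (z y)))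
  linarith

lemma card_le_of_spread (S : Finset ℕ) (d : ℕ) (hd : 0 < d) (t : ℝ) (ht : 0 ≤ t)
    (h : ∀ x ∈ S, ∀ y ∈ S, x ≤ y → x % d = y % d ∧ (y - x : ℝ) ≤ d * t) :
    (S.card : ℝ) ≤ t + 1 := by
  rcases S.eq_empty_or_nonempty with rfl | hS
  · simp; linarith
  have hm := S.min'_mem hS
  set m := S.min' hS
  have h1 : S.card ≤ (range (⌊t⌋₊ + 1)).card := by
    apply card_le_card_of_injOn (fun x => (x - m) / d)
    · intro x hx
      have hx' : x ∈ S := hx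
      have hmx : m ≤ x := S.min'_le x hx'
      have h2 := (h m hm x hx' hmx).2
      simp only [coe_range, Set.mem_Iio]
      rw [Nat.lt_succ_iff]
      apply le_floor
      have : (((x - m) / d : ℕ) : ℝ) ≤ ((x - m : ℕ) : ℝ) / d := cast_div_le
      refine this.trans ?_
      rw [div_le_iff₀ (mod_cast hd)]
      rw [Nat.cast_sub hmx]; linarith
    · intro x hx y hy hxy
      have hx' : x ∈ S := hx
      have hy' : y ∈ S := hy
      have hmx : m ≤ x := S.min'_le x hx'
      have hmy : m ≤ y := S.min'_le y hy'
      have e1 := (h m hm x hx' hmx).1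
      have e2 := (h m hm y hy' hmy).1
      simp only at hxy
      have d1 : d ∣ x - m := (Nat.modEq_iff_dvd' hmx).1 e1
      have d2 : d ∣ y - m := (Nat.modEq_iff_dvd' hmy).1 e2
      have := Nat.div_mul_cancel d1
      have := Nat.div_mul_cancel d2
      rw [hxy] at *; omega
  rw [card_range] at h1
  have h3 := floor_le ht
  have h4 : (S.card : ℝ) ≤ ((⌊t⌋₊ + 1 : ℕ) : ℝ) := mod_cast h1
  push_cast at h4; linarith

lemma recurrence (H : Finset ℕ) (X : ℕ) (hH : H ⊆ range X) (D ε θ : ℝ) (hD : 1 ≤ D) (hε : 0 ≤ ε)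
    (hc : (X : ℝ) ≤ D * H.card) (hn : ∀ h ∈ H, nn (h * θ) ≤ ε) (hεD : ε ≤ 1 / (64 * D))
    (hX : 12 * D ^ 2 < X) :
    ∃ d : ℕ, 1 ≤ d ∧ (d : ℝ) ≤ 3 * D ∧ nn (d * θ) ≤ 12 * D ^ 2 * ε / X := by
  have hX0 : (0 : ℝ) < X := by nlinarith
  -- find close pair
  obtain ⟨d, hd1, hd2, hd3⟩ : ∃ d : ℕ, 1 ≤ d ∧ (d : ℝ) ≤ 3 * D ∧ nn (d * θ) ≤ 2 * ε := by
    set B := ⌈2 * D⌉₊ with hB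
    have hB1 : 2 * D ≤ B := le_ceil _
    have hB2 : (B : ℝ) ≤ 3 * D := by
      have := Nat.ceil_lt_add_one (a := 2 * D) (by linarith); linarith
    have hB0 : 0 < B := by
      have : (0:ℝ) < B := by linarith
      exact_mod_cast this
    have hlt : (range (X / B + 1)).card < H.card := by
      rw [card_range]
      have h1 : ((X / B : ℕ) : ℝ) ≤ (X : ℝ) / B := cast_div_le
      have h2 : (X : ℝ) / B ≤ X / (2 * D) := by gcongr
      have h3 : (X : ℝ) / D ≤ H.card := by rw [div_le_iff₀ (by linarith)]; linarith
      have h4 : (1:ℝ) < X / (2 * D) := by rw [lt_div_iff₀ (by linarith)]; nlinarith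
      have h5 : (X : ℝ) / D = X / (2 * D) + X / (2 * D) := by field_simp; ring
      have : ((X / B + 1 : ℕ) : ℝ) < H.card := by push_cast; linarith
      exact_mod_cast this
    obtain ⟨x, hx, y, hy, hne, hxy⟩ := exists_ne_map_eq_of_card_lt_of_maps_to hlt (f := fun x => x / B)
      (by
        intro x hx
        have := mem_range.1 (hH hx)
        simp only [coe_range, Set.mem_Iio]
        exact Nat.lt_succ_of_le (Nat.div_le_div_right this.le))
    wlog hlt2 : x < y generalizing x y
    · exact this y hy x hx hne.symm hxy.symm (by omega)
    refine ⟨y - x, by omega, ?_, ?_⟩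
    · have h1 : y - x ≤ B := by
        have e1 := div_add_mod x B
        have e2 := div_add_mod y B
        rw [hxy] at e1
        have := mod_lt y hB0
        omega
      have : ((y - x : ℕ) : ℝ) ≤ B := mod_cast h1
      linarith
    · rw [Nat.cast_sub hlt2.le, sub_mul]
      have := nn_sub_le (y * θ) (x * θ)
      linarith [hn x hx, hn y hy]
  refine ⟨d, hd1, hd2, ?_⟩
  rcases (nn_nonneg (d * θ)).eq_or_lt with h0 | h0
  · rw [← h0]; positivity
  set β := nn (d * θ) with hβ
  set L := ⌊1 / (2 * β)⌋₊ with hL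
  have hDp : (0:ℝ) < D := by linarith
  have hε64 : 64 * D * ε ≤ 1 := by
    rw [le_div_iff₀ (by positivity)] at hεD; linarith
  have hε2 : 64 * ε ≤ 1 := by nlinarith
  have hβ1 : β ≤ 1 / 32 := by linarith
  have hL1 : 1 / (4 * β) ≤ L := by
    have := Nat.lt_floor_add_one (1 / (2 * β))
    have h2 : 1 / (2 * β) = 2 * (1 / (4 * β)) := by field_simp; ring
    have h3 : 1 ≤ 1 / (4 * β) := by rw [le_div_iff₀ (by linarith)]; linarith
    rw [← hL] at this; linarith
  have hL2 : (L : ℝ) * β ≤ 1 / 2 := by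
    have := floor_le (a := 1 / (2 * β)) (by positivity)
    rw [← hL] at this
    calc (L : ℝ) * β ≤ 1 / (2 * β) * β := by gcongr
      _ = 1 / 2 := by field_simp
  have hL0 : 0 < L := by
    have : (0:ℝ) < L := lt_of_lt_of_le (by positivity) hL1
    exact_mod_cast this
  have hdL : 0 < d * L := by positivity
  -- fibers
  have hfib : ∀ p ∈ range (X / (d * L) + 1) ×ˢ range d,
      (H.filter (fun h => (h / (d * L), h % d) = p)).card ≤ ⌊2 * ε / β + 1⌋₊ := by
    intro p _
    apply le_floor
    apply card_le_of_spread _ d hd1 _ (by positivity)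
    intro x hx y hy hxy
    simp only [mem_filter] at hx hy
    have e1 := hx.2.trans hy.2.symm
    simp only [Prod.mk.injEq] at e1
    refine ⟨e1.2, ?_⟩
    obtain ⟨j, hj⟩ := (Nat.modEq_iff_dvd' hxy).1 e1.2
    have hyx : y = x + d * j := by omega
    have hjL : j < L := by
      have e3 := div_add_mod x (d * L)
      have e4 := div_add_mod y (d * L)
      rw [e1.1] at e3
      have := mod_lt y hdL
      have h5 : d * j < d * L := by omega
      exact Nat.lt_of_mul_lt_mul_left h5
    have hjL' : (j : ℝ) < L := mod_cast hjL
    have hjb : (j : ℝ) * β < 1 / 2 := by nlinarith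
    obtain ⟨m, hm⟩ := nn_exists (d * θ)
    have h6 : nn (j * (d * θ)) = j * β := by
      have h7 : (j:ℝ) * (d * θ) = j * (d * θ - m) + ((j * m : ℤ) : ℝ) := by push_cast; ring
      rw [h7, nn_add_int, nn_eq_abs, abs_mul, ← hm]
      · simp [hβ]
      · rw [abs_mul, ← hm]; simpa [hβ] using hjb
    have h8 : nn (j * (d * θ)) ≤ 2 * ε := by
      have h9 : (j:ℝ) * (d * θ) = y * θ - x * θ := by rw [hyx]; push_cast; ring
      rw [h9]
      linarith [nn_sub_le (y * θ) (x * θ), hn x hx.1, hn y hy.1]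
    rw [h6] at h8
    have h10 : (j:ℝ) ≤ 2 * ε / β := by rw [le_div_iff₀ h0]; exact h8
    have : (y:ℝ) - x = d * j := by rw [hyx]; push_cast; ring
    rw [this]; gcongr
  have hcard := card_le_mul_card_image_of_maps_to (s := H) (f := fun h => (h / (d * L), h % d))
    (t := range (X / (d * L) + 1) ×ˢ range d) (by
      intro x hx
      have := mem_range.1 (hH hx)
      rw [mem_product, mem_range, mem_range]
      exact ⟨Nat.lt_succ_of_le (Nat.div_le_div_right this.le), mod_lt _ hd1⟩) _ hfib
  rw [card_product, card_range, card_range] at hcard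
  have hc2 : (H.card : ℝ) ≤ (2 * ε / β + 1) * ((X / (d * L) + 1) * d) := by
    have h1 : (H.card : ℝ) ≤ (⌊2 * ε / β + 1⌋₊ : ℝ) * (((X / (d * L) : ℕ) + 1) * d) := by
      exact_mod_cast hcard
    refine h1.trans ?_
    have h2 := floor_le (a := 2 * ε / β + 1) (by positivity)
    have h3 : ((X / (d * L) : ℕ) : ℝ) ≤ (X : ℝ) / ((d * L : ℕ) : ℝ) := cast_div_le
    push_cast at h3
    gcongr
  have hd0 : (0:ℝ) < d := mod_cast hd1
  have hL0' : (0:ℝ) < L := mod_cast hL0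
  have e1 : ((X:ℝ) / (d * L) + 1) * d = X / L + d := by field_simp
  have e2 : (X:ℝ) / L ≤ 4 * β * X := by
    rw [div_le_iff₀ hL0']
    have : 1 ≤ 4 * β * L := by
      rw [div_le_iff₀ (by positivity)] at hL1; linarith
    nlinarith
  rw [e1] at hc2
  have hc3 : (H.card : ℝ) ≤ (2 * ε / β + 1) * (4 * β * X + d) := hc2.trans (by gcongr)
  have e3 : (2 * ε / β + 1) * (4 * β * X + d) = 8 * ε * X + 4 * β * X + 2 * ε * d / β + d := by
    field_simp; ring
  rw [e3] at hc3
  -- now D * everything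
  have hc4 : (X:ℝ) ≤ D * (16 * ε * X + 2 * ε * d / β + d) := by
    refine hc.trans ?_
    gcongr
    nlinarith
  have e4 : D * (16 * ε * X) ≤ X / 4 := by nlinarith
  have e5 : D * d ≤ X / 4 := by nlinarith
  have e6 : (X:ℝ) / 2 ≤ D * (2 * ε * d / β) := by nlinarith
  have e7 : D * (2 * ε * d / β) ≤ D * (2 * ε * (3 * D) / β) := by gcongr
  have e8 : D * (2 * ε * (3 * D) / β) = 6 * D ^ 2 * ε / β := by field_simp; ring
  have e9 : (X:ℝ) / 2 ≤ 6 * D ^ 2 * ε / β := by linarith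
  rw [le_div_iff₀ h0] at e9
  rw [le_div_iff₀ hX0]; linarith

def WeylP (k C : ℕ) : Prop := ∀ P : Polynomial ℝ, P.natDegree ≤ k → ∀ X : ℕ, 1 ≤ X → ∀ D : ℝ, 1 ≤ D →
    (X : ℝ) ≤ D * ‖∑ x ∈ range X, ee (P.eval (x : ℝ))‖ →
    ∃ q : ℕ, 1 ≤ q ∧ (q : ℝ) ≤ C * D ^ C ∧ nn (q * P.coeff k) ≤ C * D ^ C / (X : ℝ) ^ k

lemma diff_poly_natDegree (P : Polynomial ℝ) (k : ℕ) (hP : P.natDegree ≤ k + 1) (h : ℝ) :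
    (taylor h P - P).natDegree ≤ k ∧
    (taylor h P - P).coeff k = (k + 1) * h * P.coeff (k + 1) := by
  have hc : ∀ n, k ≤ n → (taylor h P).coeff n
      = P.coeff n + (n + 1) * h * P.coeff (n + 1) := by
    intro n hn
    rw [taylor_coeff]
    have hdeg : (hasseDeriv n P).natDegree < 2 := by
      have := Polynomial.natDegree_hasseDeriv_le P n
      omega
    rw [eval_eq_sum_range' hdeg]
    simp [sum_range_succ, Polynomial.hasseDeriv_coeff]
    have : ((1 + n).choose n : ℝ) = n + 1 := by
      rw [add_comm, Nat.choose_succ_self_right]; push_cast; ring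
    rw [this, add_comm 1 n]; ring
  constructor
  · rw [Polynomial.natDegree_le_iff_coeff_eq_zero]
    intro n hn
    rw [coeff_sub, hc n (by omega),
      coeff_eq_zero_of_natDegree_lt (n := n + 1) (by omega)]
    ring
  · rw [coeff_sub, hc k le_rfl]; ring

lemma weyl_one : WeylP 1 1 := by
  intro P hP X hX D hD hS
  refine ⟨1, le_rfl, by simpa using hD, ?_⟩
  have hX0 : (0:ℝ) < X := mod_cast hX
  simp only [Nat.cast_one, one_mul, pow_one]
  rcases (nn_nonneg (P.coeff 1)).eq_or_lt with h0 | h0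
  · rw [← h0]; positivity
  have e1 : ∀ x ∈ range X, ee (P.eval (x : ℝ)) = ee (P.coeff 0) * ee (x * P.coeff 1) := by
    intro x _
    rw [← ee_add, eval_eq_sum_range' (n := 2) (by omega)]
    simp [sum_range_succ]; ring_nf
  rw [sum_congr rfl e1, ← mul_sum, norm_mul, norm_ee, one_mul] at hS
  have := geom_bound (P.coeff 1) X h0
  rw [le_div_iff₀ (by linarith)] at this
  rw [le_div_iff₀ hX0]
  have h3 : (X:ℝ) * nn (P.coeff 1) ≤ D * ‖∑ x ∈ range X, ee (x * P.coeff 1)‖ * nn (P.coeff 1) := by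
    gcongr
  nlinarith

lemma exists_large_C (K : ℕ) (e : ℕ) : ∃ C : ℕ, 1 ≤ C ∧ ∀ D : ℝ, 1 ≤ D →
    ((K : ℝ) * D ^ K) ^ e ≤ C * D ^ C := by
  refine ⟨K ^ e + K * e + 1, by omega, ?_⟩
  intro D hD
  rw [mul_pow, ← pow_mul]
  have h1 : D ^ (K * e) ≤ D ^ (K ^ e + K * e + 1) := pow_le_pow_right₀ hD (by omega)
  push_cast
  gcongr
  · have : (0:ℝ) ≤ K * e := by positivity
    linarith

set_option maxHeartbeats 1000000 in
lemma weyl_step (k C : ℕ) (hk : 1 ≤ k) (hC : 1 ≤ C) (hW : WeylP k C) :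
    ∃ C' : ℕ, 1 ≤ C' ∧ WeylP (k + 1) C' := by
  -- D' = 8 D^2, Q = C * D'^C, D1 = 4 D^2 Q, E = Q * D'^k
  -- everything ≤ K D^K
  set K0 : ℕ := (k + 1) * 12 * 3 * 64 * ((4 * C * 8 ^ C) ^ 3 * (C * 8 ^ C * 8 ^ k)) + (8 * C + 2 * k + 6) with hK0
  obtain ⟨C', hC'1, hC'⟩ := exists_large_C K0 (k + 1)
  refine ⟨C', hC'1, ?_⟩
  intro P hP X hX D hD hS
  have hX0 : (0:ℝ) < X := mod_cast hX
  by_cases hsmall : (X : ℝ) ≤ K0 * D ^ K0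
  · refine ⟨1, le_rfl, ?_, ?_⟩
    · have h1 : (1:ℝ) ≤ C' := by exact_mod_cast hC'1
      have h2 : (1:ℝ) ≤ D ^ C' := one_le_pow₀ hD
      simp; nlinarith
    · rw [le_div_iff₀ (by positivity)]
      have h1 : (X:ℝ) ^ (k+1) ≤ (K0 * D ^ K0) ^ (k+1) := by gcongr
      have h2 := hC' D hD
      have h3 := nn_le_half (((1:ℕ):ℝ) * P.coeff (k+1))
      have h4 : (0:ℝ) ≤ (X:ℝ) ^ (k+1) := by positivity
      have h5 := nn_nonneg (((1:ℕ):ℝ) * P.coeff (k+1))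
      have h6 : nn (((1:ℕ):ℝ) * P.coeff (k+1)) * (X:ℝ) ^ (k+1) ≤ 1 * (X:ℝ) ^ (k+1) :=
        mul_le_mul_of_nonneg_right (h3.trans (by norm_num)) h4
      linarith
  push Not at hsmall
  have hD0 : (0:ℝ) < D := by linarith
  set D' : ℝ := 8 * D ^ 2 with hD'
  have hD'1 : 1 ≤ D' := by nlinarith
  set Q : ℝ := C * D' ^ C with hQ
  have hC1 : (1:ℝ) ≤ C := mod_cast hC
  have hQ1 : 1 ≤ Q := by
    have : (1:ℝ) ≤ D' ^ C := one_le_pow₀ hD'1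
    nlinarith
  set D1 : ℝ := 4 * D ^ 2 * Q with hD1
  have hD1_1 : 1 ≤ D1 := by nlinarith [one_le_pow₀ hD (n := 2)]
  set E : ℝ := Q * D' ^ k with hE
  have hE1 : 1 ≤ E := by nlinarith [one_le_pow₀ hD'1 (n := k)]
  -- key bound
  have hkey : (k + 1) * 12 * 3 * 64 * D1 ^ 3 * E ≤ K0 * D ^ K0 := by
    have e1 : ((k:ℝ) + 1) * 12 * 3 * 64 * D1 ^ 3 * E
        = ((k + 1) * 12 * 3 * 64 * ((4 * C * 8 ^ C) ^ 3 * (C * 8 ^ C * 8 ^ k))) * D ^ (8 * C + 2 * k + 6) := by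
      rw [hE, hD1, hQ, hD']
      rw [mul_pow (8:ℝ) (D^2) C, mul_pow (8:ℝ) (D^2) k, ← pow_mul, ← pow_mul]
      ring
    rw [e1]
    apply mul_le_mul
    · rw [hK0]; push_cast
      have : (0:ℝ) ≤ 8 * C + 2 * k + 6 := by positivity
      linarith
    · exact pow_le_pow_right₀ hD (by rw [hK0]; exact Nat.le_add_left _ _)
    · positivity
    · positivity
  clear_value K0
  have hXbig : (k + 1) * 12 * 3 * 64 * D1 ^ 3 * E < X := lt_of_le_of_lt hkey hsmall
  have hKC : (K0:ℝ) * D ^ K0 ≤ C' * D ^ C' := by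
    refine le_trans ?_ (hC' D hD)
    have h1 : (1:ℝ) ≤ K0 * D ^ K0 := by
      have h2 : (1:ℝ) ≤ (k + 1) * 12 * 3 * 64 * D1 ^ 3 * E := by
        have h3 : (1:ℝ) ≤ D1 ^ 3 := one_le_pow₀ hD1_1
        have h4 : (0:ℝ) ≤ k := by positivity
        have h5 : (1:ℝ) ≤ (k + 1) * 12 * 3 * 64 := by linarith
        exact one_le_mul_of_one_le_of_one_le (one_le_mul_of_one_le_of_one_le h5 h3) hE1
      linarith
    exact le_self_pow₀ h1 (by omega)
  have hk0 : (0:ℝ) ≤ k := by positivity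
  have hD1sq : 1 ≤ D1 ^ 2 := one_le_pow₀ hD1_1
  have hb1 : 12 * D1 ^ 2 < X := by
    have h1 : 12 * D1 ^ 2 ≤ (k + 1) * 12 * 3 * 64 * D1 ^ 3 * E := by
      have : 12 * D1 ^ 2 * 1 * 1 ≤ 12 * D1 ^ 2 * D1 * E := by gcongr
      have h2 : (0:ℝ) ≤ 12 * D1 ^ 2 * D1 * E := by positivity
      nlinarith
    linarith
  have hb2 : 64 * D1 * E ≤ X := by
    have h1 : 64 * D1 * E ≤ (k + 1) * 12 * 3 * 64 * D1 ^ 3 * E := by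
      have : 64 * D1 * 1 * E ≤ 64 * D1 * D1 ^ 2 * E := by gcongr
      have h2 : (0:ℝ) ≤ 64 * D1 * D1 ^ 2 * E := by positivity
      nlinarith
    linarith
  -- differencing
  set T : ℕ → ℝ := fun h => ‖∑ y ∈ range (X - h), ee (P.eval ((y + h : ℕ) : ℝ)) * (starRingEnd ℂ) (ee (P.eval (y : ℝ)))‖ with hT
  have hv := vdc (fun n => ee (P.eval (n : ℝ))) (fun n => norm_ee _) X
  change _ ≤ (X:ℝ) + 2 * ∑ h ∈ Ico 1 X, T h at hv
  have hTle : ∀ h, T h ≤ (X - h : ℕ) := by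
    intro h
    refine (norm_sum_le _ _).trans ?_
    simp [norm_ee]
  set Hs := (Ico 1 X).filter (fun h => (X : ℝ) ≤ D' * T h) with hHs
  have hsumT : ∑ h ∈ Ico 1 X, T h ≤ Hs.card * X + X * (X / D') := by
    rw [← sum_filter_add_sum_filter_not (Ico 1 X) (fun h => (X : ℝ) ≤ D' * T h)]
    apply add_le_add
    · refine (sum_le_card_nsmul _ _ (X:ℝ) ?_).trans (by simp [hHs])
      intro h _
      refine (hTle h).trans ?_
      exact_mod_cast Nat.sub_le _ _
    · refine (sum_le_card_nsmul _ _ ((X:ℝ) / D') ?_).trans ?_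
      · intro h hh
        rw [mem_filter] at hh
        rw [le_div_iff₀ (by linarith)]; linarith [hh.2]
      · rw [nsmul_eq_mul]
        gcongr
        refine (card_filter_le _ _).trans ?_
        simp
  have hHcard : (X:ℝ) ≤ 4 * D ^ 2 * Hs.card := by
    have h1 : (X:ℝ)^2 ≤ D^2 * (X + 2 * (Hs.card * X + X * (X / D'))) := by
      have h2 : (X:ℝ)^2 ≤ D^2 * ‖∑ x ∈ range X, ee (P.eval (x : ℝ))‖^2 := by
        rw [← mul_pow]; gcongr
      refine h2.trans ?_
      gcongr
      linarith
    have h3 : D^2 * (X * ((X:ℝ) / D')) = X^2/8 := by rw [hD']; field_simp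
    have h4 : D^2 * X ≤ (X:ℝ)^2 / 4 := by
      have h5 : 4 * D^2 ≤ X := by
        have : 4 * D^2 * 1 ≤ 4 * D^2 * Q := by gcongr
        nlinarith
      nlinarith
    have h6 : (X:ℝ) * X ≤ X * (4 * D ^ 2 * Hs.card) := by nlinarith
    exact le_of_mul_le_mul_left h6 hX0
  -- apply IH
  have hIH : ∀ h ∈ Hs, ∃ q : ℕ, 1 ≤ q ∧ (q : ℝ) ≤ Q ∧ nn (q * ((k + 1) * h * P.coeff (k + 1))) ≤ E / (X:ℝ) ^ k := by
    intro h hh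
    rw [hHs, mem_filter, mem_Ico] at hh
    obtain ⟨hd1, hd2⟩ := diff_poly_natDegree P k hP h
    obtain ⟨q, hq1, hq2, hq3⟩ := hW (taylor (h:ℝ) P - P) hd1 (X - h) (by omega) D' hD'1 (by
      have e : ∀ y ∈ range (X - h), ee ((taylor (h:ℝ) P - P).eval (y:ℝ))
          = ee (P.eval ((y + h : ℕ) : ℝ)) * (starRingEnd ℂ) (ee (P.eval (y : ℝ))) := by
        intro y _
        rw [eval_sub, taylor_eval, ee_sub]; push_cast; rfl
      rw [sum_congr rfl e]
      refine le_trans ?_ hh.2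
      exact_mod_cast Nat.sub_le _ _)
    refine ⟨q, hq1, hq2, ?_⟩
    rw [hd2] at hq3
    refine hq3.trans ?_
    have hXh : (X:ℝ) ≤ D' * ((X - h : ℕ):ℝ) := hh.2.trans (by gcongr; exact hTle h)
    have hXh0 : (0:ℝ) < ((X - h : ℕ):ℝ) := by
      have : 0 < X - h := by omega
      exact_mod_cast this
    rw [div_le_div_iff₀ (by positivity) (by positivity), hE]
    have : (X:ℝ)^k ≤ D'^k * ((X - h : ℕ):ℝ)^k := by rw [← mul_pow]; gcongr
    calc C * D' ^ C * (X:ℝ)^k ≤ Q * (D'^k * ((X - h : ℕ):ℝ)^k) := by rw [hQ]; gcongr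
      _ = _ := by ring
  choose! qf hqf using hIH
  -- pigeonhole on q
  have hmaps : ∀ h ∈ Hs, qf h ∈ Icc 1 ⌊Q⌋₊ := by
    intro h hh
    rw [mem_Icc]
    exact ⟨(hqf h hh).1, le_floor (hqf h hh).2.1⟩
  have hne : (Icc 1 ⌊Q⌋₊).Nonempty := ⟨1, by rw [mem_Icc]; exact ⟨le_rfl, le_floor (by simpa using hQ1)⟩⟩
  have hcardIcc : ((Icc 1 ⌊Q⌋₊).card : ℝ) ≤ Q := by
    rw [Nat.card_Icc]; simp; exact floor_le (by linarith)
  obtain ⟨q, hq, hqc⟩ := exists_le_card_fiber_of_nsmul_le_card_of_maps_to (M := ℝ) (b := (Hs.card : ℝ) / Q) hmaps hne (by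
    rw [nsmul_eq_mul]
    calc ((Icc 1 ⌊Q⌋₊).card : ℝ) * (Hs.card / Q) ≤ Q * (Hs.card / Q) := by gcongr
      _ = Hs.card := by field_simp)
  rw [mem_Icc] at hq
  obtain ⟨d0, hd01, hd02, hd03⟩ := recurrence (Hs.filter (fun h => qf h = q)) X
    (by
      intro x hx
      rw [mem_filter, hHs, mem_filter, mem_Ico] at hx
      exact mem_range.2 hx.1.1.2) D1 (E / (X:ℝ)^k) (q * ((k + 1) * P.coeff (k+1))) hD1_1 (by positivity)
    (by
      rw [div_le_iff₀ (by linarith)] at hqc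
      calc (X:ℝ) ≤ 4 * D ^ 2 * Hs.card := hHcard
        _ ≤ 4 * D ^ 2 * (_ * Q) := by gcongr
        _ = _ := by rw [hD1]; ring)
    (by
      intro h hh
      rw [mem_filter] at hh
      have := (hqf h hh.1).2.2
      rw [hh.2] at this
      convert this using 2; ring)
    (by
      rw [div_le_div_iff₀ (by positivity) (by positivity)]
      have : (X:ℝ) ≤ X ^ k := le_self_pow₀ (mod_cast hX) (by omega)
      linarith)
    hb1
  refine ⟨d0 * (q * (k + 1)), ?_, ?_, ?_⟩
  · have : 0 < d0 * (q * (k+1)) := Nat.mul_pos hd01 (Nat.mul_pos hq.1 (Nat.succ_pos k))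
    exact this
  · refine le_trans ?_ hKC
    refine le_trans ?_ hkey
    have hqQ : (q:ℝ) ≤ Q := (Nat.cast_le.2 hq.2).trans (floor_le (by linarith))
    have hQE : Q ≤ E := by rw [hE]; nlinarith [one_le_pow₀ hD'1 (n := k)]
    push_cast
    calc (d0:ℝ) * (q * (k + 1)) ≤ (3 * D1) * (E * (k + 1)) := by gcongr; exact hqQ.trans hQE
      _ ≤ (3 * D1 * D1 ^ 2) * (E * (k + 1)) := by
        apply mul_le_mul_of_nonneg_right _ (by positivity)
        nlinarith
      _ ≤ _ := by
        have : (0:ℝ) ≤ (3 * D1 * D1 ^ 2) * (E * (k + 1)) := by positivity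
        nlinarith
  · have e : ((d0 * (q * (k + 1)) : ℕ) : ℝ) * P.coeff (k + 1) = d0 * (q * ((k + 1) * P.coeff (k+1))) := by
      push_cast; ring
    rw [e]
    refine hd03.trans ?_
    have e2 : 12 * D1 ^ 2 * (E / (X:ℝ) ^ k) / X = (12 * D1 ^ 2 * E) / (X:ℝ)^(k+1) := by
      field_simp; ring
    rw [e2]
    apply div_le_div_of_nonneg_right _ (by positivity)
    refine le_trans ?_ (hkey.trans hKC)
    have : 12 * D1 ^ 2 * 1 * E ≤ 12 * D1 ^ 2 * D1 * E := by gcongr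
    have h2 : (0:ℝ) ≤ 12 * D1 ^ 2 * D1 * E := by positivity
    nlinarith

theorem weyl (k : ℕ) (hk : 1 ≤ k) : ∃ C : ℕ, 1 ≤ C ∧ WeylP k C := by
  induction k, hk using Nat.le_induction with
  | base => exact ⟨1, le_rfl, weyl_one⟩
  | succ k hk ih =>
    obtain ⟨C, hC, hW⟩ := ih
    exact weyl_step k C hk hC hW

lemma addChar_map_sum {A ι : Type*} [AddCommMonoid A] (ψ : AddChar A ℂ) (s : Finset ι) (f : ι → A) :
    ψ (∑ i ∈ s, f i) = ∏ i ∈ s, ψ (f i) := by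
  classical
  induction s using Finset.induction_on with
  | empty => simp
  | insert a s ha ih => rw [sum_insert ha, prod_insert ha, AddChar.map_add_eq_mul, ih]

section Mordell
variable {p : ℕ} [hp : Fact p.Prime]

lemma esymm_eq_of_psum (m : ℕ) (hm : m < p) (x y : Fin m → ZMod p)
    (h : ∀ j, 1 ≤ j → j ≤ m → ∑ i, x i ^ j = ∑ i, y i ^ j) :
    ∀ k, k ≤ m → MvPolynomial.aeval x (MvPolynomial.esymm (Fin m) (ZMod p) k)
      = MvPolynomial.aeval y (MvPolynomial.esymm (Fin m) (ZMod p) k) := by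
  intro k
  induction k using Nat.strong_induction_on with
  | _ k ih =>
    intro hk
    rcases Nat.eq_zero_or_pos k with rfl | hk0
    · simp
    have hN := MvPolynomial.mul_esymm_eq_sum (Fin m) (ZMod p) k
    have hx := congrArg (MvPolynomial.aeval x) hN
    have hy := congrArg (MvPolynomial.aeval y) hN
    simp only [map_mul, map_pow, map_neg, map_one, map_sum, map_natCast] at hx hy
    have hk1 : (k : ZMod p) ≠ 0 := by
      intro h0
      rw [ZMod.natCast_eq_zero_iff] at h0
      have := le_of_dvd hk0 h0
      omega
    apply mul_left_cancel₀ hk1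
    rw [hx, hy]
    congr 1
    apply sum_congr rfl
    intro a ha
    rw [mem_filter, HasAntidiagonal.mem_antidiagonal] at ha
    rw [ih a.1 ha.2 (by omega)]
    congr 1
    simp only [MvPolynomial.psum, map_sum, map_pow, MvPolynomial.aeval_X]
    exact h a.2 (by omega) (by omega)

lemma mem_of_psum (m : ℕ) (hm : m < p) (x y : Fin m → ZMod p)
    (h : ∀ j, 1 ≤ j → j ≤ m → ∑ i, x i ^ j = ∑ i, y i ^ j) (i : Fin m) : ∃ j, y i = x j := by
  have he := esymm_eq_of_psum m hm x y h
  have key : ((univ.val.map x).map fun t => Polynomial.X - Polynomial.C t).prod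
      = ((univ.val.map y).map fun t => Polynomial.X - Polynomial.C t).prod := by
    rw [Multiset.prod_X_sub_X_eq_sum_esymm, Multiset.prod_X_sub_X_eq_sum_esymm]
    simp only [Multiset.card_map, card_val, card_univ, Fintype.card_fin]
    apply sum_congr rfl
    intro k hk
    have := he k (by simpa [Nat.lt_succ_iff] using hk)
    rw [MvPolynomial.aeval_esymm_eq_multiset_esymm, MvPolynomial.aeval_esymm_eq_multiset_esymm] at this
    rw [this]
  have key2 := congrArg (Polynomial.eval (y i)) key
  simp only [Multiset.map_map, Function.comp_def] at key2
  change Polynomial.eval (y i) (∏ j, (Polynomial.X - Polynomial.C (x j)))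
    = Polynomial.eval (y i) (∏ j, (Polynomial.X - Polynomial.C (y j))) at key2
  rw [eval_prod, eval_prod] at key2
  simp only [eval_sub, eval_X, eval_C] at key2
  rw [prod_eq_zero (f := fun j => y i - y j) (mem_univ i) (sub_self _), prod_eq_zero_iff] at key2
  obtain ⟨j, _, hj⟩ := key2
  exact ⟨j, sub_eq_zero.1 hj⟩

/-- the solutions of the Vinogradov system in `ZMod p` -/
def vinoSet (p m : ℕ) [NeZero p] : Finset ((Fin m → ZMod p) × (Fin m → ZMod p)) :=
  univ.filter (fun q => ∀ j : Fin m, ∑ i, q.1 i ^ (j.1 + 1) = ∑ i, q.2 i ^ (j.1 + 1))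

lemma vinoSet_card (m : ℕ) (hm : m < p) : (vinoSet p m).card ≤ p ^ m * m ^ m := by
  have h1 : (vinoSet p m).card ≤
      (univ : Finset ((Fin m → ZMod p) × (Fin m → Fin m))).card := by
    have hsub : vinoSet p m ⊆ (univ : Finset ((Fin m → ZMod p) × (Fin m → Fin m))).image
        (fun q => (q.1, fun i => q.1 (q.2 i))) := by
      rintro ⟨x, y⟩ hxy
      simp only [vinoSet, mem_filter, mem_univ, true_and] at hxy
      have := mem_of_psum m hm x y (by
        intro j hj1 hj2
        have := hxy ⟨j - 1, by omega⟩
        simpa [Nat.sub_add_cancel hj1] using this)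
      choose f hf using this
      rw [mem_image]
      exact ⟨(x, f), mem_univ _, by ext i <;> simp [hf]⟩
    exact (card_le_card hsub).trans card_image_le
  refine h1.trans ?_
  simp [ZMod.card]

lemma mean_value (m : ℕ) (ψ : AddChar (ZMod p) ℂ) (hψ : ψ.IsPrimitive) :
    ∑ c : Fin m → ZMod p, ‖∑ x : ZMod p, ψ (∑ j, c j * x ^ (j.1 + 1))‖ ^ (2 * m)
      = p ^ m * (vinoSet p m).card := by
  have hC : ((∑ c : Fin m → ZMod p, ‖∑ x : ZMod p, ψ (∑ j, c j * x ^ (j.1 + 1))‖ ^ (2 * m) : ℝ) : ℂ)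
      = ((p ^ m * (vinoSet p m).card : ℝ) : ℂ) := by
    push_cast
    have h1 : ∀ c : Fin m → ZMod p, ((‖∑ x : ZMod p, ψ (∑ j, c j * x ^ (j.1 + 1))‖ : ℂ)) ^ (2 * m)
        = ∑ q : (Fin m → ZMod p) × (Fin m → ZMod p),
            ∏ j, ψ (c j * (∑ i, q.1 i ^ (j.1 + 1) - ∑ i, q.2 i ^ (j.1 + 1))) := by
      intro c
      rw [pow_mul, ← Complex.mul_conj', mul_pow, ← map_pow, Fintype.sum_pow, map_sum, sum_mul_sum,
        ← sum_product', univ_product_univ]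
      apply sum_congr rfl
      rintro ⟨x, y⟩ _
      simp only
      rw [← addChar_map_sum, ← addChar_map_sum, ← AddChar.map_neg_eq_conj,
        ← AddChar.map_add_eq_mul, ← addChar_map_sum]
      congr 1
      simp only [mul_sub, sum_sub_distrib, mul_sum]
      rw [sum_comm, sub_eq_add_neg]
      congr 2
      rw [sum_comm]
    rw [sum_congr rfl fun c _ => h1 c, sum_comm]
    have h2 : ∀ q : (Fin m → ZMod p) × (Fin m → ZMod p),
        ∑ c : Fin m → ZMod p, ∏ j, ψ (c j * (∑ i, q.1 i ^ (j.1 + 1) - ∑ i, q.2 i ^ (j.1 + 1)))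
        = if (∀ j : Fin m, ∑ i, q.1 i ^ (j.1 + 1) = ∑ i, q.2 i ^ (j.1 + 1)) then (p:ℂ) ^ m else 0 := by
      intro q
      have := (prod_univ_sum (fun _ : Fin m => (univ : Finset (ZMod p)))
        (fun j t => ψ (t * (∑ i, q.1 i ^ (j.1 + 1) - ∑ i, q.2 i ^ (j.1 + 1)))))
      rw [Fintype.piFinset_univ] at this
      rw [← this]
      simp only [AddChar.sum_mulShift _ hψ, sub_eq_zero, ZMod.card]
      split_ifs with hq
      · simp [hq]
      · push Not at hq
        obtain ⟨j, hj⟩ := hq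
        exact prod_eq_zero (mem_univ j) (by simp [hj])
    rw [sum_congr rfl fun q _ => h2 q, ← sum_filter, sum_const, nsmul_eq_mul, mul_comm]
    rfl
  exact_mod_cast hC

lemma taylor_coeff_top {R : Type*} [CommRing R] (P : Polynomial R) (m : ℕ) (hm : 1 ≤ m) (hP : P.natDegree ≤ m) (h : R) :
    (taylor h P).coeff m = P.coeff m ∧
    (taylor h P).coeff (m - 1) = P.coeff (m - 1) + m * h * P.coeff m := by
  have hc : ∀ n, m ≤ n + 1 → (taylor h P).coeff n
      = P.coeff n + (n + 1) * h * P.coeff (n + 1) := by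
    intro n hn
    rw [taylor_coeff]
    have hdeg : (hasseDeriv n P).natDegree < 2 := by
      have := Polynomial.natDegree_hasseDeriv_le P n
      omega
    rw [eval_eq_sum_range' hdeg]
    simp [sum_range_succ, Polynomial.hasseDeriv_coeff]
    have : ((1 + n).choose n : R) = n + 1 := by
      rw [add_comm, Nat.choose_succ_self_right]; push_cast; ring
    rw [this, add_comm 1 n]; ring
  constructor
  · rw [hc m (by omega), coeff_eq_zero_of_natDegree_lt (n := m + 1) (by omega)]; ring
  · rw [hc (m-1) (by omega)]
    obtain ⟨k, rfl⟩ : ∃ k, m = k + 1 := ⟨m - 1, by omega⟩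
    simp

lemma mordell_aux (m : ℕ) (hm2 : 2 ≤ m) (hm : m < p) (ψ : AddChar (ZMod p) ℂ) (hψ : ψ.IsPrimitive)
    (f : Polynomial (ZMod p)) (hf : f.natDegree = m) :
    (p * (p - 1) : ℝ) * ‖∑ x : ZMod p, ψ (f.eval x)‖ ^ (2 * m) ≤ m * (p ^ m * (p ^ m * m ^ m)) := by
  set S := ‖∑ x : ZMod p, ψ (f.eval x)‖ with hS
  let g : ZMod p → ZMod p → Polynomial (ZMod p) := fun l u =>
    (taylor u f).comp (Polynomial.C l * Polynomial.X)
  let vec : Polynomial (ZMod p) → (Fin m → ZMod p) := fun g j => g.coeff (j.1 + 1)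
  have hgdeg : ∀ l u, (g l u).natDegree ≤ m := by
    intro l u
    refine Polynomial.natDegree_comp_le.trans ?_
    rw [natDegree_taylor, hf]
    have := (by simpa using Polynomial.natDegree_C_mul_X_pow_le l 1 : (Polynomial.C l * Polynomial.X).natDegree ≤ 1)
    nlinarith
  have hgS : ∀ l u, l ≠ 0 → ‖∑ x : ZMod p, ψ (∑ j, vec (g l u) j * x ^ (j.1 + 1))‖ = S := by
    intro l u hl
    have e1 : ∀ x, ψ (f.eval (l * x + u)) = ψ ((g l u).coeff 0) * ψ (∑ j, vec (g l u) j * x ^ (j.1 + 1)) := by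
      intro x
      rw [← AddChar.map_add_eq_mul]
      congr 1
      have : f.eval (l * x + u) = (g l u).eval x := by
        simp only [g]; simp [taylor_eval]
      rw [this, eval_eq_sum_range' (n := m + 1) (by have := hgdeg l u; omega), sum_range_succ',
        ← Fin.sum_univ_eq_sum_range (fun j => (g l u).coeff (j + 1) * x ^ (j + 1))]
      simp [vec, add_comm]
    have e2 : ∑ x, ψ (f.eval (l * x + u)) = ∑ x, ψ (f.eval x) := by
      apply Fintype.sum_bijective (fun x => l * x + u)
      · constructor
        · intro x y hxy
          simpa [hl] using hxy
        · intro y; exact ⟨l⁻¹ * (y - u), by simp [mul_inv_cancel_left₀ hl]⟩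
      · intro x; rfl
    rw [hS, ← e2, sum_congr rfl fun x _ => e1 x, ← mul_sum, norm_mul, AddChar.norm_apply, one_mul]
  -- the family
  let D : Finset (ZMod p × ZMod p) := (univ.filter (fun l : ZMod p => l ≠ 0)) ×ˢ univ
  have hDcard : D.card = (p - 1) * p := by
    simp only [D, card_product, card_univ, ZMod.card]
    congr 1
    rw [filter_ne', card_erase_of_mem (mem_univ _), card_univ, ZMod.card]
  let I := D.image (fun q => vec (g q.1 q.2))
  have hm0 : (m : ZMod p) ≠ 0 := by
    intro h0
    rw [ZMod.natCast_eq_zero_iff] at h0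
    have := le_of_dvd (by omega) h0
    omega
  have hlead : f.coeff m ≠ 0 := by
    rw [← hf]
    have : f ≠ 0 := by rintro rfl; simp at hf; omega
    simpa using this
  have hIcard : D.card ≤ m * I.card := by
    apply card_le_mul_card_image
    intro v hv
    rw [mem_image] at hv
    obtain ⟨⟨l0, u0⟩, hlu, hv⟩ := hv
    have hl0 : l0 ≠ 0 := by simpa [D] using hlu
    have : (D.filter (fun q => vec (g q.1 q.2) = v)).card ≤ (Polynomial.nthRoots m (l0 ^ m)).toFinset.card := by
      have hvec : ∀ l u l' u', vec (g l u) = vec (g l' u') →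
          l ^ m = l' ^ m ∧ (f.coeff (m-1) + m * u * f.coeff m) * l ^ (m-1) = (f.coeff (m-1) + m * u' * f.coeff m) * l' ^ (m-1) := by
        intro l u l' u' h
        have h1 := congrFun h ⟨m - 1, by omega⟩
        have h2 := congrFun h ⟨m - 2, by omega⟩
        simp only [vec, g, comp_C_mul_X_coeff] at h1 h2
        have e1 : m - 1 + 1 = m := by omega
        have e2 : m - 2 + 1 = m - 1 := by omega
        rw [e1, (taylor_coeff_top f m (by omega) hf.le _).1, (taylor_coeff_top f m (by omega) hf.le _).1] at h1
        rw [e2, (taylor_coeff_top f m (by omega) hf.le _).2, (taylor_coeff_top f m (by omega) hf.le _).2] at h2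
        exact ⟨mul_left_cancel₀ hlead h1, h2⟩
      apply card_le_card_of_injOn (fun q => q.1)
      · rintro ⟨l, u⟩ hq
        simp only [coe_filter, Set.mem_ofPred_eq] at hq
        have := hvec l u l0 u0 (hq.2.trans hv.symm)
        simp only [mem_coe, Multiset.mem_toFinset]
        rw [Polynomial.mem_nthRoots (by omega)]
        exact this.1
      · rintro ⟨l, u⟩ hq ⟨l', u'⟩ hq' hll
        simp only [coe_filter, Set.mem_ofPred_eq] at hq hq'
        simp only at hll
        subst hll
        have h3 := (hvec l u l u' (hq.2.trans hq'.2.symm)).2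
        have hl : l ≠ 0 := by simpa [D] using hq.1
        have h4 := mul_right_cancel₀ (pow_ne_zero _ hl) h3
        have h5 := add_left_cancel h4
        have h6 := mul_right_cancel₀ hlead h5
        have h7 := mul_left_cancel₀ hm0 h6
        rw [h7]
    exact this.trans ((Multiset.toFinset_card_le _).trans (Polynomial.card_nthRoots _ _))
  have hsum : (I.card : ℝ) * S ^ (2 * m) ≤ p ^ m * (p ^ m * m ^ m) := by
    have h1 : (I.card : ℝ) * S ^ (2 * m) = ∑ c ∈ I, ‖∑ x : ZMod p, ψ (∑ j, c j * x ^ (j.1 + 1))‖ ^ (2 * m) := by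
      rw [← nsmul_eq_mul, ← sum_const]
      apply sum_congr rfl
      intro c hc
      rw [mem_image] at hc
      obtain ⟨⟨l, u⟩, hlu, rfl⟩ := hc
      rw [hgS l u (by simpa [D] using hlu)]
    rw [h1]
    refine (sum_le_sum_of_subset_of_nonneg (subset_univ I) fun _ _ _ => by positivity).trans ?_
    rw [mean_value m ψ hψ]
    have := vinoSet_card (p := p) m hm
    gcongr
    exact_mod_cast this
  have hD2 : ((p:ℝ) * (p - 1)) ≤ m * I.card := by
    have h1 : ((D.card : ℕ) : ℝ) ≤ ((m * I.card : ℕ) : ℝ) := mod_cast hIcard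
    rw [hDcard] at h1
    push_cast [Nat.cast_sub hp.1.one_lt.le] at h1
    linarith
  calc (p * (p - 1) : ℝ) * S ^ (2 * m) ≤ (m * I.card) * S ^ (2 * m) := by gcongr
    _ = m * (I.card * S ^ (2 * m)) := by ring
    _ ≤ _ := by gcongr

lemma mordell_bound (d m : ℕ) (hm1 : 1 ≤ m) (hmd : m ≤ d) (hm : m < p) (ψ : AddChar (ZMod p) ℂ) (hψ : ψ.IsPrimitive)
    (f : Polynomial (ZMod p)) (hf : f.natDegree = m) :
    ‖∑ x : ZMod p, ψ (f.eval x)‖ ≤ 2 * d * p * (p : ℝ) ^ (-(1 / d : ℝ)) := by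
  have hp1 : (1:ℝ) ≤ p := mod_cast hp.1.one_lt.le
  have hp2 : (2:ℝ) ≤ p := mod_cast hp.1.two_le
  rcases hm1.eq_or_lt with rfl | hm2
  · -- linear
    have hlead : f.coeff 1 ≠ 0 := by
      rw [← hf]
      have : f ≠ 0 := by rintro rfl; simp at hf
      simpa using this
    have e1 : ∀ x, ψ (f.eval x) = ψ (f.coeff 0) * ψ (x * f.coeff 1) := by
      intro x
      rw [← AddChar.map_add_eq_mul, eval_eq_sum_range' (n := 2) (by omega)]
      simp [sum_range_succ, mul_comm]
    rw [sum_congr rfl fun x _ => e1 x, ← mul_sum, AddChar.sum_mulShift _ hψ]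
    simp [hlead]; positivity
  · have h := mordell_aux m hm2 hm ψ hψ f hf
    set S := ‖∑ x : ZMod p, ψ (f.eval x)‖
    have hS0 : 0 ≤ S := norm_nonneg _
    have hm0 : (0:ℝ) < m := mod_cast hm1
    have hd0 : (0:ℝ) < d := mod_cast (by omega : 0 < d)
    have hmd' : (m:ℝ) ≤ d := mod_cast hmd
    have h1 : S ≤ 2 * m * p * (p : ℝ) ^ (-(1 / m : ℝ)) := by
      apply le_of_pow_le_pow_left₀ (n := 2 * m) (by omega) (by positivity)
      have e1 : (2 * m * p * (p : ℝ) ^ (-(1 / m : ℝ))) ^ (2 * m) = (2 * m) ^ (2*m) * p ^ (2 * m) / p ^ 2 := by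
        rw [mul_pow, mul_pow, ← rpow_natCast ((p : ℝ) ^ (-(1 / m : ℝ))), ← rpow_mul (by positivity)]
        have : (-(1 / m : ℝ)) * ((2 * m : ℕ) : ℝ) = -(2:ℕ) := by push_cast; field_simp
        rw [this, rpow_neg (by positivity), rpow_natCast]; rfl
      rw [e1, le_div_iff₀ (by positivity)]
      have h2 : (p:ℝ)^2 * S ^ (2*m) ≤ 2 * ((p * (p - 1) : ℝ) * S ^ (2 * m)) := by
        have : (p:ℝ)^2 ≤ 2 * (p * (p-1)) := by nlinarith
        calc (p:ℝ)^2 * S ^ (2*m) ≤ (2 * (p * (p-1))) * S ^ (2*m) := by gcongr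
          _ = _ := by ring
      have h3 : 2 * (m * ((p:ℝ) ^ m * (p ^ m * m ^ m))) ≤ (2 * m) ^ (2*m) * p ^ (2 * m) := by
        have e2 : (m:ℝ) * m ^ m ≤ m ^ (2 * m) := by
          rw [← pow_succ']; exact pow_le_pow_right₀ (mod_cast hm1) (by omega)
        have e3 : (2:ℝ) ≤ 2 ^ (2*m) := le_self_pow₀ (by norm_num) (by omega)
        calc 2 * (m * ((p:ℝ) ^ m * (p ^ m * m ^ m))) = 2 * (m * m ^ m) * p ^ (2*m) := by ring
          _ ≤ 2 ^ (2*m) * m ^ (2 * m) * p ^ (2*m) := by gcongr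
          _ = _ := by rw [mul_pow]
      linarith
    refine h1.trans ?_
    gcongr
end Mordell

lemma sum_range_zmod (n : ℕ) [NeZero n] (f : ZMod n → ℂ) :
    ∑ y ∈ range n, f (y : ZMod n) = ∑ x : ZMod n, f x := by
  refine sum_bij' (fun y _ => (y : ZMod n)) (fun x _ => x.val) ?_ ?_ ?_ ?_ ?_
  · intro y _; exact mem_univ _
  · intro x _; exact mem_range.2 (ZMod.val_lt x)
  · intro y hy; exact ZMod.val_cast_of_lt (mem_range.1 hy)
  · intro x _; simp
  · intro y _; rfl

lemma ee_eq_stdAddChar (n : ℕ) [NeZero n] (j : ℤ) : ee ((j : ℝ) / n) = ZMod.stdAddChar (j : ZMod n) := by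
  rw [ZMod.stdAddChar_coe]; unfold ee; congr 1; push_cast; ring

/-- k = 1 -/
lemma hua_one (d p : ℕ) [hp : Fact p.Prime] (hd : 1 ≤ d) (hdp : d < p) (β : ℝ) (hβ : 0 < β) (hβd : β ^ d = p)
    (F : ℤ[X]) (hF : F.natDegree ≤ d) (hc : ∃ j, 1 ≤ j ∧ ¬ (p : ℤ) ∣ F.coeff j) :
    ‖avg p (fun y => ee ((F.eval (y : ℤ) : ℤ) / (p : ℝ)))‖ ≤ 2 * d / β := by
  have hp0 : (0:ℝ) < p := mod_cast hp.1.pos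
  set f : Polynomial (ZMod p) := F.map (castRingHom (ZMod p)) with hf
  have e1 : ∀ y ∈ range p, ee ((F.eval (y : ℤ) : ℤ) / (p : ℝ)) = ZMod.stdAddChar (f.eval (y : ZMod p)) := by
    intro y _
    rw [ee_eq_stdAddChar, hf]
    congr 1
    have := eval_intCast_map (castRingHom (ZMod p)) F (y:ℤ)
    simp only [cast_natCast, eq_intCast] at this
    rw [this]
  unfold avg
  rw [sum_congr rfl e1, sum_range_zmod p (fun x => ZMod.stdAddChar (f.eval x)), norm_div, Complex.norm_natCast]
  rw [div_le_iff₀ hp0]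
  obtain ⟨j, hj1, hj⟩ := hc
  have hfj : f.coeff j ≠ 0 := by
    rw [hf, coeff_map]; simpa [ZMod.intCast_zmod_eq_zero_iff_dvd] using hj
  have h1 : 1 ≤ f.natDegree := hj1.trans (le_natDegree_of_ne_zero hfj)
  have h2 : f.natDegree ≤ d := (natDegree_map_le).trans hF
  have := mordell_bound d f.natDegree h1 h2 (by omega) ZMod.stdAddChar (ZMod.isPrimitive_stdAddChar p) f rfl
  refine this.trans (le_of_eq ?_)
  have hd0 : (d:ℝ) ≠ 0 := by positivity
  have : (p:ℝ) ^ (-(1 / d : ℝ)) = β⁻¹ := by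
    rw [← hβd, ← rpow_natCast β, ← rpow_mul hβ.le]
    have : (d:ℝ) * (-(1/d)) = -1 := by field_simp
    rw [this, Real.rpow_neg_one]
  rw [this]; field_simp

/-- classes with nonvanishing derivative -/
lemma hua_class_zero (p : ℕ) [hp : Fact p.Prime] (k : ℕ) (F : ℤ[X]) (c : ℤ)
    (hder : ¬ (p : ℤ) ∣ F.derivative.eval c) :
    avg (p ^ (k + 1)) (fun z => ee ((F.eval (c + p * z) : ℤ) / ((p ^ (k + 2) : ℕ) : ℝ))) = 0 := by
  unfold avg
  have hp0 : (p:ℝ) ≠ 0 := mod_cast hp.1.ne_zero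
  rw [pow_succ, sum_range_mul, sum_comm]
  rw [sum_eq_zero, zero_div]
  intro y _
  set x0 : ℤ := c + p * y with hx0
  have hd0 : ¬ (p : ℤ) ∣ F.derivative.eval x0 := by
    intro h
    have h2 : x0 - c ∣ F.derivative.eval x0 - F.derivative.eval c := sub_dvd_eval_sub _ _ _
    have h3 : (p:ℤ) ∣ x0 - c := ⟨y, by rw [hx0]; ring⟩
    have h4 := (h3.trans h2)
    exact hder ((dvd_sub_right h).1 h4)
  have e1 : ∀ i ∈ range p, ee ((F.eval (c + p * ((p ^ k * i + y : ℕ) : ℤ)) : ℤ) / ((p ^ (k + 2) : ℕ) : ℝ))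
      = ee ((F.eval x0 : ℤ) / ((p ^ (k + 2) : ℕ) : ℝ)) * ZMod.stdAddChar ((i : ZMod p) * ((F.derivative.eval x0 : ℤ) : ZMod p)) := by
    intro i _
    have hs : (i : ZMod p) * ((F.derivative.eval x0 : ℤ) : ZMod p) = ((i * F.derivative.eval x0 : ℤ) : ZMod p) := by push_cast; ring
    rw [hs, ← ee_eq_stdAddChar, ← ee_add]
    obtain ⟨r, hr⟩ := F.binomExpansion x0 (p ^ (k+1) * i)
    have harg : c + p * ((p ^ k * i + y : ℕ) : ℤ) = x0 + p ^ (k+1) * i := by rw [hx0]; push_cast; ring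
    rw [harg, hr]
    apply ee_eq_of_sub_int (r * p ^ k * i ^ 2)
    push_cast
    field_simp
    ring
  rw [sum_congr rfl e1, ← mul_sum, sum_range_zmod p (fun x => ZMod.stdAddChar (x * ((F.derivative.eval x0 : ℤ) : ZMod p))),
    AddChar.sum_mulShift _ (ZMod.isPrimitive_stdAddChar p)]
  have : ((F.derivative.eval x0 : ℤ) : ZMod p) ≠ 0 := by
    rwa [Ne, ZMod.intCast_zmod_eq_zero_iff_dvd]
  simp [this]

lemma hua_expand (d p : ℕ) [hp : Fact p.Prime] (F : ℤ[X]) (hF : F.natDegree ≤ d)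
    (hc : ∃ j, 1 ≤ j ∧ ¬ (p : ℤ) ∣ F.coeff j) (c : ℤ) :
    ∃ σ, 1 ≤ σ ∧ σ ≤ d ∧ ∃ G : ℤ[X], G.natDegree ≤ d ∧ (∃ j, 1 ≤ j ∧ ¬ (p : ℤ) ∣ G.coeff j) ∧
      ∀ z : ℤ, F.eval (c + p * z) = F.eval c + p ^ σ * G.eval z := by
  have hpz : (p:ℤ) ≠ 0 := mod_cast hp.1.ne_zero
  set Tc := taylor c F with hTc
  set Q := Tc.comp (Polynomial.C (p:ℤ) * Polynomial.X) - Polynomial.C (Tc.coeff 0) with hQ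
  have hQc : ∀ j, 1 ≤ j → Q.coeff j = Tc.coeff j * p ^ j := by
    intro j hj
    rw [hQ, coeff_sub, comp_C_mul_X_coeff, Polynomial.coeff_C, if_neg (by omega), sub_zero]
  have hQ0 : Q.coeff 0 = 0 := by
    rw [hQ, coeff_sub, comp_C_mul_X_coeff]; simp
  have hQd : Q.natDegree ≤ d := by
    rw [Polynomial.natDegree_le_iff_coeff_eq_zero]
    intro n hn
    rw [hQc n (by omega), coeff_eq_zero_of_natDegree_lt, zero_mul]
    rw [hTc, natDegree_taylor]; omega
  -- a nonconstant coefficient of Tc prime to p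
  obtain ⟨j0, hj01, hj0⟩ : ∃ j, 1 ≤ j ∧ ¬ (p : ℤ) ∣ Tc.coeff j := by
    obtain ⟨j, hj1, hj⟩ := hc
    set f : Polynomial (ZMod p) := F.map (castRingHom (ZMod p)) with hf
    have hfj : f.coeff j ≠ 0 := by
      rw [hf, coeff_map]; simpa [ZMod.intCast_zmod_eq_zero_iff_dvd] using hj
    have h1 : 1 ≤ f.natDegree := hj1.trans (le_natDegree_of_ne_zero hfj)
    have hmap : taylor (c : ZMod p) f = Tc.map (castRingHom (ZMod p)) := by
      rw [hf, hTc, taylor_apply, taylor_apply, Polynomial.map_comp]; simp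
    have h2 : (taylor (c : ZMod p) f).natDegree = f.natDegree := natDegree_taylor _ _
    refine ⟨f.natDegree, h1, ?_⟩
    intro hdiv
    have h3 : (taylor (c : ZMod p) f).coeff f.natDegree = 0 := by
      rw [hmap, coeff_map]; simpa [ZMod.intCast_zmod_eq_zero_iff_dvd] using hdiv
    rw [← h2] at h3
    have h4 : taylor (c : ZMod p) f = 0 := by
      rwa [coeff_natDegree, Polynomial.leadingCoeff_eq_zero] at h3
    rw [h4] at h2; simp at h2; omega
  have hj0d : j0 ≤ d := by
    by_contra hcon
    apply hj0
    rw [coeff_eq_zero_of_natDegree_lt]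
    · exact dvd_zero _
    · rw [hTc, natDegree_taylor]; omega
  have hP1 : ∀ n, 1 ≤ n → Polynomial.C ((p:ℤ)^n) ∣ Q → n ≤ d := by
    intro n hn hdv
    rw [C_dvd_iff_dvd_coeff] at hdv
    by_contra hcon
    have := hdv j0
    rw [hQc j0 hj01] at this
    have h5 : (p:ℤ)^(j0+1) ∣ Tc.coeff j0 * p ^ j0 := (pow_dvd_pow _ (by omega)).trans this
    rw [pow_succ', mul_dvd_mul_iff_right (pow_ne_zero _ hpz)] at h5
    exact hj0 h5
  have hex : ∃ n, ¬ Polynomial.C ((p:ℤ)^(n+1)) ∣ Q := ⟨d, fun h => by have := hP1 _ (by omega) h; omega⟩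
  classical
  set σ := Nat.find hex with hσ
  have hσ1 : ¬ Polynomial.C ((p:ℤ)^(σ+1)) ∣ Q := Nat.find_spec hex
  have hσ0 : 1 ≤ σ := by
    rw [Nat.one_le_iff_ne_zero]
    intro h0
    rw [h0] at hσ1
    apply hσ1
    rw [C_dvd_iff_dvd_coeff]
    intro i
    rcases Nat.eq_zero_or_pos i with rfl | hi
    · rw [hQ0]; exact dvd_zero _
    · rw [hQc i hi]; exact Dvd.dvd.mul_left (pow_dvd_pow _ (by omega)) _
  have hσP : Polynomial.C ((p:ℤ)^σ) ∣ Q := by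
    have := Nat.find_min hex (m := σ - 1) (by omega)
    rw [not_not, Nat.sub_add_cancel hσ0] at this
    exact this
  obtain ⟨G, hG⟩ := hσP
  have hGc : ∀ j, Q.coeff j = p ^ σ * G.coeff j := by intro j; rw [hG, coeff_C_mul]
  refine ⟨σ, hσ0, hP1 σ hσ0 ⟨G, hG⟩, G, ?_, ?_, ?_⟩
  · rw [Polynomial.natDegree_le_iff_coeff_eq_zero]
    intro n hn
    have := hGc n
    rw [coeff_eq_zero_of_natDegree_lt (by omega)] at this
    rcases mul_eq_zero.1 this.symm with h | h
    · exact absurd h (pow_ne_zero _ hpz)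
    · exact h
  · by_contra hcon
    push Not at hcon
    apply hσ1
    rw [C_dvd_iff_dvd_coeff]
    intro i
    rcases Nat.eq_zero_or_pos i with rfl | hi
    · rw [hQ0]; exact dvd_zero _
    · rw [hGc, pow_succ]; exact mul_dvd_mul_left _ (hcon i hi)
  · intro z
    have h6 : Q.eval z = F.eval (c + p * z) - F.eval c := by
      rw [hQ]; simp [hTc, taylor_eval, Polynomial.taylor_coeff_zero, add_comm]
    have h7 : Q.eval z = p ^ σ * G.eval z := by rw [hG]; simp
    linarith

lemma periodic_ee_int (G : ℤ[X]) (n : ℕ) (hn : n ≠ 0) :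
    Function.Periodic (fun y : ℕ => ee ((G.eval (y : ℤ) : ℤ) / (n : ℝ))) n := by
  have := ee_poly_periodic G 1 n hn
  simpa using this

lemma beta_ge_one {β : ℝ} {d p : ℕ} (hd : 1 ≤ d) (hβ : 0 < β) (hβd : β ^ d = p) (hp : 1 ≤ p) : 1 ≤ β := by
  by_contra h
  push Not at h
  have := pow_lt_one₀ hβ.le h (n := d) (by omega)
  have h2 : (1:ℝ) ≤ p := mod_cast hp
  linarith

def HuaP (d p k : ℕ) (β : ℝ) : Prop := ∀ F : ℤ[X], F.natDegree ≤ d →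
  (∃ j, 1 ≤ j ∧ ¬ (p : ℤ) ∣ F.coeff j) →
    ‖avg (p ^ k) (fun y => ee ((F.eval (y : ℤ) : ℤ) / ((p ^ k : ℕ) : ℝ)))‖ ≤ (2 * d / β) ^ k

lemma hua_class_bound (d p : ℕ) [hp : Fact p.Prime] (hd : 1 ≤ d) (β : ℝ) (hβ : 0 < β)
    (hβd : β ^ d = p) (k : ℕ) (hk : 1 ≤ k) (hIH : ∀ l < k, HuaP d p l β)
    (F : ℤ[X]) (hF : F.natDegree ≤ d) (hc : ∃ j, 1 ≤ j ∧ ¬ (p : ℤ) ∣ F.coeff j) (c : ℤ) :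
    ‖avg (p ^ (k - 1)) (fun z => ee ((F.eval (c + p * z) : ℤ) / ((p ^ k : ℕ) : ℝ)))‖ ≤
      p * ((2 * d) ^ (k - 1) / β ^ k) := by
  have hβ1 := beta_ge_one hd hβ hβd hp.1.one_lt.le
  have hp0 : (p:ℝ) ≠ 0 := mod_cast hp.1.ne_zero
  have hd1 : (1:ℝ) ≤ 2 * d := by
    have : (1:ℝ) ≤ d := mod_cast hd
    linarith
  obtain ⟨σ, hσ1, hσd, G, hGd, hGc, hG⟩ := hua_expand d p F hF hc c
  by_cases hσk : k ≤ σ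
  · refine (norm_avg_le _ _ 1 zero_le_one fun y => (norm_ee _).le).trans ?_
    rw [← hβd, ← mul_div_assoc, le_div_iff₀ (by positivity), one_mul]
    have h1 : β ^ k ≤ β ^ d := pow_le_pow_right₀ hβ1 (by omega)
    have h2 : (1:ℝ) ≤ (2 * d) ^ (k-1) := one_le_pow₀ hd1
    nlinarith [pow_pos hβ d]
  push Not at hσk
  have e1 : (fun z : ℕ => ee ((F.eval (c + p * (z:ℤ)) : ℤ) / ((p ^ k : ℕ) : ℝ)))
      = fun z : ℕ => ee ((F.eval c : ℤ) / ((p ^ k : ℕ) : ℝ)) * ee ((G.eval (z : ℤ) : ℤ) / ((p ^ (k - σ) : ℕ) : ℝ)) := by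
    funext z
    rw [← ee_add, hG]
    congr 1
    have : (p:ℝ) ^ k = p ^ (k - σ) * p ^ σ := by rw [← pow_add]; congr 1; omega
    push_cast
    rw [this]; field_simp
  rw [e1]
  have e2 : avg (p ^ (k-1)) (fun z : ℕ => ee ((F.eval c : ℤ) / ((p ^ k : ℕ) : ℝ)) * ee ((G.eval (z : ℤ) : ℤ) / ((p ^ (k - σ) : ℕ) : ℝ)))
      = ee ((F.eval c : ℤ) / ((p ^ k : ℕ) : ℝ)) * avg (p ^ (k - σ)) (fun z : ℕ => ee ((G.eval (z : ℤ) : ℤ) / ((p ^ (k - σ) : ℕ) : ℝ))) := by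
    rw [← avg_eq_of_dvd (m := p ^ (k - σ)) (n := p ^ (k-1)) (pow_dvd_pow _ (by omega)) (pow_ne_zero _ hp.1.ne_zero) _
      (periodic_ee_int G _ (pow_ne_zero _ hp.1.ne_zero))]
    unfold avg
    rw [← mul_sum, mul_div_assoc]
  rw [e2, norm_mul, norm_ee, one_mul]
  refine (hIH (k - σ) (by omega) G hGd hGc).trans ?_
  rw [div_pow, ← hβd, ← mul_div_assoc, div_le_div_iff₀ (by positivity) (by positivity)]
  have h1 : ((2:ℝ) * d) ^ (k - σ) ≤ (2 * d) ^ (k - 1) := pow_le_pow_right₀ hd1 (by omega)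
  have h2 : β ^ k ≤ β ^ d * β ^ (k - σ) := by rw [← pow_add]; exact pow_le_pow_right₀ hβ1 (by omega)
  calc ((2:ℝ) * d) ^ (k - σ) * β ^ k ≤ (2 * d) ^ (k - 1) * (β ^ d * β ^ (k - σ)) := by gcongr
    _ = _ := by ring

lemma sum_range_mul' {M : Type*} [AddCommMonoid M] (m n : ℕ) (f : ℕ → M) :
    ∑ y ∈ range (m * n), f y = ∑ c ∈ range m, ∑ z ∈ range n, f (c + m * z) := by
  rw [sum_range_mul, sum_comm]
  simp only [add_comm]

theorem hua (d p : ℕ) [hp : Fact p.Prime] (hd : 1 ≤ d) (hdp : d < p) (β : ℝ) (hβ : 0 < β)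
    (hβd : β ^ d = p) : ∀ k, HuaP d p k β := by
  intro k
  induction k using Nat.strong_induction_on with
  | _ k ih =>
    intro F hF hc
    have hd0 : (0:ℝ) < d := mod_cast hd
    have hp0 : (0:ℝ) < p := mod_cast hp.1.pos
    rcases Nat.lt_or_ge k 2 with hk | hk
    · interval_cases k
      · simp [avg, norm_ee]
      · simpa using hua_one d p hd hdp β hβ hβd F hF hc
    · -- split in classes
      have hclass := hua_class_bound d p hd β hβ hβd k (by omega) ih F hF hc
      obtain ⟨l, rfl⟩ : ∃ l, k = l + 2 := ⟨k - 2, by omega⟩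
      simp only [show l + 2 - 1 = l + 1 by omega] at hclass
      have e1 : avg (p ^ (l+2)) (fun y => ee ((F.eval (y : ℤ) : ℤ) / ((p ^ (l+2) : ℕ) : ℝ)))
          = (∑ c ∈ range p, avg (p ^ (l+1)) (fun z => ee ((F.eval ((c:ℤ) + p * z) : ℤ) / ((p ^ (l+2) : ℕ) : ℝ)))) / p := by
        unfold avg
        rw [← sum_div, div_div, pow_succ' p (l+1), sum_range_mul']
        push_cast
        rw [mul_comm (p:ℂ)]
      rw [e1, norm_div, Complex.norm_natCast, div_le_iff₀ hp0]
      refine (norm_sum_le _ _).trans ?_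
      rw [← sum_filter_add_sum_filter_not (range p) (fun c : ℕ => (p:ℤ) ∣ F.derivative.eval (c:ℤ))]
      rw [sum_eq_zero (s := (range p).filter (fun c : ℕ => ¬ (p:ℤ) ∣ F.derivative.eval (c:ℤ))), add_zero]
      swap
      · intro c hcc
        rw [mem_filter] at hcc
        rw [hua_class_zero p l F c hcc.2, norm_zero]
      have hcard : ((range p).filter (fun c : ℕ => (p:ℤ) ∣ F.derivative.eval (c:ℤ))).card ≤ d := by
        set f : Polynomial (ZMod p) := F.map (castRingHom (ZMod p)) with hf
        obtain ⟨j, hj1, hj⟩ := hc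
        have hfj : f.coeff j ≠ 0 := by
          rw [hf, coeff_map]; simpa [ZMod.intCast_zmod_eq_zero_iff_dvd] using hj
        have hjd : j ≤ d := (le_natDegree_of_ne_zero hfj).trans (natDegree_map_le.trans hF)
        have hder : f.derivative ≠ 0 := by
          intro h0
          have := congrArg (fun g => Polynomial.coeff g (j-1)) h0
          simp only [coeff_derivative, Polynomial.coeff_zero] at this
          rw [Nat.sub_add_cancel hj1] at this
          rcases mul_eq_zero.1 this with h | h
          · exact hfj h
          · have h' : ((j:ℕ) : ZMod p) = 0 := by
              rw [← h]
              have : ((j - 1 + 1 : ℕ) : ZMod p) = ((j - 1 : ℕ) : ZMod p) + 1 := by push_cast; ring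
              rw [← this, Nat.sub_add_cancel hj1]
            rw [ZMod.natCast_eq_zero_iff] at h'
            have := le_of_dvd (by omega) h'
            omega
        have hle : ((range p).filter (fun c : ℕ => (p:ℤ) ∣ F.derivative.eval (c:ℤ))).card ≤ f.derivative.roots.toFinset.card := by
          apply card_le_card_of_injOn (fun c : ℕ => (c : ZMod p))
          · intro c hcc
            have hcc' : c ∈ (range p).filter (fun c : ℕ => (p:ℤ) ∣ F.derivative.eval (c:ℤ)) := hcc
            rw [mem_filter] at hcc'
            simp only [mem_coe, Multiset.mem_toFinset]
            rw [Polynomial.mem_roots hder, Polynomial.IsRoot, hf, Polynomial.derivative_map]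
            have := eval_intCast_map (castRingHom (ZMod p)) F.derivative (c:ℤ)
            simp only [cast_natCast, eq_intCast] at this
            rw [this, ZMod.intCast_zmod_eq_zero_iff_dvd]; exact hcc'.2
          · intro x hx y hy hxy
            have hx' := mem_range.1 (mem_filter.1 (mem_coe.1 hx)).1
            have hy' := mem_range.1 (mem_filter.1 (mem_coe.1 hy)).1
            have := congrArg ZMod.val hxy
            rwa [ZMod.val_cast_of_lt hx', ZMod.val_cast_of_lt hy'] at this
        refine hle.trans ((Multiset.toFinset_card_le _).trans ((Polynomial.card_roots' _).trans ?_))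
        have := Polynomial.natDegree_derivative_le f
        have h2 : f.natDegree ≤ d := (natDegree_map_le (f := castRingHom (ZMod p)) (p := F)).trans hF
        omega
      refine le_trans (sum_le_card_nsmul _ _ (p * ((2 * d) ^ (l+1) / β ^ (l+2)) : ℝ) ?_) ?_
      · intro c _
        exact hclass (c:ℤ)
      rw [nsmul_eq_mul]
      have hcard' : ((((range p).filter (fun c : ℕ => (p:ℤ) ∣ F.derivative.eval (c:ℤ))).card : ℕ) : ℝ) ≤ d := mod_cast hcard
      calc _ ≤ (d:ℝ) * (p * ((2 * d) ^ (l+1) / β ^ (l+2))) := by gcongr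
        _ ≤ (2 * d) * (p * ((2 * d) ^ (l+1) / β ^ (l+2))) := by gcongr; linarith
        _ = _ := by rw [div_pow, pow_succ ((2:ℝ) * d) (l+1)]; ring

/-- two-valued function of a residue class mod `p` -/
def Tw (p : ℕ) (f : ℕ → ℂ) : Prop :=
  ∃ c < p, ∃ u v : ℂ, ‖u‖ ≤ 1 ∧ ‖v‖ ≤ 1 ∧ ∀ y, f y = if y % p = c then u else v

lemma Tw.periodic {p : ℕ} {f : ℕ → ℂ} (h : Tw p f) : Function.Periodic f p := by
  obtain ⟨c, hc, u, v, _, _, h⟩ := h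
  intro y
  rw [h, h, Nat.add_mod_right]

lemma class_avg (p k : ℕ) (hp : 0 < p) (hk : 1 ≤ k) (c : ℕ) (hc : c < p) (g : ℕ → ℂ) :
    avg (p ^ k) (fun y => if y % p = c then g y else 0) = avg (p ^ (k-1)) (fun z => g (c + p * z)) / p := by
  obtain ⟨l, rfl⟩ : ∃ l, k = l + 1 := ⟨k - 1, by omega⟩
  simp only [Nat.add_sub_cancel]
  unfold avg
  rw [div_div, pow_succ' p l, sum_range_mul']
  have : ∀ x ∈ range p, (∑ z ∈ range (p ^ l), if (x + p * z) % p = c then g (x + p * z) else 0)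
      = if x = c then ∑ z ∈ range (p ^ l), g (c + p * z) else 0 := by
    intro x hx
    have hx' := mem_range.1 hx
    split_ifs with h
    · subst h
      apply sum_congr rfl; intro z _
      rw [Nat.add_mul_mod_self_left, mod_eq_of_lt hx', if_pos rfl]
    · apply sum_eq_zero; intro z _
      rw [Nat.add_mul_mod_self_left, mod_eq_of_lt hx', if_neg h]
  rw [sum_congr rfl this, sum_ite_eq', if_pos (mem_range.2 hc)]
  push_cast
  rw [mul_comm (p:ℂ)]

lemma hua_tw (d p : ℕ) [hp : Fact p.Prime] (hd : 1 ≤ d) (hdp : d < p) (β : ℝ) (hβ : 0 < β)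
    (hβd : β ^ d = p) (k : ℕ) (hk : 1 ≤ k) (F : ℤ[X]) (hF : F.natDegree ≤ d)
    (hc : ∃ j, 1 ≤ j ∧ ¬ (p : ℤ) ∣ F.coeff j) (f : ℕ → ℂ) (hf : Tw p f) :
    ‖avg (p ^ k) (fun y => f y * ee ((F.eval (y : ℤ) : ℤ) / ((p ^ k : ℕ) : ℝ)))‖ ≤ (4 * d / β) ^ k := by
  obtain ⟨c, hcp, u, v, hu, hv, h⟩ := hf
  have hp0 : (0:ℝ) < p := mod_cast hp.1.pos
  have hd1 : (1:ℝ) ≤ d := mod_cast hd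
  have h1 := hua d p hd hdp β hβ hβd k F hF hc
  have h2 := hua_class_bound d p hd β hβ hβd k hk (fun l _ => hua d p hd hdp β hβ hβd l) F hF hc c
  set g : ℕ → ℂ := fun y => ee ((F.eval (y : ℤ) : ℤ) / ((p ^ k : ℕ) : ℝ)) with hg
  have e1 : avg (p ^ k) (fun y => f y * g y) = v * avg (p ^ k) g
      + (u - v) * (avg (p ^ (k-1)) (fun z => g (c + p * z)) / p) := by
    rw [← class_avg p k hp.1.pos hk c hcp g]
    unfold avg
    rw [mul_div_assoc', mul_div_assoc', ← add_div, mul_sum, mul_sum, ← sum_add_distrib]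
    congr 1
    apply sum_congr rfl; intro y _
    simp only [h]; split_ifs <;> ring
  rw [e1]
  have h2' : ‖avg (p ^ (k-1)) (fun z => g (c + p * z)) / p‖ ≤ (2 * d) ^ (k - 1) / β ^ k := by
    rw [norm_div, Complex.norm_natCast, div_le_iff₀ hp0, mul_comm]
    have : (fun z : ℕ => g (c + p * z)) = fun z : ℕ => ee ((F.eval ((c:ℤ) + p * z) : ℤ) / ((p ^ k : ℕ) : ℝ)) := by
      funext z; simp only [hg]; push_cast; rfl
    rw [this]; exact h2
  have huv : ‖u - v‖ ≤ 2 := (norm_sub_le _ _).trans (by linarith)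
  calc _ ≤ ‖v‖ * ‖avg (p ^ k) g‖ + ‖u - v‖ * ‖avg (p ^ (k-1)) (fun z => g (c + p * z)) / p‖ := by
        refine (norm_add_le _ _).trans ?_; rw [norm_mul, norm_mul]
    _ ≤ 1 * (2 * d / β) ^ k + 2 * ((2 * d) ^ (k - 1) / β ^ k) := by gcongr
    _ ≤ (4 * d / β) ^ k := by
        obtain ⟨l, rfl⟩ : ∃ l, k = l + 1 := ⟨k - 1, by omega⟩
        simp only [Nat.add_sub_cancel]
        rw [div_pow, div_pow, one_mul, mul_div_assoc', ← add_div]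
        gcongr
        have h3 : ((4:ℝ) * d) ^ (l + 1) = 2 ^ (l+1) * (2 * d) ^ (l+1) := by rw [← mul_pow]; ring
        have h4 : (2:ℝ) ≤ 2 ^ (l+1) := by
          calc (2:ℝ) = 2 ^ 1 := by norm_num
            _ ≤ _ := pow_le_pow_right₀ (by norm_num) (by omega)
        have h5 : (0:ℝ) < (2 * d) ^ l := by positivity
        rw [h3, pow_succ ((2:ℝ) * d)]
        nlinarith [mul_le_mul_of_nonneg_left hd1 h5.le, mul_le_mul_of_nonneg_right h4 (by positivity : (0:ℝ) ≤ (2 * d) ^ l * (2 * d))]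

lemma tw_prod_periodic (q : ℕ) (t : ℕ → ℕ → ℂ) (ht : ∀ p ∈ q.primeFactors, Tw p (t p)) :
    Function.Periodic (fun y => ∏ p ∈ q.primeFactors, t p y) q := by
  intro y
  apply prod_congr rfl
  intro p hp
  exact periodic_of_dvd (Nat.dvd_of_mem_primeFactors hp) (ht p hp).periodic y

lemma composite_bound (d : ℕ) (hd : 1 ≤ d) (F : ℤ[X]) (hF : F.natDegree ≤ d) (t : ℕ → ℕ → ℂ) (q : ℕ) :
    q ≠ 0 → (∀ p ∈ q.primeFactors, Tw p (t p) ∧ d < p ∧ ∃ j, 1 ≤ j ∧ ¬ (p : ℤ) ∣ F.coeff j) →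
    ∀ a : ℤ, IsCoprime a (q : ℤ) →
    ‖avg q (fun y => (∏ p ∈ q.primeFactors, t p y) * ee (a * (F.eval (y : ℤ) : ℤ) / (q : ℝ)))‖ ≤
      (4 * d : ℝ) ^ (q.primeFactorsList.length) * (q : ℝ) ^ (-(1 / d : ℝ)) := by
  induction q using Nat.recOnPosPrimePosCoprime with
  | zero => intro h; exact absurd rfl h
  | one =>
    intro _ _ a _
    simp [avg, norm_ee]
  | prime_pow p k hp hk =>
    intro _ ht a ha
    haveI : Fact p.Prime := ⟨hp⟩
    rw [Nat.primeFactors_prime_pow hk.ne' hp] at ht ⊢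
    obtain ⟨ht1, hdp, j, hj, hjF⟩ := ht p (mem_singleton_self p)
    simp only [prod_singleton]
    have hp0 : (0:ℝ) < p := mod_cast hp.pos
    have hd0 : (d:ℝ) ≠ 0 := mod_cast (by omega : d ≠ 0)
    have hac : ¬ (p:ℤ) ∣ a := by
      intro h
      have h1 : (p:ℤ) ∣ ((p ^ k : ℕ):ℤ) := by push_cast; exact dvd_pow_self _ hk.ne'
      have := ha.isUnit_of_dvd' h h1
      have h3 := Int.isUnit_iff.1 this
      have := hp.two_le
      omega
    have := hua_tw d p hd hdp ((p:ℝ) ^ (1/d:ℝ)) (by positivity) (by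
        rw [← rpow_natCast, ← rpow_mul hp0.le, one_div, inv_mul_cancel₀ hd0, rpow_one]) k hk
        (Polynomial.C a * F) ((natDegree_C_mul_le _ _).trans hF) ⟨j, hj, by
          rw [coeff_C_mul]
          intro h
          rcases (Nat.prime_iff_prime_int.1 hp).dvd_or_dvd h with h | h
          · exact hac h
          · exact hjF h⟩ (t p) ht1
    simp only [eval_mul, eval_C, Int.cast_mul] at this
    refine this.trans (le_of_eq ?_)
    rw [hp.primeFactorsList_pow, List.length_replicate, div_pow, div_eq_mul_inv]
    congr 1
    rw [Nat.cast_pow, ← rpow_natCast, ← rpow_natCast, ← rpow_mul hp0.le, ← rpow_mul hp0.le, ← rpow_neg hp0.le]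
    congr 1; ring
  | coprime m n hm hn hmn ihm ihn =>
    intro h0 ht a ha
    have hm0 : m ≠ 0 := by omega
    have hn0 : n ≠ 0 := by omega
    obtain ⟨x, y, hxy⟩ := (Nat.isCoprime_iff_coprime.2 hmn)
    rw [hmn.primeFactors_mul] at ht ⊢
    have hdis := hmn.disjoint_primeFactors
    -- a/(mn) = a*y/m + a*x/n  since x*m+y*n = 1
    have hcm : IsCoprime (a * y) (m:ℤ) := by
      apply IsCoprime.mul_left
      · push_cast at ha; exact ha.of_mul_right_left
      · exact ⟨n, x, by linarith⟩
    have hcn : IsCoprime (a * x) (n:ℤ) := by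
      apply IsCoprime.mul_left
      · push_cast at ha; exact ha.of_mul_right_right
      · exact ⟨m, y, by linarith⟩
    have hm1 := ihm hm0 (fun p hp => ht p (mem_union_left _ hp)) _ hcm
    have hn1 := ihn hn0 (fun p hp => ht p (mem_union_right _ hp)) _ hcn
    have hmR : (m:ℝ) ≠ 0 := mod_cast hm0
    have hnR : (n:ℝ) ≠ 0 := mod_cast hn0
    have e1 : (fun z : ℕ => (∏ p ∈ m.primeFactors ∪ n.primeFactors, t p z) * ee (a * (F.eval (z : ℤ) : ℤ) / ((m * n : ℕ) : ℝ)))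
        = fun z : ℕ => ((∏ p ∈ m.primeFactors, t p z) * ee ((a * y : ℤ) * (F.eval (z : ℤ) : ℤ) / (m : ℝ))) *
          ((∏ p ∈ n.primeFactors, t p z) * ee ((a * x : ℤ) * (F.eval (z : ℤ) : ℤ) / (n : ℝ))) := by
      funext z
      rw [prod_union hdis]
      have : ee (a * (F.eval (z : ℤ) : ℤ) / ((m * n : ℕ) : ℝ)) = ee ((a * y : ℤ) * (F.eval (z : ℤ) : ℤ) / (m : ℝ)) * ee ((a * x : ℤ) * (F.eval (z : ℤ) : ℤ) / (n : ℝ)) := by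
        rw [← ee_add]
        congr 1
        have hxy' : (x:ℝ) * m + y * n = 1 := mod_cast hxy
        push_cast
        field_simp
        linear_combination (-(a:ℝ) * (F.eval (z : ℤ) : ℤ)) * hxy'
      rw [this]; ring
    rw [e1, avg_indep m n (by omega) (by omega) hmn, norm_mul]
    · calc _ ≤ _ := mul_le_mul hm1 hn1 (norm_nonneg _) (by positivity)
        _ = _ := by
          rw [(Nat.perm_primeFactorsList_mul hm0 hn0).length_eq, List.length_append, pow_add, Nat.cast_mul,
            mul_rpow (by positivity) (by positivity)]
          ring
    · exact periodic_mul (tw_prod_periodic m t fun p hp => (ht p (mem_union_left _ hp)).1) (ee_poly_periodic F _ m hm0)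
    · exact periodic_mul (tw_prod_periodic n t fun p hp => (ht p (mem_union_right _ hp)).1) (ee_poly_periodic F _ n hn0)

noncomputable def tp (W b p y : ℕ) : ℝ := if p ∣ b + W * y then -1 else 1 / ((p : ℝ) - 1)

noncomputable def chi (W b k y : ℕ) : ℝ := ∏ p ∈ k.primeFactors, tp W b p y

def KK (W R : ℕ) : Finset ℕ := (Icc 1 R).filter (fun k => Squarefree k ∧ Coprime k W)

noncomputable def JJ (W R : ℕ) : ℝ := ∑ k ∈ KK W R, 1 / (totient k : ℝ)

noncomputable def nu (W b R y : ℕ) : ℝ := (∑ k ∈ KK W R, chi W b k y) ^ 2 / JJ W R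

lemma mem_KK {W R k : ℕ} : k ∈ KK W R ↔ (1 ≤ k ∧ k ≤ R) ∧ Squarefree k ∧ Coprime k W := by
  simp [KK]

lemma JJ_ge_one (W R : ℕ) (hR : 1 ≤ R) : 1 ≤ JJ W R := by
  unfold JJ
  have h1 : 1 ∈ KK W R := mem_KK.2 ⟨⟨le_rfl, hR⟩, squarefree_one, Nat.coprime_one_left W⟩
  refine le_trans ?_ (single_le_sum (f := fun k : ℕ => 1 / (totient k : ℝ)) (fun i _ => by positivity) h1)
  simp

lemma nu_nonneg (W b R y : ℕ) : 0 ≤ nu W b R y := by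
  unfold nu
  exact div_nonneg (sq_nonneg _) (sum_nonneg fun _ _ => by positivity)

/-- the residue class -/
lemma dvd_iff_class (W b p : ℕ) (hp : p.Prime) (hW : ¬ p ∣ W) :
    ∃ c < p, ∀ y, p ∣ b + W * y ↔ y % p = c := by
  haveI := Fact.mk hp
  have hW0 : (W : ZMod p) ≠ 0 := by
    rwa [Ne, ZMod.natCast_eq_zero_iff]
  refine ⟨(-(b : ZMod p) * (W : ZMod p)⁻¹).val, ZMod.val_lt _, fun y => ?_⟩
  rw [← ZMod.natCast_eq_zero_iff, ← ZMod.val_natCast, (ZMod.val_injective p).eq_iff]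
  push_cast
  constructor
  · intro h
    field_simp
    linear_combination h
  · intro h
    rw [h]; field_simp; ring

lemma tp_abs_le (W b p y : ℕ) (hp : p.Prime) : |tp W b p y| ≤ 1 := by
  have : (2:ℝ) ≤ p := mod_cast hp.two_le
  unfold tp; split_ifs
  · simp
  · rw [abs_of_nonneg (by apply div_nonneg <;> linarith), div_le_one (by linarith)]; linarith

lemma chi_abs_le (W b k y : ℕ) : |chi W b k y| ≤ 1 := by
  unfold chi
  rw [abs_prod]
  exact prod_le_one (fun _ _ => abs_nonneg _) fun p hp => tp_abs_le W b p y (Nat.prime_of_mem_primeFactors hp)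

lemma tp_periodic (W b p : ℕ) : Function.Periodic (fun y => tp W b p y) p := by
  intro y
  simp only [tp]
  have : (p ∣ b + W * (y + p)) ↔ p ∣ b + W * y := by
    rw [mul_add, ← add_assoc]; exact Nat.dvd_add_left (Dvd.intro_left W rfl)
  simp only [this]

lemma chi_periodic (W b k : ℕ) : Function.Periodic (fun y => chi W b k y) k := by
  intro y
  simp only [chi]
  apply prod_congr rfl; intro p hp
  obtain ⟨c, hc⟩ := Nat.dvd_of_mem_primeFactors hp
  have h := (tp_periodic W b p).nat_mul c y
  conv_lhs => rw [hc]
  rw [mul_comm]; exact_mod_cast h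

lemma chi_periodicC (W b k : ℕ) : Function.Periodic (fun y => (chi W b k y : ℂ)) k := by
  intro y
  have := chi_periodic W b k y
  simp only at this ⊢
  rw [this]

lemma chi_mul (W b k l y : ℕ) (h : Coprime k l) : chi W b (k * l) y = chi W b k y * chi W b l y := by
  unfold chi
  rw [h.primeFactors_mul, prod_union h.disjoint_primeFactors]

lemma chi_prime (W b p y : ℕ) (hp : p.Prime) : chi W b p y = tp W b p y := by
  unfold chi; rw [hp.primeFactors, prod_singleton]

lemma chi_one (W b y : ℕ) : chi W b 1 y = 1 := by simp [chi]

lemma sum_class (p c : ℕ) (hc : c < p) (u v : ℂ) :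
    ∑ y ∈ range p, (if y % p = c then u else v) = u + (p - 1) * v := by
  have : ∀ y ∈ range p, (if y % p = c then u else v) = v + (if y = c then u - v else 0) := by
    intro y hy
    rw [mod_eq_of_lt (mem_range.1 hy)]; split_ifs <;> ring
  rw [sum_congr rfl this, sum_add_distrib, sum_ite_eq', if_pos (mem_range.2 hc)]
  simp; ring

lemma tp_avg (W b p : ℕ) (hp : p.Prime) (hW : ¬ p ∣ W) : avg p (fun y => (tp W b p y : ℂ)) = 0 := by
  obtain ⟨c, hc, h⟩ := dvd_iff_class W b p hp hW
  have h2 : (p : ℂ) - 1 ≠ 0 := by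
    rw [sub_ne_zero]; exact_mod_cast hp.one_lt.ne'
  unfold avg
  have : ∀ y ∈ range p, (tp W b p y : ℂ) = if y % p = c then -1 else 1 / ((p:ℂ) - 1) := by
    intro y _
    simp only [tp, h]; split_ifs <;> push_cast <;> rfl
  rw [sum_congr rfl this, sum_class p c hc]
  field_simp; simp

lemma tp_sq_avg (W b p : ℕ) (hp : p.Prime) (hW : ¬ p ∣ W) :
    avg p (fun y => (tp W b p y : ℂ) * (tp W b p y : ℂ)) = 1 / ((p:ℂ) - 1) := by
  obtain ⟨c, hc, h⟩ := dvd_iff_class W b p hp hW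
  have h2 : (p : ℂ) - 1 ≠ 0 := by
    rw [sub_ne_zero]; exact_mod_cast hp.one_lt.ne'
  have h3 : (p : ℂ) ≠ 0 := mod_cast hp.pos.ne'
  unfold avg
  have : ∀ y ∈ range p, (tp W b p y : ℂ) * (tp W b p y : ℂ) = if y % p = c then 1 else 1 / ((p:ℂ) - 1) ^ 2 := by
    intro y _
    simp only [tp, h]; split_ifs <;> push_cast <;> field_simp <;> ring
  rw [sum_congr rfl this, sum_class p c hc]
  field_simp; ring

lemma not_dvd_of_coprime_dvd {p k W : ℕ} (hp : p.Prime) (hk : p ∣ k) (h : Coprime k W) : ¬ p ∣ W := by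
  intro hW
  have := Nat.dvd_gcd hk hW
  rw [h] at this
  exact hp.one_lt.ne' (Nat.dvd_one.1 this)

/-- diagonal -/
lemma chi_sq_avg (W b k : ℕ) (hk : Squarefree k) (hc : Coprime k W) :
    avg k (fun y => (chi W b k y : ℂ) * chi W b k y) = 1 / (totient k : ℂ) := by
  induction k using Nat.recOnPosPrimePosCoprime with
  | prime_pow p n hp hn =>
    have : n = 1 := by
      rcases (Nat.squarefree_pow_iff hp.one_lt.ne' hn.ne').1 hk with ⟨_, h⟩; exact h
    subst this
    rw [pow_one] at *
    simp only [chi_prime W b p _ hp]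
    rw [tp_sq_avg W b p hp (not_dvd_of_coprime_dvd hp dvd_rfl hc), Nat.totient_prime hp]
    rw [Nat.cast_sub hp.one_lt.le]; simp
  | zero => exact absurd hk not_squarefree_zero
  | one => simp [avg, chi_one]
  | coprime m n hm hn hmn ihm ihn =>
    have h1 : ∀ y, (chi W b (m * n) y : ℂ) * chi W b (m * n) y =
        ((chi W b m y : ℂ) * chi W b m y) * ((chi W b n y : ℂ) * chi W b n y) := by
      intro y; rw [chi_mul W b m n y hmn]; push_cast; ring
    simp only [h1]
    have := avg_indep m n (by omega) (by omega) hmn _ _ (periodic_mul (chi_periodicC W b m) (chi_periodicC W b m))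
      (periodic_mul (chi_periodicC W b n) (chi_periodicC W b n))
    rw [this, ihm (hk.squarefree_of_dvd (Dvd.intro _ rfl)) (hc.coprime_dvd_left (Dvd.intro _ rfl)),
      ihn (hk.squarefree_of_dvd (Dvd.intro_left _ rfl)) (hc.coprime_dvd_left (Dvd.intro_left _ rfl)),
      Nat.totient_mul hmn]
    push_cast; field_simp

lemma chi_orth_aux (W b k l p : ℕ) (hk0 : k ≠ 0) (hl0 : l ≠ 0) (hk : Squarefree k) (hc : Coprime k W)
    (hp : p.Prime) (hpk : p ∣ k) (hpl : ¬ p ∣ l) :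
    avg (k * l) (fun y => (chi W b k y : ℂ) * chi W b l y) = 0 := by
  obtain ⟨m, rfl⟩ := hpk
  have hcop : Coprime p m := Nat.coprime_of_squarefree_mul hk
  have hcop2 : Coprime p (m * l) := hcop.mul_right ((Nat.Prime.coprime_iff_not_dvd hp).2 hpl)
  have h1 : ∀ y, (chi W b (p * m) y : ℂ) * chi W b l y =
      (tp W b p y : ℂ) * ((chi W b m y : ℂ) * chi W b l y) := by
    intro y; rw [chi_mul W b p m y hcop, chi_prime W b p y hp]; push_cast; ring
  simp only [h1]
  have hm0 : m ≠ 0 := by rintro rfl; simp at hk0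
  have hper : Function.Periodic (fun y => (tp W b p y : ℂ)) p := by
    intro y; have := tp_periodic W b p y; simp only at this ⊢; rw [this]
  have := avg_indep p (m * l) hp.pos.ne' (by positivity) hcop2 _ _ hper
    (periodic_mul (periodic_of_dvd (Dvd.intro _ rfl) (chi_periodicC W b m))
      (periodic_of_dvd (Dvd.intro_left _ rfl) (chi_periodicC W b l)))
  rw [mul_assoc, this, tp_avg W b p hp (not_dvd_of_coprime_dvd hp (Dvd.intro _ rfl) hc), zero_mul]

lemma chi_orthog (W b k l : ℕ) (hk : Squarefree k) (hkc : Coprime k W) (hl : Squarefree l)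
    (hlc : Coprime l W) :
    avg (k * l) (fun y => (chi W b k y : ℂ) * chi W b l y) = if k = l then 1 / (totient k : ℂ) else 0 := by
  have hk0 := hk.ne_zero
  have hl0 := hl.ne_zero
  split_ifs with h
  · subst h
    rw [avg_eq_of_dvd (Dvd.intro _ rfl) (by positivity) _ (periodic_mul (chi_periodicC W b k) (chi_periodicC W b k))]
    exact chi_sq_avg W b k hk hkc
  · by_cases h1 : ∃ p, p.Prime ∧ p ∣ k ∧ ¬ p ∣ l
    · obtain ⟨p, hp, h2, h3⟩ := h1
      exact chi_orth_aux W b k l p hk0 hl0 hk hkc hp h2 h3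
    · by_cases h2 : ∃ p, p.Prime ∧ p ∣ l ∧ ¬ p ∣ k
      · obtain ⟨p, hp, h2, h3⟩ := h2
        have := chi_orth_aux W b l k p hl0 hk0 hl hlc hp h2 h3
        rw [mul_comm k l]
        rw [← this]; congr 1; funext y; ring
      · exfalso; apply h
        push Not at h1 h2
        rw [← Nat.prod_primeFactors_of_squarefree hk, ← Nat.prod_primeFactors_of_squarefree hl]
        congr 1
        ext p; simp only [Nat.mem_primeFactors]
        constructor
        · rintro ⟨a, b, c⟩; exact ⟨a, h1 p a b, hl0⟩
        · rintro ⟨a, b, c⟩; exact ⟨a, h2 p a b, hk0⟩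

noncomputable def GG (W b R : ℕ) (H : ℤ[X]) (a : ℤ) (q : ℕ) : ℂ :=
  (∑ k ∈ KK W R, ∑ l ∈ KK W R,
    avg (k * l * q) (fun y => (chi W b k y : ℂ) * chi W b l y * ee (a * (H.eval (y:ℤ) : ℤ) / (q:ℝ)))) / JJ W R

lemma sum_range_shift (n : ℕ) (f : ℕ → ℂ) (hf : Function.Periodic f n) (D : ℕ) :
    ∑ y ∈ range n, f (y + D) = ∑ y ∈ range n, f y := by
  induction D with
  | zero => simp
  | succ D ih =>
    rw [← ih]
    have h1 := sum_range_succ (fun y => f (y + D)) n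
    have h2 := sum_range_succ' (fun y => f (y + D)) n
    have h3 : f (n + D) = f (0 + D) := by rw [add_comm, hf, zero_add]
    rw [h1, h3] at h2
    have : ∀ y, f (y + (D + 1)) = f (y + 1 + D) := fun y => by congr 1; ring
    simp only [this]
    exact (add_right_cancel h2).symm

/-- H(y+D) - H(y) ≡ c1 D mod pD -/
lemma poly_shift_mod (H : ℤ[X]) (p : ℤ) (hH : ∀ j, 2 ≤ j → p ∣ H.coeff j) (y D : ℤ) :
    ∃ z, H.eval (y + D) - H.eval y = H.coeff 1 * D + p * D * z := by
  classical
  rw [Polynomial.eval_eq_sum_range, Polynomial.eval_eq_sum_range, ← sum_sub_distrib]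
  have key : ∀ j, ∃ z, H.coeff j * (y + D) ^ j - H.coeff j * y ^ j = (if j = 1 then H.coeff 1 * D else 0) + p * D * z := by
    intro j
    rcases j with _ | _ | j
    · exact ⟨0, by simp⟩
    · exact ⟨0, by simp; ring⟩
    · obtain ⟨c, hc⟩ := hH (j+2) (by omega)
      obtain ⟨e, he⟩ := sub_dvd_pow_sub_pow (y + D) y (j + 2)
      refine ⟨c * e, ?_⟩
      rw [← mul_sub, he, hc]
      simp; ring
  choose z hz using key
  by_cases h1 : 1 ∈ range (H.natDegree + 1)
  · refine ⟨∑ j ∈ range (H.natDegree + 1), z j, ?_⟩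
    rw [sum_congr rfl fun j _ => hz j, sum_add_distrib, sum_ite_eq', if_pos h1, mul_sum]
  · refine ⟨∑ j ∈ range (H.natDegree + 1), z j, ?_⟩
    have : H.coeff 1 = 0 := coeff_eq_zero_of_natDegree_lt (by simp at h1; omega)
    rw [sum_congr rfl fun j _ => hz j, sum_add_distrib, sum_ite_eq', if_neg h1, mul_sum, this]; simp

lemma ee_eq_one_iff (p : ℕ) (hp : 0 < p) (j : ℤ) (h : ee ((j : ℝ) / p) = 1) : (p : ℤ) ∣ j := by
  haveI : NeZero p := ⟨hp.ne'⟩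
  rw [ee_eq_stdAddChar] at h
  have : (j : ZMod p) = 0 := by
    apply ZMod.injective_stdAddChar
    rw [h]; simp
  rwa [ZMod.intCast_zmod_eq_zero_iff_dvd] at this

lemma GG_term_zero (W b k l q p : ℕ) (H : ℤ[X]) (a : ℤ) (hk : Coprime k W) (hl : Coprime l W)
    (hk0 : k ≠ 0) (hl0 : l ≠ 0) (hq : q ≠ 0)
    (hp : p.Prime) (hpW : p ∣ W) (hpq : p ∣ q) (ha : IsCoprime a (q : ℤ))
    (h1 : ¬ (p : ℤ) ∣ H.coeff 1) (h2 : ∀ j, 2 ≤ j → (p : ℤ) ∣ H.coeff j) :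
    avg (k * l * q) (fun y => (chi W b k y : ℂ) * chi W b l y * ee (a * (H.eval (y:ℤ) : ℤ) / (q:ℝ))) = 0 := by
  obtain ⟨r, rfl⟩ := hpq
  have hr : r ≠ 0 := by rintro rfl; simp at hq
  set D : ℕ := k * l * r with hD
  set f : ℕ → ℂ := fun y => (chi W b k y : ℂ) * chi W b l y * ee (a * (H.eval (y:ℤ) : ℤ) / ((p * r : ℕ):ℝ)) with hf
  have hper : Function.Periodic f (k * l * (p * r)) := by
    apply periodic_mul (periodic_mul _ _)
    · exact periodic_of_dvd (Dvd.intro_left _ rfl) (ee_poly_periodic H a (p * r) hq)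
    · exact periodic_of_dvd ⟨l * (p * r), by ring⟩ (chi_periodicC W b k)
    · exact periodic_of_dvd ⟨k * (p * r), by ring⟩ (chi_periodicC W b l)
  have hω : ∀ y, f (y + D) = f y * ee (((a * H.coeff 1 * (k * l) : ℤ) : ℝ) / p) := by
    intro y
    have e1 : (chi W b k (y + D) : ℂ) = chi W b k y :=
      periodic_of_dvd (n := D) ⟨l * r, by rw [hD]; ring⟩ (chi_periodicC W b k) y
    have e2 : (chi W b l (y + D) : ℂ) = chi W b l y :=
      periodic_of_dvd (n := D) ⟨k * r, by rw [hD]; ring⟩ (chi_periodicC W b l) y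
    simp only [hf, e1, e2]
    rw [mul_assoc _ (ee _) (ee _), ← ee_add]
    congr 1
    obtain ⟨z, hz⟩ := poly_shift_mod H p h2 y D
    apply ee_eq_of_sub_int (a * (k * l) * z)
    have hz' : ((H.eval ((y + D : ℕ) : ℤ) : ℤ) : ℝ) = (H.eval (y:ℤ) : ℤ) + H.coeff 1 * D + p * D * z := by
      have : (H.eval ((y + D : ℕ) : ℤ) : ℤ) = H.eval (y:ℤ) + H.coeff 1 * D + p * D * z := by
        push_cast; linarith
      rw [this]; push_cast; ring
    have hp0 : (p:ℝ) ≠ 0 := mod_cast hp.pos.ne'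
    have hr0 : (r:ℝ) ≠ 0 := mod_cast hr
    rw [hz', hD]; push_cast
    field_simp
    ring
  have hS := sum_range_shift _ f hper D
  simp only [hω] at hS
  rw [← sum_mul] at hS
  have hne : ee (((a * H.coeff 1 * (k * l) : ℤ) : ℝ) / p) ≠ 1 := by
    intro h
    have hd := ee_eq_one_iff p hp.pos _ h
    have hpi := Nat.prime_iff_prime_int.1 hp
    have nk : ∀ m : ℕ, Coprime m W → ¬ (p:ℤ) ∣ m := by
      intro m hm hpm
      exact not_dvd_of_coprime_dvd hp (mod_cast hpm) hm hpW
    rcases hpi.dvd_or_dvd hd with h | h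
    · rcases hpi.dvd_or_dvd h with h | h
      · have : IsCoprime a (p:ℤ) := by
          push_cast at ha
          exact IsCoprime.of_mul_right_left ha
        exact hpi.not_unit (this.isUnit_of_dvd' h dvd_rfl)
      · exact h1 h
    · rcases hpi.dvd_or_dvd h with h | h
      · exact nk k hk h
      · exact nk l hl h
  have : ∑ y ∈ range (k * l * (p * r)), f y = 0 := by
    have : (∑ y ∈ range (k * l * (p * r)), f y) * (ee (((a * H.coeff 1 * (k * l) : ℤ) : ℝ) / p) - 1) = 0 := by
      rw [mul_sub, hS]; ring
    rcases mul_eq_zero.1 this with h | h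
    · exact h
    · exact absurd (sub_eq_zero.1 h) hne
  unfold avg
  rw [this, zero_div]

lemma GG_zero (W b R q p : ℕ) (H : ℤ[X]) (a : ℤ) (hq : q ≠ 0)
    (hp : p.Prime) (hpW : p ∣ W) (hpq : p ∣ q) (ha : IsCoprime a (q : ℤ))
    (h1 : ¬ (p : ℤ) ∣ H.coeff 1) (h2 : ∀ j, 2 ≤ j → (p : ℤ) ∣ H.coeff j) : GG W b R H a q = 0 := by
  unfold GG
  rw [sum_eq_zero, zero_div]
  intro k hk
  apply sum_eq_zero
  intro l hl
  rw [mem_KK] at hk hl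
  exact GG_term_zero W b k l q p H a hk.2.2 hl.2.2 (by omega) (by omega) hq hp hpW hpq ha h1 h2

lemma GG_one (W b R : ℕ) (hR : 1 ≤ R) (H : ℤ[X]) (a : ℤ) : GG W b R H a 1 = 1 := by
  unfold GG
  have e : ∀ y : ℕ, ee (a * (H.eval (y:ℤ) : ℤ) / ((1:ℕ):ℝ)) = 1 := by
    intro y
    rw [← ee_int (a * H.eval (y:ℤ))]; congr 1; push_cast; simp
  simp only [e, mul_one]
  have : ∀ k ∈ KK W R, ∑ l ∈ KK W R, avg (k * l) (fun y => (chi W b k y : ℂ) * chi W b l y) = 1 / (totient k : ℂ) := by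
    intro k hk
    rw [sum_congr rfl fun l hl => chi_orthog W b k l (mem_KK.1 hk).2.1 (mem_KK.1 hk).2.2 (mem_KK.1 hl).2.1 (mem_KK.1 hl).2.2]
    rw [sum_ite_eq, if_pos hk]
  rw [sum_congr rfl this]
  have hJ := JJ_ge_one W R hR
  have : (∑ k ∈ KK W R, 1 / (totient k : ℂ)) = (JJ W R : ℂ) := by
    unfold JJ; push_cast; rfl
  rw [this, div_self]
  exact_mod_cast (by linarith : JJ W R ≠ 0)

lemma divisors_card_le (q : ℕ) (hq : q ≠ 0) : q.divisors.card ≤ 2 ^ q.primeFactorsList.length := by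
  induction q using Nat.recOnMul with
  | zero => exact absurd rfl hq
  | one => simp
  | prime p hp => rw [hp.divisors, Nat.primeFactorsList_prime hp]; simp [hp.one_lt.ne]
  | mul m n ihm ihn =>
    have hm : m ≠ 0 := by rintro rfl; simp at hq
    have hn : n ≠ 0 := by rintro rfl; simp at hq
    rw [(Nat.perm_primeFactorsList_mul hm hn).length_eq, List.length_append, pow_add, Nat.divisors_mul]
    exact (card_mul_le).trans (Nat.mul_le_mul (ihm hm) (ihn hn))

lemma rough_pow_le (A e : ℝ) (hA : 1 ≤ A) (q : ℕ) (hq : q ≠ 0) (h : ∀ p, p.Prime → p ∣ q → A ≤ (p:ℝ) ^ e) :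
    A ^ q.primeFactorsList.length ≤ (q:ℝ) ^ e := by
  induction q using Nat.recOnMul with
  | zero => exact absurd rfl hq
  | one => simp
  | prime p hp => rw [Nat.primeFactorsList_prime hp]; simpa using h p hp dvd_rfl
  | mul m n ihm ihn =>
    have hm : m ≠ 0 := by rintro rfl; simp at hq
    have hn : n ≠ 0 := by rintro rfl; simp at hq
    rw [(Nat.perm_primeFactorsList_mul hm hn).length_eq, List.length_append, pow_add]
    push_cast
    rw [mul_rpow (by positivity) (by positivity)]
    exact mul_le_mul (ihm hm fun p hp hd => h p hp (hd.mul_right n)) (ihn hn fun p hp hd => h p hp (hd.mul_left m))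
      (by positivity) (by positivity)

lemma gcd_split (k q : ℕ) (hk : Squarefree k) :
    k = Nat.gcd k q * (k / Nat.gcd k q) ∧ Coprime (Nat.gcd k q) (k / Nat.gcd k q) ∧
      Coprime (k / Nat.gcd k q) q ∧ Squarefree (k / Nat.gcd k q) := by
  have h1 : k = Nat.gcd k q * (k / Nat.gcd k q) := (Nat.mul_div_cancel' (Nat.gcd_dvd_left k q)).symm
  have h2 : Coprime (Nat.gcd k q) (k / Nat.gcd k q) := Nat.coprime_of_squarefree_mul (h1 ▸ hk)
  have hd : k / Nat.gcd k q ∣ k := Nat.div_dvd_of_dvd (Nat.gcd_dvd_left k q)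
  refine ⟨h1, h2, ?_, hk.squarefree_of_dvd hd⟩
  apply Nat.coprime_of_dvd
  intro p hp hp1 hp2
  have : p ∣ Nat.gcd k q := Nat.dvd_gcd (hp1.trans hd) hp2
  have := Nat.dvd_gcd this hp1
  rw [h2] at this
  exact hp.one_lt.ne' (Nat.dvd_one.1 this)

lemma chi_gcd (W b k q y : ℕ) (hk0 : k ≠ 0) (hq0 : q ≠ 0) : (chi W b (Nat.gcd k q) y : ℂ) =
    ∏ p ∈ q.primeFactors, (if p ∣ k then (tp W b p y : ℂ) else 1) := by
  rw [← prod_filter]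
  unfold chi
  push_cast
  apply prod_congr _ fun _ _ => rfl
  ext p
  have : Nat.gcd k q ≠ 0 := Nat.gcd_ne_zero_left hk0
  simp only [Nat.mem_primeFactors, mem_filter, Nat.dvd_gcd_iff]
  tauto

lemma Tw_tp (W b p k l : ℕ) (hp : p.Prime) (hW : ¬ p ∣ W) :
    Tw p (fun y => (if p ∣ k then (tp W b p y : ℂ) else 1) * (if p ∣ l then (tp W b p y : ℂ) else 1)) := by
  obtain ⟨c, hc, h⟩ := dvd_iff_class W b p hp hW
  have h1 : ∃ u v : ℂ, ‖u‖ ≤ 1 ∧ ‖v‖ ≤ 1 ∧ ∀ y, (tp W b p y : ℂ) = if y % p = c then u else v := by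
    refine ⟨-1, 1 / ((p:ℂ) - 1), by simp, ?_, ?_⟩
    · have : (1:ℂ) / ((p:ℂ) - 1) = ((1 / ((p:ℝ) - 1) : ℝ) : ℂ) := by push_cast; rfl
      rw [this, norm_real]
      have : (2:ℝ) ≤ p := mod_cast hp.two_le
      rw [norm_eq_abs, abs_of_nonneg (by apply div_nonneg <;> linarith), div_le_one (by linarith)]; linarith
    · intro y
      simp only [tp, h]; split_ifs <;> push_cast <;> rfl
  obtain ⟨u, v, hu, hv, hy⟩ := h1
  simp only [hy]
  refine ⟨c, hc, (if p ∣ k then u else 1) * (if p ∣ l then u else 1), (if p ∣ k then v else 1) * (if p ∣ l then v else 1), ?_, ?_, ?_⟩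
  · rw [norm_mul]; apply mul_le_one₀ _ (norm_nonneg _) _ <;> split_ifs <;> simp [hu]
  · rw [norm_mul]; apply mul_le_one₀ _ (norm_nonneg _) _ <;> split_ifs <;> simp [hv]
  · intro y; beta_reduce; split_ifs <;> rfl

lemma GG_term_bound (d : ℕ) (hd : 1 ≤ d) (W b k l q : ℕ) (H : ℤ[X]) (hH : H.natDegree ≤ d) (a : ℤ)
    (hk : Squarefree k) (hkc : Coprime k W) (hl : Squarefree l) (hlc : Coprime l W)
    (hq : q ≠ 0) (ha : IsCoprime a (q : ℤ))
    (hpq : ∀ p, p.Prime → p ∣ q → ¬ p ∣ W ∧ d < p ∧ ∃ j, 1 ≤ j ∧ ¬ (p:ℤ) ∣ H.coeff j) :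
    ‖avg (k * l * q) (fun y => (chi W b k y : ℂ) * chi W b l y * ee (a * (H.eval (y:ℤ) : ℤ) / (q:ℝ)))‖ ≤
     (if k / Nat.gcd k q = l / Nat.gcd l q then 1 / (totient (k / Nat.gcd k q) : ℝ) else 0) *
      ((4 * d : ℝ) ^ (q.primeFactorsList.length) * (q:ℝ) ^ (-(1 / d : ℝ))) := by
  obtain ⟨k1, k2, k3, k4⟩ := gcd_split k q hk
  obtain ⟨l1, l2, l3, l4⟩ := gcd_split l q hl
  have hk0 := hk.ne_zero
  have hl0 := hl.ne_zero
  set g := Nat.gcd k q with hg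
  set g' := Nat.gcd l q with hg'
  set m := k / g
  set m' := l / g'
  have hgq : g ∣ q := Nat.gcd_dvd_right _ _
  have hgq' : g' ∣ q := Nat.gcd_dvd_right _ _
  set A : ℕ → ℂ := fun y => (chi W b g y : ℂ) * chi W b g' y * ee (a * (H.eval (y:ℤ) : ℤ) / (q:ℝ)) with hA
  set B : ℕ → ℂ := fun y => (chi W b m y : ℂ) * chi W b m' y with hB
  have e1 : ∀ y, (chi W b k y : ℂ) * chi W b l y * ee (a * (H.eval (y:ℤ) : ℤ) / (q:ℝ)) = A y * B y := by
    intro y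
    have h1 : chi W b k y = chi W b g y * chi W b m y := by rw [← chi_mul W b g m y k2, ← k1]
    have h2 : chi W b l y = chi W b g' y * chi W b m' y := by rw [← chi_mul W b g' m' y l2, ← l1]
    rw [h1, h2, hA, hB]; push_cast; ring
  have hAp : Function.Periodic A q :=
    periodic_mul (periodic_mul (periodic_of_dvd hgq (chi_periodicC W b g)) (periodic_of_dvd hgq' (chi_periodicC W b g')))
      (ee_poly_periodic H a q hq)
  have hBp : Function.Periodic B (m * m') :=
    periodic_mul (periodic_of_dvd (Dvd.intro _ rfl) (chi_periodicC W b m)) (periodic_of_dvd (Dvd.intro_left _ rfl) (chi_periodicC W b m'))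
  have hm0 : m ≠ 0 := k4.ne_zero
  have hm0' : m' ≠ 0 := l4.ne_zero
  have hdvd : q * (m * m') ∣ k * l * q := ⟨g * g', by
    rw [show k * l * q = (g * m) * (g' * m') * q by rw [← k1, ← l1]]; ring⟩
  simp only [e1]
  rw [avg_eq_of_dvd hdvd (by positivity) _ (periodic_mul (periodic_of_dvd (Dvd.intro _ rfl) hAp) (periodic_of_dvd (Dvd.intro_left _ rfl) hBp)),
    avg_indep q (m * m') hq (by positivity) (k3.symm.mul_right l3.symm) A B hAp hBp, norm_mul, mul_comm]
  have hmd : m ∣ k := ⟨g, by rw [mul_comm]; exact k1⟩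
  have hmd' : m' ∣ l := ⟨g', by rw [mul_comm]; exact l1⟩
  have eB : ‖avg (m * m') B‖ = (if m = m' then 1 / (totient m : ℝ) else 0) := by
    rw [hB, chi_orthog W b m m' k4 (hkc.coprime_dvd_left hmd) l4 (hlc.coprime_dvd_left hmd')]
    split_ifs <;> simp
  rw [eB]
  apply mul_le_mul_of_nonneg_left
  · have := composite_bound d hd H hH (fun p y => (if p ∣ k then (tp W b p y : ℂ) else 1) * (if p ∣ l then (tp W b p y : ℂ) else 1))
      q hq (fun p hp => ⟨Tw_tp W b p k l (Nat.prime_of_mem_primeFactors hp) (hpq p (Nat.prime_of_mem_primeFactors hp) (Nat.dvd_of_mem_primeFactors hp)).1,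
        (hpq p (Nat.prime_of_mem_primeFactors hp) (Nat.dvd_of_mem_primeFactors hp)).2⟩) a ha
    simp only [prod_mul_distrib, ← chi_gcd W b _ q _ hk0 hq, ← chi_gcd W b _ q _ hl0 hq] at this
    exact this
  · split_ifs <;> positivity

lemma GG_bound (d : ℕ) (hd : 1 ≤ d) (W b R q : ℕ) (hR : 1 ≤ R) (H : ℤ[X]) (hH : H.natDegree ≤ d) (a : ℤ)
    (hq : q ≠ 0) (ha : IsCoprime a (q : ℤ))
    (hpq : ∀ p, p.Prime → p ∣ q → ¬ p ∣ W ∧ d < p ∧ ∃ j, 1 ≤ j ∧ ¬ (p:ℤ) ∣ H.coeff j) :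
    ‖GG W b R H a q‖ ≤ (16 * d : ℝ) ^ (q.primeFactorsList.length) * (q:ℝ) ^ (-(1 / d : ℝ)) := by
  have hJ := JJ_ge_one W R hR
  unfold GG
  rw [norm_div, norm_real, norm_eq_abs, abs_of_pos (by linarith), div_le_iff₀ (by linarith)]
  set B := ((4 * d : ℝ) ^ (q.primeFactorsList.length) * (q:ℝ) ^ (-(1 / d : ℝ))) with hB
  have hB0 : 0 ≤ B := by positivity
  refine (norm_sum_le _ _).trans ((sum_le_sum fun k hk => (norm_sum_le _ _).trans (sum_le_sum fun l hl =>
    GG_term_bound d hd W b k l q H hH a (mem_KK.1 hk).2.1 (mem_KK.1 hk).2.2 (mem_KK.1 hl).2.1 (mem_KK.1 hl).2.2 hq ha hpq)).trans ?_)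
  simp only [← sum_mul]
  rw [← hB]
  have key : ∑ k ∈ KK W R, ∑ l ∈ KK W R, (if k / Nat.gcd k q = l / Nat.gcd l q then 1 / (totient (k / Nat.gcd k q) : ℝ) else 0)
      ≤ (q.divisors.card : ℝ) * q.divisors.card * JJ W R := by
    rw [← sum_product', ← sum_filter]
    have : (q.divisors.card : ℝ) * q.divisors.card * JJ W R =
        ∑ x ∈ (q.divisors ×ˢ q.divisors) ×ˢ KK W R, 1 / (totient x.2 : ℝ) := by
      rw [sum_product]; simp only [sum_const, card_product, nsmul_eq_mul]; push_cast; rfl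
    rw [this]
    have inj : Set.InjOn (fun x : ℕ × ℕ => ((Nat.gcd x.1 q, Nat.gcd x.2 q), x.1 / Nat.gcd x.1 q))
        ((KK W R ×ˢ KK W R).filter (fun x => x.1 / Nat.gcd x.1 q = x.2 / Nat.gcd x.2 q) : Finset (ℕ × ℕ)) := by
      rintro ⟨k, l⟩ hx ⟨k', l'⟩ hx' h
      simp only [coe_filter, mem_product, Set.mem_setOf_eq, mem_KK] at hx hx'
      simp only [Prod.mk.injEq] at h
      have a1 := (gcd_split k q hx.1.1.2.1).1
      have a2 := (gcd_split k' q hx'.1.1.2.1).1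
      have a3 := (gcd_split l q hx.1.2.2.1).1
      have a4 := (gcd_split l' q hx'.1.2.2.1).1
      obtain ⟨⟨b1, b2⟩, b3⟩ := h
      refine Prod.ext ?_ ?_
      · simp only; rw [a1, a2, b1]; congr 1; rw [← b1]; rw [b1] at b3 ⊢; exact b3
      · simp only
        have e : l / Nat.gcd l q = l' / Nat.gcd l' q := by rw [← hx.2, ← hx'.2]; exact b3
        rw [a3, a4, e, b2]
    rw [← sum_image (g := (fun x : ℕ × ℕ => ((Nat.gcd x.1 q, Nat.gcd x.2 q), x.1 / Nat.gcd x.1 q)))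
      (f := fun x : (ℕ × ℕ) × ℕ => 1 / (totient x.2 : ℝ)) inj]
    apply sum_le_sum_of_subset_of_nonneg
    · rw [image_subset_iff]
      rintro ⟨k, l⟩ hx
      simp only [mem_filter, mem_product, mem_KK] at hx
      simp only [mem_product, Nat.mem_divisors, mem_KK]
      obtain ⟨c1, c2, c3, c4⟩ := gcd_split k q hx.1.1.2.1
      have hdv : k / Nat.gcd k q ∣ k := Nat.div_dvd_of_dvd (Nat.gcd_dvd_left k q)
      exact ⟨⟨⟨Nat.gcd_dvd_right _ _, hq⟩, Nat.gcd_dvd_right _ _, hq⟩, ⟨Nat.pos_of_ne_zero c4.ne_zero, (Nat.div_le_self _ _).trans hx.1.1.1.2⟩,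
        c4, hx.1.1.2.2.coprime_dvd_left hdv⟩
    · intros; positivity
  have hdiv : (q.divisors.card : ℝ) ≤ 2 ^ q.primeFactorsList.length := mod_cast divisors_card_le q hq
  calc _ ≤ ((q.divisors.card : ℝ) * q.divisors.card * JJ W R) * B := mul_le_mul_of_nonneg_right key hB0
    _ ≤ ((2 ^ q.primeFactorsList.length : ℝ) * 2 ^ q.primeFactorsList.length * JJ W R) * B := by gcongr
    _ = _ := by
      rw [hB, show (16 * d : ℝ) = 2 * 2 * (4 * d) by ring, mul_pow (2 * 2 : ℝ), mul_pow (2:ℝ) 2]; ring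

lemma sum_inv_sq_le (n : ℕ) : ∑ m ∈ Icc 1 n, 1 / ((m:ℝ) ^ 2) ≤ 2 := by
  have : ∀ n : ℕ, 1 ≤ n → ∑ m ∈ Icc 1 n, 1 / ((m:ℝ) ^ 2) ≤ 2 - 1 / (n:ℝ) := by
    intro n hn
    induction n, hn using Nat.le_induction with
    | base => norm_num
    | succ k hk ih =>
      rw [sum_Icc_succ_top (by omega)]
      have hk' : (0:ℝ) < k := mod_cast hk
      have : 1 / (((k+1:ℕ):ℝ) ^ 2) ≤ 1 / (k:ℝ) - 1 / ((k+1:ℕ):ℝ) := by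
        push_cast
        rw [div_sub_div _ _ hk'.ne' (by positivity), div_le_div_iff₀ (by positivity) (by positivity)]
        nlinarith
      linarith
  rcases Nat.eq_zero_or_pos n with rfl | hn
  · simp
  · refine (this n hn).trans ?_
    have : (0:ℝ) ≤ 1 / n := by positivity
    linarith

def SQ (R : ℕ) : Finset ℕ := (Icc 1 R).filter Squarefree

lemma log_le_sum_sq (R : ℕ) : log (R + 1) ≤ 2 * ∑ k ∈ SQ R, 1 / (k:ℝ) := by
  have h1 : log ((R:ℝ) + 1) ≤ ∑ n ∈ Icc 1 R, 1 / (n:ℝ) := by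
    have := log_add_one_le_harmonic R
    rw [harmonic_eq_sum_Icc] at this
    push_cast at this
    simpa using this
  refine h1.trans ?_
  have h2 : ∑ n ∈ Icc 1 R, 1 / (n:ℝ) ≤ ∑ x ∈ SQ R ×ˢ Icc 1 R, 1 / (x.1:ℝ) * (1 / (x.2:ℝ) ^ 2) := by
    have hex : ∀ n : ℕ, ∃ x : ℕ × ℕ, n ∈ Icc 1 R → x ∈ SQ R ×ˢ Icc 1 R ∧ x.2 ^ 2 * x.1 = n := by
      intro n
      by_cases hn : n ∈ Icc 1 R
      · rw [mem_Icc] at hn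
        obtain ⟨a, m, ha, hm, h, hs⟩ := Nat.sq_mul_squarefree_of_pos (show 0 < n by omega)
        refine ⟨(a, m), fun _ => ⟨?_, h⟩⟩
        rw [mem_product, SQ, mem_filter, mem_Icc, mem_Icc]
        have ha' : a ≤ n := by rw [← h]; exact Nat.le_mul_of_pos_left a (by positivity)
        have hm' : m ≤ n := by rw [← h]; nlinarith
        simp only
        exact ⟨⟨⟨ha, ha'.trans hn.2⟩, hs⟩, hm, hm'.trans hn.2⟩
      · exact ⟨(0,0), fun h => absurd h hn⟩
    choose φ hφ using hex
    have inj : Set.InjOn φ (Icc 1 R : Finset ℕ) := by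
      intro n hn n' hn' h
      rw [← (hφ n hn).2, ← (hφ n' hn').2, h]
    have e : ∀ n ∈ Icc 1 R, 1 / (n:ℝ) = (fun x : ℕ × ℕ => 1 / (x.1:ℝ) * (1 / (x.2:ℝ) ^ 2)) (φ n) := by
      intro n hn
      have := (hφ n hn).2
      conv_lhs => rw [← this]
      push_cast
      rw [one_div_mul_one_div, mul_comm]
    rw [sum_congr rfl e, ← sum_image (g := φ) (f := fun x : ℕ × ℕ => 1 / (x.1:ℝ) * (1 / (x.2:ℝ) ^ 2)) inj]
    apply sum_le_sum_of_subset_of_nonneg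
    · rw [image_subset_iff]; exact fun n hn => (hφ n hn).1
    · intros; positivity
  refine h2.trans ?_
  rw [sum_product]
  simp only [← mul_sum]
  rw [← sum_mul, mul_comm]
  apply mul_le_mul_of_nonneg_right (sum_inv_sq_le R)
  exact sum_nonneg fun _ _ => by positivity

lemma sq_le_KK (W R : ℕ) (hW : W ≠ 0) :
    ∑ k ∈ SQ R, 1 / (k:ℝ) ≤ (∏ p ∈ W.primeFactors, (1 + 1 / (p:ℝ))) * ∑ v ∈ KK W R, 1 / (v:ℝ) := by
  rw [prod_one_add, sum_mul_sum, ← sum_product']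
  set φ : ℕ → Finset ℕ × ℕ := fun k => ((Nat.gcd k W).primeFactors, k / Nat.gcd k W) with hφ
  have hsp : ∀ k ∈ SQ R, (∏ p ∈ (Nat.gcd k W).primeFactors, p) * (k / Nat.gcd k W) = k := by
    intro k hk
    rw [SQ, mem_filter] at hk
    rw [Nat.prod_primeFactors_of_squarefree (hk.2.squarefree_of_dvd (Nat.gcd_dvd_left k W))]
    exact (gcd_split k W hk.2).1.symm
  have inj : Set.InjOn φ (SQ R : Finset ℕ) := by
    intro k hk k' hk' h
    rw [← hsp k hk, ← hsp k' hk']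
    simp only [hφ, Prod.mk.injEq] at h
    rw [h.1, h.2]
  have e : ∀ k ∈ SQ R, 1 / (k:ℝ) = (fun x : Finset ℕ × ℕ => (∏ p ∈ x.1, 1 / (p:ℝ)) * (1 / (x.2:ℝ))) (φ k) := by
    intro k hk
    conv_lhs => rw [← hsp k hk]
    simp only [hφ, Nat.cast_mul, Nat.cast_prod, prod_div_distrib, prod_const_one]
    rw [one_div_mul_one_div]
  rw [sum_congr rfl e, ← sum_image (g := φ) (f := fun x : Finset ℕ × ℕ => (∏ p ∈ x.1, 1 / (p:ℝ)) * (1 / (x.2:ℝ))) inj]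
  apply sum_le_sum_of_subset_of_nonneg
  · rw [image_subset_iff]
    intro k hk
    rw [SQ, mem_filter, mem_Icc] at hk
    obtain ⟨c1, c2, c3, c4⟩ := gcd_split k W hk.2
    simp only [hφ, mem_product, mem_powerset, mem_KK]
    exact ⟨Nat.primeFactors_mono (Nat.gcd_dvd_right k W) hW, ⟨Nat.pos_of_ne_zero c4.ne_zero, (Nat.div_le_self _ _).trans hk.1.2⟩, c4, c3⟩
  · intros; positivity

lemma totient_prod (W : ℕ) (hW : W ≠ 0) : (totient W : ℝ) * (∏ p ∈ W.primeFactors, (1 + 1 / (p:ℝ))) ≤ W := by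
  have h := Nat.totient_eq_mul_prod_factors W
  have h' : (totient W : ℝ) = W * ∏ p ∈ W.primeFactors, (1 - (p:ℝ)⁻¹) := by
    have h2 := congrArg (Rat.cast (K := ℝ)) h
    push_cast at h2
    exact h2
  rw [h', mul_assoc, ← prod_mul_distrib]
  have : ∏ p ∈ W.primeFactors, ((1 - (p:ℝ)⁻¹) * (1 + 1 / (p:ℝ))) ≤ 1 := by
    apply prod_le_one
    · intro p hp
      have : (1:ℝ) ≤ p := mod_cast (Nat.prime_of_mem_primeFactors hp).one_le
      have := inv_le_one_of_one_le₀ this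
      apply mul_nonneg <;> [linarith; positivity]
    · intro p hp
      have : (1 - (p:ℝ)⁻¹) * (1 + 1 / (p:ℝ)) = 1 - ((p:ℝ)⁻¹)^2 := by rw [one_div]; ring
      rw [this]; nlinarith [sq_nonneg ((p:ℝ)⁻¹)]
  calc (W:ℝ) * _ ≤ W * 1 := by gcongr
    _ = W := mul_one _

lemma JJ_lower (W R : ℕ) (hW : W ≠ 0) : (totient W : ℝ) / W * log (R + 1) / 2 ≤ JJ W R := by
  have h1 := log_le_sum_sq R
  have h2 := sq_le_KK W R hW
  have h3 := totient_prod W hW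
  have h4 : ∑ v ∈ KK W R, 1 / (v:ℝ) ≤ JJ W R := by
    apply sum_le_sum
    intro k hk
    have hk0 : 0 < k := by have := (mem_KK.1 hk).1.1; omega
    have : 0 < totient k := Nat.totient_pos.2 hk0
    apply one_div_le_one_div_of_le (mod_cast this)
    exact_mod_cast Nat.totient_le k
  have hW0 : (0:ℝ) < W := mod_cast Nat.pos_of_ne_zero hW
  have h0 : 0 ≤ ∑ v ∈ KK W R, 1 / (v:ℝ) := sum_nonneg fun _ _ => by positivity
  have hJ0 : 0 ≤ JJ W R := h0.trans h4
  calc (totient W : ℝ) / W * log (R + 1) / 2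
      ≤ (totient W : ℝ) / W * (2 * ((∏ p ∈ W.primeFactors, (1 + 1 / (p:ℝ))) * ∑ v ∈ KK W R, 1 / (v:ℝ))) / 2 := by
        gcongr; linarith
    _ = ((totient W : ℝ) * (∏ p ∈ W.primeFactors, (1 + 1 / (p:ℝ)))) / W * ∑ v ∈ KK W R, 1 / (v:ℝ) := by ring
    _ ≤ W / W * JJ W R := by gcongr
    _ = JJ W R := by rw [div_self hW0.ne', one_mul]

lemma totient_sqfree (k : ℕ) (hk : Squarefree k) : (totient k : ℝ) = ∏ p ∈ k.primeFactors, ((p:ℝ) - 1) := by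
  conv_lhs => rw [Nat.totient_eq_div_primeFactors_mul, Nat.prod_primeFactors_of_squarefree hk, Nat.div_self (Nat.pos_of_ne_zero hk.ne_zero), one_mul]
  push_cast
  apply prod_congr rfl
  intro p hp
  rw [Nat.cast_sub (Nat.prime_of_mem_primeFactors hp).one_le]; simp

lemma nu_prime (W b R y : ℕ) (hR : 1 ≤ R) (hp : (b + W * y).Prime) (hgt : R < b + W * y) : nu W b R y = JJ W R := by
  have hJ := JJ_ge_one W R hR
  have : ∑ k ∈ KK W R, chi W b k y = JJ W R := by
    apply sum_congr rfl
    intro k hk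
    rw [mem_KK] at hk
    rw [totient_sqfree k hk.2.1, ← prod_const_one, ← prod_div_distrib]
    apply prod_congr rfl
    intro p hpk
    have h1 := Nat.prime_of_mem_primeFactors hpk
    have h2 := le_of_dvd (by omega) (Nat.dvd_of_mem_primeFactors hpk)
    unfold tp
    rw [if_neg]
    · simp
    · intro hd
      rcases (Nat.dvd_prime hp).1 hd with h | h
      · exact h1.one_lt.ne' h
      · omega
  unfold nu
  rw [this, sq, mul_div_assoc, div_self (by linarith), mul_one]

lemma abel_id (q u : ℕ → ℂ) (X : ℕ) : ∑ y ∈ range X, q y * u y =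
    (∑ y ∈ range X, q y) * u X - ∑ y ∈ range X, (∑ z ∈ range (y+1), q z) * (u (y+1) - u y) := by
  induction X with
  | zero => simp
  | succ n ih => rw [sum_range_succ, ih, sum_range_succ (fun y => (∑ z ∈ range (y+1), q z) * (u (y+1) - u y)), sum_range_succ q]; ring

lemma partial_bound (n : ℕ) (hn : n ≠ 0) (q : ℕ → ℂ) (hq : Function.Periodic q n) (B : ℝ)
    (hb : ∀ y, ‖q y‖ ≤ B) (h0 : ∑ y ∈ range n, q y = 0) (x : ℕ) : ‖∑ y ∈ range x, q y‖ ≤ B * n := by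
  have hB : 0 ≤ B := (norm_nonneg _).trans (hb 0)
  have hx : x = n * (x / n) + x % n := (div_add_mod x n).symm
  have : ∑ y ∈ range x, q y = ∑ y ∈ range (x % n), q y := by
    conv_lhs => rw [hx, sum_range_add]
    rw [sum_range_mul_periodic _ _ _ hq, h0]
    simp only [mul_zero, zero_add]
    apply sum_congr rfl; intro y _
    have := periodic_of_dvd (n := n * (x/n)) (Dvd.intro _ rfl) hq y
    rw [add_comm]; exact this
  rw [this]
  refine (norm_sum_le _ _).trans ((sum_le_sum fun y _ => hb y).trans ?_)
  rw [sum_const, card_range, nsmul_eq_mul, mul_comm]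
  have : ((x % n : ℕ):ℝ) ≤ n := mod_cast (mod_lt x (Nat.pos_of_ne_zero hn)).le
  gcongr

lemma periodic_times_smooth (n : ℕ) (hn : n ≠ 0) (p u : ℕ → ℂ) (hp : Function.Periodic p n)
    (hp1 : ∀ y, ‖p y‖ ≤ 1) (hu : ∀ y, ‖u y‖ ≤ 1) (X : ℕ) (V : ℝ)
    (hV : ∑ y ∈ range X, ‖u (y+1) - u y‖ ≤ V) :
    ‖∑ y ∈ range X, p y * u y - avg n p * ∑ y ∈ range X, u y‖ ≤ 2 * n * (1 + V) := by
  set q : ℕ → ℂ := fun y => p y - avg n p with hq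
  have hqp : Function.Periodic q n := fun y => by simp [hq, hp y]
  have hav : ‖avg n p‖ ≤ 1 := norm_avg_le n p 1 zero_le_one hp1
  have hq2 : ∀ y, ‖q y‖ ≤ 2 := fun y => (norm_sub_le _ _).trans (by linarith [hp1 y])
  have hn' : (n:ℂ) ≠ 0 := mod_cast hn
  have hq0 : ∑ y ∈ range n, q y = 0 := by
    simp only [hq, sum_sub_distrib, sum_const, card_range, nsmul_eq_mul, avg]
    field_simp; simp
  have e : ∑ y ∈ range X, p y * u y - avg n p * ∑ y ∈ range X, u y = ∑ y ∈ range X, q y * u y := by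
    rw [mul_sum, ← sum_sub_distrib]; apply sum_congr rfl; intro y _; simp only [hq]; ring
  have hpb := partial_bound n hn q hqp 2 hq2 hq0
  rw [e, abel_id]
  refine (norm_sub_le _ _).trans ?_
  have h1 : ‖(∑ y ∈ range X, q y) * u X‖ ≤ 2 * n := by
    rw [norm_mul]
    calc _ ≤ (2 * n : ℝ) * 1 := mul_le_mul (hpb X) (hu X) (norm_nonneg _) (by positivity)
      _ = _ := mul_one _
  have h2 : ‖∑ y ∈ range X, (∑ z ∈ range (y+1), q z) * (u (y+1) - u y)‖ ≤ 2 * n * V := by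
    refine (norm_sum_le _ _).trans ?_
    calc _ ≤ ∑ y ∈ range X, (2 * n : ℝ) * ‖u (y+1) - u y‖ := by
          apply sum_le_sum; intro y _; rw [norm_mul]; gcongr; exact hpb _
      _ = 2 * n * ∑ y ∈ range X, ‖u (y+1) - u y‖ := by rw [mul_sum]
      _ ≤ _ := by gcongr
  linarith

noncomputable def Vs (W b R : ℕ) (H : ℤ[X]) (X : ℕ) (α : ℝ) : ℂ :=
  ∑ y ∈ range X, (nu W b R y : ℂ) * ee (α * (H.eval (y:ℤ) : ℤ))

noncomputable def Es (H : ℤ[X]) (X : ℕ) (β : ℝ) : ℂ :=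
  ∑ y ∈ range X, ee (β * (H.eval (y:ℤ) : ℤ))

lemma card_KK_le (W R : ℕ) : (KK W R).card ≤ R := (card_filter_le _ _).trans (by simp)

lemma Vs_expand (W b R : ℕ) (H : ℤ[X]) (X : ℕ) (α : ℝ) : Vs W b R H X α =
    (∑ k ∈ KK W R, ∑ l ∈ KK W R, ∑ y ∈ range X, (chi W b k y : ℂ) * chi W b l y * ee (α * (H.eval (y:ℤ) : ℤ))) / JJ W R := by
  unfold Vs nu
  have : ∀ y, (((∑ k ∈ KK W R, chi W b k y) ^ 2 / JJ W R : ℝ) : ℂ) * ee (α * (H.eval (y:ℤ) : ℤ)) =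
     (∑ k ∈ KK W R, ∑ l ∈ KK W R, (chi W b k y : ℂ) * chi W b l y * ee (α * (H.eval (y:ℤ) : ℤ))) / JJ W R := by
    intro y
    push_cast
    rw [sq, sum_mul_sum, div_mul_eq_mul_div, sum_mul]
    simp only [sum_mul]
  simp only [this]
  rw [← sum_div, sum_comm]
  refine congrArg (fun z : ℂ => z / (JJ W R : ℂ)) (sum_congr rfl fun k _ => ?_)
  exact sum_comm

/-- variation of a polynomial phase -/
lemma phase_var (H : ℤ[X]) (X : ℕ) (β : ℝ) (hmono : ∀ y : ℕ, y < X → H.eval (y:ℤ) ≤ H.eval ((y+1:ℕ):ℤ)) :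
    ∑ y ∈ range X, ‖ee (β * (H.eval ((y+1:ℕ):ℤ) : ℤ)) - ee (β * (H.eval (y:ℤ) : ℤ))‖ ≤
      2 * π * |β| * ((H.eval (X:ℤ) : ℤ) - (H.eval 0 : ℤ)) := by
  have h1 : ∀ y ∈ range X, ‖ee (β * (H.eval ((y+1:ℕ):ℤ) : ℤ)) - ee (β * (H.eval (y:ℤ) : ℤ))‖ ≤
      2 * π * |β| * (((H.eval ((y+1:ℕ):ℤ) : ℤ):ℝ) - (H.eval (y:ℤ) : ℤ)) := by
    intro y hy
    have hm := hmono y (mem_range.1 hy)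
    have e : ee (β * (H.eval ((y+1:ℕ):ℤ) : ℤ)) - ee (β * (H.eval (y:ℤ) : ℤ)) =
        ee (β * (H.eval (y:ℤ) : ℤ)) * (ee (β * (((H.eval ((y+1:ℕ):ℤ) : ℤ):ℝ) - (H.eval (y:ℤ) : ℤ))) - 1) := by
      rw [mul_sub, mul_one, ← ee_add]; congr 2; ring
    rw [e, norm_mul, norm_ee, one_mul]
    refine (norm_ee_sub_one_le _).trans ?_
    rw [abs_mul, abs_of_nonneg (a := ((H.eval ((y+1:ℕ):ℤ) : ℤ):ℝ) - (H.eval (y:ℤ) : ℤ))]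
    · rw [mul_assoc (2 * π)]
    · rw [sub_nonneg]; exact_mod_cast hm
  refine (sum_le_sum h1).trans ?_
  rw [← mul_sum, sum_range_sub (fun y : ℕ => ((H.eval (y:ℤ) : ℤ):ℝ))]
  simp

lemma Vs_approx (W b R : ℕ) (hR : 1 ≤ R) (H : ℤ[X]) (X : ℕ)
    (hmono : ∀ y : ℕ, y < X → H.eval (y:ℤ) ≤ H.eval ((y+1:ℕ):ℤ)) (α : ℝ) (a : ℤ) (q : ℕ) (hq : q ≠ 0) :
    ‖Vs W b R H X α - GG W b R H a q * Es H X (α - a / q)‖ ≤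
      2 * R ^ 4 * q * (1 + 2 * π * |α - a / q| * ((H.eval (X:ℤ) : ℤ) - (H.eval 0 : ℤ))) := by
  have hJ := JJ_ge_one W R hR
  set β := α - a / q with hβ
  set M : ℝ := ((H.eval (X:ℤ) : ℤ) : ℝ) - (H.eval 0 : ℤ) with hM
  have hvar := phase_var H X β hmono
  rw [← hM] at hvar
  have hv0 : 0 ≤ 2 * π * |β| * M := (sum_nonneg fun _ _ => norm_nonneg _).trans hvar
  rw [Vs_expand]
  unfold GG
  rw [div_mul_eq_mul_div, ← sub_div, norm_div, norm_real, norm_eq_abs, abs_of_pos (by linarith)]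
  rw [sum_mul, ← sum_sub_distrib]
  simp only [sum_mul, ← sum_sub_distrib]
  have hterm : ∀ k ∈ KK W R, ∀ l ∈ KK W R,
      ‖∑ y ∈ range X, (chi W b k y : ℂ) * chi W b l y * ee (α * (H.eval (y:ℤ) : ℤ)) -
        avg (k * l * q) (fun y => (chi W b k y : ℂ) * chi W b l y * ee (a * (H.eval (y:ℤ) : ℤ) / (q:ℝ))) * Es H X β‖
      ≤ 2 * (R * R * q) * (1 + 2 * π * |β| * M) := by
    intro k hk l hl
    rw [mem_KK] at hk hl
    have hk0 : k ≠ 0 := by omega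
    have hl0 : l ≠ 0 := by omega
    have := periodic_times_smooth (k * l * q) (by positivity)
      (fun y => (chi W b k y : ℂ) * chi W b l y * ee (a * (H.eval (y:ℤ) : ℤ) / (q:ℝ)))
      (fun y => ee (β * (H.eval (y:ℤ) : ℤ))) (periodic_mul (periodic_mul
        (periodic_of_dvd ⟨l * q, by ring⟩ (chi_periodicC W b k)) (periodic_of_dvd ⟨k * q, by ring⟩ (chi_periodicC W b l)))
        (periodic_of_dvd (Dvd.intro_left _ rfl) (ee_poly_periodic H a q hq))) ?_ (fun y => (norm_ee _).le) X _ hvar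
    · have e : ∀ y : ℕ, (chi W b k y : ℂ) * chi W b l y * ee (a * (H.eval (y:ℤ) : ℤ) / (q:ℝ)) * ee (β * (H.eval (y:ℤ) : ℤ))
          = (chi W b k y : ℂ) * chi W b l y * ee (α * (H.eval (y:ℤ) : ℤ)) := by
        intro y
        rw [mul_assoc _ (ee _), ← ee_add]; congr 2; rw [hβ]; ring
      simp only [e] at this
      refine this.trans ?_
      have hk1 : (k:ℝ) ≤ R := mod_cast hk.1.2
      have hl1 : (l:ℝ) ≤ R := mod_cast hl.1.2
      push_cast
      gcongr
    · intro y
      rw [norm_mul, norm_mul, norm_ee, mul_one, norm_real, norm_real]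
      exact mul_le_one₀ (chi_abs_le W b k y) (norm_nonneg _) (chi_abs_le W b l y)
  set Z := 2 * ((R:ℝ) * R * q) * (1 + 2 * π * |β| * M) with hZ
  have hZ0 : 0 ≤ Z := by positivity
  have hc : ((KK W R).card : ℝ) ≤ R := mod_cast card_KK_le W R
  calc _ ≤ ‖∑ k ∈ KK W R, ∑ l ∈ KK W R, (∑ y ∈ range X, (chi W b k y : ℂ) * chi W b l y * ee (α * (H.eval (y:ℤ) : ℤ)) -
        avg (k * l * q) (fun y => (chi W b k y : ℂ) * chi W b l y * ee (a * (H.eval (y:ℤ) : ℤ) / (q:ℝ))) * Es H X β)‖ :=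
        div_le_self (norm_nonneg _) hJ
    _ ≤ ∑ k ∈ KK W R, ∑ l ∈ KK W R, Z :=
        (norm_sum_le _ _).trans (sum_le_sum fun k hk => (norm_sum_le _ _).trans (sum_le_sum fun l hl => hterm k hk l hl))
    _ = (KK W R).card * ((KK W R).card * Z) := by simp
    _ ≤ R * (R * Z) := by gcongr
    _ = _ := by rw [hZ]; ring

/-- total mass of the sieve weight -/
lemma nu_mass (W b R X : ℕ) (hR : 1 ≤ R) : |∑ y ∈ range X, nu W b R y - X| ≤ 2 * (R:ℝ) ^ 4 := by
  have := Vs_approx W b R hR 0 X (by simp) 0 0 1 one_ne_zero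
  rw [GG_one W b R hR] at this
  simp only [Vs, Es, Polynomial.eval_zero, Int.cast_zero, mul_zero, ee_zero] at this
  simp at this
  have e : (∑ y ∈ range X, (nu W b R y : ℂ)) - X = ((∑ y ∈ range X, nu W b R y - X : ℝ) : ℂ) := by push_cast; rfl
  rw [e, norm_real] at this
  exact this

noncomputable def Psis (H : ℤ[X]) (X : ℕ) (α : ℝ) : ℂ :=
  ∑ y ∈ range X, (1 / ((H.eval ((y+1:ℕ):ℤ) : ℤ) - (H.eval (y:ℤ) : ℤ) : ℂ)) *
    ∑ m ∈ Ico (H.eval (y:ℤ)) (H.eval ((y+1:ℕ):ℤ)), ee (α * (m:ℤ))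

lemma Es_Psis (H : ℤ[X]) (X : ℕ) (hmono : ∀ y : ℕ, y < X → H.eval (y:ℤ) < H.eval ((y+1:ℕ):ℤ)) (α : ℝ) :
    ‖Es H X α - Psis H X α‖ ≤ 2 * π * |α| * ((H.eval (X:ℤ) : ℤ) - (H.eval 0 : ℤ)) := by
  unfold Es Psis
  rw [← sum_sub_distrib]
  refine (norm_sum_le _ _).trans ?_
  have h1 : ∀ y ∈ range X, ‖ee (α * (H.eval (y:ℤ) : ℤ)) - (1 / ((H.eval ((y+1:ℕ):ℤ) : ℤ) - (H.eval (y:ℤ) : ℤ) : ℂ)) *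
    ∑ m ∈ Ico (H.eval (y:ℤ)) (H.eval ((y+1:ℕ):ℤ)), ee (α * (m:ℤ))‖ ≤
      2 * π * |α| * (((H.eval ((y+1:ℕ):ℤ) : ℤ):ℝ) - (H.eval (y:ℤ) : ℤ)) := by
    intro y hy
    have hm := hmono y (mem_range.1 hy)
    set u := H.eval (y:ℤ) with hu
    set v := H.eval ((y+1:ℕ):ℤ) with hv
    have huv : (0:ℝ) < (v:ℝ) - u := by rw [sub_pos]; exact_mod_cast hm
    have hcard : ((Ico u v).card : ℝ) = v - u := by
      rw [Int.card_Ico, ← cast_natCast, Int.toNat_of_nonneg (by omega)]; push_cast; rfl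
    have huvC : ((v:ℂ) - u) ≠ 0 := by
      rw [sub_ne_zero]; exact_mod_cast hm.ne'
    have hcardC : ((Ico u v).card : ℂ) = v - u := mod_cast hcard
    have e : ee (α * u) - (1 / ((v:ℂ) - u)) * ∑ m ∈ Ico u v, ee (α * (m:ℤ)) =
        (∑ m ∈ Ico u v, (ee (α * u) - ee (α * (m:ℤ)))) / ((v:ℂ) - u) := by
      rw [sum_sub_distrib, sum_const, nsmul_eq_mul, hcardC]; field_simp
    rw [e, norm_div]
    have hn : ‖(v:ℂ) - u‖ = v - u := by
      have : (v:ℂ) - u = (((v:ℝ) - u : ℝ) : ℂ) := by push_cast; rfl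
      rw [this, norm_real, norm_eq_abs, abs_of_pos huv]
    rw [hn, div_le_iff₀ huv]
    refine (norm_sum_le _ _).trans ?_
    have : ∀ m ∈ Ico u v, ‖ee (α * u) - ee (α * (m:ℤ))‖ ≤ 2 * π * |α| * ((v:ℝ) - u) := by
      intro m hm
      rw [mem_Ico] at hm
      have e : ee (α * u) - ee (α * (m:ℤ)) = ee (α * (m:ℤ)) * (ee (α * (u - m)) - 1) := by
        rw [mul_sub, mul_one, ← ee_add]; congr 2; ring
      rw [e, norm_mul, norm_ee, one_mul]
      refine (norm_ee_sub_one_le _).trans ?_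
      rw [abs_mul, ← mul_assoc]
      gcongr
      rw [abs_sub_comm, abs_of_nonneg]
      · have : (m:ℝ) ≤ v := by exact_mod_cast hm.2.le
        linarith
      · rw [sub_nonneg]; exact_mod_cast hm.1
    refine (sum_le_sum this).trans ?_
    rw [sum_const, nsmul_eq_mul, hcard]; linarith
  refine (sum_le_sum h1).trans ?_
  rw [← mul_sum, sum_range_sub (fun y : ℕ => ((H.eval (y:ℤ) : ℤ):ℝ))]
  simp

lemma geom_Ico (α : ℝ) (u v : ℤ) (huv : u ≤ v) :
    (∑ m ∈ Ico u v, ee (α * (m:ℤ))) * (ee α - 1) = ee (α * v) - ee (α * u) := by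
  induction v, huv using Int.le_induction with
  | base => simp
  | succ v hv ih =>
    rw [← insert_Ico_right_eq_Ico_add_one hv, sum_insert (by simp), add_mul, ih]
    have : ee (α * ((v+1:ℤ):ℝ)) = ee (α * v) * ee α := by rw [← ee_add]; congr 1; push_cast; ring
    rw [this]; ring

/-- Abel with monotone weights -/
lemma abel_mono (w : ℕ → ℝ) (z : ℕ → ℂ) (hz : ∀ y, ‖z y‖ ≤ 1) (X : ℕ) (h0 : ∀ y, y < X → 0 ≤ w y)
    (hm : ∀ y, y + 1 < X → w (y+1) ≤ w y) (hX : 0 < X) :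
    ‖∑ y ∈ range X, (w y : ℂ) * (z (y+1) - z y)‖ ≤ 2 * w 0 := by
  have key : ∀ n, n < X → ‖∑ y ∈ range (n+1), (w y : ℂ) * (z (y+1) - z y) - w n * z (n+1)‖ ≤ 2 * w 0 - w n := by
    intro n
    induction n with
    | zero =>
      intro h
      simp only [zero_add, sum_range_one]
      have : (w 0 : ℂ) * (z 1 - z 0) - w 0 * z 1 = -(w 0 * z 0) := by ring
      rw [this, norm_neg, norm_mul, norm_real, norm_eq_abs, abs_of_nonneg (h0 0 hX)]
      nlinarith [hz 0, h0 0 hX]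
    | succ n ih =>
      intro h
      have ih' := ih (by omega)
      have hm' := hm n h
      rw [sum_range_succ]
      have : ∑ y ∈ range (n+1), (w y : ℂ) * (z (y+1) - z y) + (w (n+1) : ℂ) * (z (n+1+1) - z (n+1)) - w (n+1) * z (n+1+1)
        = (∑ y ∈ range (n+1), (w y : ℂ) * (z (y+1) - z y) - w n * z (n+1)) + ((w n - w (n+1) : ℝ) : ℂ) * z (n+1) := by
        push_cast; ring
      rw [this]
      refine (norm_add_le _ _).trans ?_
      rw [norm_mul, norm_real, norm_eq_abs, abs_of_nonneg (by linarith)]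
      nlinarith [hz (n+1)]
  obtain ⟨n, rfl⟩ : ∃ n, X = n + 1 := ⟨X - 1, by omega⟩
  have h1 := key n (by omega)
  have h2 : ‖(w n : ℂ) * z (n+1)‖ ≤ w n := by
    rw [norm_mul, norm_real, norm_eq_abs, abs_of_nonneg (h0 n (by omega))]
    nlinarith [hz (n+1), h0 n (by omega)]
  calc _ = ‖(∑ y ∈ range (n+1), (w y : ℂ) * (z (y+1) - z y) - w n * z (n+1)) + w n * z (n+1)‖ := by congr 1; ring
    _ ≤ _ := (norm_add_le _ _).trans (by linarith)

lemma Psis_bound (H : ℤ[X]) (X : ℕ) (hX : 0 < X) (hmono : ∀ y : ℕ, y < X → H.eval (y:ℤ) < H.eval ((y+1:ℕ):ℤ))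
    (hgap : ∀ y : ℕ, y + 1 < X → H.eval ((y+1:ℕ):ℤ) - H.eval (y:ℤ) ≤ H.eval ((y+2:ℕ):ℤ) - H.eval ((y+1:ℕ):ℤ))
    (α : ℝ) (hα : 0 < nn α) :
    ‖Psis H X α‖ ≤ 1 / (((H.eval 1 : ℤ) - (H.eval 0 : ℤ)) * nn α) := by
  set w : ℕ → ℝ := fun y => 1 / (((H.eval ((y+1:ℕ):ℤ) : ℤ):ℝ) - (H.eval (y:ℤ) : ℤ)) with hw
  have hpos : ∀ y < X, (0:ℝ) < ((H.eval ((y+1:ℕ):ℤ) : ℤ):ℝ) - (H.eval (y:ℤ) : ℤ) := by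
    intro y hy; rw [sub_pos]; exact_mod_cast hmono y hy
  have h1 := abel_mono w (fun y => ee (α * (H.eval (y:ℤ) : ℤ))) (fun y => (norm_ee _).le) X
    (fun y hy => (one_div_pos.2 (hpos y hy)).le)
    (fun y hy => one_div_le_one_div_of_le (hpos y (by omega)) (by
      have := hgap y hy
      have : ((H.eval ((y+1:ℕ):ℤ) - H.eval (y:ℤ) : ℤ) : ℝ) ≤ ((H.eval ((y+2:ℕ):ℤ) - H.eval ((y+1:ℕ):ℤ) : ℤ):ℝ) := mod_cast this
      rw [Int.cast_sub, Int.cast_sub] at this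
      exact this)) hX
  have e : Psis H X α * (ee α - 1) = ∑ y ∈ range X, (w y : ℂ) * (ee (α * (H.eval ((y+1:ℕ):ℤ) : ℤ)) - ee (α * (H.eval (y:ℤ) : ℤ))) := by
    unfold Psis
    rw [sum_mul]
    apply sum_congr rfl; intro y hy
    rw [mul_assoc, geom_Ico _ _ _ (hmono y (mem_range.1 hy)).le]
    congr 1; simp only [hw]; push_cast; rfl
  have h2 := norm_ee_sub_one_ge α
  have h3 : ‖Psis H X α‖ * ‖ee α - 1‖ ≤ 2 * w 0 := by rw [← norm_mul, e]; exact h1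
  have hw0 : w 0 = 1 / (((H.eval 1 : ℤ):ℝ) - (H.eval 0 : ℤ)) := by simp [hw]
  have hg0 : (0:ℝ) < ((H.eval 1 : ℤ):ℝ) - (H.eval 0 : ℤ) := by simpa using hpos 0 hX
  rw [← one_div_mul_one_div, ← hw0, mul_one_div, le_div_iff₀ hα]
  have hw0' : 0 ≤ w 0 := by rw [hw0]; positivity
  nlinarith [norm_nonneg (Psis H X α)]

lemma ev_const (K e : ℝ) (he : 0 < e) : ∀ᶠ N : ℕ in atTop, K ≤ (N:ℝ) ^ e :=
  ((tendsto_rpow_atTop he).comp tendsto_natCast_atTop_atTop).eventually_ge_atTop K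

lemma ev_log (K e : ℝ) (he : 0 < e) : ∀ᶠ N : ℕ in atTop, K * log N ≤ (N:ℝ) ^ e := by
  have h := (isLittleO_log_rpow_atTop he).bound (c := 1 / (|K| + 1)) (by positivity)
  have h2 := tendsto_natCast_atTop_atTop (R := ℝ) |>.eventually h
  filter_upwards [h2, eventually_ge_atTop 1] with N hN h1
  have h1' : (1:ℝ) ≤ N := mod_cast h1
  rw [norm_eq_abs, norm_eq_abs, abs_of_nonneg (Real.log_nonneg h1'), abs_of_nonneg (show (0:ℝ) ≤ (N:ℝ)^e by positivity)] at hN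
  rw [one_div_mul_eq_div, le_div_iff₀ (show 0 < |K| + 1 by positivity)] at hN
  nlinarith [le_abs_self K, Real.log_nonneg h1', abs_nonneg K]

lemma floor_rpow_facts (N : ℕ) (hN : 1 ≤ N) (e : ℝ) (he : 0 < e) :
    1 ≤ ⌊(N:ℝ) ^ e⌋₊ ∧ (⌊(N:ℝ) ^ e⌋₊ : ℝ) ≤ (N:ℝ) ^ e ∧ e * log N ≤ log (⌊(N:ℝ) ^ e⌋₊ + 1) := by
  have h1' : (1:ℝ) ≤ N := mod_cast hN
  have h1 : (1:ℝ) ≤ (N:ℝ)^e := one_le_rpow h1' he.le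
  refine ⟨le_floor (by simpa using h1), floor_le (by positivity), ?_⟩
  rw [← Real.log_rpow (by linarith)]
  exact log_le_log (by positivity) (Nat.lt_floor_add_one _).le

lemma bt_count (W b N R : ℕ) (hW : 0 < W) (hb : b < W) (hR : 1 ≤ R) :
    JJ W R * (((range (N+1)).filter (fun x => x.Prime ∧ x % W = b)).card - R) ≤ ((N / W + 1 : ℕ) : ℝ) + 2 * (R:ℝ)^4 + 0 := by
  classical
  have hJ := JJ_ge_one W R hR
  set S := (range (N+1)).filter (fun x => x.Prime ∧ x % W = b) with hS
  set S1 := S.filter (fun x => R < x) with hS1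
  have hc1 : (S.card : ℝ) - R ≤ S1.card := by
    have h1 : S.card ≤ S1.card + R := by
      rw [← card_filter_add_card_filter_not (s := S) (fun x => R < x)]
      gcongr
      have : S.filter (fun x => ¬ R < x) ⊆ Icc 1 R := by
        intro x hx
        simp only [hS, mem_filter, not_lt] at hx
        exact mem_Icc.2 ⟨hx.1.2.1.one_le, hx.2⟩
      simpa using card_le_card this
    have : (S.card : ℝ) ≤ S1.card + R := mod_cast h1
    linarith
  have hc2 : JJ W R * S1.card ≤ ∑ y ∈ range (N/W+1), nu W b R y := by
    have e : ∀ x ∈ S1, b + W * (x / W) = x ∧ x.Prime ∧ R < x ∧ x / W ∈ range (N/W+1) := by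
      intro x hx
      simp only [hS1, hS, mem_filter, mem_range] at hx
      refine ⟨?_, hx.1.2.1, hx.2, ?_⟩
      · rw [← hx.1.2.2]; exact Nat.mod_add_div x W
      · rw [mem_range, Nat.lt_succ_iff]; exact Nat.div_le_div_right (by omega)
    calc JJ W R * S1.card = ∑ x ∈ S1, nu W b R (x / W) := by
          rw [sum_congr rfl fun x hx => nu_prime W b R (x/W) hR (by rw [(e x hx).1]; exact (e x hx).2.1) (by rw [(e x hx).1]; exact (e x hx).2.2.1)]
          simp [mul_comm]
      _ = ∑ y ∈ S1.image (fun x => x / W), nu W b R y := by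
          rw [sum_image]
          intro x hx x' hx' h
          rw [← (e x hx).1, ← (e x' hx').1]; simp only at h; rw [h]
      _ ≤ _ := by
          apply sum_le_sum_of_subset_of_nonneg
          · rw [image_subset_iff]; exact fun x hx => (e x hx).2.2.2
          · intros; exact nu_nonneg _ _ _ _
  have hm := abs_le.1 (nu_mass W b R (N/W+1) hR)
  have : JJ W R * (S.card - R) ≤ JJ W R * S1.card := by gcongr
  linarith [hm.2]

lemma bt (W : ℕ) (hW : 0 < W) : ∀ᶠ N : ℕ in atTop, ∀ b < W,
    (((range (N+1)).filter (fun x => x.Prime ∧ x % W = b)).card : ℝ) ≤ 33 * N / (totient W * log N) := by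
  filter_upwards [ev_const (4 * W) (1/2) (by norm_num), ev_log W (1/2) (by norm_num), eventually_ge_atTop 3] with N h1 h2 h3 b hb
  have hN1 : (1:ℝ) ≤ N := mod_cast (by omega : 1 ≤ N)
  obtain ⟨f1, f2, f3⟩ := floor_rpow_facts N (by omega) (1/8) (by norm_num)
  set R := ⌊(N:ℝ)^(1/8:ℝ)⌋₊ with hR
  have hlog : 0 < log N := log_pos (by exact_mod_cast (by omega : 1 < N))
  have hc := bt_count W b N R hW hb f1
  have hJ1 := JJ_ge_one W R f1
  have hJ := JJ_lower W R hW.ne'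
  set S := ((((range (N+1)).filter (fun x => x.Prime ∧ x % W = b)).card : ℕ) : ℝ) with hS
  have hW0 : (0:ℝ) < W := mod_cast hW
  have hφ : (0:ℝ) < totient W := mod_cast Nat.totient_pos.2 hW
  have hφW : (totient W : ℝ) ≤ W := mod_cast Nat.totient_le W
  have hsq : (N:ℝ)^(1/2:ℝ) * (N:ℝ)^(1/2:ℝ) = N := by rw [← rpow_add (by linarith)]; norm_num
  set r := (N:ℝ)^(1/2:ℝ) with hr
  have hr1 : 1 ≤ r := one_le_rpow hN1 (by norm_num)
  have hR4 : (R:ℝ)^4 ≤ r := by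
    calc (R:ℝ)^4 ≤ ((N:ℝ)^(1/8:ℝ))^4 := by gcongr
      _ = r := by rw [← rpow_natCast, ← rpow_mul (by linarith), hr]; norm_num
  have hRr : (R:ℝ) ≤ r := f2.trans (rpow_le_rpow_of_exponent_le hN1 (by norm_num))
  have hdiv : ((N / W + 1 : ℕ) : ℝ) ≤ N / W + 1 := by push_cast; gcongr; exact cast_div_le
  have hNW : 4 * r ≤ N / W := by
    rw [le_div_iff₀ hW0, ← hsq]; nlinarith
  -- J (S - R) ≤ 2 N / W
  have hub : JJ W R * (S - R) ≤ 2 * (N / W) := by linarith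
  by_cases hSR : S ≤ R
  · rw [le_div_iff₀ (by positivity)]
    have : S * (totient W * log N) ≤ r * (W * log N) := by
      apply mul_le_mul (hSR.trans hRr) _ (by positivity) (by positivity)
      gcongr
    nlinarith
  · push Not at hSR
    have hJ' : (totient W : ℝ) / W * (1/8 * log N) / 2 ≤ JJ W R := by
      refine le_trans ?_ hJ; gcongr
    have h5 : (totient W : ℝ) / W * (1/8 * log N) / 2 * (S - R) ≤ 2 * (N / W) :=
      (mul_le_mul_of_nonneg_right hJ' (by linarith)).trans hub
    have h6 : (totient W : ℝ) * log N * (S - R) ≤ 32 * N := by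
      have : (totient W : ℝ) / W * (1/8 * log N) / 2 * (S - R) = (totient W : ℝ) * log N * (S - R) / (16 * W) := by
        field_simp; ring
      rw [this, div_le_iff₀ (by positivity)] at h5
      have e : 2 * ((N:ℝ) / W) * (16 * W) = 32 * N := by field_simp; ring
      linarith
    have h7 : (R:ℝ) * (totient W * log N) ≤ N := by
      calc _ ≤ r * (W * log N) := by gcongr
        _ ≤ r * r := by gcongr
        _ = N := hsq
    rw [le_div_iff₀ (by positivity)]
    nlinarith

lemma sum_class_range (X n r : ℕ) (hn : 0 < n) (hr : r < n) (f : ℕ → ℂ) :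
    ∑ y ∈ (range X).filter (fun y => y % n = r), f y = ∑ z ∈ range ((X + n - 1 - r) / n), f (r + n * z) := by
  symm
  apply sum_bij (fun z _ => r + n * z)
  · intro z hz
    rw [mem_range, Nat.lt_iff_add_one_le, Nat.le_div_iff_mul_le hn] at hz
    rw [mem_filter, mem_range, Nat.add_mul_mod_self_left, mod_eq_of_lt hr]
    refine ⟨?_, rfl⟩
    have : (z+1) * n = n * z + n := by ring
    omega
  · intro z _ z' _ h
    have : n * z = n * z' := by omega
    exact Nat.eq_of_mul_eq_mul_left hn this
  · intro y hy
    rw [mem_filter, mem_range] at hy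
    refine ⟨y / n, ?_, ?_⟩
    · rw [mem_range, Nat.lt_iff_add_one_le, Nat.le_div_iff_mul_le hn]
      have h1 := Nat.mod_add_div y n
      have : (y / n +1) * n = n * (y / n) + n := by ring
      omega
    · have h1 := Nat.mod_add_div y n
      omega
  · intros; rfl

lemma aux_nX (n X : ℕ) (hn : 0 < n) (hX : 0 < X) : X + n - 1 ≤ n * X := by
  obtain ⟨n', rfl⟩ : ∃ n', n = n' + 1 := ⟨n - 1, by omega⟩
  obtain ⟨X', rfl⟩ : ∃ X', X = X' + 1 := ⟨X - 1, by omega⟩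
  have : (n'+1) * (X' + 1) = n' * X' + n' + X' + 1 := by ring
  omega

lemma exists_big {ι : Type*} (s : Finset ι) (f : ι → ℂ) (K v : ℝ) (hs : (s.card : ℝ) ≤ K)
    (hv : 0 < v) (h : v ≤ ‖∑ i ∈ s, f i‖) : ∃ i ∈ s, v ≤ K * ‖f i‖ := by
  by_contra hcon
  push Not at hcon
  have hne : s.Nonempty := by
    rw [nonempty_iff_ne_empty]; rintro rfl; simp at h; linarith
  have hc : (0:ℝ) < s.card := mod_cast hne.card_pos
  have hK : 0 < K := hc.trans_le hs
  have h1 : ∑ i ∈ s, ‖f i‖ < ∑ i ∈ s, v / K := by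
    apply sum_lt_sum_of_nonempty hne
    intro i hi
    rw [lt_div_iff₀ hK, mul_comm]; exact hcon i hi
  rw [sum_const, nsmul_eq_mul] at h1
  have h2 : (s.card : ℝ) * (v / K) ≤ K * (v / K) := by gcongr
  rw [mul_div_cancel₀ _ hK.ne'] at h2
  linarith [norm_sum_le s f]

lemma comp_lin_coeff (H : Polynomial ℝ) (d : ℕ) (hd : H.natDegree = d) (r n : ℝ) :
    ((taylor r H).comp (Polynomial.C n * Polynomial.X)).coeff d = H.coeff d * n ^ d := by
  rw [comp_C_mul_X_coeff]
  congr 1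
  rw [← hd, Polynomial.coeff_taylor_natDegree]; rfl

lemma minor (d : ℕ) (hd : 1 ≤ d) : ∃ C : ℕ, 1 ≤ C ∧ ∀ (W b R : ℕ) (_ : 1 ≤ R) (H : ℤ[X])
    (_ : H.natDegree = d) (X : ℕ) (_ : 1 ≤ X) (D : ℝ) (_ : 1 ≤ D) (α : ℝ), (X:ℝ) ≤ D * ‖Vs W b R H X α‖ →
    ∃ n : ℕ, 1 ≤ n ∧ (n:ℝ) ≤ R ^ 2 ∧ ∃ q : ℕ, 1 ≤ q ∧ (q:ℝ) ≤ C * (D * R ^ 4) ^ C ∧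
      nn (q * (α * H.coeff d * n ^ d)) ≤ C * (D * R ^ 4) ^ (C + d) / X ^ d := by
  obtain ⟨C, hC, hweyl⟩ := weyl d hd
  refine ⟨C, hC, fun W b R hR H hH X hX D hD α h => ?_⟩
  have hJ := JJ_ge_one W R hR
  have hX0 : (0:ℝ) < X := mod_cast hX
  have hR0 : (1:ℝ) ≤ R := mod_cast hR
  set v := ‖Vs W b R H X α‖ with hv
  have hv0 : 0 < v := by
    by_contra hc
    have : v = 0 := le_antisymm (not_lt.1 hc) (norm_nonneg _)
    rw [this] at h; linarith
  have hc : ((KK W R).card : ℝ) ≤ R := mod_cast card_KK_le W R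
  have h1 : v ≤ ‖∑ k ∈ KK W R, ∑ l ∈ KK W R, ∑ y ∈ range X, (chi W b k y : ℂ) * chi W b l y * ee (α * (H.eval (y:ℤ) : ℤ))‖ := by
    rw [hv, Vs_expand, norm_div, norm_real, norm_eq_abs, abs_of_pos (by linarith)]
    exact div_le_self (norm_nonneg _) hJ
  obtain ⟨k, hk, h2⟩ := exists_big _ _ R v hc hv0 h1
  have h2' : v / R ≤ ‖∑ l ∈ KK W R, ∑ y ∈ range X, (chi W b k y : ℂ) * chi W b l y * ee (α * (H.eval (y:ℤ) : ℤ))‖ := by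
    rw [div_le_iff₀ (by linarith), mul_comm]; exact h2
  obtain ⟨l, hl, h3⟩ := exists_big _ _ R (v / R) hc (by positivity) h2'
  rw [mem_KK] at hk hl
  set n := k * l with hn
  have hn0 : 0 < n := Nat.mul_pos (by omega) (by omega)
  have hnR : (n:ℝ) ≤ R ^ 2 := by
    have hk1 : (k:ℝ) ≤ R := mod_cast hk.1.2
    have hl1 : (l:ℝ) ≤ R := mod_cast hl.1.2
    rw [hn, sq]; push_cast; gcongr
  have h3' : v / R / R ≤ ‖∑ r ∈ range n, ∑ y ∈ (range X).filter (fun y => y % n = r),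
      (chi W b k y : ℂ) * chi W b l y * ee (α * (H.eval (y:ℤ) : ℤ))‖ := by
    rw [sum_fiberwise_of_maps_to (fun y _ => mem_range.2 (mod_lt y hn0))]
    rw [div_le_iff₀ (by linarith), mul_comm]; exact h3
  obtain ⟨r, hr, h4⟩ := exists_big _ _ (R^2) (v / R / R) (by simpa using hnR) (by positivity) h3'
  have hr' := mem_range.1 hr
  rw [sum_class_range X n r hn0 hr'] at h4
  set Xr := (X + n - 1 - r) / n with hXr
  set P : Polynomial ℝ := Polynomial.C α * (taylor (r:ℝ) (H.map (castRingHom ℝ))).comp (Polynomial.C (n:ℝ) * Polynomial.X) with hP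
  have hnat : (H.map (castRingHom ℝ)).natDegree = d := by
    rw [Polynomial.natDegree_map_eq_of_injective (RingHom.injective_int _), hH]
  have heval : ∀ z : ℕ, P.eval (z:ℝ) = α * (H.eval ((r + n * z : ℕ):ℤ) : ℤ) := by
    intro z
    rw [hP, eval_mul, eval_C, Polynomial.eval_comp, taylor_eval, poly_cast_real]
    simp only [eval_mul, eval_C, eval_X]
    push_cast
    rw [add_comm]
  have hsum : ∑ z ∈ range Xr, (chi W b k (r + n * z) : ℂ) * chi W b l (r + n * z) * ee (α * (H.eval ((r + n * z : ℕ):ℤ) : ℤ))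
      = ((chi W b k r : ℂ) * chi W b l r) * ∑ z ∈ range Xr, ee (P.eval (z:ℝ)) := by
    rw [mul_sum]; apply sum_congr rfl; intro z _
    have e1 : (chi W b k (r + n * z) : ℂ) = chi W b k r :=
      periodic_of_dvd (n := n * z) ⟨l * z, by rw [hn]; ring⟩ (chi_periodicC W b k) r
    have e2 : (chi W b l (r + n * z) : ℂ) = chi W b l r :=
      periodic_of_dvd (n := n * z) ⟨k * z, by rw [hn]; ring⟩ (chi_periodicC W b l) r
    rw [e1, e2, heval]
  rw [hsum, norm_mul] at h4
  have hchi : ‖(chi W b k r : ℂ) * chi W b l r‖ ≤ 1 := by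
    rw [norm_mul, norm_real, norm_real]
    exact mul_le_one₀ (chi_abs_le W b k r) (norm_nonneg _) (chi_abs_le W b l r)
  set s := ‖∑ z ∈ range Xr, ee (P.eval (z:ℝ))‖ with hs
  have hs0 : 0 ≤ s := norm_nonneg _
  have h5 : v ≤ R ^ 4 * s := by
    have : v / R / R ≤ R^2 * s := h4.trans (by
      apply mul_le_mul_of_nonneg_left _ (by positivity)
      nlinarith [norm_nonneg ((chi W b k r : ℂ) * chi W b l r)])
    rw [div_div, div_le_iff₀ (by positivity)] at this
    linarith
  set D' := D * (R:ℝ)^4 with hD'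
  have hR4 : (1:ℝ) ≤ (R:ℝ)^4 := one_le_pow₀ hR0
  have hD1 : 1 ≤ D' := by nlinarith
  have h6 : (X:ℝ) ≤ D' * s := h.trans (by rw [hD', mul_assoc]; gcongr)
  have hsX : s ≤ Xr := by
    refine (norm_sum_le _ _).trans ?_
    simp [norm_ee]
  have hXr1 : 1 ≤ Xr := by
    by_contra hcon
    have : Xr = 0 := Nat.lt_one_iff.1 (not_le.1 hcon)
    rw [this] at hsX; push_cast at hsX
    nlinarith
  have hXrX : (Xr:ℝ) ≤ X := by
    have : Xr ≤ X := by
      rw [hXr]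
      apply Nat.div_le_of_le_mul
      rcases Nat.eq_zero_or_pos X with h0 | h0
      · omega
      · have : n ≤ n * X := Nat.le_mul_of_pos_right n h0
        have : X ≤ n * X := Nat.le_mul_of_pos_left X hn0
        have := aux_nX n X hn0 h0
        omega
    exact_mod_cast this
  have hPd : P.natDegree ≤ d := by
    rw [hP]
    refine (natDegree_C_mul_le _ _).trans ?_
    refine (Polynomial.natDegree_comp_le).trans ?_
    rw [natDegree_taylor, hnat]
    calc d * _ ≤ d * 1 := by gcongr; exact (natDegree_C_mul_le _ _).trans Polynomial.natDegree_X_le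
      _ = d := mul_one d
  obtain ⟨q, hq1, hq2, hq3⟩ := hweyl P hPd Xr hXr1 D' hD1 (hXrX.trans h6)
  refine ⟨n, hn0, hnR, q, hq1, hq2, ?_⟩
  have hcoef : P.coeff d = α * H.coeff d * n ^ d := by
    rw [hP, coeff_C_mul, comp_lin_coeff _ d hnat, coeff_map]
    simp; ring
  rw [hcoef] at hq3
  refine hq3.trans ?_
  have hXr0 : (0:ℝ) < Xr := mod_cast hXr1
  have : (X:ℝ) ^ d ≤ D' ^ d * (Xr:ℝ)^d := by
    rw [← mul_pow]; gcongr; exact h6.trans (by gcongr)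
  rw [div_le_div_iff₀ (by positivity) (by positivity), pow_add]
  calc C * D' ^ C * (X:ℝ)^d ≤ C * D' ^ C * (D' ^ d * (Xr:ℝ)^d) := by gcongr
    _ = _ := by ring

structure NiceH (d : ℕ) (B : ℝ) (X : ℕ) (H : ℤ[X]) : Prop where
  deg : H.natDegree = d
  lead1 : 1 ≤ H.coeff d
  leadB : (H.coeff d : ℝ) ≤ B
  mono : ∀ y : ℕ, y < X → H.eval (y:ℤ) < H.eval ((y+1:ℕ):ℤ)
  gap : ∀ y : ℕ, y + 1 < X → H.eval ((y+1:ℕ):ℤ) - H.eval (y:ℤ) ≤ H.eval ((y+2:ℕ):ℤ) - H.eval ((y+1:ℕ):ℤ)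
  top : ((H.eval (X:ℤ) : ℤ):ℝ) - (H.eval 0 : ℤ) ≤ B * X ^ d
  gap0 : (X:ℝ) ^ d ≤ B * (X * (((H.eval 1 : ℤ):ℝ) - (H.eval 0 : ℤ)))

lemma reduce_frac (α : ℝ) (q : ℕ) (hq : 1 ≤ q) (e : ℝ) (h : nn (q * α) ≤ e) :
    ∃ (a : ℤ) (q' : ℕ), IsCoprime a (q' : ℤ) ∧ 1 ≤ q' ∧ q' ≤ q ∧ |α - a / q'| ≤ e := by
  obtain ⟨A, hA⟩ := nn_exists (q * α)
  rw [hA] at h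
  have hq0 : (0:ℝ) < q := mod_cast hq
  have hq1 : (1:ℝ) ≤ q := mod_cast hq
  set g := Int.gcd A q with hg
  have hg0 : 0 < g := Int.gcd_pos_of_ne_zero_right _ (by omega)
  have hgA : (g:ℤ) ∣ A := Int.gcd_dvd_left _ _
  have hgq : g ∣ q := by
    have : (g:ℤ) ∣ q := Int.gcd_dvd_right _ _
    exact_mod_cast this
  refine ⟨A / g, q / g, ?_, ?_, Nat.div_le_self _ _, ?_⟩
  · rw [Int.isCoprime_iff_gcd_eq_one]
    push_cast
    exact Int.gcd_div_gcd_div_gcd hg0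
  · exact Nat.div_pos (le_of_dvd hq hgq) hg0
  · have hg0' : (g:ℝ) ≠ 0 := by exact_mod_cast hg0.ne'
    have e1 : ((A / g : ℤ):ℝ) / ((q / g : ℕ):ℝ) = A / q := by
      rw [Int.cast_div hgA (mod_cast hg0.ne'), Nat.cast_div hgq hg0']
      push_cast
      field_simp
    rw [e1]
    have : |α - A / q| * q = |q * α - A| := by
      rw [← abs_of_pos hq0, ← abs_mul, abs_of_pos hq0]; congr 1; field_simp
    nlinarith [abs_nonneg (α - A / q)]

theorem PR (d : ℕ) (hd : 1 ≤ d) : ∃ ρ : ℝ, 0 < ρ ∧ ρ ≤ 1 / 32 ∧ ∀ B : ℝ, 1 ≤ B → ∀ᶠ X : ℕ in atTop,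
    ∀ (W b : ℕ) (H : ℤ[X]), NiceH d B X H →
    (∀ (α : ℝ) (a : ℤ) (q : ℕ), 1 ≤ q → (q:ℝ) ≤ (X:ℝ) ^ (1/8:ℝ) → |α - a / q| ≤ (X:ℝ) ^ (1/8 - (d:ℝ)) →
      ‖Vs W b ⌊(X:ℝ)^ρ⌋₊ H X α - GG W b ⌊(X:ℝ)^ρ⌋₊ H a q * Es H X (α - a / q)‖ ≤ (X:ℝ) ^ (1 - ρ)) ∧
    (∀ α : ℝ, ‖Vs W b ⌊(X:ℝ)^ρ⌋₊ H X α‖ ≤ (X:ℝ) ^ (1 - ρ) ∨ ∃ (a : ℤ) (q : ℕ), IsCoprime a (q:ℤ) ∧ 1 ≤ q ∧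
      (q:ℝ) ≤ (X:ℝ) ^ (1/8:ℝ) ∧ |α - a / q| ≤ (X:ℝ) ^ (1/8 - (d:ℝ))) := by
  obtain ⟨C, hC, hmin⟩ := minor d hd
  have hC1 : (1:ℝ) ≤ C := mod_cast hC
  have hd1 : (1:ℝ) ≤ d := mod_cast hd
  set ρ : ℝ := 1 / (16 * (5 * C + 7 * d)) with hρ
  have hρ0 : 0 < ρ := by positivity
  have hρ1 : ρ ≤ 1 / 32 := by
    rw [hρ]; apply one_div_le_one_div_of_le (by norm_num); nlinarith
  have hρC : 5 * ρ * (C + d) + 2 * d * ρ = 1 / 16 := by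
    rw [hρ]; field_simp; ring
  refine ⟨ρ, hρ0, hρ1, fun B hB => ?_⟩
  filter_upwards [ev_const (C * B) (1/16) (by norm_num), ev_const (2 + 4 * π * B) (1/8) (by norm_num),
    eventually_ge_atTop 1] with X e1 e2 hX W b H hH
  have hX1 : (1:ℝ) ≤ X := mod_cast hX
  have hX0 : (0:ℝ) < X := by linarith
  obtain ⟨f1, f2, f3⟩ := floor_rpow_facts X hX ρ hρ0
  set R := ⌊(X:ℝ)^ρ⌋₊ with hR
  have hR4 : (R:ℝ)^4 ≤ (X:ℝ)^(4*ρ) := by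
    calc (R:ℝ)^4 ≤ ((X:ℝ)^ρ)^4 := by gcongr
      _ = _ := by rw [← rpow_natCast, ← rpow_mul hX0.le, mul_comm]; norm_num
  constructor
  · intro α a q hq1 hq2 hβ
    refine (Vs_approx W b R f1 H X (fun y hy => (hH.mono y hy).le) α a q (by omega)).trans ?_
    have htop := hH.top
    have hM0 : 0 ≤ ((H.eval (X:ℤ) : ℤ):ℝ) - (H.eval 0 : ℤ) := by
      have hc := hH.gap0
      have := phase_var H X 1 (fun y hy => (hH.mono y hy).le)
      have h2 := (sum_nonneg fun (y:ℕ) (_ : y ∈ range X) => norm_nonneg (ee (1 * (H.eval ((y+1:ℕ):ℤ) : ℤ)) - ee (1 * (H.eval (y:ℤ) : ℤ)))).trans this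
      rw [abs_one, mul_one] at h2
      exact nonneg_of_mul_nonneg_right h2 (by positivity)
    have h1 : |α - a / q| * (((H.eval (X:ℤ) : ℤ):ℝ) - (H.eval 0 : ℤ)) ≤ B * (X:ℝ)^(1/8:ℝ) := by
      calc _ ≤ (X:ℝ) ^ (1/8 - (d:ℝ)) * (B * X ^ d) := by gcongr
        _ = B * (X:ℝ)^(1/8:ℝ) := by
          rw [← rpow_natCast X d, mul_left_comm, ← rpow_add hX0]; norm_num
    have hx8 : (1:ℝ) ≤ (X:ℝ)^(1/8:ℝ) := one_le_rpow hX1 (by norm_num)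
    have h2 : 1 + 2 * π * |α - a / q| * (((H.eval (X:ℤ) : ℤ):ℝ) - (H.eval 0 : ℤ)) ≤ (1 + 2 * π * B) * (X:ℝ)^(1/8:ℝ) := by
      have := mul_le_mul_of_nonneg_left h1 (show 0 ≤ 2 * π by positivity)
      nlinarith
    have hpi : 0 ≤ 2 * π * |α - a / q| * (((H.eval (X:ℤ) : ℤ):ℝ) - (H.eval 0 : ℤ)) := by positivity
    calc 2 * (R:ℝ)^4 * q * (1 + 2 * π * |α - a / q| * (((H.eval (X:ℤ) : ℤ):ℝ) - (H.eval 0 : ℤ)))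
        ≤ 2 * (X:ℝ)^(4*ρ) * (X:ℝ)^(1/8:ℝ) * ((1 + 2 * π * B) * (X:ℝ)^(1/8:ℝ)) := by gcongr
      _ = (X:ℝ)^(4*ρ) * (X:ℝ)^(1/8:ℝ) * (X:ℝ)^(1/8:ℝ) * (2 + 4 * π * B) := by ring
      _ ≤ (X:ℝ)^(4*ρ) * (X:ℝ)^(1/8:ℝ) * (X:ℝ)^(1/8:ℝ) * (X:ℝ)^(1/8:ℝ) := by gcongr
      _ = (X:ℝ)^(4*ρ + 1/8 + 1/8 + 1/8) := by rw [rpow_add hX0, rpow_add hX0, rpow_add hX0]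
      _ ≤ _ := rpow_le_rpow_of_exponent_le hX1 (by linarith)
  · intro α
    by_cases hV : ‖Vs W b R H X α‖ ≤ (X:ℝ) ^ (1 - ρ)
    · exact Or.inl hV
    right
    push Not at hV
    have hDX : (X:ℝ) ≤ (X:ℝ)^ρ * ‖Vs W b R H X α‖ := by
      calc (X:ℝ) = (X:ℝ)^ρ * (X:ℝ)^(1-ρ) := by rw [← rpow_add hX0]; simp
        _ ≤ _ := by gcongr
    obtain ⟨n, hn1, hn2, q, hq1, hq2, hq3⟩ := hmin W b R f1 H hH.deg X hX ((X:ℝ)^ρ) (one_le_rpow hX1 hρ0.le) α hDX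
    have hD' : (X:ℝ)^ρ * (R:ℝ)^4 ≤ (X:ℝ)^(5*ρ) := by
      calc _ ≤ (X:ℝ)^ρ * (X:ℝ)^(4*ρ) := by gcongr
        _ = _ := by rw [← rpow_add hX0]; congr 1; ring
    have hpw : ∀ k : ℕ, ((X:ℝ)^ρ * (R:ℝ)^4)^k ≤ (X:ℝ)^(5*ρ*k) := by
      intro k
      calc _ ≤ ((X:ℝ)^(5*ρ))^k := by gcongr
        _ = _ := by rw [← rpow_natCast, ← rpow_mul hX0.le]
    set ℓ : ℕ := (H.coeff d).toNat with hℓ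
    have hl1 := hH.lead1
    have hℓ1 : (ℓ:ℤ) = H.coeff d := Int.toNat_of_nonneg (by omega)
    have hℓ2 : (ℓ:ℝ) = H.coeff d := mod_cast congrArg (Int.cast (R := ℝ)) hℓ1
    have hnn : nn ((q * n ^ d * ℓ : ℕ) * α) ≤ (X:ℝ) ^ (1/8 - (d:ℝ)) := by
      have e : ((q * n ^ d * ℓ : ℕ):ℝ) * α = q * (α * H.coeff d * n ^ d) := by
        push_cast; rw [hℓ2]; ring
      rw [e]
      refine hq3.trans ?_
      rw [div_le_iff₀ (by positivity)]
      calc C * ((X:ℝ)^ρ * (R:ℝ)^4)^(C+d) ≤ (C * B) * (X:ℝ)^(5*ρ*(C+d:ℕ)) := by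
            gcongr
            · nlinarith
            · exact hpw _
        _ ≤ (X:ℝ)^(1/16:ℝ) * (X:ℝ)^(1/16:ℝ) := by
            gcongr
            · push_cast
              have : 0 ≤ 2 * d * ρ := by positivity
              linarith
        _ = (X:ℝ) ^ (1/8 - (d:ℝ)) * X ^ d := by
            rw [← rpow_natCast, ← rpow_add hX0, ← rpow_add hX0]; norm_num
    have hpos : 1 ≤ q * n ^ d * ℓ := by
      have : 0 < ℓ := by omega
      have : 0 < n ^ d := by positivity
      exact Nat.mul_pos (Nat.mul_pos (by omega) this) (by omega)
    obtain ⟨a, q', ha, hq', hq'', hβ⟩ := reduce_frac α _ hpos _ hnn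
    refine ⟨a, q', ha, hq', ?_, hβ⟩
    calc (q':ℝ) ≤ (q * n ^ d * ℓ : ℕ) := by exact_mod_cast hq''
      _ = q * n ^ d * ℓ := by push_cast; rfl
      _ ≤ (C * (X:ℝ)^(5*ρ*C)) * (X:ℝ)^(2*d*ρ) * B := by
          gcongr
          · exact hq2.trans (by gcongr; exact hpw C)
          · calc (n:ℝ)^d ≤ (((X:ℝ)^ρ)^2)^d := by
                  gcongr; exact hn2.trans (by gcongr)
              _ = _ := by
                rw [← pow_mul, ← rpow_natCast, ← rpow_mul hX0.le]; congr 1; push_cast; ring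
          · rw [hℓ2]; exact hH.leadB
      _ = (C * B) * (X:ℝ)^(5*ρ*C + 2*d*ρ) := by rw [rpow_add hX0]; ring
      _ ≤ (X:ℝ)^(1/16:ℝ) * (X:ℝ)^(1/16:ℝ) := by
          gcongr
          · have : 0 ≤ 5 * ρ * d := by positivity
            linarith
      _ = (X:ℝ)^(1/8:ℝ) := by rw [← rpow_add hX0]; norm_num

structure RoughH (d w W : ℕ) (H : ℤ[X]) : Prop where
  hdw : d ≤ w
  small : ∀ p : ℕ, p.Prime → p ≤ w → p ∣ W ∧ ¬ (p:ℤ) ∣ H.coeff 1 ∧ ∀ j, 2 ≤ j → (p:ℤ) ∣ H.coeff j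
  big : ∀ p : ℕ, p.Prime → w < p → ¬ p ∣ W ∧ ¬ (p:ℤ) ∣ H.coeff d

noncomputable def c0 (d : ℕ) : ℝ := 1 / ((d:ℝ) + 1 / 16)

lemma c0_pos (d : ℕ) : 0 < c0 d := by unfold c0; positivity

lemma c0_lt (d : ℕ) (hd : 1 ≤ d) : c0 d < 1 / (d:ℝ) := by
  unfold c0
  have : (1:ℝ) ≤ d := mod_cast hd
  apply one_div_lt_one_div_of_lt <;> linarith

lemma GG_rough (d : ℕ) (hd : 1 ≤ d) : ∃ w0 : ℕ, ∀ w : ℕ, w0 ≤ w → ∀ (W b R q : ℕ) (H : ℤ[X]) (a : ℤ), 1 ≤ R →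
    RoughH d w W H → H.natDegree = d → q ≠ 0 → IsCoprime a (q:ℤ) →
    GG W b R H a q = 0 ∨ ((∀ p, p.Prime → p ∣ q → w < p) ∧ ‖GG W b R H a q‖ ≤ (q:ℝ) ^ (-(c0 d))) := by
  have he : 0 < 1 / (d:ℝ) - c0 d := sub_pos.2 (c0_lt d hd)
  have hd1 : (1:ℝ) ≤ d := mod_cast hd
  obtain ⟨w0, hw0⟩ := eventually_atTop.1 (ev_const (16 * d) _ he)
  refine ⟨w0, fun w hw W b R q H a hR hr hdeg hq ha => ?_⟩
  by_cases hs : ∀ p, p.Prime → p ∣ q → w < p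
  · refine Or.inr ⟨hs, ?_⟩
    refine (GG_bound d hd W b R q hR H hdeg.le a hq ha fun p hp hpq => ?_).trans ?_
    · have h1 := hs p hp hpq
      exact ⟨(hr.big p hp h1).1, lt_of_le_of_lt hr.hdw h1, d, hd, (hr.big p hp h1).2⟩
    · have h2 := rough_pow_le (16 * d) (1 / (d:ℝ) - c0 d) (by linarith) q hq (fun p hp hpq => hw0 p (hw.trans (hs p hp hpq).le))
      have hq0 : (0:ℝ) < q := mod_cast Nat.pos_of_ne_zero hq
      calc (16 * d : ℝ) ^ (q.primeFactorsList.length) * (q:ℝ) ^ (-(1 / d : ℝ)) ≤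
          (q:ℝ) ^ (1 / (d:ℝ) - c0 d) * (q:ℝ) ^ (-(1 / d : ℝ)) := by gcongr
        _ = _ := by rw [← rpow_add hq0]; congr 1; ring
  · push Not at hs
    obtain ⟨p, hp, hpq, hpw⟩ := hs
    have := hr.small p hp hpw
    exact Or.inl (GG_zero W b R q p H a hq hp this.1 hpq ha this.2.1 this.2.2)

lemma Es_norm_le (H : ℤ[X]) (X : ℕ) (β : ℝ) : ‖Es H X β‖ ≤ X := by
  unfold Es
  refine (norm_sum_le _ _).trans ?_
  simp [norm_ee]

lemma Es_sub_int (H : ℤ[X]) (X : ℕ) (β : ℝ) (n : ℤ) : Es H X (β - n) = Es H X β := by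
  unfold Es
  refine sum_congr rfl fun y _ => ?_
  apply ee_eq_of_sub_int (-(n * H.eval (y:ℤ)))
  push_cast; ring

lemma Psis_sub_int (H : ℤ[X]) (X : ℕ) (β : ℝ) (n : ℤ) : Psis H X (β - n) = Psis H X β := by
  unfold Psis
  refine sum_congr rfl fun y _ => ?_
  congr 1
  refine sum_congr rfl fun m _ => ?_
  apply ee_eq_of_sub_int (-(n * m))
  push_cast; ring

lemma NiceH.Psis_le {d : ℕ} {B : ℝ} {X : ℕ} {H : ℤ[X]} (h : NiceH d B X H) (hX : 1 ≤ X) (α : ℝ) (hα : 0 < nn α) :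
    ‖Psis H X α‖ ≤ 1 / ((((H.eval 1 : ℤ):ℝ) - (H.eval 0 : ℤ)) * nn α) := by
  exact Psis_bound H X hX h.mono h.gap α hα

lemma NiceH.gap_pos {d : ℕ} {B : ℝ} {X : ℕ} {H : ℤ[X]} (h : NiceH d B X H) (hX : 1 ≤ X) :
    0 < ((H.eval 1 : ℤ):ℝ) - (H.eval 0 : ℤ) := by
  have := h.mono 0 hX
  simp only [Nat.cast_zero, zero_add, Nat.cast_one] at this
  have h2 : ((H.eval 0 : ℤ):ℝ) < (H.eval 1 : ℤ) := mod_cast this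
  linarith

lemma NiceH.EsPsis {d : ℕ} {B : ℝ} {X : ℕ} {H : ℤ[X]} (h : NiceH d B X H) (hX : 1 ≤ X)
    (β : ℝ) (hβ : |β| ≤ (X:ℝ) ^ (1/8 - (d:ℝ))) : ‖Es H X β - Psis H X β‖ ≤ 2 * π * B * (X:ℝ) ^ (1/8:ℝ) := by
  have hX0 : (0:ℝ) < X := mod_cast hX
  refine (Es_Psis H X h.mono β).trans ?_
  have e1 : (X:ℝ) ^ (1/8:ℝ) = (X:ℝ) ^ (1/8 - (d:ℝ)) * (X:ℝ) ^ d := by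
    rw [← rpow_natCast, ← rpow_add hX0]; congr 1; ring
  have hB : 0 ≤ B := by have := h.leadB; have h1 := h.lead1; have : (1:ℝ) ≤ H.coeff d := by exact_mod_cast h1
                        linarith
  calc 2 * π * |β| * (((H.eval (X:ℤ) : ℤ):ℝ) - (H.eval 0 : ℤ)) ≤ 2 * π * |β| * (B * (X:ℝ)^d) := by
        gcongr; exact h.top
    _ ≤ 2 * π * (X:ℝ) ^ (1/8 - (d:ℝ)) * (B * (X:ℝ)^d) := by gcongr
    _ = _ := by rw [e1]; ring

theorem analytic (d : ℕ) (hd : 1 ≤ d) : ∃ ρ : ℝ, 0 < ρ ∧ ρ ≤ 1 / 32 ∧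
    (∃ w0 : ℕ, ∀ w : ℕ, w0 ≤ w → ∀ B : ℝ, 1 ≤ B → ∀ B2 : ℝ, 1 ≤ B2 → ∀ᶠ X : ℕ in atTop,
      ∀ (W b : ℕ) (H : ℤ[X]), NiceH d B X H → RoughH d w W H → ∀ Pr : ℝ, 0 ≤ Pr →
        Pr ≤ B2 * (X * (((H.eval 1 : ℤ):ℝ) - (H.eval 0 : ℤ))) → ∀ α : ℝ, ∃ (a : ℤ) (q : ℕ), 1 ≤ q ∧
        (∀ p, p.Prime → p ∣ q → w < p) ∧
        ‖Vs W b ⌊(X:ℝ)^ρ⌋₊ H X α‖ ≤ X * (2 * B2 * (q:ℝ) ^ (-(c0 d)) / (1 + Pr * |α - a / q|) + (X:ℝ) ^ (-(ρ/2)))) ∧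
    (∀ ε : ℝ, 0 < ε → ∃ w0 : ℕ, ∀ w : ℕ, w0 ≤ w → ∀ B : ℝ, 1 ≤ B → ∀ᶠ X : ℕ in atTop,
      ∀ (W b : ℕ) (H : ℤ[X]), NiceH d B X H → RoughH d w W H → ∀ α : ℝ,
        ‖Vs W b ⌊(X:ℝ)^ρ⌋₊ H X α - Psis H X α‖ ≤ ε * X) := by
  obtain ⟨ρ, hρ0, hρ1, hPR⟩ := PR d hd
  obtain ⟨w0, hw0⟩ := GG_rough d hd
  have hd1 : (1:ℝ) ≤ d := mod_cast hd
  refine ⟨ρ, hρ0, hρ1, ⟨w0, fun w hw B hB B2 hB2 => ?_⟩, fun ε hε => ?_⟩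
  · filter_upwards [hPR B hB, ev_const (1 + 2 * π * B) (ρ/2) (by positivity), ev_const 4 (7/8) (by norm_num),
      eventually_ge_atTop 1] with X hX hc h2 hX1 W b H hN hR Pr hPr0 hPr α
    obtain ⟨hA, hM⟩ := hX W b H hN
    have hX0 : (0:ℝ) < X := mod_cast hX1
    have hX1' : (1:ℝ) ≤ X := mod_cast hX1
    have hR1 := (floor_rpow_facts X hX1 ρ hρ0).1
    have hg := hN.gap_pos hX1
    have e0 : (X:ℝ) ^ (1 - ρ) = X * (X:ℝ) ^ (-ρ) := by
      rw [sub_eq_add_neg, rpow_add hX0, rpow_one]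
    have e1 : (1 + 2 * π * B) * (X:ℝ) ^ (-ρ) ≤ (X:ℝ) ^ (-(ρ/2)) := by
      calc (1 + 2 * π * B) * (X:ℝ) ^ (-ρ) ≤ (X:ℝ) ^ (ρ/2) * (X:ℝ) ^ (-ρ) := by gcongr
        _ = _ := by rw [← rpow_add hX0]; congr 1; ring
    have e2 : (X:ℝ) ^ (1/8:ℝ) ≤ (X:ℝ) ^ (1 - ρ) := rpow_le_rpow_of_exponent_le hX1' (by linarith)
    have hpB : 0 ≤ 2 * π * B := by positivity
    have e3 : (X:ℝ) ^ (1 - ρ) + 2 * π * B * (X:ℝ) ^ (1/8:ℝ) ≤ X * (X:ℝ) ^ (-(ρ/2)) := by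
      calc (X:ℝ) ^ (1 - ρ) + 2 * π * B * (X:ℝ) ^ (1/8:ℝ) ≤ (X:ℝ) ^ (1 - ρ) + 2 * π * B * (X:ℝ) ^ (1 - ρ) := by gcongr
        _ = X * ((1 + 2 * π * B) * (X:ℝ) ^ (-ρ)) := by rw [e0]; ring
        _ ≤ _ := by gcongr
    have e4 : (X:ℝ) ^ (1 - ρ) ≤ X * (X:ℝ) ^ (-(ρ/2)) := le_trans (by nlinarith [rpow_nonneg hX0.le (1/8:ℝ)]) e3
    have triv : ‖Vs W b ⌊(X:ℝ)^ρ⌋₊ H X α‖ ≤ (X:ℝ) ^ (1 - ρ) → ∃ (a : ℤ) (q : ℕ), 1 ≤ q ∧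
        (∀ p, p.Prime → p ∣ q → w < p) ∧
        ‖Vs W b ⌊(X:ℝ)^ρ⌋₊ H X α‖ ≤ X * (2 * B2 * (q:ℝ) ^ (-(c0 d)) / (1 + Pr * |α - a / q|) + (X:ℝ) ^ (-(ρ/2))) := by
      intro h
      refine ⟨0, 1, le_rfl, fun p hp h1 => absurd h1 hp.not_dvd_one, h.trans (e4.trans ?_)⟩
      gcongr
      have : 0 ≤ 2 * B2 * ((1:ℕ):ℝ) ^ (-(c0 d)) / (1 + Pr * |α - (0:ℤ) / (1:ℕ)|) := by positivity
      linarith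
    rcases hM α with h | ⟨a, q, hco, hq1, hqX, hβ⟩
    · exact triv h
    · have hAA := hA α a q hq1 hqX hβ
      rcases hw0 w hw W b _ q H a hR1 hR hN.deg (by omega) hco with h0 | ⟨hrough, hG⟩
      · rw [h0, zero_mul, sub_zero] at hAA
        exact triv hAA
      · refine ⟨a, q, hq1, hrough, ?_⟩
        set β := α - a / q with hβd
        have hq0 : (0:ℝ) < q := mod_cast hq1
        have hqc : (q:ℝ) ^ (-(c0 d)) ≤ 1 := Real.rpow_le_one_of_one_le_of_nonpos (mod_cast hq1) (by linarith [c0_pos d])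
        have hE : ‖Es H X β‖ ≤ X * (2 * B2 / (1 + Pr * |β|)) + 2 * π * B * (X:ℝ) ^ (1/8:ℝ) := by
          have hp : 0 ≤ Pr * |β| := by positivity
          by_cases hs : Pr * |β| ≤ 1
          · have h1 : 1 ≤ 2 * B2 / (1 + Pr * |β|) := by rw [le_div_iff₀ (by linarith)]; linarith
            have := Es_norm_le H X β
            have h2 : (X:ℝ) * 1 ≤ X * (2 * B2 / (1 + Pr * |β|)) := by gcongr
            have : 0 ≤ 2 * π * B * (X:ℝ) ^ (1/8:ℝ) := by positivity
            linarith
          · push Not at hs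
            have hβ0 : 0 < |β| := by
              rcases (abs_nonneg β).eq_or_lt with h | h
              · rw [← h] at hs; simp at hs; linarith
              · exact h
            have hhalf : |β| < 1/2 := by
              refine lt_of_le_of_lt hβ ?_
              calc (X:ℝ) ^ (1/8 - (d:ℝ)) ≤ (X:ℝ) ^ (-(7/8:ℝ)) := rpow_le_rpow_of_exponent_le hX1' (by linarith)
                _ = ((X:ℝ) ^ (7/8:ℝ))⁻¹ := rpow_neg hX0.le _
                _ ≤ 4⁻¹ := inv_anti₀ (by norm_num) h2
                _ < 1/2 := by norm_num
            have hnn : nn β = |β| := nn_eq_abs hhalf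
            have h1 := hN.EsPsis hX1 β hβ
            have h2 := hN.Psis_le hX1 β (by rw [hnn]; exact hβ0)
            rw [hnn] at h2
            have h3 : 1 / ((((H.eval 1 : ℤ):ℝ) - (H.eval 0 : ℤ)) * |β|) ≤ X * (2 * B2 / (1 + Pr * |β|)) := by
              rw [← mul_div_assoc, div_le_div_iff₀ (by positivity) (by positivity)]
              have : Pr * |β| ≤ B2 * (X * (((H.eval 1 : ℤ):ℝ) - (H.eval 0 : ℤ))) * |β| := by gcongr
              nlinarith
            calc ‖Es H X β‖ = ‖Psis H X β + (Es H X β - Psis H X β)‖ := by congr 1; ring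
              _ ≤ _ := norm_add_le _ _
              _ ≤ _ := by linarith
        have hp : 0 ≤ 1 + Pr * |β| := by positivity
        have hc0 : 0 ≤ 2 * π * B * (X:ℝ) ^ (1/8:ℝ) := by positivity
        calc ‖Vs W b ⌊(X:ℝ)^ρ⌋₊ H X α‖ = ‖(Vs W b ⌊(X:ℝ)^ρ⌋₊ H X α - GG W b ⌊(X:ℝ)^ρ⌋₊ H a q * Es H X β) + GG W b ⌊(X:ℝ)^ρ⌋₊ H a q * Es H X β‖ := by
              congr 1; ring
          _ ≤ _ := norm_add_le _ _
          _ ≤ (X:ℝ) ^ (1 - ρ) + (q:ℝ) ^ (-(c0 d)) * (X * (2 * B2 / (1 + Pr * |β|)) + 2 * π * B * (X:ℝ) ^ (1/8:ℝ)) := by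
              rw [norm_mul]; gcongr
          _ ≤ (X:ℝ) ^ (1 - ρ) + (X * (2 * B2 * (q:ℝ) ^ (-(c0 d)) / (1 + Pr * |β|)) + 1 * (2 * π * B * (X:ℝ) ^ (1/8:ℝ))) := by
              rw [mul_add]
              have : (q:ℝ) ^ (-(c0 d)) * (X * (2 * B2 / (1 + Pr * |β|))) = X * (2 * B2 * (q:ℝ) ^ (-(c0 d)) / (1 + Pr * |β|)) := by ring
              rw [this]
              gcongr
          _ ≤ _ := by linarith
  · have : Tendsto (fun w : ℕ => ((w:ℝ)) ^ (-(c0 d))) atTop (nhds 0) :=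
      (tendsto_rpow_neg_atTop (c0_pos d)).comp tendsto_natCast_atTop_atTop
    obtain ⟨w1, hw1⟩ := eventually_atTop.1 ((tendsto_order.1 this).2 (ε/2) (by positivity))
    refine ⟨max (max w0 w1) 1, fun w hw B hB => ?_⟩
    have hww0 : w0 ≤ w := le_trans (le_trans (le_max_left _ _) (le_max_left _ _)) hw
    have hww1 : w1 ≤ w := le_trans (le_trans (le_max_right _ _) (le_max_left _ _)) hw
    have hww2 : 1 ≤ w := le_trans (le_max_right _ _) hw
    filter_upwards [hPR B hB, ev_const ((1 + 2 * π * B) * (2/ε)) ρ (by positivity),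
      eventually_ge_atTop 1] with X hX hc hX1 W b H hN hR α
    obtain ⟨hA, hM⟩ := hX W b H hN
    have hX0 : (0:ℝ) < X := mod_cast hX1
    have hX1' : (1:ℝ) ≤ X := mod_cast hX1
    have hR1 := (floor_rpow_facts X hX1 ρ hρ0).1
    have hg := hN.gap_pos hX1
    have e2 : (X:ℝ) ^ (1/8:ℝ) ≤ (X:ℝ) ^ (1 - ρ) := rpow_le_rpow_of_exponent_le hX1' (by linarith)
    have e2' : (X:ℝ) ^ (7/8:ℝ) ≤ (X:ℝ) ^ (1 - ρ) := rpow_le_rpow_of_exponent_le hX1' (by linarith)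
    have e3 : (1 + 2 * π * B) * (X:ℝ) ^ (1 - ρ) ≤ ε / 2 * X := by
      have : (X:ℝ) = (X:ℝ) ^ ρ * (X:ℝ) ^ (1 - ρ) := by rw [← rpow_add hX0]; simp
      calc (1 + 2 * π * B) * (X:ℝ) ^ (1 - ρ) = ε / 2 * (((1 + 2 * π * B) * (2/ε)) * (X:ℝ) ^ (1 - ρ)) := by field_simp
        _ ≤ ε / 2 * ((X:ℝ) ^ ρ * (X:ℝ) ^ (1 - ρ)) := by gcongr
        _ = _ := by rw [← this]
    by_cases hn : nn α ≤ (X:ℝ) ^ (1/8 - (d:ℝ))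
    · obtain ⟨n, hn'⟩ := nn_exists α
      have hb : |α - n| ≤ (X:ℝ) ^ (1/8 - (d:ℝ)) := by rw [← hn']; exact hn
      have h1 := hA α n 1 le_rfl (by simpa using one_le_rpow hX1' (by norm_num : (0:ℝ) ≤ 1/8)) (by simpa using hb)
      rw [GG_one _ _ _ hR1, one_mul, Nat.cast_one, div_one, Es_sub_int] at h1
      have h2 := hN.EsPsis hX1 (α - n) hb
      rw [Es_sub_int, Psis_sub_int] at h2
      calc _ = ‖(Vs W b ⌊(X:ℝ)^ρ⌋₊ H X α - Es H X α) + (Es H X α - Psis H X α)‖ := by congr 1; ring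
        _ ≤ _ := norm_add_le _ _
        _ ≤ (X:ℝ) ^ (1 - ρ) + 2 * π * B * (X:ℝ) ^ (1 - ρ) := by
          refine add_le_add h1 (h2.trans ?_); gcongr
        _ = (1 + 2 * π * B) * (X:ℝ) ^ (1 - ρ) := by ring
        _ ≤ ε * X := by nlinarith
    · push Not at hn
      have hn0 : 0 < nn α := lt_trans (by positivity) hn
      have hPs : ‖Psis H X α‖ ≤ B * (X:ℝ) ^ (1 - ρ) := by
        refine (hN.Psis_le hX1 α hn0).trans ?_
        have hg0 := hN.gap0
        set g := ((H.eval 1 : ℤ):ℝ) - (H.eval 0 : ℤ)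
        calc 1 / (g * nn α) ≤ 1 / (g * (X:ℝ) ^ (1/8 - (d:ℝ))) := by gcongr
          _ ≤ B * (X:ℝ) ^ (7/8:ℝ) := by
            rw [div_le_iff₀ (by positivity)]
            have e : (X:ℝ) ^ (7/8:ℝ) * (X:ℝ) ^ (1/8 - (d:ℝ)) * (X:ℝ)^d = X := by
              rw [← rpow_natCast, ← rpow_add hX0, ← rpow_add hX0]
              conv_rhs => rw [← rpow_one (X:ℝ)]
              congr 1; ring
            have h3 : (X:ℝ)^d ≤ X * (B * (X:ℝ) ^ (7/8:ℝ) * (g * (X:ℝ) ^ (1/8 - (d:ℝ)))) / X * X^d := by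
              have : X * (B * (X:ℝ) ^ (7/8:ℝ) * (g * (X:ℝ) ^ (1/8 - (d:ℝ)))) / X * X^d = B * g * ((X:ℝ) ^ (7/8:ℝ) * (X:ℝ) ^ (1/8 - (d:ℝ)) * (X:ℝ)^d) := by
                field_simp
              rw [this, e]; linarith
            rw [mul_div_cancel_left₀ _ hX0.ne'] at h3
            have hXd : (0:ℝ) < (X:ℝ)^d := by positivity
            by_contra hcon
            push Not at hcon
            nlinarith
          _ ≤ _ := by gcongr
      have hV : ‖Vs W b ⌊(X:ℝ)^ρ⌋₊ H X α‖ ≤ (X:ℝ) ^ (1 - ρ) + ε / 2 * X := by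
        rcases hM α with h | ⟨a, q, hco, hq1, hqX, hβ⟩
        · have : 0 ≤ ε / 2 * X := by positivity
          linarith
        · have hAA := hA α a q hq1 hqX hβ
          have hGG : ‖GG W b ⌊(X:ℝ)^ρ⌋₊ H a q‖ ≤ ε / 2 := by
            rcases hw0 w hww0 W b _ q H a hR1 hR hN.deg (by omega) hco with h0 | ⟨hrough, hG⟩
            · rw [h0, norm_zero]; positivity
            · refine hG.trans (le_trans ?_ (hw1 w hww1).le)
              have hq2 : q ≠ 1 := by
                rintro rfl
                have := nn_le_abs_sub α a
                rw [Nat.cast_one, div_one] at hβ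
                linarith
              obtain ⟨p, hp, hpq⟩ := Nat.exists_prime_and_dvd hq2
              have : w ≤ q := (hrough p hp hpq).le.trans (le_of_dvd hq1 hpq)
              exact Real.rpow_le_rpow_of_nonpos (mod_cast hww2) (mod_cast this) (by linarith [c0_pos d])
          calc ‖Vs W b ⌊(X:ℝ)^ρ⌋₊ H X α‖ = ‖(Vs W b ⌊(X:ℝ)^ρ⌋₊ H X α - GG W b ⌊(X:ℝ)^ρ⌋₊ H a q * Es H X (α - a/q)) + GG W b ⌊(X:ℝ)^ρ⌋₊ H a q * Es H X (α - a/q)‖ := by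
                congr 1; ring
            _ ≤ _ := norm_add_le _ _
            _ ≤ _ := by
                rw [norm_mul]
                refine add_le_add hAA ?_
                have := Es_norm_le H X (α - a/q)
                gcongr
      have hpi := Real.pi_gt_three
      have hz : 0 ≤ (X:ℝ) ^ (1 - ρ) := by positivity
      calc _ ≤ ‖Vs W b ⌊(X:ℝ)^ρ⌋₊ H X α‖ + ‖Psis H X α‖ := norm_sub_le _ _
        _ ≤ (X:ℝ) ^ (1 - ρ) + ε / 2 * X + B * (X:ℝ) ^ (1 - ρ) := add_le_add hV hPs
        _ ≤ ε / 2 * X + (1 + 2 * π * B) * (X:ℝ) ^ (1 - ρ) := by nlinarith [mul_nonneg (by linarith : (0:ℝ) ≤ B) hz]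
        _ ≤ ε * X := by linarith

section fourier
variable {P : ℕ} [NeZero P]

/-- normalised Fourier coefficient -/
noncomputable def ft (f : ZMod P → ℝ) (ξ : ZMod P) : ℂ :=
  (∑ m, (f m : ℂ) * ZMod.stdAddChar (m * ξ)) / P

noncomputable def cv (f g : ZMod P → ℝ) (m : ZMod P) : ℝ := (∑ n, f n * g (m - n)) / P

lemma P_ne : (P : ℂ) ≠ 0 := mod_cast NeZero.ne P
lemma P_pos : (0:ℝ) < (P : ℝ) := mod_cast Nat.pos_of_ne_zero (NeZero.ne P)

lemma chi_norm (x : ZMod P) : ‖(ZMod.stdAddChar x : ℂ)‖ = 1 := AddChar.norm_apply _ _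

lemma chi_neg (x : ZMod P) : (ZMod.stdAddChar (-x) : ℂ) = conj (ZMod.stdAddChar x : ℂ) :=
  AddChar.map_neg_eq_conj _ _

lemma chi_orth (x : ZMod P) : ∑ ξ : ZMod P, (ZMod.stdAddChar (x * ξ) : ℂ) = if x = 0 then (P:ℂ) else 0 := by
  have := AddChar.sum_mulShift x (ZMod.isPrimitive_stdAddChar P)
  simp only [mul_comm x]
  rw [this]; simp [ZMod.card]

lemma ft_conj (f : ZMod P → ℝ) (ξ : ZMod P) : conj (ft f ξ) = ft f (-ξ) := by
  unfold ft
  rw [map_div₀, map_sum, Complex.conj_natCast]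
  congr 1
  apply sum_congr rfl; intro m _
  rw [map_mul, Complex.conj_ofReal, mul_neg, chi_neg]

lemma ft_inv (f : ZMod P → ℝ) (m : ZMod P) : (f m : ℂ) = ∑ ξ, ft f ξ * ZMod.stdAddChar (-(m * ξ)) := by
  unfold ft
  have : ∀ ξ : ZMod P, (∑ n, (f n : ℂ) * ZMod.stdAddChar (n * ξ)) / P * ZMod.stdAddChar (-(m * ξ))
      = ∑ n, (f n : ℂ) / P * ZMod.stdAddChar ((n - m) * ξ) := by
    intro ξ
    rw [sum_div, sum_mul]
    apply sum_congr rfl; intro n _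
    rw [sub_mul, sub_eq_add_neg, AddChar.map_add_eq_mul]; ring
  simp only [this]
  rw [sum_comm]
  simp only [← mul_sum, chi_orth, sub_eq_zero, mul_ite, mul_zero, sum_ite_eq', mem_univ, if_true]
  field_simp [P_ne (P := P)]

lemma ft_cv (f g : ZMod P → ℝ) (ξ : ZMod P) : ft (cv f g) ξ = ft f ξ * ft g ξ := by
  unfold ft cv
  rw [div_mul_div_comm, sum_mul_sum]
  push_cast
  have : ∑ m, (∑ n, (f n : ℂ) * g (m - n)) / P * ZMod.stdAddChar (m * ξ)
      = (∑ n, ∑ m, (f n : ℂ) * ZMod.stdAddChar (n * ξ) * (g m * ZMod.stdAddChar (m * ξ))) / P := by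
    have h1 : ∀ m, (∑ n, (f n : ℂ) * g (m - n)) / P * ZMod.stdAddChar (m * ξ) = (∑ n, (f n : ℂ) * g (m - n) * ZMod.stdAddChar (m * ξ)) / P := by
      intro m; rw [← sum_mul]; ring
    simp only [h1]
    rw [← sum_div, sum_comm]
    congr 1
    apply sum_congr rfl; intro n _
    rw [← Equiv.sum_comp (Equiv.addRight n)]
    apply sum_congr rfl; intro m _
    simp only [Equiv.coe_addRight, add_sub_cancel_right, add_mul, AddChar.map_add_eq_mul]
    ring
  rw [this, div_div]

lemma parseval (f : ZMod P → ℝ) : (∑ m, (f m) ^ 2) / P = ∑ ξ, ‖ft f ξ‖ ^ 2 := by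
  have h : (((∑ m, (f m) ^ 2) / P : ℝ) : ℂ) = ((∑ ξ, ‖ft f ξ‖ ^ 2 : ℝ) : ℂ) := by
    push_cast
    have h1 : ∀ m, (f m : ℂ) ^ 2 = ∑ ξ, ft f ξ * (f m * ZMod.stdAddChar (-(m * ξ))) := by
      intro m
      rw [sq]
      nth_rewrite 1 [ft_inv f m]
      rw [sum_mul]
      apply sum_congr rfl; intro ξ _; ring
    simp only [h1]
    rw [sum_comm, sum_div]
    apply sum_congr rfl; intro ξ _
    rw [← mul_sum, mul_div_assoc, ← Complex.mul_conj', ft_conj]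
    unfold ft
    simp only [mul_neg]
  exact_mod_cast h

/-- the counting form as a Fourier sum -/
lemma count_fourier {s : ℕ} (a : Fin s → ZMod P) (f : ZMod P → ℝ) :
    ((∑ m ∈ (univ : Finset (Fin s → ZMod P)).filter (fun m => ∑ i, a i * m i = 0), ∏ i, f (m i) : ℝ) : ℂ) * P
      = (P : ℂ) ^ s * ∑ ξ, ∏ i, ft f (a i * ξ) := by
  have h1 : ∀ ξ : ZMod P, (P:ℂ) ^ s * ∏ i, ft f (a i * ξ) = ∑ m : Fin s → ZMod P, (∏ i, (f (m i) : ℂ)) * ZMod.stdAddChar ((∑ i, a i * m i) * ξ) := by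
    intro ξ
    unfold ft
    rw [prod_div_distrib, prod_const, card_univ, Fintype.card_fin, mul_div_cancel₀ _ (pow_ne_zero _ P_ne), prod_univ_sum]
    rw [Fintype.piFinset_univ]
    apply sum_congr rfl; intro m _
    rw [prod_mul_distrib, sum_mul, addChar_map_sum]
    congr 1
    apply prod_congr rfl; intro i _
    congr 1; ring
  rw [mul_sum]
  simp only [h1]
  rw [sum_comm]
  simp only [← mul_sum, chi_orth]
  push_cast
  rw [sum_mul, sum_filter]
  apply sum_congr rfl; intro m _
  split_ifs <;> simp

end fourier

section bohr
variable {P : ℕ} [NeZero P]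

noncomputable def bohr (Γ : Finset (ZMod P)) (t : ℝ) : Finset (ZMod P) :=
  open Classical in univ.filter (fun m => ∀ ξ ∈ Γ, ‖(ZMod.stdAddChar (m * ξ) : ℂ) - 1‖ ≤ t)

lemma mem_bohr {Γ : Finset (ZMod P)} {t : ℝ} {m : ZMod P} :
    m ∈ bohr Γ t ↔ ∀ ξ ∈ Γ, ‖(ZMod.stdAddChar (m * ξ) : ℂ) - 1‖ ≤ t := by
  classical
  unfold bohr; simp

lemma chi_sub_norm (x y : ZMod P) : ‖(ZMod.stdAddChar (x - y) : ℂ) - 1‖ = ‖(ZMod.stdAddChar x : ℂ) - ZMod.stdAddChar y‖ := by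
  have : (ZMod.stdAddChar x : ℂ) = ZMod.stdAddChar (x - y) * ZMod.stdAddChar y := by
    rw [← AddChar.map_add_eq_mul, sub_add_cancel]
  rw [this, ← sub_one_mul, norm_mul, chi_norm, mul_one]

lemma bohr_sub {Γ : Finset (ZMod P)} {t : ℝ} {m n : ZMod P} (hm : m ∈ bohr Γ (t / 2)) (hn : n ∈ bohr Γ (t / 2)) :
    m - n ∈ bohr Γ t := by
  rw [mem_bohr] at *
  intro ξ hξ
  rw [sub_mul, chi_sub_norm]
  have h1 := hm ξ hξ
  have h2 := hn ξ hξ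
  rw [norm_sub_rev] at h2
  have := norm_add_le ((ZMod.stdAddChar (m * ξ) : ℂ) - 1) (1 - ZMod.stdAddChar (n * ξ))
  rw [sub_add_sub_cancel] at this
  linarith

lemma bohr_mono {Γ Γ' : Finset (ZMod P)} {t t' : ℝ} (h : Γ' ⊆ Γ) (ht : t ≤ t') : bohr Γ t ⊆ bohr Γ' t' := by
  intro m hm
  rw [mem_bohr] at *
  exact fun ξ hξ => (hm ξ (h hξ)).trans ht

lemma zero_mem_bohr (Γ : Finset (ZMod P)) {t : ℝ} (ht : 0 ≤ t) : (0 : ZMod P) ∈ bohr Γ t := by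
  rw [mem_bohr]; intro ξ _; simpa using ht

lemma chi_val (x : ZMod P) : (ZMod.stdAddChar x : ℂ) = ee ((x.val : ℝ) / P) := by
  have := ee_eq_stdAddChar P (x.val : ℤ)
  rw [cast_natCast, cast_natCast, ZMod.natCast_zmod_val] at this
  exact this.symm

lemma bohr_card (Γ : Finset (ZMod P)) (t : ℝ) (K : ℕ) (hK : 1 ≤ K) (hKt : 2 * π / K ≤ t) :
    P ≤ (bohr Γ t).card * K ^ Γ.card := by
  classical
  have hP : 0 < P := Nat.pos_of_ne_zero (NeZero.ne P)
  have hlt : ∀ x : ZMod P, x.val * K / P < K := by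
    intro x
    rw [Nat.div_lt_iff_lt_mul hP, mul_comm]
    exact Nat.mul_lt_mul_of_pos_left (ZMod.val_lt x) (by omega)
  let F : ZMod P → (Γ → Fin K) := fun m ξ => ⟨(m * ξ.1).val * K / P, hlt _⟩
  have h := card_le_mul_card_image_of_maps_to (s := (univ : Finset (ZMod P))) (t := (univ : Finset (Γ → Fin K)))
    (f := F) (fun _ _ => mem_univ _) (bohr Γ t).card ?_
  · simpa [ZMod.card] using h
  intro b _
  rcases (univ.filter (fun m => F m = b)).eq_empty_or_nonempty with h0 | ⟨m0, hm0⟩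
  · rw [h0]; simp
  apply card_le_card_of_injOn (fun m => m - m0)
  · intro m hm
    have hm' : F m = b := by simpa using hm
    have hm0' : F m0 = b := by simpa using hm0
    show m - m0 ∈ bohr Γ t
    rw [mem_bohr]
    intro ξ hξ
    have heq : (m * ξ).val * K / P = (m0 * ξ).val * K / P := by
      have := congrFun (hm'.trans hm0'.symm) ⟨ξ, hξ⟩
      simpa [F] using this
    rw [sub_mul, chi_sub_norm, chi_val, chi_val]
    set x := (m * ξ).val
    set y := (m0 * ξ).val
    have h1 : ‖ee ((x:ℝ) / P) - ee ((y:ℝ) / P)‖ = ‖ee ((x:ℝ) / P - y / P) - 1‖ := by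
      have : ee ((x:ℝ) / P) = ee ((x:ℝ) / P - y / P) * ee ((y:ℝ) / P) := by rw [← ee_add, sub_add_cancel]
      rw [this, ← sub_one_mul, norm_mul, norm_ee, mul_one]
    rw [h1]
    refine (norm_ee_sub_one_le _).trans (le_trans ?_ hKt)
    have hPr : (0:ℝ) < P := mod_cast hP
    have hKr : (0:ℝ) < K := mod_cast hK
    have hx := div_add_mod (x * K) P
    have hy := div_add_mod (y * K) P
    have hx2 := mod_lt (x * K) hP
    have hy2 := mod_lt (y * K) hP
    rw [heq] at hx
    have habs : |(x:ℝ) / P - y / P| ≤ 1 / K := by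
      rw [← sub_div, abs_div, abs_of_pos hPr, div_le_div_iff₀ hPr hKr, one_mul]
      rw [← abs_of_pos hKr, ← abs_mul, abs_le]
      have h3 : x * K ≤ y * K + P := by omega
      have h4 : y * K ≤ x * K + P := by omega
      have h3' : (x:ℝ) * K ≤ y * K + P := mod_cast h3
      have h4' : (y:ℝ) * K ≤ x * K + P := mod_cast h4
      constructor <;> nlinarith
    calc 2 * π * |(x:ℝ) / P - y / P| ≤ 2 * π * (1 / K) := by gcongr
      _ = _ := by ring
  · intro x _ y _ hxy
    simpa using hxy

lemma ft_norm_le (β : ZMod P → ℝ) (hβ : ∀ m, 0 ≤ β m) (ξ : ZMod P) : ‖ft β ξ‖ ≤ (∑ m, β m) / P := by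
  unfold ft
  rw [norm_div, Complex.norm_natCast]
  have := P_pos (P := P)
  gcongr
  refine (norm_sum_le _ _).trans (sum_le_sum fun m _ => ?_)
  rw [norm_mul, chi_norm, mul_one, norm_real, norm_of_nonneg (hβ m)]

lemma cv_nonneg {f g : ZMod P → ℝ} (hf : ∀ m, 0 ≤ f m) (hg : ∀ m, 0 ≤ g m) (m : ZMod P) : 0 ≤ cv f g m :=
  div_nonneg (sum_nonneg fun n _ => mul_nonneg (hf n) (hg _)) P_pos.le

lemma sigma_exists (Γ : Finset (ZMod P)) (t : ℝ) (ht : 0 ≤ t) :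
    ∃ σ h : ZMod P → ℝ, (∀ m, 0 ≤ σ m) ∧ (∀ ξ, ft σ ξ = h ξ) ∧ (∀ ξ, 0 ≤ h ξ) ∧ (∀ ξ, h ξ ≤ 1) ∧
      h 0 = 1 ∧ (∀ ξ ∈ Γ, 1 - 2 * t ≤ h ξ) ∧ ∑ ξ, h ξ ≤ P / (bohr Γ t).card := by
  classical
  set B := bohr Γ t with hB
  have hB0 : (0:ℝ) < B.card := mod_cast card_pos.2 ⟨0, zero_mem_bohr Γ ht⟩
  have hP := P_pos (P := P)
  set β : ZMod P → ℝ := fun m => if m ∈ B then (P:ℝ) / B.card else 0 with hβ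
  have hβ0 : ∀ m, 0 ≤ β m := by intro m; simp only [hβ]; split_ifs <;> positivity
  have hsum : ∑ m, β m = P := by
    simp only [hβ]; rw [sum_ite_mem, univ_inter, sum_const, nsmul_eq_mul]; field_simp
  have hsum2 : ∑ m, β m ^ 2 = P ^ 2 / B.card := by
    simp only [hβ, ite_pow]; rw [zero_pow two_ne_zero, sum_ite_mem, univ_inter, sum_const, nsmul_eq_mul]; field_simp
  have hn1 : ∀ ξ, ‖ft β ξ‖ ≤ 1 := by
    intro ξ
    have := ft_norm_le β hβ0 ξ
    rwa [hsum, div_self hP.ne'] at this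
  refine ⟨cv β (fun m => β (-m)), fun ξ => ‖ft β ξ‖ ^ 2, cv_nonneg hβ0 (fun m => hβ0 _), ?_, fun ξ => by positivity,
    fun ξ => pow_le_one₀ (norm_nonneg _) (hn1 ξ), ?_, ?_, ?_⟩
  · intro ξ
    rw [ft_cv]
    have : ft (fun m => β (-m)) ξ = conj (ft β ξ) := by
      rw [ft_conj]; unfold ft
      rw [← Equiv.sum_comp (Equiv.neg (ZMod P))]
      simp
    rw [this, Complex.mul_conj']; push_cast; rfl
  · have : ft β 0 = 1 := by
      unfold ft
      simp only [mul_zero, AddChar.map_zero_eq_one, mul_one]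
      rw [← ofReal_sum, hsum]; simp [P_ne]
    simp [this]
  · intro ξ hξ
    have h1 : ‖ft β ξ - 1‖ ≤ t := by
      have : ft β ξ - 1 = (∑ m, (β m : ℂ) * (ZMod.stdAddChar (m * ξ) - 1)) / P := by
        unfold ft
        simp only [mul_sub, mul_one, sum_sub_distrib]
        rw [← ofReal_sum univ β, hsum, sub_div]; simp [P_ne]
      rw [this, norm_div, Complex.norm_natCast, div_le_iff₀ hP]
      refine (norm_sum_le _ _).trans ?_
      rw [← hsum, mul_sum]
      apply sum_le_sum; intro m _
      rw [norm_mul, norm_real, norm_of_nonneg (hβ0 m), mul_comm]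
      by_cases hm : m ∈ B
      · exact mul_le_mul_of_nonneg_right (mem_bohr.1 hm ξ hξ) (hβ0 m)
      · simp [hβ, hm]
    have h2 : 1 - t ≤ ‖ft β ξ‖ := by
      have := norm_sub_norm_le 1 (1 - ft β ξ)
      rw [sub_sub_cancel, norm_one, norm_sub_rev 1] at this
      linarith
    have h3 := norm_nonneg (ft β ξ)
    show 1 - 2 * t ≤ ‖ft β ξ‖ ^ 2
    rcases le_total t 1 with h | h
    · nlinarith
    · nlinarith
  · rw [← parseval, hsum2]
    apply le_of_eq; field_simp

lemma kappa_exists (σ h : ℕ → ZMod P → ℝ) (hσ : ∀ i m, 0 ≤ σ i m) (hft : ∀ i ξ, ft (σ i) ξ = h i ξ) (S : Finset ℕ) :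
    ∃ κ : ZMod P → ℝ, (∀ m, 0 ≤ κ m) ∧ ∀ ξ, ft κ ξ = ((∏ i ∈ S, h i ξ : ℝ) : ℂ) := by
  classical
  induction S using Finset.induction_on with
  | empty =>
    refine ⟨fun m => if m = 0 then (P:ℝ) else 0, fun m => ?_, fun ξ => ?_⟩
    · have := P_pos (P := P)
      show 0 ≤ if m = 0 then (P:ℝ) else 0
      split_ifs <;> positivity
    · unfold ft
      rw [Fintype.sum_eq_single 0]
      · simp [P_ne]
      · intro x hx; simp [hx]
  | insert i S hi ih =>
    obtain ⟨κ, hκ, hk⟩ := ih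
    refine ⟨cv (σ i) κ, cv_nonneg (hσ i) hκ, fun ξ => ?_⟩
    rw [ft_cv, hk, hft, prod_insert hi]; push_cast; rfl

lemma one_sub_prod_le (S : Finset ℕ) (h : ℕ → ℝ) (h0 : ∀ i, 0 ≤ h i) (h1 : ∀ i, h i ≤ 1) :
    1 - ∏ i ∈ S, h i ≤ ∑ i ∈ S, (1 - h i) := by
  classical
  induction S using Finset.induction_on with
  | empty => simp
  | insert i S hi ih =>
    rw [prod_insert hi, sum_insert hi]
    have h2 : ∏ i ∈ S, h i ≤ 1 := prod_le_one (fun i _ => h0 i) (fun i _ => h1 i)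
    have h3 : 0 ≤ ∏ i ∈ S, h i := prod_nonneg (fun i _ => h0 i)
    nlinarith [h0 i, h1 i]

end bohr

section trans
variable {P : ℕ} [NeZero P]

lemma ft_sub (f g : ZMod P → ℝ) (ξ : ZMod P) : ft (fun m => f m - g m) ξ = ft f ξ - ft g ξ := by
  unfold ft; rw [← sub_div, ← sum_sub_distrib]; congr 1
  apply sum_congr rfl; intro m _; push_cast; ring

lemma ft_shift (g : ZMod P → ℝ) (b ξ : ZMod P) : ft (fun m => g (m + b)) ξ = ft g ξ * ZMod.stdAddChar (-(b * ξ)) := by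
  unfold ft
  rw [div_mul_eq_mul_div, ← Equiv.sum_comp (Equiv.subRight b), sum_mul]
  congr 1
  apply sum_congr rfl; intro m _
  simp only [Equiv.subRight_apply, sub_add_cancel]
  rw [sub_mul, sub_eq_add_neg, AddChar.map_add_eq_mul]; ring

lemma shift_energy (g : ZMod P → ℝ) (b : ZMod P) :
    (∑ m, (g (m + b) - g m) ^ 2) / P = ∑ ξ, ‖ft g ξ‖ ^ 2 * ‖(ZMod.stdAddChar (b * ξ) : ℂ) - 1‖ ^ 2 := by
  rw [parseval (fun m => g (m + b) - g m)]
  apply sum_congr rfl; intro ξ _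
  rw [ft_sub (fun m => g (m + b)) g, ft_shift, ← mul_sub_one, norm_mul, mul_pow]
  congr 2
  rw [chi_neg, ← map_one (starRingEnd ℂ), ← map_sub, RCLike.norm_conj, map_one]

lemma cv_upper (f ν ψ κ u : ZMod P → ℝ) (C0 ε : ℝ) (hfν : ∀ m, f m ≤ ν m)
    (hψ : ∀ m, ψ m ≤ C0) (hκ : ∀ m, 0 ≤ κ m) (hu : ∀ ξ, ft κ ξ = u ξ) (hu0 : ∀ ξ, 0 ≤ u ξ) (hu1 : u 0 = 1)
    (hε : ∀ ξ, ‖ft ν ξ - ft ψ ξ‖ ≤ ε) (m : ZMod P) : cv f κ m ≤ C0 + ε * ∑ ξ, u ξ := by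
  have hP := P_pos (P := P)
  have hκs : (∑ m, κ m) / P = 1 := by
    have h := hu 0
    unfold ft at h
    simp only [mul_zero, AddChar.map_zero_eq_one, mul_one, hu1] at h
    rw [← ofReal_sum] at h
    exact_mod_cast h
  have h1 : cv f κ m ≤ cv ν κ m := by
    unfold cv; gcongr with n _
    · exact hκ _
    · exact hfν n
  have h2 : cv ψ κ m ≤ C0 := by
    calc cv ψ κ m ≤ (∑ n, C0 * κ (m - n)) / P := by
          unfold cv; gcongr with n _
          · exact hκ _
          · exact hψ n
      _ = C0 * ((∑ m, κ m) / P) := by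
          rw [← mul_sum, mul_div_assoc, ← Equiv.sum_comp (Equiv.subLeft m) κ]; rfl
      _ = C0 := by rw [hκs, mul_one]
  have h3 : cv ν κ m - cv ψ κ m ≤ ε * ∑ ξ, u ξ := by
    refine (le_abs_self _).trans ?_
    rw [← norm_eq_abs, ← norm_real, ofReal_sub, ft_inv (cv ν κ) m, ft_inv (cv ψ κ) m, ← sum_sub_distrib, mul_sum]
    refine (norm_sum_le _ _).trans (sum_le_sum fun ξ _ => ?_)
    rw [ft_cv, ft_cv, ← sub_mul, ← sub_mul, norm_mul, norm_mul, chi_norm, mul_one, hu, norm_real,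
      norm_of_nonneg (hu0 ξ)]
    exact mul_le_mul_of_nonneg_right (hε ξ) (hu0 ξ)
  linarith

lemma prod_diff_le {ι : Type*} (S : Finset ι) (x y : ι → ℝ) (M : ℝ) (hM : 1 ≤ M) (hx0 : ∀ i, 0 ≤ x i) (hx : ∀ i, x i ≤ M)
    (hy0 : ∀ i, 0 ≤ y i) (hy : ∀ i, y i ≤ M) :
    |∏ i ∈ S, x i - ∏ i ∈ S, y i| ≤ M ^ S.card * ∑ i ∈ S, |x i - y i| := by
  classical
  induction S using Finset.induction_on with
  | empty => simp
  | insert i S hi ih =>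
    rw [prod_insert hi, prod_insert hi, sum_insert hi, card_insert_of_notMem hi]
    have h1 : ∏ j ∈ S, x j ≤ M ^ S.card := by
      rw [← prod_const]; exact prod_le_prod (fun j _ => hx0 j) (fun j _ => hx j)
    have h0 : 0 ≤ ∏ j ∈ S, x j := prod_nonneg (fun j _ => hx0 j)
    have hMp : (0:ℝ) < M ^ S.card := by positivity
    have e : x i * ∏ j ∈ S, x j - y i * ∏ j ∈ S, y j = (x i - y i) * ∏ j ∈ S, x j + y i * (∏ j ∈ S, x j - ∏ j ∈ S, y j) := by ring
    rw [e]
    calc _ ≤ |x i - y i| * ∏ j ∈ S, x j + y i * |∏ j ∈ S, x j - ∏ j ∈ S, y j| := by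
          refine (abs_add_le _ _).trans ?_
          rw [abs_mul, abs_mul, abs_of_nonneg h0, abs_of_nonneg (hy0 i)]
      _ ≤ |x i - y i| * M ^ (S.card + 1) + M * (M ^ S.card * ∑ j ∈ S, |x j - y j|) := by
          have h5 : M ^ S.card ≤ M ^ (S.card + 1) := pow_le_pow_right₀ hM (by omega)
          have h6 := sum_nonneg (fun j (_ : j ∈ S) => abs_nonneg (x j - y j))
          gcongr
          · exact h1.trans h5
          · exact hy i
      _ = _ := by ring

noncomputable def lam {s : ℕ} (a : Fin s → ZMod P) (f : ZMod P → ℝ) : ℝ :=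
  ∑ m ∈ (univ : Finset (Fin s → ZMod P)).filter (fun m => ∑ i, a i * m i = 0), ∏ i, f (m i)

lemma l1_le_l2 (x : ZMod P → ℝ) (η : ℝ) (hη : 0 ≤ η) (h : (∑ m, (x m) ^ 2) / P ≤ η ^ 2) : ∑ m, |x m| ≤ P * η := by
  have hP := P_pos (P := P)
  have h1 := sq_sum_le_card_mul_sum_sq (s := (univ : Finset (ZMod P))) (f := fun m => |x m|)
  simp only [sq_abs, card_univ, ZMod.card] at h1
  rw [div_le_iff₀ hP] at h
  have : (∑ m, |x m|) ^ 2 ≤ (P * η) ^ 2 := by nlinarith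
  exact (sq_le_sq₀ (sum_nonneg fun _ _ => abs_nonneg _) (by positivity)).1 this

lemma lambda_lower {s : ℕ} (a : Fin s → ZMod P) (ha : ∑ i, a i = 0) (g : ZMod P → ℝ) (M δ η : ℝ)
    (hM : 1 ≤ M) (hδ : 0 < δ) (hη : 0 ≤ η) (hg0 : ∀ m, 0 ≤ g m) (hgM : ∀ m, g m ≤ M) (hgδ : δ ≤ (∑ m, g m) / P)
    (hηs : s * M ^ s * η ≤ δ ^ s / 2) (B' B : Finset (ZMod P)) (hB : ∀ m ∈ B', ∀ n ∈ B', m - n ∈ B)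
    (hB2 : ∀ b ∈ B, (∑ m, (g (m + b) - g m) ^ 2) / P ≤ η ^ 2) :
    (B'.card : ℝ) ^ s * (δ ^ s / 2) ≤ P * lam a g := by
  classical
  have hP := P_pos (P := P)
  -- inner
  have inner : ∀ b : Fin s → ZMod P, (∀ i, b i ∈ B) → P * (δ ^ s / 2) ≤ ∑ m, ∏ i, g (m + b i) := by
    intro b hb
    have h1 : ∀ m, g m ^ s - M ^ s * ∑ i, |g (m + b i) - g m| ≤ ∏ i, g (m + b i) := by
      intro m
      have := prod_diff_le univ (fun i => g (m + b i)) (fun _ => g m) M hM (fun i => hg0 _) (fun i => hgM _) (fun i => hg0 _) (fun i => hgM _)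
      simp only [prod_const, card_univ, Fintype.card_fin] at this
      have := (abs_le.1 this).1
      linarith
    have h2 : ∑ m, (g m ^ s - M ^ s * ∑ i, |g (m + b i) - g m|) ≤ ∑ m, ∏ i, g (m + b i) := sum_le_sum fun m _ => h1 m
    rw [sum_sub_distrib, ← mul_sum, sum_comm] at h2
    have h3 : ∑ i, ∑ m, |g (m + b i) - g m| ≤ s * (P * η) := by
      calc _ ≤ ∑ i : Fin s, (P * η) := sum_le_sum fun i _ => l1_le_l2 (fun m => g (m + b i) - g m) η hη (hB2 _ (hb i))
        _ = _ := by simp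
    have h4 : P * δ ^ s ≤ ∑ m, g m ^ s := by
      have h5 := Real.pow_arith_mean_le_arith_mean_pow (univ : Finset (ZMod P)) (fun _ => (1:ℝ) / P) g (fun _ _ => by positivity)
        (by simp [ZMod.card, hP.ne']) (fun i _ => hg0 i) s
      rw [← mul_sum, ← mul_sum, one_div_mul_eq_div, one_div_mul_eq_div, le_div_iff₀ hP] at h5
      have h6 : δ ^ s ≤ ((∑ m, g m) / P) ^ s := pow_le_pow_left₀ hδ.le hgδ s
      nlinarith
    have hMs : (0:ℝ) < M ^ s := by positivity
    nlinarith [mul_le_mul_of_nonneg_left h3 hMs.le]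
  set Z := (univ : Finset (Fin s → ZMod P)).filter (fun m => ∑ i, a i * m i = 0) with hZ
  set 𝓑 := Z.filter (fun b => ∀ i, b i ∈ B) with h𝓑
  have hcard : B'.card ^ s ≤ 𝓑.card * P := by
    have h := card_le_mul_card_image_of_maps_to (s := Fintype.piFinset (fun _ : Fin s => B')) (t := (univ : Finset (ZMod P)))
      (f := fun m => ∑ i, a i * m i) (fun _ _ => mem_univ _) 𝓑.card ?_
    · simpa [ZMod.card] using h
    intro c _
    rcases ((Fintype.piFinset (fun _ : Fin s => B')).filter (fun m => ∑ i, a i * m i = c)).eq_empty_or_nonempty with h0 | ⟨m0, hm0⟩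
    · rw [h0]; simp
    rw [mem_filter, Fintype.mem_piFinset] at hm0
    apply card_le_card_of_injOn (fun m => m - m0)
    · intro m hm
      have hm' := mem_filter.1 (mem_coe.1 hm)
      rw [Fintype.mem_piFinset] at hm'
      rw [mem_coe, h𝓑, mem_filter, hZ, mem_filter]
      refine ⟨⟨mem_univ _, ?_⟩, fun i => hB _ (hm'.1 i) _ (hm0.1 i)⟩
      simp only [Pi.sub_apply, mul_sub, sum_sub_distrib]
      rw [hm'.2, hm0.2, sub_self]
    · intro x _ y _ hxy; simpa using hxy
  have hswap : ∑ b ∈ 𝓑, ∑ m, ∏ i, g (m + b i) ≤ P * lam a g := by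
    rw [sum_comm]
    have : ∀ m : ZMod P, ∑ b ∈ 𝓑, ∏ i, g (m + b i) ≤ lam a g := by
      intro m
      unfold lam
      rw [← hZ]
      have e : ∑ b ∈ 𝓑, ∏ i, g (m + b i) = ∑ x ∈ 𝓑.image (fun b i => m + b i), ∏ i, g (x i) := by
        rw [sum_image]
        intro x _ y _ hxy
        funext i
        simpa using congrFun hxy i
      rw [e]
      apply sum_le_sum_of_subset_of_nonneg
      · intro x hx
        obtain ⟨b, hb, rfl⟩ := mem_image.1 hx
        rw [h𝓑, mem_filter, hZ, mem_filter] at hb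
        rw [hZ, mem_filter]
        refine ⟨mem_univ _, ?_⟩
        simp only [mul_add, sum_add_distrib]
        rw [hb.1.2, ← sum_mul, ha, zero_mul, zero_add]
      · intro x _ _; exact prod_nonneg fun i _ => hg0 _
    calc _ ≤ ∑ m : ZMod P, lam a g := sum_le_sum fun m _ => this m
      _ = _ := by simp [ZMod.card]
  have hlow : (𝓑.card : ℝ) * (P * (δ ^ s / 2)) ≤ ∑ b ∈ 𝓑, ∑ m, ∏ i, g (m + b i) := by
    rw [← nsmul_eq_mul]
    apply card_nsmul_le_sum
    intro b hb
    exact inner b (mem_filter.1 hb).2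
  have hc' : (B'.card : ℝ) ^ s ≤ 𝓑.card * P := mod_cast hcard
  have := pow_pos hδ s
  nlinarith [mul_le_mul_of_nonneg_right hc' (by positivity : (0:ℝ) ≤ δ ^ s / 2)]

end trans

lemma prod_le_max_pow {s : ℕ} (x : Fin s → ℝ) (hx : ∀ i, 0 ≤ x i) (t C0 : ℝ) (ht : 0 < t) (hC : 1 ≤ C0)
    (hxC : ∀ i, x i ≤ C0) (v : ℝ) (hv0 : 0 ≤ v) (hv1 : v ≤ 1) (i : Fin s) (hv : t ≤ x i → v ≤ 4 * t) :
    (∏ j, x j) * v ≤ (4 * t * C0 + t ^ (1/4:ℝ)) * ∑ j, x j ^ ((s:ℝ) - 1/4) := by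
  have hs : 0 < s := i.pos
  obtain ⟨j0, -, hj0⟩ := exists_max_image (univ : Finset (Fin s)) x ⟨i, mem_univ i⟩
  set y := x j0 with hy
  have hy0 : 0 ≤ y := hx j0
  have hs1 : (1:ℝ) ≤ s := mod_cast hs
  have hsum : y ^ ((s:ℝ) - 1/4) ≤ ∑ j, x j ^ ((s:ℝ) - 1/4) :=
    single_le_sum (f := fun j => x j ^ ((s:ℝ) - 1/4)) (fun j _ => rpow_nonneg (hx j) _) (mem_univ j0)
  have hsum0 : 0 ≤ ∑ j, x j ^ ((s:ℝ) - 1/4) := sum_nonneg fun j _ => rpow_nonneg (hx j) _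
  have hp0 : 0 ≤ ∏ j, x j := prod_nonneg fun j _ => hx j
  have ht4 : 0 ≤ t ^ (1/4:ℝ) := by positivity
  by_cases h : t ≤ x i
  · have h1 : ∏ j, x j ≤ C0 * y ^ ((s:ℝ) - 1/4) := by
      calc ∏ j, x j ≤ ∏ j : Fin s, y := prod_le_prod (fun j _ => hx j) (fun j hj => hj0 j hj)
        _ = y ^ (s:ℝ) := by simp
        _ = y ^ (1/4:ℝ) * y ^ ((s:ℝ) - 1/4) := by
            rw [← Real.rpow_add_of_nonneg hy0 (by norm_num) (by linarith)]; congr 1; ring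
        _ ≤ _ := by
            gcongr
            calc y ^ (1/4:ℝ) ≤ C0 ^ (1/4:ℝ) := by gcongr; exact hxC j0
              _ ≤ C0 ^ (1:ℝ) := rpow_le_rpow_of_exponent_le hC (by norm_num)
              _ = C0 := rpow_one _
    calc (∏ j, x j) * v ≤ (C0 * ∑ j, x j ^ ((s:ℝ) - 1/4)) * (4 * t) := by
          apply mul_le_mul _ (hv h) hv0 (by positivity)
          exact h1.trans (by gcongr)
      _ ≤ _ := by nlinarith
  · push Not at h
    have h1 : ∏ j, x j ≤ t ^ (1/4:ℝ) * y ^ ((s:ℝ) - 1/4) := by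
      rw [← mul_prod_erase univ x (mem_univ i)]
      have h2 : ∏ j ∈ univ.erase i, x j ≤ y ^ ((s:ℝ) - 1) := by
        calc ∏ j ∈ univ.erase i, x j ≤ ∏ j ∈ univ.erase i, y := prod_le_prod (fun j _ => hx j) (fun j _ => hj0 j (mem_univ j))
          _ = y ^ ((s:ℝ) - 1) := by
            rw [prod_const, card_erase_of_mem (mem_univ i), card_univ, Fintype.card_fin, ← rpow_natCast, Nat.cast_sub hs, Nat.cast_one]
      have h3 : x i ≤ t ^ (1/4:ℝ) * y ^ (3/4:ℝ) := by
        calc x i = x i ^ (1/4:ℝ) * x i ^ (3/4:ℝ) := by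
              rw [← Real.rpow_add_of_nonneg (hx i) (by norm_num) (by norm_num)]; norm_num
          _ ≤ _ := by
              have := hx i
              gcongr
              exact hj0 i (mem_univ i)
      calc _ ≤ (t ^ (1/4:ℝ) * y ^ (3/4:ℝ)) * y ^ ((s:ℝ) - 1) :=
            mul_le_mul h3 h2 (prod_nonneg fun j _ => hx j) (by positivity)
        _ = _ := by
            rw [mul_assoc, ← Real.rpow_add_of_nonneg hy0 (by norm_num) (by linarith)]; congr 2; ring
    calc (∏ j, x j) * v ≤ (t ^ (1/4:ℝ) * ∑ j, x j ^ ((s:ℝ) - 1/4)) * 1 := by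
          apply mul_le_mul _ hv1 hv0 (by positivity)
          exact h1.trans (by gcongr)
      _ ≤ _ := by
          have : 0 ≤ 4 * t * C0 * ∑ j, x j ^ ((s:ℝ) - 1/4) := by positivity
          nlinarith

lemma norm_le_of_moment {α : Type*} [Fintype α] (F : α → ℂ) (s : ℕ) (hs : 2 ≤ s) (C0 : ℝ) (hC : 1 ≤ C0)
    (h : ∑ x, ‖F x‖ ^ ((s:ℝ) - 1/4) ≤ C0) (x : α) : ‖F x‖ ≤ C0 := by
  by_contra hx
  push Not at hx
  have h1 : ‖F x‖ ^ ((s:ℝ) - 1/4) ≤ C0 :=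
    (single_le_sum (f := fun x => ‖F x‖ ^ ((s:ℝ) - 1/4)) (fun j _ => rpow_nonneg (norm_nonneg _) _) (mem_univ x)).trans h
  have h2 : (2:ℝ) ≤ s := mod_cast hs
  have h3 : ‖F x‖ ^ (1:ℝ) ≤ ‖F x‖ ^ ((s:ℝ) - 1/4) := rpow_le_rpow_of_exponent_le (by linarith) (by linarith)
  rw [rpow_one] at h3
  linarith

lemma lam_compare {P : ℕ} [hP : Fact P.Prime] {s : ℕ} (hs : 2 ≤ s) (a : Fin s → ZMod P) (ha : ∀ i, a i ≠ 0)
    (f g u : ZMod P → ℝ) (C0 t : ℝ) (hC : 1 ≤ C0) (ht : 0 < t) (hu0 : ∀ ξ, 0 ≤ u ξ) (hu1 : ∀ ξ, u ξ ≤ 1)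
    (hg : ∀ ξ, ft g ξ = ft f ξ * u ξ) (hmom : ∑ ξ, ‖ft f ξ‖ ^ ((s:ℝ) - 1/4) ≤ C0)
    (hut : ∀ ξ, t ≤ ‖ft f ξ‖ → 1 - u ξ ≤ 4 * t) :
    |lam a f - lam a g| * P ≤ (P:ℝ) ^ s * (s ^ 2 * (4 * t * C0 + t ^ (1/4:ℝ)) * C0) := by
  have h1 : ((lam a f - lam a g : ℝ) : ℂ) * P = (P:ℂ) ^ s * ∑ ξ, (∏ i, ft f (a i * ξ)) * ((1 - ∏ i, u (a i * ξ) : ℝ) : ℂ) := by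
    have e1 := count_fourier a f
    have e2 := count_fourier a g
    unfold lam
    rw [ofReal_sub, sub_mul, e1, e2, ← mul_sub, ← sum_sub_distrib]
    congr 1
    apply sum_congr rfl; intro ξ _
    simp only [hg, prod_mul_distrib]
    push_cast; ring
  have h2 : |lam a f - lam a g| * P = ‖((lam a f - lam a g : ℝ) : ℂ) * P‖ := by
    rw [norm_mul, norm_real, Complex.norm_natCast, norm_eq_abs]
  rw [h2, h1, norm_mul, norm_pow, Complex.norm_natCast]
  gcongr
  have hS := norm_le_of_moment (ft f) s hs C0 hC hmom
  set A := (4 * t * C0 + t ^ (1/4:ℝ)) with hA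
  have hA0 : 0 ≤ A := by positivity
  calc ‖∑ ξ, (∏ i, ft f (a i * ξ)) * ((1 - ∏ i, u (a i * ξ) : ℝ) : ℂ)‖
      ≤ ∑ ξ, ∑ i : Fin s, (A * ∑ j, ‖ft f (a j * ξ)‖ ^ ((s:ℝ) - 1/4)) := by
        refine (norm_sum_le _ _).trans (sum_le_sum fun ξ _ => ?_)
        rw [norm_mul, norm_prod, norm_real, norm_eq_abs]
        have h3 : ∏ i, u (a i * ξ) ≤ 1 := prod_le_one (fun i _ => hu0 _) (fun i _ => hu1 _)
        rw [abs_of_nonneg (by linarith)]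
        have h4 : 1 - ∏ i, u (a i * ξ) ≤ ∑ i, (1 - u (a i * ξ)) := by
          have key : ∀ S : Finset (Fin s), 1 - ∏ i ∈ S, u (a i * ξ) ≤ ∑ i ∈ S, (1 - u (a i * ξ)) := by
            intro S
            classical
            induction S using Finset.induction_on with
            | empty => simp
            | insert i S hi ih =>
              rw [prod_insert hi, sum_insert hi]
              have h2 : ∏ i ∈ S, u (a i * ξ) ≤ 1 := prod_le_one (fun i _ => hu0 _) (fun i _ => hu1 _)
              have h3 : 0 ≤ ∏ i ∈ S, u (a i * ξ) := prod_nonneg (fun i _ => hu0 _)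
              nlinarith [hu0 (a i * ξ), hu1 (a i * ξ)]
          exact key univ
        calc _ ≤ (∏ i, ‖ft f (a i * ξ)‖) * ∑ i, (1 - u (a i * ξ)) := by gcongr
          _ = ∑ i, (∏ i, ‖ft f (a i * ξ)‖) * (1 - u (a i * ξ)) := by rw [mul_sum]
          _ ≤ _ := by
            apply sum_le_sum; intro i _
            exact prod_le_max_pow (fun j => ‖ft f (a j * ξ)‖) (fun j => norm_nonneg _) t C0 ht hC (fun j => hS _)
              (1 - u (a i * ξ)) (by linarith [hu1 (a i * ξ)]) (by linarith [hu0 (a i * ξ)]) i (hut _)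
    _ = s * (A * ∑ j, ∑ ξ, ‖ft f (a j * ξ)‖ ^ ((s:ℝ) - 1/4)) := by
        rw [sum_comm (s := (univ : Finset (Fin s))) (t := (univ : Finset (ZMod P))), mul_sum, mul_sum]
        apply sum_congr rfl; intro ξ _
        rw [sum_const, nsmul_eq_mul]; simp
    _ ≤ s * (A * ∑ j : Fin s, C0) := by
        gcongr with j _
        exact (Equiv.sum_comp (Equiv.mulLeft₀ (a j) (ha j)) (fun ξ => ‖ft f ξ‖ ^ ((s:ℝ) - 1/4))).le.trans hmom
    _ = _ := by simp; ring

/-- choice of parameters -/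
lemma trans_params (s : ℕ) (δ C0 ε0 : ℝ) (hδ : 0 < δ) (hC : 1 ≤ C0) (hε0 : 0 < ε0) (b : ℝ) (hb : 0 < b) :
    ∃ t0 : ℝ, 0 < t0 ∧ ∀ t, 0 < t → t ≤ t0 → 4 * t ^ 2 / b + t ^ 2 * (C0 + 1) ^ 2 ≤ ε0 ∧
      s ^ 2 * (4 * t * C0 + t ^ (1/4:ℝ)) * C0 ≤ b ^ s * (δ ^ s / 4) := by
  have h1 : Tendsto (fun t : ℝ => 4 * t ^ 2 / b + t ^ 2 * (C0 + 1) ^ 2) (nhds 0) (nhds (4 * 0 ^ 2 / b + 0 ^ 2 * (C0 + 1) ^ 2)) := by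
    apply Continuous.tendsto
    fun_prop
  have h2 : Tendsto (fun t : ℝ => s ^ 2 * (4 * t * C0 + t ^ (1/4:ℝ)) * C0) (nhds 0) (nhds (s ^ 2 * (4 * 0 * C0 + 0 ^ (1/4:ℝ)) * C0)) := by
    apply Continuous.tendsto
    have : Continuous (fun t : ℝ => t ^ (1/4:ℝ)) := Real.continuous_rpow_const (by norm_num)
    fun_prop
  have e1 := h1.eventually_lt_const (u := ε0) (by norm_num; exact hε0)
  have e2 := h2.eventually_lt_const (u := b ^ s * (δ ^ s / 4)) (by
    rw [Real.zero_rpow (by norm_num)]; simp only [mul_zero, zero_mul, add_zero]; positivity)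
  obtain ⟨r, hr, hball⟩ := Metric.eventually_nhds_iff.1 (e1.and e2)
  refine ⟨r / 2, by positivity, fun t ht htr => ?_⟩
  have := hball (y := t) (by rw [dist_zero_right, norm_of_nonneg ht.le]; linarith)
  exact ⟨this.1.le, this.2.le⟩

/-- lower bound for the density of a Bohr set -/
noncomputable def bb (s : ℕ) (C0 t : ℝ) : ℝ := 1 / ((⌈4 * π / t⌉₊ : ℝ) ^ ⌈C0 / t ^ s⌉₊)

lemma bb_pos (s : ℕ) (C0 t : ℝ) (ht : 0 < t) : 0 < bb s C0 t := by
  unfold bb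
  have : 0 < ⌈4 * π / t⌉₊ := Nat.ceil_pos.2 (by positivity)
  positivity

section
variable {P : ℕ} [NeZero P]

noncomputable def spec (f : ZMod P → ℝ) (t : ℝ) : Finset (ZMod P) :=
  open Classical in univ.filter (fun ξ => t ≤ ‖ft f ξ‖)

lemma mem_spec {f : ZMod P → ℝ} {t : ℝ} {ξ : ZMod P} : ξ ∈ spec f t ↔ t ≤ ‖ft f ξ‖ := by
  classical
  unfold spec; simp

lemma bohr_spec_card (s : ℕ) (hs : 1 ≤ s) (f : ZMod P → ℝ) (C0 t : ℝ) (ht : 0 < t) (ht1 : t ≤ 1)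
    (hmom : ∑ ξ, ‖ft f ξ‖ ^ ((s:ℝ) - 1/4) ≤ C0) : bb s C0 t * P ≤ (bohr (spec f t) (t / 2)).card := by
  have hK : 0 < ⌈4 * π / t⌉₊ := Nat.ceil_pos.2 (by positivity)
  have hs1 : (1:ℝ) ≤ s := mod_cast hs
  have hcard : (spec f t).card ≤ ⌈C0 / t ^ s⌉₊ := by
    have h1 : ((spec f t).card : ℝ) * t ^ s ≤ C0 := by
      calc ((spec f t).card : ℝ) * t ^ s ≤ ∑ ξ ∈ spec f t, ‖ft f ξ‖ ^ ((s:ℝ) - 1/4) := by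
            rw [← nsmul_eq_mul]
            apply card_nsmul_le_sum
            intro ξ hξ
            calc t ^ s = t ^ (s:ℝ) := (rpow_natCast _ _).symm
              _ ≤ t ^ ((s:ℝ) - 1/4) := Real.rpow_le_rpow_of_exponent_ge ht ht1 (by linarith)
              _ ≤ _ := rpow_le_rpow ht.le (mem_spec.1 hξ) (by linarith)
        _ ≤ _ := sum_le_sum_of_subset_of_nonneg (subset_univ _) (fun _ _ _ => rpow_nonneg (norm_nonneg _) _)
        _ ≤ C0 := hmom
    rw [← le_div_iff₀ (by positivity)] at h1
    exact_mod_cast h1.trans (le_ceil _)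
  have h := bohr_card (spec f t) (t / 2) ⌈4 * π / t⌉₊ hK (by
    rw [div_le_iff₀ (mod_cast hK)]
    have := le_ceil (4 * π / t)
    rw [div_le_iff₀ ht] at this
    nlinarith)
  have h2 : P ≤ (bohr (spec f t) (t / 2)).card * ⌈4 * π / t⌉₊ ^ ⌈C0 / t ^ s⌉₊ :=
    h.trans (Nat.mul_le_mul_left _ (Nat.pow_le_pow_right hK hcard))
  unfold bb
  rw [div_mul_eq_mul_div, one_mul, div_le_iff₀ (by positivity)]
  exact_mod_cast h2
end

lemma sum_halving (t : ℕ → ℝ) (h0 : ∀ i, 0 ≤ t i) (h : ∀ i, t (i+1) ≤ t i / 2) (k n : ℕ) (hkn : k ≤ n) :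
    ∑ i ∈ Ico k n, t i ≤ 2 * t k - 2 * t n := by
  induction n, hkn using Nat.le_induction with
  | base => simp
  | succ n hn ih => rw [sum_Ico_succ_top hn]; linarith [h n]

theorem transference (s : ℕ) (hs : 2 ≤ s) (δ C0 : ℝ) (hδ : 0 < δ) (hC : 1 ≤ C0) :
    ∃ ε > (0:ℝ), ∃ c > (0:ℝ), ∀ (P : ℕ) [Fact P.Prime] (a : Fin s → ZMod P), (∀ i, a i ≠ 0) → ∑ i, a i = 0 →
      ∀ f ν ψ : ZMod P → ℝ, (∀ m, 0 ≤ f m) → (∀ m, f m ≤ ν m) → δ ≤ (∑ m, f m) / P → (∀ m, ψ m ≤ C0) →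
      (∀ ξ, ‖ft ν ξ - ft ψ ξ‖ ≤ ε) → ∑ ξ, ‖ft f ξ‖ ^ ((s:ℝ) - 1/4) ≤ C0 → c * (P:ℝ) ^ s ≤ P * lam a f := by
  set M := C0 + 1 with hM
  have hM1 : 1 ≤ M := by linarith
  have hs0 : (0:ℝ) < s := mod_cast (by omega : 0 < s)
  set e0 : ℝ := δ ^ s / (6 * s * M ^ s) with he0
  have he0p : 0 < e0 := by positivity
  set J : ℕ := ⌈M ^ 2 / e0 ^ 2⌉₊ + 1 with hJ
  have hJp : 0 < J := by omega
  set L := 2 * J with hL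
  choose t0 ht0 ht0' using trans_params s δ C0 (e0 ^ 2) hδ hC (by positivity)
  -- sequence of positive parameters
  let tt : ℕ → {t : ℝ // 0 < t} := fun n => Nat.rec ⟨1, one_pos⟩
    (fun _ t => ⟨min (t.1 / 2) (t0 (bb s C0 t.1) (bb_pos s C0 t.1 t.2)), lt_min (half_pos t.2) (ht0 _ _)⟩) n
  set t : ℕ → ℝ := fun n => (tt n).1 with ht
  have htp : ∀ i, 0 < t i := fun i => (tt i).2
  have hthalf : ∀ i, t (i+1) ≤ t i / 2 := fun i => min_le_left _ _
  have htt0 : ∀ i, t (i+1) ≤ t0 (bb s C0 (t i)) (bb_pos s C0 (t i) (htp i)) := fun i => min_le_right _ _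
  have htanti : Antitone t := antitone_nat_of_succ_le fun i => (hthalf i).trans (by linarith [htp i])
  have ht1 : ∀ i, t i ≤ 1 := fun i => htanti (Nat.zero_le i)
  clear_value t
  set b : ℕ → ℝ := fun i => bb s C0 (t i) with hb
  have hbp : ∀ i, 0 < b i := fun i => bb_pos s C0 (t i) (htp i)
  obtain ⟨c, hc, hcb⟩ : ∃ c > 0, ∀ i ∈ range (L+1), c ≤ b i ^ s * (δ ^ s / 4) := by
    obtain ⟨i0, -, hi0⟩ := exists_min_image (range (L+1)) (fun i => b i ^ s * (δ ^ s / 4)) ⟨0, by simp⟩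
    exact ⟨_, by have := hbp i0; positivity, hi0⟩
  refine ⟨b L, hbp L, c, hc, ?_⟩
  intro P hPp a ha hasum f ν ψ hf0 hfν hfδ hψ hε hmom
  have hP := P_pos (P := P)
  have hbohr : ∀ i, b i * P ≤ (bohr (spec f (t i)) (t i / 2)).card := fun i =>
    bohr_spec_card s (by omega) f C0 (t i) (htp i) (ht1 i) hmom
  choose σ h hσ hft hh0 hh1 hhz hhΓ hhsum using fun i => sigma_exists (spec f (t i)) (t i) (htp i).le
  have hhsum' : ∀ i, ∑ ξ, h i ξ ≤ 1 / b i := by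
    intro i
    refine (hhsum i).trans ?_
    have h1 : ((bohr (spec f (t i)) (t i / 2)).card : ℝ) ≤ (bohr (spec f (t i)) (t i)).card := by
      exact_mod_cast card_le_card (bohr_mono (Subset.refl _) (by linarith [htp i]))
    have h2 := hbohr i
    have hbp' := hbp i
    have hpos : (0:ℝ) < (bohr (spec f (t i)) (t i)).card := lt_of_lt_of_le (by positivity) (h2.trans h1)
    rw [div_le_div_iff₀ hpos hbp', one_mul, mul_comm]
    linarith
  choose κ hκ hκft using fun k => kappa_exists σ h hσ hft (Ico k (L+1))
  set u : ℕ → ZMod P → ℝ := fun k ξ => ∏ i ∈ Ico k (L+1), h i ξ with hu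
  have hu0 : ∀ k ξ, 0 ≤ u k ξ := fun k ξ => prod_nonneg fun i _ => hh0 i ξ
  have hu1 : ∀ k ξ, u k ξ ≤ 1 := fun k ξ => prod_le_one (fun i _ => hh0 i ξ) (fun i _ => hh1 i ξ)
  have husucc : ∀ k ξ, k ≤ L → u k ξ = h k ξ * u (k+1) ξ := by
    intro k ξ hk
    simp only [hu]
    rw [prod_eq_prod_Ico_succ_bot (by omega)]
  have hule : ∀ k ξ, k ≤ L → u k ξ ≤ h k ξ := by
    intro k ξ hk
    rw [husucc k ξ hk]
    exact mul_le_of_le_one_right (hh0 k ξ) (hu1 _ ξ)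
  have hule2 : ∀ k ξ, k ≤ L → u k ξ ≤ u (k+1) ξ := by
    intro k ξ hk
    rw [husucc k ξ hk]
    exact mul_le_of_le_one_left (hu0 _ ξ) (hh1 k ξ)
  have huL : ∀ k ξ, k ≤ L → u k ξ ≤ h L ξ := by
    intro k ξ hk
    simp only [hu]
    rw [prod_Ico_succ_top hk]
    exact mul_le_of_le_one_left (hh0 L ξ) (prod_le_one (fun i _ => hh0 i ξ) (fun i _ => hh1 i ξ))
  set g : ℕ → ZMod P → ℝ := fun k => cv f (κ k) with hg
  have hgft : ∀ k ξ, ft (g k) ξ = ft f ξ * u k ξ := fun k ξ => by simp only [hg]; rw [ft_cv, hκft]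
  have hg0 : ∀ k m, 0 ≤ g k m := fun k m => cv_nonneg hf0 (hκ k) m
  have huz : ∀ k, u k 0 = 1 := fun k => prod_eq_one fun i _ => hhz i
  have hgM : ∀ k, k ≤ L → ∀ m, g k m ≤ M := by
    intro k hk m
    refine (cv_upper f ν ψ (κ k) (u k) C0 (b L) hfν hψ (hκ k) (hκft k) (hu0 k) (huz k) hε m).trans ?_
    have h1 : ∑ ξ, u k ξ ≤ 1 / b L := (sum_le_sum fun ξ _ => huL k ξ hk).trans (hhsum' L)
    have h2 : b L * ∑ ξ, u k ξ ≤ 1 := by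
      have := mul_le_mul_of_nonneg_left h1 (hbp L).le
      rwa [mul_one_div_cancel (hbp L).ne'] at this
    linarith
  have hgδ : ∀ k, δ ≤ (∑ m, g k m) / P := by
    intro k
    have h1 := hgft k 0
    rw [huz k] at h1
    unfold ft at h1
    simp only [mul_zero, AddChar.map_zero_eq_one, mul_one, Complex.ofReal_one] at h1
    rw [← ofReal_sum, ← ofReal_sum] at h1
    have h2 : (∑ m, g k m) / P = (∑ m, f m) / P := mod_cast h1
    rw [h2]; exact hfδ
  set E : ℕ → ℝ := fun k => ∑ ξ, ‖ft f ξ‖ ^ 2 * u k ξ ^ 2 with hE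
  have hEg : ∀ k, E k = (∑ m, g k m ^ 2) / P := by
    intro k
    rw [parseval]
    apply sum_congr rfl; intro ξ _
    rw [hgft, norm_mul, norm_real, norm_of_nonneg (hu0 k ξ), mul_pow]
  have hE0 : ∀ k, 0 ≤ E k := fun k => sum_nonneg fun ξ _ => by positivity
  have hEM : ∀ k, k ≤ L → E k ≤ M ^ 2 := by
    intro k hk
    rw [hEg, div_le_iff₀ hP]
    calc ∑ m, g k m ^ 2 ≤ ∑ m : ZMod P, M ^ 2 := sum_le_sum fun m _ => pow_le_pow_left₀ (hg0 k m) (hgM k hk m) 2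
      _ = _ := by simp [ZMod.card]; ring
  -- pigeonhole
  obtain ⟨j, hj, hjE⟩ : ∃ j ∈ range J, E (2 * (j+1)) - E (2 * j) ≤ e0 ^ 2 := by
    apply exists_le_of_sum_le ⟨0, mem_range.2 hJp⟩
    rw [sum_range_sub (fun j => E (2 * j)), sum_const, card_range, nsmul_eq_mul]
    have h1 := hEM (2 * J) le_rfl
    have h2 := hE0 (2 * 0)
    have h3 : M ^ 2 / e0 ^ 2 ≤ J := (le_ceil _).trans (by rw [hJ]; push_cast; linarith)
    rw [div_le_iff₀ (by positivity)] at h3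
    linarith
  rw [mem_range] at hj
  set k := 2 * j with hk
  have hkL : k + 2 ≤ L := by omega
  rw [show 2 * (j + 1) = k + 2 by omega] at hjE
  -- g_{k+2} - g_k
  have hdiff : (∑ m, (g (k+2) m - g k m) ^ 2) / P ≤ e0 ^ 2 := by
    rw [parseval (fun m => g (k+2) m - g k m)]
    refine le_trans ?_ hjE
    simp only [hE]
    rw [← sum_sub_distrib]
    apply sum_le_sum; intro ξ _
    rw [ft_sub (g (k+2)) (g k), hgft, hgft, ← mul_sub, norm_mul, mul_pow, ← ofReal_sub, norm_real, norm_eq_abs, sq_abs, ← mul_sub]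
    apply mul_le_mul_of_nonneg_left _ (by positivity)
    have h1 := (hule2 k ξ (by omega)).trans (hule2 (k+1) ξ (by omega))
    nlinarith [hu0 k ξ]
  -- shifts of g_k
  have hshift : ∀ β ∈ bohr (spec f (t (k+1))) (t (k+1)), (∑ m, (g k (m + β) - g k m) ^ 2) / P ≤ e0 ^ 2 := by
    intro β hβ
    rw [shift_energy]
    have hpar := (ht0' _ (hbp k) (t (k+1)) (htp _) (htt0 k)).1
    have hsplit : ∀ ξ, ‖ft (g k) ξ‖ ^ 2 * ‖(ZMod.stdAddChar (β * ξ) : ℂ) - 1‖ ^ 2 ≤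
        4 * t (k+1) ^ 2 * h k ξ + t (k+1) ^ 2 * (‖ft f ξ‖ ^ 2 * u k ξ ^ 2) := by
      intro ξ
      rw [hgft, norm_mul, norm_real, norm_of_nonneg (hu0 k ξ), mul_pow]
      have h0 := hh0 k ξ
      by_cases hξ : ξ ∈ spec f (t (k+1))
      · have h1 := mem_bohr.1 hβ ξ hξ
        have h2 : ‖(ZMod.stdAddChar (β * ξ) : ℂ) - 1‖ ^ 2 ≤ t (k+1) ^ 2 := pow_le_pow_left₀ (norm_nonneg _) h1 2
        have h3 : 0 ≤ 4 * t (k+1) ^ 2 * h k ξ := by positivity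
        have h4 : 0 ≤ ‖ft f ξ‖ ^ 2 * u k ξ ^ 2 := by positivity
        nlinarith
      · rw [mem_spec, not_le] at hξ
        have h1 : ‖(ZMod.stdAddChar (β * ξ) : ℂ) - 1‖ ≤ 2 := by
          refine (norm_sub_le _ _).trans ?_
          rw [chi_norm, norm_one]; norm_num
        have h2 : ‖(ZMod.stdAddChar (β * ξ) : ℂ) - 1‖ ^ 2 ≤ 4 := by
          calc _ ≤ (2:ℝ) ^ 2 := pow_le_pow_left₀ (norm_nonneg _) h1 2
            _ = 4 := by norm_num
        have h3 : ‖ft f ξ‖ ^ 2 ≤ t (k+1) ^ 2 := pow_le_pow_left₀ (norm_nonneg _) hξ.le 2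
        have h4 : u k ξ ^ 2 ≤ h k ξ := by
          calc u k ξ ^ 2 ≤ u k ξ * 1 := by rw [sq]; exact mul_le_mul_of_nonneg_left (hu1 k ξ) (hu0 k ξ)
            _ ≤ h k ξ := by rw [mul_one]; exact hule k ξ (by omega)
        have h5 : 0 ≤ t (k+1) ^ 2 * (‖ft f ξ‖ ^ 2 * u k ξ ^ 2) := by positivity
        calc ‖ft f ξ‖ ^ 2 * u k ξ ^ 2 * ‖(ZMod.stdAddChar (β * ξ) : ℂ) - 1‖ ^ 2
            ≤ t (k+1) ^ 2 * h k ξ * 4 := by gcongr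
          _ ≤ _ := by linarith
    refine (sum_le_sum fun ξ _ => hsplit ξ).trans ?_
    rw [sum_add_distrib, ← mul_sum, ← mul_sum]
    refine le_trans ?_ hpar
    have h1 := hhsum' k
    have h2 := hEM k (by omega)
    have h3 : 4 * t (k+1) ^ 2 / bb s C0 (t k) = 4 * t (k+1) ^ 2 * (1 / b k) := by rw [mul_one_div]
    rw [h3]
    gcongr
  -- shifts of g_{k+2}
  have hshift2 : ∀ β ∈ bohr (spec f (t (k+1))) (t (k+1)), (∑ m, (g (k+2) (m + β) - g (k+2) m) ^ 2) / P ≤ (3 * e0) ^ 2 := by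
    intro β hβ
    have h1 := hshift β hβ
    have h2 : (∑ m, (g (k+2) (m + β) - g k (m + β)) ^ 2) / P ≤ e0 ^ 2 := by
      have := Equiv.sum_comp (Equiv.addRight β) (fun m => (g (k+2) m - g k m) ^ 2)
      simp only [Equiv.coe_addRight] at this
      rw [this]; exact hdiff
    have h3 : ∑ m, (g (k+2) (m + β) - g (k+2) m) ^ 2 ≤ ∑ m, (3 * (g (k+2) (m + β) - g k (m + β)) ^ 2 + 3 * (g k (m + β) - g k m) ^ 2
        + 3 * (g (k+2) m - g k m) ^ 2) := by
      apply sum_le_sum; intro m _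
      set x := g (k+2) (m + β) - g k (m + β)
      set y := g k (m + β) - g k m
      set z := g (k+2) m - g k m
      have : g (k+2) (m + β) - g (k+2) m = x + y - z := by simp only [x, y, z]; ring
      rw [this]
      nlinarith [sq_nonneg (x - y), sq_nonneg (x + z), sq_nonneg (y + z)]
    rw [sum_add_distrib, sum_add_distrib, ← mul_sum, ← mul_sum, ← mul_sum] at h3
    rw [div_le_iff₀ hP] at *
    linarith
  have hlow := lambda_lower a hasum (g (k+2)) M δ (3 * e0) hM1 hδ (by positivity) (hg0 _) (hgM _ hkL) (hgδ _)
    (by rw [he0]; apply le_of_eq; field_simp; ring) (bohr (spec f (t (k+1))) (t (k+1) / 2)) (bohr (spec f (t (k+1))) (t (k+1)))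
    (fun m hm n hn => bohr_sub hm hn) hshift2
  have hcmp := lam_compare hs a ha f (g (k+2)) (u (k+2)) C0 (t (k+2)) hC (htp _) (hu0 _) (hu1 _) (hgft _) hmom (by
    intro ξ hξ
    refine (one_sub_prod_le _ (fun i => h i ξ) (fun i => hh0 i ξ) (fun i => hh1 i ξ)).trans ?_
    calc ∑ i ∈ Ico (k+2) (L+1), (1 - h i ξ) ≤ ∑ i ∈ Ico (k+2) (L+1), 2 * t i := by
          apply sum_le_sum; intro i hi
          have := hhΓ i ξ (mem_spec.2 ((htanti (mem_Ico.1 hi).1).trans hξ))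
          linarith
      _ = 2 * ∑ i ∈ Ico (k+2) (L+1), t i := by rw [mul_sum]
      _ ≤ 2 * (2 * t (k+2) - 2 * t (L+1)) := by
          gcongr; exact sum_halving t (fun i => (htp i).le) hthalf _ _ (by omega)
      _ ≤ 4 * t (k+2) := by linarith [htp (L+1)])
  have hpar := (ht0' _ (hbp (k+1)) (t (k+2)) (htp _) (htt0 (k+1))).2
  have hcb' := hcb (k+1) (mem_range.2 (by omega))
  have hB1 : (b (k+1) * P) ^ s ≤ ((bohr (spec f (t (k+1))) (t (k+1) / 2)).card : ℝ) ^ s :=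
    pow_le_pow_left₀ (mul_nonneg (hbp _).le hP.le) (hbohr (k+1)) s
  have hPs : (0:ℝ) < (P:ℝ) ^ s := by positivity
  have h1 : (b (k+1) * P) ^ s * (δ ^ s / 2) ≤ P * lam a (g (k+2)) :=
    (mul_le_mul_of_nonneg_right hB1 (by positivity)).trans hlow
  rw [mul_pow] at h1
  have h2 : |lam a f - lam a (g (k+2))| * P ≤ (P:ℝ) ^ s * (b (k+1) ^ s * (δ ^ s / 4)) :=
    hcmp.trans (mul_le_mul_of_nonneg_left hpar hPs.le)
  have h3 := mul_le_mul_of_nonneg_right (neg_abs_le (lam a f - lam a (g (k+2)))) hP.le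
  have h4 := mul_le_mul_of_nonneg_right hcb' hPs.le
  nlinarith

section restr
variable {P : ℕ} [NeZero P]

lemma chi_sub (x y : ZMod P) : (ZMod.stdAddChar (x - y) : ℂ) = ZMod.stdAddChar x * conj (ZMod.stdAddChar y : ℂ) := by
  rw [sub_eq_add_neg, AddChar.map_add_eq_mul, chi_neg]

lemma norm_sq_eq (z : ℂ) : ((‖z‖ ^ 2 : ℝ) : ℂ) = z * conj z := by
  rw [Complex.mul_conj']; push_cast; rfl

lemma dual_bound (f ν : ZMod P → ℝ) (hf : ∀ m, 0 ≤ f m) (hfν : ∀ m, f m ≤ ν m) (Ξ : Finset (ZMod P)) (η : ℝ) (hη : 0 ≤ η)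
    (hΞ : ∀ ξ ∈ Ξ, η ≤ ‖ft f ξ‖) :
    (η * Ξ.card) ^ 2 ≤ ((∑ m, ν m) / P) * ∑ ξ ∈ Ξ, ∑ ξ' ∈ Ξ, ‖ft ν (ξ - ξ')‖ := by
  have hν : ∀ m, 0 ≤ ν m := fun m => (hf m).trans (hfν m)
  have hP := P_pos (P := P)
  have hc : ∀ z : ℂ, ∃ c : ℂ, ‖c‖ ≤ 1 ∧ c * z = (‖z‖ : ℂ) := by
    intro z
    by_cases hz : z = 0
    · exact ⟨0, by simp, by simp [hz]⟩
    · refine ⟨conj z / ‖z‖, ?_, ?_⟩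
      · rw [norm_div, norm_real, norm_norm, RCLike.norm_conj]; exact div_self_le_one _
      · rw [div_mul_eq_mul_div, mul_comm, Complex.mul_conj', sq, mul_div_assoc, div_self (by simpa using hz), mul_one]
  choose c hc1 hc2 using hc
  set C : ZMod P → ℂ := fun ξ => c (ft f ξ) with hC
  set g : ZMod P → ℂ := fun m => ∑ ξ ∈ Ξ, C ξ * ZMod.stdAddChar (m * ξ) with hg
  have h1 : ((∑ ξ ∈ Ξ, ‖ft f ξ‖ : ℝ) : ℂ) = (∑ m, (f m : ℂ) * g m) / P := by
    push_cast
    simp only [← hc2]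
    simp only [hg, mul_sum]
    rw [sum_comm, sum_div]
    refine sum_congr rfl fun ξ _ => ?_
    simp only [hC]
    conv_lhs => rw [show ft f ξ = (∑ m, (f m : ℂ) * ZMod.stdAddChar (m * ξ)) / P from rfl]
    rw [← mul_div_assoc, mul_sum]
    congr 1
    refine sum_congr rfl fun m _ => ?_
    simp only [ft]; ring
  have h2 : η * Ξ.card ≤ (∑ m, ν m * ‖g m‖) / P := by
    have a1 : η * Ξ.card ≤ ∑ ξ ∈ Ξ, ‖ft f ξ‖ := by
      rw [mul_comm, ← nsmul_eq_mul]; exact card_nsmul_le_sum _ _ _ hΞ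
    have a2 : (∑ ξ ∈ Ξ, ‖ft f ξ‖) = ‖((∑ ξ ∈ Ξ, ‖ft f ξ‖ : ℝ) : ℂ)‖ := by
      rw [norm_real, norm_of_nonneg]; positivity
    rw [a2, h1, norm_div, Complex.norm_natCast] at a1
    refine a1.trans ?_
    gcongr
    refine (norm_sum_le _ _).trans (sum_le_sum fun m _ => ?_)
    rw [norm_mul, norm_real, norm_of_nonneg (hf m)]
    gcongr; exact hfν m
  have h3 : (∑ m, ν m * ‖g m‖) ^ 2 ≤ (∑ m, ν m) * ∑ m, ν m * ‖g m‖ ^ 2 := by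
    refine sum_sq_le_sum_mul_sum_of_sq_le_mul _ (fun m _ => hν m) (fun m _ => mul_nonneg (hν m) (by positivity)) fun m _ => ?_
    apply le_of_eq; ring
  have h4 : ∑ m, ν m * ‖g m‖ ^ 2 ≤ P * ∑ ξ ∈ Ξ, ∑ ξ' ∈ Ξ, ‖ft ν (ξ - ξ')‖ := by
    have e : ((∑ m, ν m * ‖g m‖ ^ 2 : ℝ) : ℂ) = P * ∑ ξ ∈ Ξ, ∑ ξ' ∈ Ξ, C ξ * conj (C ξ') * ft ν (ξ - ξ') := by
      rw [ofReal_sum]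
      simp only [ofReal_mul, norm_sq_eq]
      simp only [hg, map_sum, sum_mul_sum]
      simp only [mul_sum]
      rw [sum_comm]
      refine sum_congr rfl fun ξ _ => ?_
      rw [sum_comm]
      refine sum_congr rfl fun ξ' _ => ?_
      unfold ft
      have hP' := P_ne (P := P)
      field_simp
      rw [mul_sum]
      refine sum_congr rfl fun m _ => ?_
      rw [mul_sub, chi_sub, map_mul (starRingEnd ℂ)]; ring
    have e2 : (∑ m, ν m * ‖g m‖ ^ 2) = ‖((∑ m, ν m * ‖g m‖ ^ 2 : ℝ) : ℂ)‖ := by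
      rw [norm_real, norm_of_nonneg]
      exact sum_nonneg fun m _ => mul_nonneg (hν m) (by positivity)
    rw [e2, e, norm_mul, Complex.norm_natCast]
    gcongr
    refine (norm_sum_le _ _).trans (sum_le_sum fun ξ _ => (norm_sum_le _ _).trans (sum_le_sum fun ξ' _ => ?_))
    rw [norm_mul, norm_mul, RCLike.norm_conj]
    have b1 := hc1 (ft f ξ)
    have b2 := hc1 (ft f ξ')
    calc ‖C ξ‖ * ‖C ξ'‖ * ‖ft ν (ξ - ξ')‖ ≤ 1 * 1 * ‖ft ν (ξ - ξ')‖ := by gcongr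
      _ = _ := by ring
  calc (η * Ξ.card) ^ 2 ≤ ((∑ m, ν m * ‖g m‖) / P) ^ 2 := by gcongr
    _ = (∑ m, ν m * ‖g m‖) ^ 2 / P ^ 2 := by rw [div_pow]
    _ ≤ (∑ m, ν m) * (P * ∑ ξ ∈ Ξ, ∑ ξ' ∈ Ξ, ‖ft ν (ξ - ξ')‖) / P ^ 2 := by
      gcongr
      refine h3.trans ?_
      have := sum_nonneg fun m (_ : m ∈ univ) => hν m
      gcongr
    _ = _ := by field_simp

/-- exponential sum over the level set -/
noncomputable def SS (Ξ : Finset (ZMod P)) (m : ZMod P) : ℂ := ∑ ξ ∈ Ξ, ZMod.stdAddChar (m * ξ)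

lemma SS_neg (Ξ : Finset (ZMod P)) (m : ZMod P) : ‖SS Ξ (-m)‖ = ‖SS Ξ m‖ := by
  rw [← RCLike.norm_conj (SS Ξ m)]
  congr 1
  unfold SS
  rw [map_sum]
  refine sum_congr rfl fun ξ _ => ?_
  rw [neg_mul, chi_neg]

lemma SS_le (Ξ : Finset (ZMod P)) (m : ZMod P) : ‖SS Ξ m‖ ≤ Ξ.card := by
  unfold SS
  refine (norm_sum_le _ _).trans ?_
  simp [chi_norm]

lemma SS_sq (Ξ : Finset (ZMod P)) (m : ZMod P) :
    ((‖SS Ξ m‖ ^ 2 : ℝ) : ℂ) = ∑ ξ ∈ Ξ, ∑ ξ' ∈ Ξ, ZMod.stdAddChar (m * (ξ - ξ')) := by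
  rw [norm_sq_eq]
  unfold SS
  rw [map_sum, sum_mul_sum]
  simp only [mul_sub, chi_sub]

lemma SS_parseval (Ξ : Finset (ZMod P)) : ∑ m, ‖SS Ξ m‖ ^ 2 = P * Ξ.card := by
  have : ((∑ m, ‖SS Ξ m‖ ^ 2 : ℝ) : ℂ) = ((P * Ξ.card : ℝ) : ℂ) := by
    rw [ofReal_sum]
    simp only [SS_sq]
    rw [sum_comm]
    simp only [sum_comm (s := univ)]
    have : ∀ ξ ∈ Ξ, ∑ ξ' ∈ Ξ, ∑ x : ZMod P, (ZMod.stdAddChar (x * (ξ - ξ')) : ℂ) = P := by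
      intro ξ hξ
      simp only [mul_comm _ (ξ - _), chi_orth, sub_eq_zero]
      rw [sum_ite_eq, if_pos hξ]
    rw [sum_congr rfl this]
    simp [mul_comm]
  exact_mod_cast this

lemma fejer_ind (q K : ℕ) (ζ : ZMod P) (t : ℝ) (ht : nn ((q:ℝ) * (ζ.val / P)) ≤ t) (hK : (K:ℝ) * t ≤ 1 / 16) :
    (K:ℝ) ^ 2 ≤ 4 * ‖∑ k ∈ range K, (ZMod.stdAddChar (((k * q : ℕ) : ZMod P) * ζ) : ℂ)‖ ^ 2 := by
  have hval : ∀ k : ℕ, (ZMod.stdAddChar (((k * q : ℕ) : ZMod P) * ζ) : ℂ) = ee ((k:ℝ) * ((q:ℝ) * (ζ.val / P))) := by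
    intro k
    have := ee_eq_stdAddChar P (((k * q : ℕ) * ζ.val : ℕ) : ℤ)
    have e : ((((k * q : ℕ) * ζ.val : ℕ) : ℤ) : ZMod P) = ((k * q : ℕ) : ZMod P) * ζ := by
      push_cast; rw [ZMod.natCast_zmod_val]
    rw [e] at this
    rw [← this]; congr 1; push_cast; ring
  simp only [hval]
  set u := (q:ℝ) * (ζ.val / P) with hu
  have hn0 := nn_nonneg u
  have h1 : ∀ k ∈ range K, ‖ee ((k:ℝ) * u) - 1‖ ≤ 1/2 := by
    intro k hk
    rw [mem_range] at hk
    obtain ⟨n, hn⟩ := nn_exists ((k:ℝ) * u)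
    have e : ee ((k:ℝ) * u) = ee ((k:ℝ) * u - n) := by rw [ee_sub_int]
    rw [e]
    refine (norm_ee_sub_one_le _).trans ?_
    rw [← hn]
    have b1 := nn_nat_mul_le k u
    have hk' : (k:ℝ) ≤ K := mod_cast hk.le
    have b2 : nn ((k:ℝ) * u) ≤ 1/16 := by
      refine b1.trans (le_trans ?_ hK); gcongr
    have := Real.pi_lt_four
    have := pi_pos
    nlinarith [nn_nonneg ((k:ℝ) * u)]
  have h2 : (K:ℝ) / 2 ≤ ‖∑ k ∈ range K, ee ((k:ℝ) * u)‖ := by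
    have : ‖∑ k ∈ range K, (ee ((k:ℝ) * u) - 1)‖ ≤ K / 2 := by
      refine (norm_sum_le_of_le _ h1).trans ?_
      simp; apply le_of_eq; ring
    rw [sum_sub_distrib] at this
    simp only [sum_const, card_range, nsmul_eq_mul, mul_one] at this
    have t2 := norm_sub_norm_le (K:ℂ) (∑ k ∈ range K, ee ((k:ℝ) * u))
    rw [norm_sub_rev, Complex.norm_natCast] at t2
    linarith
  have : (0:ℝ) ≤ K := by positivity
  nlinarith

lemma pair_sum (Ξ : Finset (ZMod P)) (q K : ℕ) :
    ∑ ξ ∈ Ξ, ∑ ξ' ∈ Ξ, ‖∑ k ∈ range K, (ZMod.stdAddChar (((k * q : ℕ) : ZMod P) * (ξ - ξ')) : ℂ)‖ ^ 2 ≤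
      K * ((Ξ.card:ℝ) ^ 2 + 2 * ∑ m ∈ Ico 1 K, ‖SS Ξ ((q * m : ℕ) : ZMod P)‖ ^ 2) := by
  have e : ∑ ξ ∈ Ξ, ∑ ξ' ∈ Ξ, ‖∑ k ∈ range K, (ZMod.stdAddChar (((k * q : ℕ) : ZMod P) * (ξ - ξ')) : ℂ)‖ ^ 2 =
      ∑ k ∈ range K, ∑ k' ∈ range K, ‖SS Ξ (((k * q : ℕ) : ZMod P) - ((k' * q : ℕ) : ZMod P))‖ ^ 2 := by
    have : ((∑ ξ ∈ Ξ, ∑ ξ' ∈ Ξ, ‖∑ k ∈ range K, (ZMod.stdAddChar (((k * q : ℕ) : ZMod P) * (ξ - ξ')) : ℂ)‖ ^ 2 : ℝ) : ℂ) =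
      ((∑ k ∈ range K, ∑ k' ∈ range K, ‖SS Ξ (((k * q : ℕ) : ZMod P) - ((k' * q : ℕ) : ZMod P))‖ ^ 2 : ℝ) : ℂ) := by
      simp only [ofReal_sum, SS_sq]
      simp only [norm_sq_eq, map_sum, sum_mul_sum, ← chi_sub, ← sub_mul]
      have s1 : ∀ ξ ∈ Ξ, ∑ ξ' ∈ Ξ, ∑ i ∈ range K, ∑ j ∈ range K, (ZMod.stdAddChar ((((i * q : ℕ) : ZMod P) - ((j * q : ℕ) : ZMod P)) * (ξ - ξ')) : ℂ) =
         ∑ i ∈ range K, ∑ j ∈ range K, ∑ ξ' ∈ Ξ, (ZMod.stdAddChar ((((i * q : ℕ) : ZMod P) - ((j * q : ℕ) : ZMod P)) * (ξ - ξ')) : ℂ) := by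
        intro ξ _
        rw [sum_comm]
        exact sum_congr rfl fun i _ => sum_comm
      rw [sum_congr rfl s1, sum_comm]
      exact sum_congr rfl fun i _ => sum_comm
    exact_mod_cast this
  rw [e]
  have h : ∀ k ∈ range K, ∑ k' ∈ range K, ‖SS Ξ (((k * q : ℕ) : ZMod P) - ((k' * q : ℕ) : ZMod P))‖ ^ 2 ≤
      (Ξ.card:ℝ) ^ 2 + 2 * ∑ m ∈ Ico 1 K, ‖SS Ξ ((q * m : ℕ) : ZMod P)‖ ^ 2 := by
    intro k hk
    rw [mem_range] at hk
    set G : ℕ → ℝ := fun m => ‖SS Ξ ((q * m : ℕ) : ZMod P)‖ ^ 2 with hG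
    have hG0 : ∀ m, 0 ≤ G m := fun m => by positivity
    have key : ∀ k', ‖SS Ξ (((k * q : ℕ) : ZMod P) - ((k' * q : ℕ) : ZMod P))‖ ^ 2 = G (max k k' - min k k') := by
      intro k'
      rcases le_total k' k with h | h
      · rw [max_eq_left h, min_eq_right h]
        simp only [hG]
        congr 3
        push_cast [Nat.cast_sub h]; ring
      · rw [max_eq_right h, min_eq_left h]
        simp only [hG]
        rw [← SS_neg]
        congr 3
        push_cast [Nat.cast_sub h]; ring
    simp only [key]
    rw [← sum_range_add_sum_Ico _ hk.le, sum_eq_sum_Ico_succ_bot hk]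
    have a1 : ∑ k' ∈ range k, G (max k k' - min k k') ≤ ∑ m ∈ Ico 1 K, G m := by
      rw [show ∑ k' ∈ range k, G (max k k' - min k k') = ∑ m ∈ (range k).image (fun k' => k - k'), G m by
        rw [sum_image (f := G) (fun x hx y hy hxy => by
          simp only [coe_range, Set.mem_Iio] at hx hy; omega)]
        refine sum_congr rfl fun x hx => ?_
        rw [mem_range] at hx
        rw [max_eq_left hx.le, min_eq_right hx.le]]
      refine sum_le_sum_of_subset_of_nonneg (fun m hm => ?_) fun m _ _ => hG0 m
      simp only [mem_image, mem_range, mem_Ico] at hm ⊢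
      obtain ⟨x, hx, rfl⟩ := hm
      omega
    have a2 : ∑ k' ∈ Ico (k+1) K, G (max k k' - min k k') ≤ ∑ m ∈ Ico 1 K, G m := by
      rw [show ∑ k' ∈ Ico (k+1) K, G (max k k' - min k k') = ∑ m ∈ (Ico (k+1) K).image (fun k' => k' - k), G m by
        rw [sum_image (f := G) (fun x hx y hy hxy => by
          simp only [coe_Ico, Set.mem_Ico] at hx hy; omega)]
        refine sum_congr rfl fun x hx => ?_
        rw [mem_Ico] at hx
        rw [max_eq_right (by omega), min_eq_left (by omega)]]
      refine sum_le_sum_of_subset_of_nonneg (fun m hm => ?_) fun m _ _ => hG0 m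
      simp only [mem_image, mem_Ico] at hm ⊢
      obtain ⟨x, hx, rfl⟩ := hm
      omega
    have a3 : G (max k k - min k k) ≤ (Ξ.card:ℝ) ^ 2 := by
      simp only [hG]
      have := SS_le Ξ ((q * (max k k - min k k) : ℕ) : ZMod P)
      gcongr
    have : ∑ m ∈ Ico 1 K, ‖SS Ξ ((q * m : ℕ) : ZMod P)‖ ^ 2 = ∑ m ∈ Ico 1 K, G m := rfl
    linarith
  refine (sum_le_sum h).trans ?_
  rw [sum_const, card_range, nsmul_eq_mul]

end restr

open Classical in
noncomputable def QQ (w Q : ℕ) : Finset ℕ := (Icc 1 Q).filter (fun q => ∀ p, p.Prime → p ∣ q → w < p)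

lemma mem_QQ {w Q q : ℕ} : q ∈ QQ w Q ↔ (1 ≤ q ∧ q ≤ Q) ∧ ∀ p, p.Prime → p ∣ q → w < p := by
  simp [QQ]

lemma QQ_card (w Q : ℕ) : (QQ w Q).card ≤ Q := by
  have : QQ w Q ⊆ Icc 1 Q := fun x hx => mem_Icc.2 (mem_QQ.1 hx).1
  simpa using card_le_card this

noncomputable def dQ (w Q n : ℕ) : ℕ := ((QQ w Q).filter (· ∣ n)).card

lemma dQ_pow (k w Q n : ℕ) (ε1 : ℝ) (hn : n ≠ 0) (hw : ∀ p : ℕ, w < p → (2:ℝ)^k ≤ (p:ℝ) ^ ε1) :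
    ((dQ w Q n : ℕ) : ℝ) ^ k ≤ ∑ L ∈ (Icc 1 (Q^k)).filter (· ∣ n), (L:ℝ) ^ ε1 := by
  classical
  set D := (QQ w Q).filter (· ∣ n) with hD
  set T := Fintype.piFinset (fun _ : Fin k => D) with hT
  have hcard : ((dQ w Q n : ℕ) : ℝ) ^ k = (T.card : ℝ) := by
    rw [hT, Fintype.card_piFinset]; simp [dQ, hD]
  rw [hcard]
  set R := ((Icc 1 (Q^k)).filter (· ∣ n)).filter (fun L => ∀ p, p.Prime → p ∣ L → w < p) with hR
  have hmem : ∀ x ∈ T, ∀ i, (1 ≤ x i ∧ x i ≤ Q) ∧ (∀ p, p.Prime → p ∣ x i → w < p) ∧ x i ∣ n := by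
    intro x hx i
    have := Fintype.mem_piFinset.1 hx i
    rw [hD, mem_filter, mem_QQ] at this
    exact ⟨this.1.1, this.1.2, this.2⟩
  have hmap : ∀ x ∈ T, univ.lcm x ∈ R := by
    intro x hx
    have hx' := hmem x hx
    have hdn : univ.lcm x ∣ n := Finset.lcm_dvd fun i _ => (hx' i).2.2
    have hdp : univ.lcm x ∣ ∏ i, x i := Finset.lcm_dvd fun i _ => dvd_prod_of_mem _ (mem_univ i)
    have hpos : 0 < ∏ i, x i := prod_pos fun i _ => (hx' i).1.1
    rw [hR, mem_filter, mem_filter, mem_Icc]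
    refine ⟨⟨⟨Nat.pos_of_ne_zero fun h => hn (by rw [h] at hdn; simpa using hdn), ?_⟩, hdn⟩, ?_⟩
    · refine (le_of_dvd hpos hdp).trans ((prod_le_prod' fun i _ => (hx' i).1.2).trans ?_)
      simp
    · intro p hp hpd
      obtain ⟨i, _, hi⟩ := (Prime.dvd_finset_prod_iff hp.prime _).1 (hpd.trans hdp)
      exact (hx' i).2.1 p hp hi
  rw [card_eq_sum_card_fiberwise hmap]
  push_cast
  refine le_trans (sum_le_sum fun L hL => ?_) (sum_le_sum_of_subset_of_nonneg (filter_subset _ _) fun L _ _ => by positivity)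
  rw [hR, mem_filter, mem_filter, mem_Icc] at hL
  have hL0 : L ≠ 0 := by omega
  have h1 : (T.filter (fun x => univ.lcm x = L)).card ≤ (L.divisors.card) ^ k := by
    have : T.filter (fun x => univ.lcm x = L) ⊆ Fintype.piFinset (fun _ : Fin k => L.divisors) := by
      intro x hx
      rw [mem_filter] at hx
      rw [Fintype.mem_piFinset]
      intro i
      rw [Nat.mem_divisors]
      exact ⟨hx.2 ▸ Finset.dvd_lcm (mem_univ i), hL0⟩
    refine (card_le_card this).trans ?_
    rw [Fintype.card_piFinset]; simp
  calc ((T.filter (fun x => univ.lcm x = L)).card : ℝ) ≤ ((L.divisors.card ^ k : ℕ) : ℝ) := by exact_mod_cast h1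
    _ ≤ (((2 ^ L.primeFactorsList.length) ^ k : ℕ) : ℝ) := by
      have := divisors_card_le L hL0
      exact_mod_cast Nat.pow_le_pow_left this k
    _ = ((2:ℝ)^k) ^ L.primeFactorsList.length := by push_cast; rw [← pow_mul, ← pow_mul, mul_comm]
    _ ≤ _ := rough_pow_le _ ε1 (one_le_pow₀ (by norm_num)) L hL0 fun p hp hpL => hw p (hL.2 p hp hpL)

lemma dQ_moment (k w Q P : ℕ) (ε1 : ℝ) (hε : 0 ≤ ε1) (hw : ∀ p : ℕ, w < p → (2:ℝ)^k ≤ (p:ℝ) ^ ε1) :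
    ∑ n ∈ Ico 1 P, ((dQ w Q n : ℕ) : ℝ) ^ k ≤ P * (((Q^k : ℕ):ℝ) ^ ε1 * (1 + log ((Q^k : ℕ):ℝ))) := by
  set Y := Q^k with hY
  have h1 : ∑ n ∈ Ico 1 P, ((dQ w Q n : ℕ) : ℝ) ^ k ≤ ∑ n ∈ Ico 1 P, ∑ L ∈ (Icc 1 Y).filter (· ∣ n), (L:ℝ) ^ ε1 :=
    sum_le_sum fun n hn => dQ_pow k w Q n ε1 (by rw [mem_Ico] at hn; omega) hw
  refine h1.trans ?_
  simp only [sum_filter]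
  rw [sum_comm]
  have h2 : ∀ L ∈ Icc 1 Y, ∑ n ∈ Ico 1 P, (if L ∣ n then (L:ℝ) ^ ε1 else 0) ≤ P * (Y:ℝ) ^ ε1 * (1 / L) := by
    intro L hL
    rw [mem_Icc] at hL
    rw [← sum_filter, sum_const, nsmul_eq_mul]
    have hc : ((Ico 1 P).filter (L ∣ ·)).card ≤ P / L := by
      rw [← Nat.Ioc_filter_dvd_card_eq_div]
      apply card_le_card
      apply filter_subset_filter
      intro x hx; rw [mem_Ico] at hx; rw [mem_Ioc]; omega
    have hc' : (((Ico 1 P).filter (L ∣ ·)).card : ℝ) ≤ P / L := le_trans (mod_cast hc) cast_div_le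
    have hLY : (L:ℝ) ≤ Y := mod_cast hL.2
    calc _ ≤ (P:ℝ) / L * (Y:ℝ) ^ ε1 := by gcongr
      _ = _ := by ring
  refine (sum_le_sum h2).trans ?_
  rw [← mul_sum, mul_assoc]
  gcongr
  have := harmonic_le_one_add_log Y
  rw [harmonic_eq_sum_Icc] at this
  push_cast at this
  simpa [one_div] using this

section restr
variable {P : ℕ} [NeZero P]

lemma dQ_SS (w Q : ℕ) (B : ℕ) (Ξ : Finset (ZMod P)) (D M : ℝ) (hD : 0 < D)
    (hM : ∑ n ∈ Ico 1 P, ((dQ w Q n : ℕ) : ℝ) ^ (B+1) ≤ P * M) :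
    ∑ n ∈ Ico 1 P, (dQ w Q n : ℝ) * ‖SS Ξ (n : ZMod P)‖ ^ 2 ≤ P * (D * Ξ.card + M / D ^ B * (Ξ.card:ℝ) ^ 2) := by
  have h1 : ∀ n : ℕ, (dQ w Q n : ℝ) ≤ D + (dQ w Q n : ℝ) ^ (B+1) / D ^ B := by
    intro n
    set x := (dQ w Q n : ℝ)
    have hx : 0 ≤ x := by positivity
    by_cases h : x ≤ D
    · have : 0 ≤ x ^ (B+1) / D ^ B := by positivity
      linarith
    · push Not at h
      have : x ≤ x ^ (B+1) / D ^ B := by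
        rw [le_div_iff₀ (by positivity), pow_succ, mul_comm]
        gcongr
      linarith
  calc ∑ n ∈ Ico 1 P, (dQ w Q n : ℝ) * ‖SS Ξ (n : ZMod P)‖ ^ 2
      ≤ ∑ n ∈ Ico 1 P, (D * ‖SS Ξ (n : ZMod P)‖ ^ 2 + (dQ w Q n : ℝ) ^ (B+1) / D ^ B * (Ξ.card:ℝ) ^ 2) := by
        refine sum_le_sum fun n _ => ?_
        have := SS_le Ξ (n : ZMod P)
        calc _ ≤ (D + (dQ w Q n : ℝ) ^ (B+1) / D ^ B) * ‖SS Ξ (n : ZMod P)‖ ^ 2 := by gcongr; exact h1 n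
          _ = D * ‖SS Ξ (n : ZMod P)‖ ^ 2 + (dQ w Q n : ℝ) ^ (B+1) / D ^ B * ‖SS Ξ (n : ZMod P)‖ ^ 2 := by ring
          _ ≤ _ := by gcongr
    _ = D * ∑ n ∈ Ico 1 P, ‖SS Ξ (n : ZMod P)‖ ^ 2 + (∑ n ∈ Ico 1 P, (dQ w Q n : ℝ) ^ (B+1)) / D ^ B * (Ξ.card:ℝ) ^ 2 := by
        rw [sum_add_distrib, ← mul_sum, ← sum_mul, ← sum_div]
    _ ≤ D * (P * Ξ.card) + (P * M) / D ^ B * (Ξ.card:ℝ) ^ 2 := by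
        gcongr
        rw [← SS_parseval]
        rw [show ∑ n ∈ Ico 1 P, ‖SS Ξ (n : ZMod P)‖ ^ 2 = ∑ m ∈ (Ico 1 P).image (fun n : ℕ => (n : ZMod P)), ‖SS Ξ m‖ ^ 2 by
          rw [sum_image (f := fun m : ZMod P => ‖SS Ξ m‖ ^ 2)]
          intro x hx y hy hxy
          simp only [coe_Ico, Set.mem_Ico] at hx hy
          have := congrArg ZMod.val hxy
          simp only at this
          rwa [ZMod.val_natCast_of_lt hx.2, ZMod.val_natCast_of_lt hy.2] at this]
        exact sum_le_sum_of_subset_of_nonneg (subset_univ _) fun _ _ _ => by positivity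
    _ = _ := by ring

lemma q_sum (w Q : ℕ) (G : ℕ → ℝ) (hG : ∀ n, 0 ≤ G n) (K : ℕ → ℕ) (hK : ∀ q ∈ QQ w Q, q * K q ≤ P) :
    ∑ q ∈ QQ w Q, ∑ m ∈ Ico 1 (K q), G (q * m) ≤ ∑ n ∈ Ico 1 P, (dQ w Q n : ℝ) * G n := by
  have e : ∀ n, (dQ w Q n : ℝ) * G n = ∑ q ∈ QQ w Q, if q ∣ n then G n else 0 := by
    intro n
    rw [← sum_filter, sum_const, nsmul_eq_mul, dQ]
  simp only [e]
  rw [sum_comm]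
  refine sum_le_sum fun q hq => ?_
  have hq1 := (mem_QQ.1 hq).1.1
  rw [← sum_filter]
  rw [show ∑ m ∈ Ico 1 (K q), G (q * m) = ∑ n ∈ (Ico 1 (K q)).image (fun m => q * m), G n by
    rw [sum_image (f := G)]
    intro x _ y _ hxy
    exact Nat.eq_of_mul_eq_mul_left hq1 hxy]
  refine sum_le_sum_of_subset_of_nonneg (fun n hn => ?_) fun _ _ _ => hG _
  simp only [mem_image, mem_Ico, mem_filter] at hn ⊢
  obtain ⟨m, hm, rfl⟩ := hn
  have h1 := hK q hq
  refine ⟨⟨Nat.mul_pos hq1 hm.1, ?_⟩, Dvd.intro _ rfl⟩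
  exact lt_of_lt_of_le (Nat.mul_lt_mul_of_pos_left hm.2 hq1) h1

end restr

section restr
variable {P : ℕ} [NeZero P]

def Kq (P q j : ℕ) : ℕ := P / (16 * q * 2 ^ j)

noncomputable def Lz (Z : ℝ) : ℕ := Nat.log 2 ⌊2 * Z⌋₊

lemma near_bound (d w : ℕ) (ν : ZMod P → ℝ) (C θ η Z : ℝ) (hC : 0 < C) (hη : 0 < η) (hZ : Z = 8 * C / η ^ 2)
    (hZ1 : 1 ≤ Z) (hθ : θ ≤ η ^ 2 / 8) (hP : 32 * Z ^ ((d:ℝ) + 1/16 + 1) ≤ P) (ζ : ZMod P)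
    (hk : ∃ (a : ℤ) (q : ℕ), 1 ≤ q ∧ (∀ p, p.Prime → p ∣ q → w < p) ∧
      ‖ft ν ζ‖ ≤ C * (q:ℝ) ^ (-(c0 d)) / (1 + P * |(ζ.val:ℝ) / P - a / q|) + θ)
    (hbig : η ^ 2 / 4 < ‖ft ν ζ‖) :
    ‖ft ν ζ‖ ≤ ∑ q ∈ QQ w ⌊Z ^ ((d:ℝ) + 1/16)⌋₊, ∑ j ∈ range (Lz Z + 1), 4 * C * (q:ℝ) ^ (-(c0 d)) * (1 / 2 ^ j) *
      (4 / (Kq P q j : ℝ) ^ 2 * ‖∑ k ∈ range (Kq P q j), (ZMod.stdAddChar (((k * q : ℕ) : ZMod P) * ζ) : ℂ)‖ ^ 2) := by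
  let Tm : ℕ → ℕ → ℝ := fun q j => 4 * C * (q:ℝ) ^ (-(c0 d)) * (1 / 2 ^ j) *
      (4 / (Kq P q j : ℝ) ^ 2 * ‖∑ k ∈ range (Kq P q j), (ZMod.stdAddChar (((k * q : ℕ) : ZMod P) * ζ) : ℂ)‖ ^ 2)
  have hTm0 : ∀ q j, 0 ≤ Tm q j := fun q j => by simp only [Tm]; positivity
  change _ ≤ ∑ q ∈ QQ w ⌊Z ^ ((d:ℝ) + 1/16)⌋₊, ∑ j ∈ range (Lz Z + 1), Tm q j
  obtain ⟨a, q, hq1, hrough, hk⟩ := hk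
  set β := (ζ.val:ℝ) / P - a / q with hβ
  have hPp := P_pos (P := P)
  set t := P * |β| with ht
  have ht0 : 0 ≤ t := by positivity
  have hq0 : (0:ℝ) < q := mod_cast hq1
  set u := (q:ℝ) ^ (-(c0 d)) with hu
  have hu0 : 0 < u := by positivity
  have h1 : η ^ 2 / 8 ≤ C * u / (1 + t) := by linarith
  have h2 : ‖ft ν ζ‖ ≤ 2 * (C * u / (1 + t)) := by linarith
  have h3 : (q:ℝ) ^ (c0 d) * (1 + t) ≤ Z := by
    rw [le_div_iff₀ (by linarith)] at h1
    have e : (q:ℝ) ^ (c0 d) * u = 1 := by rw [hu, ← rpow_add hq0]; simp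
    have : (q:ℝ) ^ (c0 d) * (η ^ 2 / 8 * (1 + t)) ≤ (q:ℝ) ^ (c0 d) * (C * u) := by gcongr
    rw [hZ, le_div_iff₀ (by positivity)]
    nlinarith
  have hqc1 : 1 ≤ (q:ℝ) ^ (c0 d) := one_le_rpow (mod_cast hq1) (c0_pos d).le
  have h4 : (q:ℝ) ^ (c0 d) ≤ Z := by nlinarith
  have h5 : 1 + t ≤ Z := by nlinarith
  have hqE : (q:ℝ) ≤ Z ^ ((d:ℝ) + 1/16) := by
    have : (q:ℝ) = ((q:ℝ) ^ (c0 d)) ^ ((d:ℝ) + 1/16) := by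
      rw [← rpow_mul hq0.le]
      have : c0 d * ((d:ℝ) + 1/16) = 1 := by unfold c0; field_simp
      rw [this, rpow_one]
    rw [this]
    exact rpow_le_rpow (by positivity) h4 (by positivity)
  have hqQ : q ∈ QQ w ⌊Z ^ ((d:ℝ) + 1/16)⌋₊ := mem_QQ.2 ⟨⟨hq1, le_floor hqE⟩, hrough⟩
  -- dyadic index
  obtain ⟨j, hj1, hj2⟩ : ∃ j : ℕ, t ≤ 2 ^ j ∧ (2:ℝ) ^ j ≤ 2 * (1 + t) := by
    have hex : ∃ j : ℕ, t ≤ (2:ℝ) ^ j := by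
      obtain ⟨n, hn⟩ := pow_unbounded_of_one_lt t (by norm_num : (1:ℝ) < 2)
      exact ⟨n, hn.le⟩
    classical
    refine ⟨Nat.find hex, Nat.find_spec hex, ?_⟩
    rcases Nat.eq_zero_or_pos (Nat.find hex) with h | h
    · rw [h]; simp; linarith
    · have := Nat.find_min hex (Nat.sub_lt h one_pos)
      push Not at this
      have e : (2:ℝ) ^ (Nat.find hex) = 2 * 2 ^ (Nat.find hex - 1) := by rw [← pow_succ']; congr 1; omega
      rw [e]; linarith
  have hj3 : (2:ℝ) ^ j ≤ 2 * Z := by linarith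
  have hjL : j ∈ range (Lz Z + 1) := by
    rw [mem_range, Nat.lt_succ_iff, Lz]
    apply Nat.le_log_of_pow_le (by norm_num)
    apply le_floor; push_cast; exact hj3
  have hnn : ∀ x : ℝ, 0 ≤ ‖ft ν ζ‖ := fun _ => norm_nonneg _
  set K := Kq P q j with hK
  have h16 : (16 * q * 2 ^ j : ℝ) ≤ P := by
    refine le_trans ?_ hP
    rw [rpow_add (by linarith), rpow_one]
    calc (16 * q * 2 ^ j : ℝ) ≤ 16 * Z ^ ((d:ℝ) + 1/16) * (2 * Z) := by gcongr
      _ = _ := by ring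
  have hKpos : 0 < K := by
    rw [hK, Kq]; apply Nat.div_pos; · exact_mod_cast h16
    · positivity
  have hKle : (K:ℝ) * (16 * q * 2 ^ j) ≤ P := by
    have := Nat.div_mul_le_self P (16 * q * 2 ^ j)
    rw [hK, Kq]; exact_mod_cast this
  have hK0 : (0:ℝ) < K := mod_cast hKpos
  have hfe := fejer_ind q K ζ (q * (2 ^ j / P)) (by
      have := nn_le_abs_sub ((q:ℝ) * (ζ.val / P)) a
      refine this.trans ?_
      have e : (q:ℝ) * (ζ.val / P) - a = q * β := by rw [hβ]; field_simp
      rw [e, abs_mul, abs_of_pos hq0]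
      gcongr
      rw [le_div_iff₀ hPp]; linarith [hj1, mul_comm (P:ℝ) |β|]) (by
      have : (K:ℝ) * (q * (2 ^ j / P)) = (K * (16 * q * 2 ^ j)) / P / 16 := by field_simp
      rw [this]
      rw [div_le_div_iff_of_pos_right (by norm_num), div_le_one hPp]; exact hKle)
  set V := ‖∑ k ∈ range K, (ZMod.stdAddChar (((k * q : ℕ) : ZMod P) * ζ) : ℂ)‖ ^ 2 with hV
  have hone : 1 ≤ 4 / (K:ℝ) ^ 2 * V := by
    rw [div_mul_eq_mul_div, le_div_iff₀ (by positivity)]; linarith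
  calc ‖ft ν ζ‖ ≤ 2 * (C * u / (1 + t)) := h2
    _ ≤ 4 * C * u * (1 / 2 ^ j) * 1 := by
      have : 1 / (1 + t) ≤ 2 * (1 / 2 ^ j) := by
        rw [mul_one_div, div_le_div_iff₀ (by linarith) (by positivity)]; linarith
      calc 2 * (C * u / (1 + t)) = 2 * (C * u) * (1 / (1 + t)) := by ring
        _ ≤ 2 * (C * u) * (2 * (1 / 2 ^ j)) := by gcongr
        _ = _ := by ring
    _ ≤ 4 * C * u * (1 / 2 ^ j) * (4 / (K:ℝ) ^ 2 * V) := by gcongr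
    _ = Tm q j := rfl
    _ ≤ ∑ j ∈ range (Lz Z + 1), Tm q j := single_le_sum (f := Tm q) (fun j _ => hTm0 q j) hjL
    _ ≤ _ := single_le_sum (f := fun q : ℕ => ∑ j ∈ range (Lz Z + 1), Tm q j) (fun q _ => sum_nonneg fun j _ => hTm0 q j) hqQ

lemma big_sum (d w : ℕ) (hd : 1 ≤ d) (Ξ : Finset (ZMod P)) (C Z : ℝ) (hC : 0 < C)
    (hZ1 : 1 ≤ Z) (hP : 32 * Z ^ ((d:ℝ) + 1/16 + 1) ≤ P) :
    ∑ ξ ∈ Ξ, ∑ ξ' ∈ Ξ, ∑ q ∈ QQ w ⌊Z ^ ((d:ℝ) + 1/16)⌋₊, ∑ j ∈ range (Lz Z + 1), 4 * C * (q:ℝ) ^ (-(c0 d)) * (1 / 2 ^ j) *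
      (4 / (Kq P q j : ℝ) ^ 2 * ‖∑ k ∈ range (Kq P q j), (ZMod.stdAddChar (((k * q : ℕ) : ZMod P) * (ξ - ξ')) : ℂ)‖ ^ 2) ≤
    512 * C * (Lz Z + 1) * Z ^ ((d:ℝ) + 1/16 - 1) / P * (Z ^ ((d:ℝ) + 1/16) * (Ξ.card:ℝ) ^ 2 +
      2 * ∑ n ∈ Ico 1 P, (dQ w ⌊Z ^ ((d:ℝ) + 1/16)⌋₊ n : ℝ) * ‖SS Ξ (n : ZMod P)‖ ^ 2) := by
  set Q := ⌊Z ^ ((d:ℝ) + 1/16)⌋₊ with hQ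
  have hPp := P_pos (P := P)
  have hE0 : 0 ≤ Z ^ ((d:ℝ) + 1/16) := by positivity
  have hd1 : (1:ℝ) ≤ d := mod_cast hd
  have swap : ∑ ξ ∈ Ξ, ∑ ξ' ∈ Ξ, ∑ q ∈ QQ w Q, ∑ j ∈ range (Lz Z + 1), 4 * C * (q:ℝ) ^ (-(c0 d)) * (1 / 2 ^ j) *
      (4 / (Kq P q j : ℝ) ^ 2 * ‖∑ k ∈ range (Kq P q j), (ZMod.stdAddChar (((k * q : ℕ) : ZMod P) * (ξ - ξ')) : ℂ)‖ ^ 2) =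
      ∑ q ∈ QQ w Q, ∑ j ∈ range (Lz Z + 1), 4 * C * (q:ℝ) ^ (-(c0 d)) * (1 / 2 ^ j) *
      (4 / (Kq P q j : ℝ) ^ 2 * ∑ ξ ∈ Ξ, ∑ ξ' ∈ Ξ, ‖∑ k ∈ range (Kq P q j), (ZMod.stdAddChar (((k * q : ℕ) : ZMod P) * (ξ - ξ')) : ℂ)‖ ^ 2) := by
    simp only [mul_sum]
    have s1 : ∀ ξ ∈ Ξ, ∑ ξ' ∈ Ξ, ∑ q ∈ QQ w Q, ∑ j ∈ range (Lz Z + 1), 4 * C * (q:ℝ) ^ (-(c0 d)) * (1 / 2 ^ j) *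
      (4 / (Kq P q j : ℝ) ^ 2 * ‖∑ k ∈ range (Kq P q j), (ZMod.stdAddChar (((k * q : ℕ) : ZMod P) * (ξ - ξ')) : ℂ)‖ ^ 2) =
       ∑ q ∈ QQ w Q, ∑ j ∈ range (Lz Z + 1), ∑ ξ' ∈ Ξ, 4 * C * (q:ℝ) ^ (-(c0 d)) * (1 / 2 ^ j) *
      (4 / (Kq P q j : ℝ) ^ 2 * ‖∑ k ∈ range (Kq P q j), (ZMod.stdAddChar (((k * q : ℕ) : ZMod P) * (ξ - ξ')) : ℂ)‖ ^ 2) := by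
      intro ξ _
      rw [sum_comm]
      exact sum_congr rfl fun i _ => sum_comm
    rw [sum_congr rfl s1, sum_comm]
    exact sum_congr rfl fun i _ => sum_comm
  rw [swap]
  set G : ℕ → ℝ := fun n => ‖SS Ξ (n : ZMod P)‖ ^ 2 with hG
  have hG0 : ∀ n, 0 ≤ G n := fun n => by positivity
  have hqle : ∀ q ∈ QQ w Q, (q:ℝ) ≤ Z ^ ((d:ℝ) + 1/16) := fun q hq =>
    le_trans (by exact_mod_cast (mem_QQ.1 hq).1.2) (floor_le hE0)
  have hterm : ∀ q ∈ QQ w Q, ∀ j ∈ range (Lz Z + 1), 4 * C * (q:ℝ) ^ (-(c0 d)) * (1 / 2 ^ j) *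
      (4 / (Kq P q j : ℝ) ^ 2 * ∑ ξ ∈ Ξ, ∑ ξ' ∈ Ξ, ‖∑ k ∈ range (Kq P q j), (ZMod.stdAddChar (((k * q : ℕ) : ZMod P) * (ξ - ξ')) : ℂ)‖ ^ 2) ≤
      512 * C * Z ^ ((d:ℝ) + 1/16 - 1) / P * ((Ξ.card:ℝ) ^ 2 + 2 * ∑ m ∈ Ico 1 (Kq P q 0), G (q * m)) := by
    intro q hq j hj
    have hq1 := (mem_QQ.1 hq).1.1
    have hq0 : (0:ℝ) < q := mod_cast hq1
    have hj3 : (2:ℝ) ^ j ≤ 2 * Z := by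
      rw [mem_range, Nat.lt_succ_iff, Lz] at hj
      have h1 : 2 ^ j ≤ ⌊2 * Z⌋₊ := (Nat.pow_le_pow_right (by norm_num) hj).trans
        (Nat.pow_log_le_self 2 (Nat.pos_iff_ne_zero.1 (Nat.floor_pos.2 (by linarith))))
      refine le_trans ?_ (floor_le (by linarith))
      exact_mod_cast h1
    have h16 : (16 * q * 2 ^ j : ℝ) ≤ P := by
      refine le_trans ?_ hP
      rw [rpow_add (by linarith), rpow_one]
      calc (16 * q * 2 ^ j : ℝ) ≤ 16 * Z ^ ((d:ℝ) + 1/16) * (2 * Z) := by gcongr; exact hqle q hq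
        _ = _ := by ring
    set K := Kq P q j with hK
    have h16n : 16 * q * 2 ^ j ≤ P := mod_cast h16
    have hKpos : 0 < K := by
      rw [hK, Kq]; exact Nat.div_pos h16n (by positivity)
    have hK0 : (0:ℝ) < K := mod_cast hKpos
    have hKlow : (P:ℝ) ≤ K * (32 * q * 2 ^ j) := by
      have h1 := Nat.lt_div_mul_add (a := P) (b := 16 * q * 2 ^ j) (by positivity)
      have h2 : P / (16 * q * 2 ^ j) = K := rfl
      rw [h2] at h1
      have h3 : P ≤ K * (32 * q * 2 ^ j) := by nlinarith [Nat.mul_le_mul_right (16 * q * 2 ^ j) hKpos]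
      exact_mod_cast h3
    have hps := pair_sum Ξ q K
    have hmono : ∑ m ∈ Ico 1 K, G (q * m) ≤ ∑ m ∈ Ico 1 (Kq P q 0), G (q * m) := by
      refine sum_le_sum_of_subset_of_nonneg (Ico_subset_Ico le_rfl ?_) fun _ _ _ => hG0 _
      rw [hK, Kq, Kq]
      apply Nat.div_le_div_left _ (by positivity)
      gcongr; norm_num; positivity
    have hu : (q:ℝ) ^ (-(c0 d)) * q ≤ Z ^ ((d:ℝ) + 1/16 - 1) := by
      have hc1 : c0 d * ((d:ℝ) + 1/16) = 1 := by unfold c0; field_simp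
      have hcle : 0 ≤ 1 - c0 d := by
        have := c0_pos d
        nlinarith
      calc (q:ℝ) ^ (-(c0 d)) * q = (q:ℝ) ^ (1 - c0 d) := by
            rw [sub_eq_neg_add, rpow_add hq0, rpow_one]
        _ ≤ (Z ^ ((d:ℝ) + 1/16)) ^ (1 - c0 d) := rpow_le_rpow hq0.le (hqle q hq) hcle
        _ = _ := by
            rw [← rpow_mul (by linarith)]; congr 1
            rw [mul_sub, mul_one, mul_comm ((d:ℝ) + 1/16), hc1]
    set S1 := ∑ m ∈ Ico 1 K, ‖SS Ξ ((q * m : ℕ) : ZMod P)‖ ^ 2 with hS1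
    set S2 := ∑ m ∈ Ico 1 (Kq P q 0), G (q * m) with hS2
    have hS12 : S1 ≤ S2 := hmono
    have hS10 : 0 ≤ S1 := sum_nonneg fun _ _ => by positivity
    calc _ ≤ 4 * C * (q:ℝ) ^ (-(c0 d)) * (1 / 2 ^ j) * (4 / (K:ℝ) ^ 2 * (K * ((Ξ.card:ℝ) ^ 2 + 2 * S1))) := by gcongr
      _ = 16 * C * (q:ℝ) ^ (-(c0 d)) * ((Ξ.card:ℝ) ^ 2 + 2 * S1) * (1 / (2 ^ j * K)) := by field_simp; ring
      _ ≤ 16 * C * (q:ℝ) ^ (-(c0 d)) * ((Ξ.card:ℝ) ^ 2 + 2 * S2) * (32 * q / P) := by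
        have h9 : 1 / (2 ^ j * (K:ℝ)) ≤ 32 * q / P := by
          rw [div_le_div_iff₀ (by positivity) hPp]; nlinarith
        exact mul_le_mul (by gcongr) h9 (by positivity) (by have : 0 ≤ S2 := hS10.trans hS12
                                                            positivity)
      _ = 512 * C * ((q:ℝ) ^ (-(c0 d)) * q) / P * ((Ξ.card:ℝ) ^ 2 + 2 * S2) := by ring
      _ ≤ _ := by
        have : 0 ≤ S2 := hS10.trans hS12
        gcongr
  refine (sum_le_sum fun q hq => sum_le_sum fun j hj => hterm q hq j hj).trans ?_
  simp only [sum_const, card_range, nsmul_eq_mul]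
  rw [← mul_sum, ← mul_sum, sum_add_distrib, sum_const, nsmul_eq_mul, ← mul_sum]
  have hqs := q_sum (P := P) w Q G hG0 (fun q => Kq P q 0) (fun q hq => by
    have := Nat.div_mul_le_self P (16 * q * 2 ^ 0)
    simp only [Kq]
    nlinarith)
  have hcard : ((QQ w Q).card : ℝ) ≤ Z ^ ((d:ℝ) + 1/16) := by
    refine le_trans ?_ (floor_le hE0)
    have : (QQ w Q).card ≤ Q := QQ_card w Q
    exact_mod_cast this
  push_cast
  calc _ = 512 * C * (Lz Z + 1) * Z ^ ((d:ℝ) + 1/16 - 1) / P * (((QQ w Q).card : ℝ) * (Ξ.card:ℝ) ^ 2 + 2 * ∑ q ∈ QQ w Q, ∑ m ∈ Ico 1 (Kq P q 0), G (q * m)) := by ring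
    _ ≤ _ := by gcongr

end restr

lemma Lz_le (Z : ℝ) (hZ : 1 ≤ Z) : (Lz Z : ℝ) + 1 ≤ 64 * Z ^ (1/16:ℝ) := by
  have h1 : 2 ^ (Lz Z) ≤ ⌊2 * Z⌋₊ := Nat.pow_log_le_self 2 (Nat.pos_iff_ne_zero.1 (Nat.floor_pos.2 (by linarith)))
  have h2 : (2:ℝ) ^ (Lz Z) ≤ 2 * Z := le_trans (mod_cast h1) (floor_le (by linarith))
  have h3 := log_le_log (by positivity) h2
  rw [Real.log_pow, Real.log_mul (by norm_num) (by linarith)] at h3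
  have h4 := Real.log_le_rpow_div (by linarith : 0 ≤ Z) (by norm_num : (0:ℝ) < 1/16)
  have h5 := Real.log_two_gt_d9
  have h6 : 1 ≤ Z ^ (1/16:ℝ) := one_le_rpow hZ (by norm_num)
  have h7 : (0:ℝ) ≤ Lz Z := by positivity
  have h8 : 0 ≤ log Z := Real.log_nonneg hZ
  nlinarith

lemma lev_alg (C Z z R D M0 Big P E1 ZE DB : ℝ) (hC : 0 < C) (hZ : 0 < Z) (hP : 0 < P)
    (h1 : 4 * C * R ^ 2 ≤ 2 * Z * Big) (eE : Z * E1 = ZE)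
    (h3 : Big ≤ 512 * C * (64 * z) * E1 / P * (ZE * R ^ 2 + 2 * (P * (D * R + M0 * z / DB * R ^ 2)))) :
    R ^ 2 ≤ 2 ^ 14 * z * ZE * (ZE / P * R ^ 2 + 2 * (D * R) + 2 * (M0 * z / DB) * R ^ 2) := by
  have : 4 * C * R ^ 2 ≤ 4 * C * (2 ^ 14 * z * ZE * (ZE / P * R ^ 2 + 2 * (D * R) + 2 * (M0 * z / DB) * R ^ 2)) := by
    refine h1.trans ((mul_le_mul_of_nonneg_left h3 (by positivity)).trans_eq ?_)
    generalize M0 * z / DB = u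
    rw [← eE]
    field_simp
    ring
  exact le_of_mul_le_mul_left this (by positivity)

set_option maxHeartbeats 1000000 in
theorem level_set (d : ℕ) (hd : 1 ≤ d) : ∃ w0 : ℕ, ∃ K : ℝ, 1 ≤ K ∧ ∀ w : ℕ, w0 ≤ w → ∀ (P : ℕ) [NeZero P] (f ν : ZMod P → ℝ) (C θ η : ℝ),
    1 ≤ C → (∀ m, 0 ≤ f m) → (∀ m, f m ≤ ν m) → (∑ m, ν m) / P ≤ 2 →
    (∀ ζ : ZMod P, ∃ (a : ℤ) (q : ℕ), 1 ≤ q ∧ (∀ p, p.Prime → p ∣ q → w < p) ∧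
      ‖ft ν ζ‖ ≤ C * (q:ℝ) ^ (-(c0 d)) / (1 + P * |(ζ.val:ℝ) / P - a / q|) + θ) →
    0 < η → η ≤ 2 → θ ≤ η ^ 2 / 8 → 2 ^ 16 * (8 * C / η ^ 2) ^ (2 * ((d:ℝ) + 1/16) + 1) ≤ P →
    ∀ Ξ : Finset (ZMod P), (∀ ξ ∈ Ξ, η ≤ ‖ft f ξ‖) → (Ξ.card : ℝ) ≤ K * (8 * C / η ^ 2) ^ ((d:ℝ) + 3/16) := by
  have hd1 : (1:ℝ) ≤ d := mod_cast hd
  set E : ℝ := (d:ℝ) + 1/16 with hE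
  have hE0 : 0 < E := by positivity
  set B : ℕ := 16 * (d + 1) with hB
  set k : ℕ := B + 1 with hk
  have hk0 : (0:ℝ) < k := by positivity
  set ε1 : ℝ := 1 / (32 * k * E) with hε1
  have hε0 : 0 < ε1 := by positivity
  obtain ⟨w0, hw0⟩ := eventually_atTop.1 (ev_const (2^k) ε1 hε0)
  set M0 : ℝ := 1 + 1 / ε1 with hM0
  have hM01 : 1 ≤ M0 := by have : 0 < 1 / ε1 := by positivity
                           linarith
  set A : ℝ := 2 ^ 17 * M0 with hA
  have hA1 : 1 ≤ A := by rw [hA]; linarith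
  refine ⟨w0, 2 ^ 16 * A, by linarith, fun w hw P _ f ν C θ η hC hf hfν hmass hker hη0 hη2 hθ hP Ξ hΞ => ?_⟩
  have hPp := P_pos (P := P)
  set Z := 8 * C / η ^ 2 with hZ
  have hZ1 : 1 ≤ Z := by rw [hZ, le_div_iff₀ (by positivity)]; nlinarith
  have hZ0 : 0 < Z := by linarith
  have hP1 : 32 * Z ^ (E + 1) ≤ P := by
    refine le_trans ?_ hP
    have : Z ^ (E + 1) ≤ Z ^ (2 * E + 1) := rpow_le_rpow_of_exponent_le hZ1 (by linarith)
    have : 0 ≤ Z ^ (2 * E + 1) := by positivity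
    linarith
  set Q := ⌊Z ^ E⌋₊ with hQ
  set z := Z ^ (1/16:ℝ) with hz
  have hz1 : 1 ≤ z := one_le_rpow hZ1 (by norm_num)
  have hz0 : 0 < z := by linarith
  set R := (Ξ.card : ℝ) with hR
  have hR0 : 0 ≤ R := by positivity
  -- moment
  have hM : ∑ n ∈ Ico 1 P, ((dQ w Q n : ℕ) : ℝ) ^ (B+1) ≤ P * (M0 * z) := by
    refine (dQ_moment k w Q P ε1 hε0.le fun p hp => hw0 p (by omega)).trans ?_
    refine mul_le_mul_of_nonneg_left ?_ hPp.le
    have hQ1 : 1 ≤ Q := le_floor (by simpa using one_le_rpow hZ1 hE0.le)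
    set Y : ℝ := ((Q ^ k : ℕ) : ℝ) with hY
    have hY1 : 1 ≤ Y := by rw [hY]; exact_mod_cast Nat.one_le_pow _ _ hQ1
    have hYle : Y ≤ Z ^ (E * k) := by
      rw [rpow_mul hZ0.le, rpow_natCast, hY, Nat.cast_pow]
      gcongr
      exact floor_le (by positivity)
    have hx1 : 1 ≤ Y ^ ε1 := one_le_rpow hY1 hε0.le
    have hlog := Real.log_le_rpow_div (by linarith : 0 ≤ Y) hε0
    have hsq : Y ^ ε1 * Y ^ ε1 ≤ z := by
      rw [← rpow_add (by linarith)]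
      calc Y ^ (ε1 + ε1) ≤ (Z ^ (E * k)) ^ (ε1 + ε1) := rpow_le_rpow (by linarith) hYle (by linarith)
        _ = z := by
          rw [← rpow_mul hZ0.le, hz]; congr 1
          rw [hε1]; field_simp; ring
    calc Y ^ ε1 * (1 + log Y) ≤ Y ^ ε1 * (Y ^ ε1 + Y ^ ε1 / ε1) := by gcongr
      _ = M0 * (Y ^ ε1 * Y ^ ε1) := by rw [hM0]; ring
      _ ≤ _ := by gcongr
  set D := A * z with hD
  have hD0 : 0 < D := by positivity
  have hSS := dQ_SS w Q B Ξ D (M0 * z) hD0 hM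
  rw [← hR] at hSS
  have hbs := big_sum d w hd Ξ C Z (by linarith) hZ1 (by rw [← hE]; exact hP1)
  rw [← hE, ← hQ, ← hR] at hbs
  set Tot := ∑ n ∈ Ico 1 P, (dQ w Q n : ℝ) * ‖SS Ξ (n : ZMod P)‖ ^ 2 with hTot
  set Big := ∑ ξ ∈ Ξ, ∑ ξ' ∈ Ξ, ∑ q ∈ QQ w Q, ∑ j ∈ range (Lz Z + 1), 4 * C * (q:ℝ) ^ (-(c0 d)) * (1 / 2 ^ j) *
      (4 / (Kq P q j : ℝ) ^ 2 * ‖∑ k ∈ range (Kq P q j), (ZMod.stdAddChar (((k * q : ℕ) : ZMod P) * (ξ - ξ')) : ℂ)‖ ^ 2) with hBig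
  have hdual := dual_bound f ν hf hfν Ξ η hη0.le hΞ
  rw [← hR] at hdual
  have hpairs : ∑ ξ ∈ Ξ, ∑ ξ' ∈ Ξ, ‖ft ν (ξ - ξ')‖ ≤ η ^ 2 / 4 * R ^ 2 + Big := by
    have e : η ^ 2 / 4 * R ^ 2 = ∑ ξ ∈ Ξ, ∑ ξ' ∈ Ξ, η ^ 2 / 4 := by
      simp [sum_const]; ring
    rw [e, hBig, ← sum_add_distrib]
    refine sum_le_sum fun ξ _ => ?_
    rw [← sum_add_distrib]
    refine sum_le_sum fun ξ' _ => ?_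
    by_cases hb : η ^ 2 / 4 < ‖ft ν (ξ - ξ')‖
    · have := near_bound d w ν C θ η Z (by linarith) hη0 hZ hZ1 hθ (by rw [← hE]; exact hP1) (ξ - ξ') (hker _) hb
      rw [← hE, ← hQ] at this
      refine this.trans ?_
      have : 0 ≤ η ^ 2 / 4 := by positivity
      linarith
    · push Not at hb
      refine hb.trans ?_
      refine le_add_of_nonneg_right (sum_nonneg fun q _ => sum_nonneg fun j _ => ?_)
      positivity
  have hTot0 : 0 ≤ Tot := sum_nonneg fun _ _ => by positivity
  clear_value Big Tot
  have hBig0 : 0 ≤ η ^ 2 / 4 * R ^ 2 + Big := le_trans (sum_nonneg fun _ _ => sum_nonneg fun _ _ => norm_nonneg _) hpairs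
  have h1 : (η * R) ^ 2 ≤ 2 * (η ^ 2 / 4 * R ^ 2 + Big) := hdual.trans (mul_le_mul hmass hpairs (sum_nonneg fun _ _ => sum_nonneg fun _ _ => norm_nonneg _) (by norm_num))
  have hηZ : η ^ 2 * Z = 8 * C := by rw [hZ]; field_simp
  have hL := Lz_le Z hZ1
  have hC0 : 0 < C := by linarith
  have hBig2 : 4 * C * R ^ 2 ≤ 2 * Z * Big := by nlinarith
  have hBig3 : Big ≤ 512 * C * (64 * z) * Z ^ (E - 1) / P * (Z ^ E * R ^ 2 + 2 * (P * (D * R + M0 * z / D ^ B * R ^ 2))) := by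
    refine hbs.trans ?_
    have hx : 0 ≤ Z ^ E * R ^ 2 + 2 * Tot := by positivity
    refine mul_le_mul ?_ ?_ hx (by positivity)
    · refine div_le_div_of_nonneg_right ?_ hPp.le
      refine mul_le_mul_of_nonneg_right ?_ (by positivity)
      exact mul_le_mul_of_nonneg_left hL (by positivity)
    · linarith
  have eE : Z * Z ^ (E - 1) = Z ^ E := by
    rw [Real.rpow_sub_one hZ0.ne']; field_simp
  have hZE : 0 < Z ^ E := by positivity
  have h2 : R ^ 2 ≤ 2 ^ 14 * z * Z ^ E * (Z ^ E / P * R ^ 2 + 2 * (D * R) + 2 * (M0 * z / D ^ B) * R ^ 2) :=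
    lev_alg C Z z R D M0 Big P _ _ _ hC0 hZ0 hPp hBig2 eE hBig3
  have t1 : 2 ^ 14 * z * Z ^ E * (Z ^ E / P) ≤ 1 / 4 := by
    have : z * Z ^ E * Z ^ E ≤ Z ^ (2 * E + 1) := by
      rw [hz, ← rpow_add hZ0, ← rpow_add hZ0]
      exact rpow_le_rpow_of_exponent_le hZ1 (by linarith)
    rw [← mul_div_assoc, div_le_iff₀ hPp]
    linarith
  have t2 : 2 ^ 14 * z * Z ^ E * (2 * (M0 * z / D ^ B)) ≤ 1 / 4 := by
    have hDB : A * Z ^ ((d:ℝ) + 1) ≤ D ^ B := by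
      rw [hD, mul_pow]
      have e1 : z ^ B = Z ^ ((d:ℝ) + 1) := by
        rw [hz, ← rpow_natCast, ← rpow_mul hZ0.le, hB]; congr 1; push_cast; ring
      rw [e1]
      gcongr
      exact le_self_pow₀ hA1 (by omega)
    have e2 : z * Z ^ E * z ≤ Z ^ ((d:ℝ) + 1) := by
      rw [hz, ← rpow_add hZ0, ← rpow_add hZ0]
      exact rpow_le_rpow_of_exponent_le hZ1 (by rw [hE]; linarith)
    have hDB0 : 0 < D ^ B := by positivity
    have : 2 ^ 14 * z * Z ^ E * (2 * (M0 * z / D ^ B)) = 2 ^ 15 * M0 * (z * Z ^ E * z) / D ^ B := by ring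
    rw [this, div_le_iff₀ hDB0]
    have e3 : A * (z * Z ^ E * z) ≤ D ^ B := le_trans (by gcongr) hDB
    rw [hA] at e3
    linarith
  have hzz : z * Z ^ E * z = Z ^ ((d:ℝ) + 3/16) := by
    rw [hz, ← rpow_add hZ0, ← rpow_add hZ0, hE]; congr 1; ring
  have h3 : R ^ 2 ≤ 2 ^ 16 * A * Z ^ ((d:ℝ) + 3/16) * R := by
    rw [← hzz]
    have hR2 : 0 ≤ R ^ 2 := by positivity
    have e : 2 ^ 14 * z * Z ^ E * (Z ^ E / P * R ^ 2 + 2 * (D * R) + 2 * (M0 * z / D ^ B) * R ^ 2) =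
      (2 ^ 14 * z * Z ^ E * (Z ^ E / P)) * R ^ 2 + (2 ^ 14 * z * Z ^ E * (2 * (M0 * z / D ^ B))) * R ^ 2 + 2 ^ 15 * A * (z * Z ^ E * z) * R := by
      rw [hD]; ring
    rw [e] at h2
    have a1 := mul_le_mul_of_nonneg_right t1 hR2
    have a2 := mul_le_mul_of_nonneg_right t2 hR2
    linarith
  rcases hR0.eq_or_lt with h | h
  · rw [← h]; positivity
  · rw [sq] at h3
    exact le_of_mul_le_mul_right h3 h

theorem restr (d T s : ℕ) (hd : 1 ≤ d) (hT : d ≤ T) (hs : 2 * T + 1 ≤ s) : ∃ w0 : ℕ, ∀ C : ℝ, 1 ≤ C → ∃ C' : ℝ, 1 ≤ C' ∧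
    ∀ w : ℕ, w0 ≤ w → ∀ (P : ℕ) [NeZero P] (f ν : ZMod P → ℝ) (θ η : ℝ),
    (∀ m, 0 ≤ f m) → (∀ m, f m ≤ ν m) → (∑ m, ν m) / P ≤ 2 →
    (∀ ζ : ZMod P, ∃ (a : ℤ) (q : ℕ), 1 ≤ q ∧ (∀ p, p.Prime → p ∣ q → w < p) ∧
      ‖ft ν ζ‖ ≤ C * (q:ℝ) ^ (-(c0 d)) / (1 + P * |(ζ.val:ℝ) / P - a / q|) + θ) →
    0 < η → η ≤ 2 → θ ≤ η ^ 2 / 8 → 2 ^ 16 * (8 * C / η ^ 2) ^ (2 * ((d:ℝ) + 1/16) + 1) ≤ P →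
    η ^ (3/4:ℝ) * ∑ ξ, ‖ft f ξ‖ ^ (2 * T) ≤ 1 →
    ∑ ξ, ‖ft f ξ‖ ^ ((s:ℝ) - 1/4) ≤ C' := by
  obtain ⟨w0, K, hK, hlev⟩ := level_set d hd
  refine ⟨w0, fun C hC => ?_⟩
  set p : ℝ := (s:ℝ) - 1/4 with hp
  set E : ℝ := (d:ℝ) + 3/16 with hE
  have hE0 : 0 < E := by positivity
  have hs' : (2:ℝ) * T + 1 ≤ s := mod_cast hs
  have hT' : (d:ℝ) ≤ T := mod_cast hT
  have hp0 : (2:ℝ) * T + 3/4 ≤ p := by rw [hp]; linarith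
  have hp1 : 0 < p := by have : (0:ℝ) ≤ T := by positivity
                         linarith
  set r : ℝ := (1/2:ℝ) ^ (p - 2 * E) with hr
  have hr0 : 0 < r := by positivity
  have hr1 : r < 1 := Real.rpow_lt_one (by norm_num) (by norm_num) (by rw [hE]; linarith)
  have hC0 : 0 < C := by linarith
  set G1 : ℝ := 2 ^ p * K * (8 * C) ^ E * (1 - r)⁻¹ with hG1
  have hr1' : 0 < 1 - r := by linarith
  have hG10 : 0 ≤ G1 := by positivity
  set G2 : ℝ := 2 ^ (p - (2 * T + 3/4)) with hG2
  have hG20 : 0 ≤ G2 := by positivity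
  refine ⟨1 + G1 + G2, by linarith, fun w hw P _ f ν θ η hf hfν hmass hker hη0 hη2 hθ hP hsm => ?_⟩
  have hle2 : ∀ ξ, ‖ft f ξ‖ ≤ 2 := fun ξ => (ft_norm_le f hf ξ).trans
    (le_trans (div_le_div_of_nonneg_right (sum_le_sum fun m _ => hfν m) (by positivity)) hmass)
  generalize hF : (fun ξ => ‖ft f ξ‖) = F at *
  have hF' : ∀ ξ, ‖ft f ξ‖ = F ξ := fun ξ => by rw [← hF]
  simp only [hF'] at hsm hle2 ⊢
  have hF0 : ∀ ξ, 0 ≤ F ξ := fun ξ => by rw [← hF']; positivity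
  rw [← sum_filter_add_sum_filter_not univ (fun ξ => η ≤ F ξ)]
  have hsmall : ∑ ξ with ¬ η ≤ F ξ, F ξ ^ p ≤ G2 := by
    calc ∑ ξ with ¬ η ≤ F ξ, F ξ ^ p ≤ ∑ ξ with ¬ η ≤ F ξ, G2 * (η ^ (3/4:ℝ) * F ξ ^ (2 * T)) := by
          refine sum_le_sum fun ξ hξ => ?_
          have hξ' : F ξ < η := by simpa using hξ
          have e : p = (p - (2 * T + 3/4)) + (3/4) + ((2 * T : ℕ):ℝ) := by push_cast; ring
          have h0 := hF0 ξ
          rcases h0.eq_or_lt with h | h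
          · rw [← h, Real.zero_rpow hp1.ne']; positivity
          conv_lhs => rw [e, rpow_add h, rpow_add h, rpow_natCast]
          rw [hG2, mul_assoc]
          refine mul_le_mul (rpow_le_rpow h0 (hle2 ξ) (by linarith)) ?_ (by positivity) (by positivity)
          refine mul_le_mul_of_nonneg_right (rpow_le_rpow h0 hξ'.le (by norm_num)) (by positivity)
      _ ≤ ∑ ξ, G2 * (η ^ (3/4:ℝ) * F ξ ^ (2 * T)) := by
          refine sum_le_sum_of_subset_of_nonneg (filter_subset _ _) fun ξ _ _ => ?_
          have := hF0 ξ
          positivity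
      _ = G2 * (η ^ (3/4:ℝ) * ∑ ξ, F ξ ^ (2 * T)) := by rw [mul_sum, mul_sum]
      _ ≤ G2 * 1 := mul_le_mul_of_nonneg_left hsm hG20
      _ = G2 := mul_one _
  have hbig : ∑ ξ with η ≤ F ξ, F ξ ^ p ≤ G1 := by
    have hex : ∀ ξ, ∃ n : ℕ, η ≤ F ξ → (1/2:ℝ) ^ n ≤ F ξ ∧ F ξ ≤ 2 * (1/2) ^ n := by
      intro ξ
      by_cases h : η ≤ F ξ
      · obtain ⟨n, h1, h2⟩ := exists_nat_pow_near_of_lt_one (x := F ξ / 2) (y := (1/2:ℝ)) (by linarith) (by have := hle2 ξ; linarith) (by norm_num) (by norm_num)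
        refine ⟨n, fun _ => ⟨?_, by linarith⟩⟩
        rw [pow_succ] at h1
        linarith
      · exact ⟨0, fun h' => absurd h' h⟩
    choose n hn using hex
    set I := univ.sup n + 1 with hI
    have hnI : ∀ ξ, n ξ ∈ range I := fun ξ => mem_range.2 (Nat.lt_succ_of_le (le_sup (f := n) (mem_univ ξ)))
    let Tm : ℕ → ℝ := fun i => 2 ^ p * ((1/2:ℝ) ^ i) ^ p
    have hTm0 : ∀ i, 0 ≤ Tm i := fun i => by simp only [Tm]; positivity
    have hcard : ∀ i, Tm i * #({ξ | η ≤ F ξ ∧ (1/2:ℝ) ^ i ≤ F ξ} : Finset (ZMod P)) ≤ 2 ^ p * K * (8 * C) ^ E * r ^ i := by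
      intro i
      set η' := max η ((1/2:ℝ) ^ i) with hη'
      have hi1 : (1/2:ℝ) ^ i ≤ 1 := pow_le_one₀ (by norm_num) (by norm_num)
      have hge : η ≤ η' := le_max_left _ _
      have hge2 : (1/2:ℝ) ^ i ≤ η' := le_max_right _ _
      have hη'0 : 0 < η' := by linarith
      have hsq : η ^ 2 ≤ η' ^ 2 := by gcongr
      have hc := hlev w hw P f ν C θ η' hC hf hfν hmass hker hη'0 (max_le hη2 (by linarith)) (by linarith)
        (le_trans (by gcongr) hP) ({ξ | η ≤ F ξ ∧ (1/2:ℝ) ^ i ≤ F ξ} : Finset (ZMod P)) (by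
          intro ξ hξ
          rw [hF']
          simp only [mem_filter, mem_univ, true_and] at hξ
          exact max_le hξ.1 hξ.2)
      have hc2 : (8 * C / η' ^ 2) ^ E ≤ (8 * C) ^ E * ((1/2:ℝ) ^ i) ^ (-(2 * E)) := by
        have : 8 * C / η' ^ 2 ≤ 8 * C / ((1/2:ℝ) ^ i) ^ 2 := by gcongr
        refine (rpow_le_rpow (by positivity) this hE0.le).trans_eq ?_
        rw [Real.div_rpow (by positivity) (by positivity), rpow_neg (by positivity), rpow_mul (by positivity), div_eq_mul_inv]
        norm_num
      calc Tm i * #({ξ | η ≤ F ξ ∧ (1/2:ℝ) ^ i ≤ F ξ} : Finset (ZMod P)) ≤ Tm i * (K * ((8 * C) ^ E * ((1/2:ℝ) ^ i) ^ (-(2 * E)))) := by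
            refine mul_le_mul_of_nonneg_left (hc.trans ?_) (hTm0 i)
            gcongr
        _ = 2 ^ p * K * (8 * C) ^ E * (((1/2:ℝ) ^ i) ^ p * ((1/2:ℝ) ^ i) ^ (-(2 * E))) := by simp only [Tm]; ring
        _ = _ := by
            rw [← rpow_add (by positivity), hr, ← rpow_natCast, ← rpow_natCast, ← rpow_mul (by norm_num), ← rpow_mul (by norm_num)]
            congr 2; ring
    calc ∑ ξ with η ≤ F ξ, F ξ ^ p ≤ ∑ ξ with η ≤ F ξ, ∑ i ∈ range I, if (1/2:ℝ) ^ i ≤ F ξ then Tm i else 0 := by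
          refine sum_le_sum fun ξ hξ => ?_
          have hξ' : η ≤ F ξ := by simpa using hξ
          obtain ⟨h1, h2⟩ := hn ξ hξ'
          refine le_trans ?_ (single_le_sum (f := fun i => if (1/2:ℝ) ^ i ≤ F ξ then Tm i else 0) (fun i _ => ?_) (hnI ξ))
          · simp only [if_pos h1, Tm]
            rw [← mul_rpow (by norm_num) (by positivity)]
            exact rpow_le_rpow (hF0 ξ) h2 hp1.le
          · split_ifs
            · exact hTm0 i
            · exact le_rfl
      _ = ∑ i ∈ range I, Tm i * #({ξ | η ≤ F ξ ∧ (1/2:ℝ) ^ i ≤ F ξ} : Finset (ZMod P)) := by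
          rw [sum_comm]
          refine sum_congr rfl fun i _ => ?_
          rw [← sum_filter, filter_filter, sum_const, nsmul_eq_mul, mul_comm]
      _ ≤ ∑ i ∈ range I, 2 ^ p * K * (8 * C) ^ E * r ^ i := sum_le_sum fun i _ => hcard i
      _ = 2 ^ p * K * (8 * C) ^ E * ∑ i ∈ range I, r ^ i := by rw [mul_sum]
      _ ≤ G1 := by
          rw [hG1]
          refine mul_le_mul_of_nonneg_left ?_ (by positivity)
          rw [← tsum_geometric_of_lt_one hr0.le hr1]
          exact (summable_geometric_of_lt_one hr0.le hr1).sum_le_tsum _ fun _ _ => by positivity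
  linarith

section push
variable {P : ℕ} [NeZero P]

noncomputable def pf {ι : Type*} (X : ℕ) (S : Finset ι) (g : ι → ℝ) (φ : ι → ℤ) (m : ZMod P) : ℝ :=
  ((P:ℝ) / X) * ∑ i ∈ S.filter (fun i => ((φ i : ℤ) : ZMod P) = m), g i

lemma chi_ee (n : ℤ) (ξ : ZMod P) : (ZMod.stdAddChar (((n:ℤ):ZMod P) * ξ) : ℂ) = ee ((ξ.val:ℝ) / P * n) := by
  have := ee_eq_stdAddChar P (n * (ξ.val : ℤ))
  rw [Int.cast_mul, Int.cast_mul, cast_natCast, cast_natCast, ZMod.natCast_zmod_val] at this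
  rw [← this]; congr 1; ring

lemma sum_fiber {ι : Type*} {E : Type*} [AddCommMonoid E] (S : Finset ι) (φ : ι → ZMod P) (g : ι → E) :
    ∑ m, ∑ i ∈ S.filter (fun i => φ i = m), g i = ∑ i ∈ S, g i := by
  simp only [sum_filter]
  rw [sum_comm]
  refine sum_congr rfl fun i _ => ?_
  simp

lemma pf_ft {ι : Type*} (X : ℕ) (S : Finset ι) (g : ι → ℝ) (φ : ι → ℤ) (ξ : ZMod P) :
    ft (pf X S g φ) ξ = (∑ i ∈ S, (g i : ℂ) * ZMod.stdAddChar (((φ i : ℤ) : ZMod P) * ξ)) / X := by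
  unfold ft pf
  have hP := P_ne (P := P)
  rw [← sum_fiber (P := P) S (fun i => ((φ i : ℤ) : ZMod P))]
  rw [div_eq_iff hP, sum_div, sum_mul]
  refine sum_congr rfl fun m _ => ?_
  push_cast
  rw [mul_sum, sum_mul, sum_div, sum_mul]
  refine sum_congr rfl fun i hi => ?_
  rw [(mem_filter.1 hi).2]
  ring

lemma pf_sum {ι : Type*} (X : ℕ) (S : Finset ι) (g : ι → ℝ) (φ : ι → ℤ) :
    (∑ m : ZMod P, pf X S g φ m) / P = (∑ i ∈ S, g i) / X := by
  have hP := (P_pos (P := P)).ne'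
  unfold pf
  rw [← mul_sum, sum_fiber (P := P) S (fun i => ((φ i : ℤ) : ZMod P))]
  field_simp

lemma pf_nonneg {ι : Type*} (X : ℕ) (S : Finset ι) (g : ι → ℝ) (φ : ι → ℤ) (hg : ∀ i ∈ S, 0 ≤ g i) (m : ZMod P) :
    0 ≤ pf X S g φ m :=
  mul_nonneg (by positivity) (sum_nonneg fun i hi => hg i (mem_filter.1 hi).1)

lemma pf_mono {ι : Type*} (X : ℕ) (S S' : Finset ι) (g g' : ι → ℝ) (φ : ι → ℤ) (hS : S ⊆ S') (hg : ∀ i ∈ S, g i ≤ g' i)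
    (hg' : ∀ i ∈ S', 0 ≤ g' i) (m : ZMod P) :
    pf X S g φ m ≤ pf X S' g' φ m := by
  refine mul_le_mul_of_nonneg_left ?_ (by positivity)
  refine (sum_le_sum fun i hi => hg i (mem_filter.1 hi).1).trans ?_
  exact sum_le_sum_of_subset_of_nonneg (filter_subset_filter _ hS) fun i hi _ => hg' i (mem_filter.1 hi).1

noncomputable def GS (S : Finset ℕ) (φ : ℕ → ℤ) (ξ : ZMod P) : ℂ := ∑ y ∈ S, ZMod.stdAddChar (((φ y : ℤ) : ZMod P) * ξ)

lemma GS_le (S : Finset ℕ) (φ : ℕ → ℤ) (ξ : ZMod P) : ‖GS S φ ξ‖ ≤ S.card := by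
  refine (norm_sum_le _ _).trans ?_
  simp [chi_norm]

lemma GS_neg (S : Finset ℕ) (φ : ℕ → ℤ) (ξ : ZMod P) : GS S φ (-ξ) = conj (GS S φ ξ) := by
  unfold GS
  rw [map_sum]
  refine sum_congr rfl fun y _ => ?_
  rw [mul_neg, chi_neg]

lemma pf_ft_const (X : ℕ) (S : Finset ℕ) (J : ℝ) (φ : ℕ → ℤ) (ξ : ZMod P) :
    ft (pf X S (fun _ => J) φ) ξ = (J / X : ℝ) * GS S φ ξ := by
  rw [pf_ft, ← mul_sum, GS]; push_cast; ring

lemma count_pi {ι : Type*} [Fintype ι] [DecidableEq ι] (S : ι → Finset ℕ) (φ : ℕ → ℤ) (a : ι → ZMod P) :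
    ((#((Fintype.piFinset S).filter (fun y => ∑ i, a i * ((φ (y i) : ℤ) : ZMod P) = 0)) : ℕ) : ℂ) * P
      = ∑ ξ : ZMod P, ∏ i, GS (S i) φ (a i * ξ) := by
  have h1 : ∀ ξ : ZMod P, ∏ i, GS (S i) φ (a i * ξ) = ∑ y ∈ Fintype.piFinset S, (ZMod.stdAddChar ((∑ i, a i * ((φ (y i) : ℤ) : ZMod P)) * ξ) : ℂ) := by
    intro ξ
    unfold GS
    rw [prod_univ_sum]
    refine sum_congr rfl fun y _ => ?_
    rw [sum_mul, addChar_map_sum]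
    refine prod_congr rfl fun i _ => ?_
    congr 1; ring
  simp only [h1]
  rw [sum_comm]
  simp only [chi_orth]
  rw [← sum_filter, sum_const, nsmul_eq_mul]

/-- lam for a push-forward of a constant weight -/
lemma lam_pf {s : ℕ} (X : ℕ) (S : Finset ℕ) (J : ℝ) (φ : ℕ → ℤ) (a : Fin s → ZMod P) :
    lam a (pf X S (fun _ => J) φ) * P = (P:ℝ) ^ s * (J / X) ^ s *
      (#((Fintype.piFinset fun _ : Fin s => S).filter (fun y => ∑ i, a i * ((φ (y i) : ℤ) : ZMod P) = 0)) * P) := by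
  have h1 := count_fourier a (pf X S (fun _ => J) φ)
  have h2 := count_pi (fun _ : Fin s => S) φ a
  have : ((lam a (pf X S (fun _ => J) φ) * P : ℝ) : ℂ) = ((P:ℝ) ^ s * (J / X) ^ s *
      (#((Fintype.piFinset fun _ : Fin s => S).filter (fun y => ∑ i, a i * ((φ (y i) : ℤ) : ZMod P) = 0)) * P) : ℝ) := by
    rw [ofReal_mul, lam, ofReal_natCast, h1]
    rw [ofReal_mul, ofReal_mul ((#_ : ℕ) : ℝ), ofReal_natCast, ofReal_natCast, h2]
    simp only [pf_ft_const, prod_mul_distrib, prod_const, card_univ, Fintype.card_fin]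
    rw [← mul_sum]
    push_cast; ring
  exact_mod_cast this

lemma moment_eq (T : ℕ) (S : Finset ℕ) (φ : ℕ → ℤ) :
    ∑ ξ : ZMod P, ‖GS S φ ξ‖ ^ (2 * T) = #((Fintype.piFinset fun _ : Fin T ⊕ Fin T => S).filter
      (fun y => ∑ i, (Sum.elim (fun _ => 1) (fun _ => -1) i : ZMod P) * ((φ (y i) : ℤ) : ZMod P) = 0)) * (P:ℝ) := by
  have h := count_pi (fun _ : Fin T ⊕ Fin T => S) φ (fun i => (Sum.elim (fun _ => 1) (fun _ => -1) i : ZMod P))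
  have h2 : (∑ ξ : ZMod P, ∏ i : Fin T ⊕ Fin T, GS S φ ((Sum.elim (fun _ => 1) (fun _ => -1) i : ZMod P) * ξ)) =
      ((∑ ξ : ZMod P, ‖GS S φ ξ‖ ^ (2 * T) : ℝ) : ℂ) := by
    rw [ofReal_sum]
    refine sum_congr rfl fun ξ _ => ?_
    rw [Fintype.prod_sum_type]
    simp only [Sum.elim_inl, Sum.elim_inr, one_mul, neg_one_mul, GS_neg, prod_const, card_univ, Fintype.card_fin]
    rw [← mul_pow, Complex.mul_conj, pow_mul, normSq_eq_norm_sq]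
    push_cast; ring
  rw [h2] at h
  exact_mod_cast h.symm

end push

section H
variable {d : ℕ} {B : ℝ} {X : ℕ} {H : ℤ[X]}

lemma NiceH.le_of_le (h : NiceH d B X H) : ∀ y' : ℕ, y' ≤ X → ∀ y : ℕ, y ≤ y' → H.eval (y:ℤ) ≤ H.eval (y':ℤ) := by
  intro y'
  induction y' with
  | zero => intro _ y hy; rw [Nat.le_zero.1 hy]
  | succ n ih =>
    intro hn y hy
    rcases Nat.lt_or_ge y (n+1) with h1 | h1
    · exact (ih (by omega) y (by omega)).trans (h.mono n (by omega)).le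
    · rw [show y = n + 1 by omega]

lemma NiceH.gap_ge (h : NiceH d B X H) : ∀ y : ℕ, y < X → H.eval 1 - H.eval 0 ≤ H.eval ((y+1:ℕ):ℤ) - H.eval (y:ℤ) := by
  intro y
  induction y with
  | zero => intro _; simp
  | succ n ih => intro hn; exact (ih (by omega)).trans (h.gap n (by omega))

lemma NiceH.gap_mul_le (h : NiceH d B X H) : (X:ℤ) * (H.eval 1 - H.eval 0) ≤ H.eval (X:ℤ) - H.eval 0 := by
  have : ∀ n : ℕ, n ≤ X → (n:ℤ) * (H.eval 1 - H.eval 0) ≤ H.eval (n:ℤ) - H.eval 0 := by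
    intro n
    induction n with
    | zero => simp
    | succ n ih =>
      intro hn
      have h1 := ih (by omega)
      have h2 := h.gap_ge n (by omega)
      push_cast at *
      linarith
  exact this X le_rfl

/-- index set for the spread-out density -/
noncomputable def spS (H : ℤ[X]) (X : ℕ) : Finset (Σ _ : ℕ, ℤ) :=
  (range X).sigma (fun y => Ico (H.eval (y:ℤ)) (H.eval ((y+1:ℕ):ℤ)))

noncomputable def spg (H : ℤ[X]) (i : Σ _ : ℕ, ℤ) : ℝ := 1 / (((H.eval ((i.1+1:ℕ):ℤ) : ℤ):ℝ) - (H.eval (i.1:ℤ) : ℤ))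

lemma psi_ft {P : ℕ} [NeZero P] (ξ : ZMod P) : ft (pf X (spS H X) (spg H) (fun i => i.2)) ξ = Psis H X ((ξ.val:ℝ) / P) / X := by
  rw [pf_ft, Psis, spS, sum_sigma]
  congr 1
  refine sum_congr rfl fun y _ => ?_
  rw [mul_sum]
  refine sum_congr rfl fun n _ => ?_
  rw [chi_ee, spg]
  push_cast
  rfl

lemma psi_le {P : ℕ} [NeZero P] (h : NiceH d B X H) (h0 : H.eval 0 = 0) (hX : 1 ≤ X) (hP : H.eval (X:ℤ) ≤ P) (m : ZMod P) :
    pf X (spS H X) (spg H) (fun i => i.2) m ≤ (P:ℝ) / X * (1 / (((H.eval 1 : ℤ):ℝ) - (H.eval 0 : ℤ))) := by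
  refine mul_le_mul_of_nonneg_left ?_ (by positivity)
  set F := (spS H X).filter (fun i => ((i.2 : ℤ) : ZMod P) = m) with hF
  have hmem : ∀ i ∈ F, i.1 < X ∧ H.eval (i.1:ℤ) ≤ i.2 ∧ i.2 < H.eval ((i.1+1:ℕ):ℤ) ∧ ((i.2 : ℤ) : ZMod P) = m := by
    intro i hi
    simp only [hF, spS, mem_filter, mem_sigma, mem_range, mem_Ico] at hi
    tauto
  have hrng : ∀ i ∈ F, 0 ≤ i.2 ∧ i.2 < P := by
    intro i hi
    obtain ⟨h1, h2, h3, -⟩ := hmem i hi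
    have a1 := h.le_of_le i.1 h1.le 0 (Nat.zero_le _)
    have a2 := h.le_of_le X le_rfl (i.1+1) h1
    simp only [Nat.cast_zero, h0] at a1
    exact ⟨by linarith, by linarith⟩
  have hcard : F.card ≤ 1 := by
    rw [card_le_one]
    intro i hi j hj
    obtain ⟨h1, h2, h3, h4⟩ := hmem i hi
    obtain ⟨k1, k2, k3, k4⟩ := hmem j hj
    have e : i.2 = j.2 := by
      have := (ZMod.intCast_eq_intCast_iff' _ _ P).1 (h4.trans k4.symm)
      rwa [Int.emod_eq_of_lt (hrng i hi).1 (hrng i hi).2, Int.emod_eq_of_lt (hrng j hj).1 (hrng j hj).2] at this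
    have e1 : i.1 = j.1 := by
      rcases lt_trichotomy i.1 j.1 with hl | hl | hl
      · have := h.le_of_le j.1 k1.le (i.1+1) hl
        omega
      · exact hl
      · have := h.le_of_le i.1 h1.le (j.1+1) hl
        omega
    obtain ⟨i1, i2⟩ := i
    obtain ⟨j1, j2⟩ := j
    simp only at e e1
    subst e; subst e1; rfl
  have hg := h.gap_pos hX
  have hle : ∀ i ∈ F, spg H i ≤ 1 / (((H.eval 1 : ℤ):ℝ) - (H.eval 0 : ℤ)) := by
    intro i hi
    have := h.gap_ge i.1 (hmem i hi).1
    have h' : (((H.eval 1 : ℤ):ℝ) - (H.eval 0 : ℤ)) ≤ (((H.eval ((i.1+1:ℕ):ℤ) : ℤ):ℝ) - (H.eval (i.1:ℤ) : ℤ)) := mod_cast this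
    exact one_div_le_one_div_of_le hg h'
  refine (sum_le_card_nsmul F _ _ hle).trans ?_
  rw [nsmul_eq_mul]
  have : (F.card:ℝ) ≤ 1 := mod_cast hcard
  have h1 : 0 ≤ 1 / (((H.eval 1 : ℤ):ℝ) - (H.eval 0 : ℤ)) := by positivity
  nlinarith

end H

lemma degen {P : ℕ} [hP : Fact P.Prime] {s : ℕ} (S : Finset ℕ) (φ : ℕ → ℤ) (a : Fin s → ZMod P) (ha : ∀ i, a i ≠ 0)
    (i j : Fin s) (hij : i ≠ j) :
    (#((Fintype.piFinset fun _ : Fin s => S).filter (fun y => y i = y j ∧ ∑ k, a k * ((φ (y k) : ℤ) : ZMod P) = 0)) : ℝ) * P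
      ≤ #S * (s * ∑ ξ : ZMod P, ‖GS S φ ξ‖ ^ (s - 2)) := by
  classical
  let Sv : ℕ → Fin s → Finset ℕ := fun v k => if k = i ∨ k = j then {v} else S
  have hsub : (Fintype.piFinset fun _ : Fin s => S).filter (fun y => y i = y j ∧ ∑ k, a k * ((φ (y k) : ℤ) : ZMod P) = 0) ⊆
      S.biUnion (fun v => (Fintype.piFinset (Sv v)).filter (fun y => ∑ k, a k * ((φ (y k) : ℤ) : ZMod P) = 0)) := by
    intro y hy
    simp only [mem_filter, Fintype.mem_piFinset] at hy
    simp only [mem_biUnion, mem_filter, Fintype.mem_piFinset]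
    refine ⟨y i, hy.1 i, fun k => ?_, hy.2.2⟩
    simp only [Sv]
    split_ifs with hk
    · rcases hk with hk | hk
      · rw [hk]; simp
      · rw [hk, ← hy.2.1]; simp
    · exact hy.1 k
  have hv : ∀ v ∈ S, (#((Fintype.piFinset (Sv v)).filter (fun y => ∑ k, a k * ((φ (y k) : ℤ) : ZMod P) = 0)) : ℝ) * P ≤
      s * ∑ ξ : ZMod P, ‖GS S φ ξ‖ ^ (s - 2) := by
    intro v _
    have h := count_pi (Sv v) φ a
    have h2 : (#((Fintype.piFinset (Sv v)).filter (fun y => ∑ k, a k * ((φ (y k) : ℤ) : ZMod P) = 0)) : ℝ) * P =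
        ‖∑ ξ : ZMod P, ∏ k, GS (Sv v k) φ (a k * ξ)‖ := by
      rw [← h, norm_mul, Complex.norm_natCast, Complex.norm_natCast]
    rw [h2]
    have hterm : ∀ ξ : ZMod P, ‖∏ k, GS (Sv v k) φ (a k * ξ)‖ ≤ ∑ k, ‖GS S φ (a k * ξ)‖ ^ (s - 2) := by
      intro ξ
      rw [norm_prod]
      obtain ⟨k0, -, hk0⟩ := exists_max_image (univ : Finset (Fin s)) (fun k => ‖GS S φ (a k * ξ)‖) ⟨i, mem_univ i⟩
      set U : Finset (Fin s) := (univ.erase i).erase j with hU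
      have hUc : U.card = s - 2 := by
        rw [hU, card_erase_of_mem (mem_erase.2 ⟨hij.symm, mem_univ _⟩), card_erase_of_mem (mem_univ _), card_univ, Fintype.card_fin]
        omega
      have e1 : ∏ k, ‖GS (Sv v k) φ (a k * ξ)‖ ≤ ∏ k ∈ U, ‖GS S φ (a k * ξ)‖ := by
        rw [← mul_prod_erase univ _ (mem_univ i), ← mul_prod_erase (univ.erase i) _ (mem_erase.2 ⟨hij.symm, mem_univ j⟩), ← hU]
        have b1 : ‖GS (Sv v i) φ (a i * ξ)‖ ≤ 1 := (GS_le _ _ _).trans (by simp [Sv])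
        have b2 : ‖GS (Sv v j) φ (a j * ξ)‖ ≤ 1 := (GS_le _ _ _).trans (by simp [Sv])
        have b3 : ∏ k ∈ U, ‖GS (Sv v k) φ (a k * ξ)‖ = ∏ k ∈ U, ‖GS S φ (a k * ξ)‖ := by
          refine prod_congr rfl fun k hk => ?_
          simp only [hU, mem_erase] at hk
          simp only [Sv, if_neg (show ¬ (k = i ∨ k = j) by tauto)]
        rw [b3]
        have b4 : 0 ≤ ∏ k ∈ U, ‖GS S φ (a k * ξ)‖ := prod_nonneg fun _ _ => norm_nonneg _
        have b5 := mul_le_mul_of_nonneg_right b2 b4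
        calc _ ≤ 1 * (1 * ∏ k ∈ U, ‖GS S φ (a k * ξ)‖) := mul_le_mul b1 b5 (by positivity) (by norm_num)
          _ = _ := by ring
      refine e1.trans ?_
      calc ∏ k ∈ U, ‖GS S φ (a k * ξ)‖ ≤ ∏ k ∈ U, ‖GS S φ (a k0 * ξ)‖ := prod_le_prod (fun _ _ => norm_nonneg _) fun k _ => hk0 k (mem_univ k)
        _ = ‖GS S φ (a k0 * ξ)‖ ^ (s - 2) := by rw [prod_const, hUc]
        _ ≤ _ := single_le_sum (f := fun k => ‖GS S φ (a k * ξ)‖ ^ (s - 2)) (fun _ _ => by positivity) (mem_univ k0)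
    refine (norm_sum_le _ _).trans ((sum_le_sum fun ξ _ => hterm ξ).trans ?_)
    rw [sum_comm]
    have : ∀ k : Fin s, ∑ ξ : ZMod P, ‖GS S φ (a k * ξ)‖ ^ (s - 2) = ∑ ξ : ZMod P, ‖GS S φ ξ‖ ^ (s - 2) := by
      intro k
      exact Fintype.sum_equiv (Equiv.mulLeft₀ (a k) (ha k)) _ _ fun ξ => rfl
    simp only [this, sum_const, card_univ, Fintype.card_fin, nsmul_eq_mul]
    exact le_rfl
  calc _ ≤ ((∑ v ∈ S, #((Fintype.piFinset (Sv v)).filter (fun y => ∑ k, a k * ((φ (y k) : ℤ) : ZMod P) = 0)) : ℕ) : ℝ) * P := by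
        refine mul_le_mul_of_nonneg_right ?_ (by positivity)
        exact_mod_cast (card_le_card hsub).trans card_biUnion_le
    _ = ∑ v ∈ S, (#((Fintype.piFinset (Sv v)).filter (fun y => ∑ k, a k * ((φ (y k) : ℤ) : ZMod P) = 0)) : ℝ) * P := by
        push_cast; rw [sum_mul]
    _ ≤ ∑ v ∈ S, s * ∑ ξ : ZMod P, ‖GS S φ ξ‖ ^ (s - 2) := sum_le_sum hv
    _ = _ := by rw [sum_const, nsmul_eq_mul]

def eT (T : ℕ) : Fin T ⊕ Fin T ≃ Fin (2 * T) := finSumFinEquiv.trans (finCongr (by omega))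

lemma eT_inl (T : ℕ) (i : Fin T) (h : i.1 < 2 * T) : (⟨i.1, h⟩ : Fin (2*T)) = eT T (Sum.inl i) := by
  ext; simp [eT]

lemma eT_inr (T : ℕ) (i : Fin T) (h : T + i.1 < 2 * T) : (⟨T + i.1, h⟩ : Fin (2*T)) = eT T (Sum.inr i) := by
  ext; simp [eT, add_comm]

lemma dmp_le (d T : ℕ) (h : DiagonalMomentProperty d T) : d ≤ T := by
  by_contra hlt
  push Not at hlt
  obtain ⟨C, hC, hb⟩ := h (Polynomial.X ^ d) (by simp) (1/2) (by norm_num)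
  obtain ⟨N, hN, hN1⟩ := ((ev_const (C + 1) (1/2) (by norm_num)).and (eventually_ge_atTop 1)).exists
  have h1 := hb N hN1
  have hN0 : (0:ℝ) < N := mod_cast hN1
  have hN1' : (1:ℝ) ≤ N := mod_cast hN1
  have h2 : N ^ T ≤ #(((Fintype.piFinset fun _ : Fin (2 * T) => Finset.Icc 1 N).filter
          (fun x => (∑ i : Fin T, (Polynomial.X ^ d : ℤ[X]).eval (x ⟨i.1, by have := i.isLt; omega⟩ : ℤ))
                  = ∑ i : Fin T, (Polynomial.X ^ d : ℤ[X]).eval (x ⟨T + i.1, by have := i.isLt; omega⟩ : ℤ)))) := by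
    have : N ^ T = #(Fintype.piFinset fun _ : Fin T => Finset.Icc 1 N) := by simp
    rw [this]
    refine card_le_card_of_injOn (fun y k => Sum.elim y y ((eT T).symm k)) ?_ ?_
    · intro y hy
      simp only [mem_coe, Fintype.mem_piFinset] at hy
      simp only [mem_coe, mem_filter, Fintype.mem_piFinset, eT_inl, eT_inr, Equiv.symm_apply_apply, Sum.elim_inl, Sum.elim_inr, and_true]
      intro k
      rcases (eT T).symm k with i | i <;> simpa using hy i
    · intro y _ y' _ hyy
      funext i
      have := congrFun hyy (eT T (Sum.inl i))
      simpa using this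
  have h3 : (N:ℝ) ^ T ≤ C * (N : ℝ) ^ ((2 * T : ℝ) - (d : ℝ) + 1/2) := le_trans (mod_cast h2) h1
  have hd : (T:ℝ) + 1 ≤ d := mod_cast hlt
  have h4 : (N : ℝ) ^ ((2 * T : ℝ) - (d : ℝ) + 1/2) * (N:ℝ) ^ (1/2:ℝ) ≤ (N:ℝ) ^ T := by
    rw [← rpow_add hN0, ← rpow_natCast]
    exact rpow_le_rpow_of_exponent_le hN1' (by linarith)
  have h5 : 0 < (N : ℝ) ^ ((2 * T : ℝ) - (d : ℝ) + 1/2) := by positivity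
  nlinarith

lemma dmp_count (d T : ℕ) (hmom : DiagonalMomentProperty d T) (h : ℤ[X]) (hdeg : h.natDegree = d) (ε : ℝ) (hε : 0 < ε) :
    ∃ C : ℝ, 1 ≤ C ∧ ∀ N : ℕ, 1 ≤ N → ∀ (P : ℕ) [NeZero P] (S : Finset ℕ) (φ : ℕ → ℤ) (b W : ℕ) (κ c M : ℤ), 1 ≤ W → κ ≠ 0 →
      (∀ y ∈ S, 1 ≤ b + W * y ∧ b + W * y ≤ N) → (∀ y ∈ S, h.eval ((b + W * y : ℕ) : ℤ) = c + κ * φ y) →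
      (∀ y ∈ S, 0 ≤ φ y ∧ φ y ≤ M) → T * M < P →
      ∑ ξ : ZMod P, ‖GS S φ ξ‖ ^ (2 * T) ≤ C * (N:ℝ) ^ ((2 * T : ℝ) - d + ε) * P := by
  obtain ⟨C, hC, hb⟩ := hmom h hdeg ε hε
  refine ⟨C + 1, by linarith, fun N hN P _ S φ b W κ c M hW hκ hrange hh hφ hP => ?_⟩
  rw [moment_eq]
  refine mul_le_mul_of_nonneg_right ?_ (by positivity)
  have h1 := hb N hN
  refine le_trans ?_ (h1.trans (mul_le_mul_of_nonneg_right (by linarith) (by positivity)))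
  rw [Nat.cast_le]
  refine card_le_card_of_injOn (fun y k => b + W * y ((eT T).symm k)) ?_ ?_
  · intro y hy
    simp only [mem_coe, mem_filter, Fintype.mem_piFinset] at hy
    obtain ⟨hyS, hy0⟩ := hy
    simp only [mem_coe, mem_filter, Fintype.mem_piFinset, mem_Icc]
    refine ⟨fun k => hrange _ (hyS _), ?_⟩
    simp only [eT_inl, eT_inr, Equiv.symm_apply_apply]
    rw [Fintype.sum_sum_type] at hy0
    simp only [Sum.elim_inl, Sum.elim_inr, one_mul, neg_one_mul, sum_neg_distrib] at hy0
    have hz : ∑ i : Fin T, φ (y (Sum.inl i)) = ∑ i : Fin T, φ (y (Sum.inr i)) := by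
      have hc : (((∑ i : Fin T, φ (y (Sum.inl i)) - ∑ i : Fin T, φ (y (Sum.inr i)) : ℤ)) : ZMod P) = 0 := by
        push_cast; rw [sub_eq_add_neg]; exact hy0
      rw [ZMod.intCast_zmod_eq_zero_iff_dvd] at hc
      have u1 : ∀ g : Fin T → Fin T ⊕ Fin T, 0 ≤ ∑ i : Fin T, φ (y (g i)) ∧ ∑ i : Fin T, φ (y (g i)) ≤ T * M := by
        intro g
        refine ⟨sum_nonneg fun i _ => (hφ _ (hyS _)).1, ?_⟩
        refine (sum_le_card_nsmul _ _ M fun i _ => (hφ _ (hyS _)).2).trans_eq ?_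
        simp
      have a1 := u1 Sum.inl
      have a2 := u1 Sum.inr
      have := Int.eq_zero_of_abs_lt_dvd hc (by rw [abs_lt]; constructor <;> linarith)
      linarith
    have e : ∀ g : Fin T → Fin T ⊕ Fin T, ∑ i : Fin T, h.eval ((b + W * y (g i) : ℕ) : ℤ) = T * c + κ * ∑ i : Fin T, φ (y (g i)) := by
      intro g
      rw [sum_congr rfl fun i _ => hh _ (hyS (g i)), sum_add_distrib, mul_sum]; simp
    have e1 := e Sum.inl
    have e2 := e Sum.inr
    rw [hz, ← e2] at e1
    exact e1
  · intro y _ y' _ hyy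
    funext i
    have := congrFun hyy (eT T i)
    simp only [Equiv.symm_apply_apply, add_right_inj] at this
    exact Nat.eq_of_mul_eq_mul_left hW this

lemma pow_sum {α : Type*} [Fintype α] (g : α → ℝ) (X : ℝ) (hX : 1 ≤ X) (hg0 : ∀ x, 0 ≤ g x) (hgX : ∀ x, g x ≤ X) (s T d : ℕ)
    (hd : 1 ≤ d) (hdT : d ≤ T) (hs : 2 * T + 1 ≤ s) (C3 P : ℝ) (hC3 : 0 ≤ C3) (hP : (Fintype.card α : ℝ) = P)
    (hM : ∑ x, g x ^ (2 * T) ≤ C3 * X ^ ((2 * T : ℝ) - d + 1/8) * P) :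
    ∑ x, g x ^ (s - 2) ≤ (C3 + 1) * X ^ ((s:ℝ) - 1 - d - 3/8) * P := by
  have hX0 : 0 < X := by linarith
  have hdT' : (d:ℝ) ≤ T := mod_cast hdT
  set u := X ^ (1/2:ℝ) with hu
  have hu0 : 0 < u := by positivity
  set Y := X ^ (s - 1 - 2 * T) with hY
  have hY0 : 0 < Y := by positivity
  have hterm : ∀ x, g x ^ (s - 2) ≤ Y * (u⁻¹ * g x ^ (2 * T) + u ^ (2 * T - 1)) := by
    intro x
    have e : s - 2 = (s - 1 - 2 * T) + (2 * T - 1) := by omega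
    rw [e, pow_add]
    refine mul_le_mul (pow_le_pow_left₀ (hg0 x) (hgX x) _) ?_ (pow_nonneg (hg0 x) _) hY0.le
    rcases le_total (g x) u with h | h
    · have h1 := pow_le_pow_left₀ (hg0 x) h (2 * T - 1)
      have : 0 ≤ u⁻¹ * g x ^ (2 * T) := mul_nonneg (by positivity) (pow_nonneg (hg0 x) _)
      linarith
    · have h1 : g x ^ (2 * T) = g x * g x ^ (2 * T - 1) := by rw [← pow_succ']; congr 1; omega
      have h2 : 1 ≤ u⁻¹ * g x := by rw [inv_mul_eq_div, le_div_iff₀ hu0]; linarith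
      have h3 : 0 ≤ g x ^ (2 * T - 1) := pow_nonneg (hg0 x) _
      have h4 : 0 ≤ u ^ (2 * T - 1) := by positivity
      rw [h1, ← mul_assoc]
      nlinarith
  have hs1 : ((s - 1 - 2 * T : ℕ):ℝ) = (s:ℝ) - 1 - 2 * T := by
    rw [Nat.sub_sub, Nat.cast_sub (by omega)]; push_cast; ring
  have hs2 : ((2 * T - 1 : ℕ):ℝ) = 2 * T - 1 := by
    rw [Nat.cast_sub (by omega)]; push_cast; ring
  have hY' : Y = X ^ ((s:ℝ) - 1 - 2 * T) := by rw [hY, ← rpow_natCast, hs1]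
  have hP0 : 0 ≤ P := by rw [← hP]; positivity
  calc ∑ x, g x ^ (s - 2) ≤ ∑ x, Y * (u⁻¹ * g x ^ (2 * T) + u ^ (2 * T - 1)) := sum_le_sum fun x _ => hterm x
    _ = Y * u⁻¹ * ∑ x, g x ^ (2 * T) + P * (Y * u ^ (2 * T - 1)) := by
        rw [← mul_sum, sum_add_distrib, ← mul_sum, sum_const, card_univ, nsmul_eq_mul, hP]; ring
    _ ≤ Y * u⁻¹ * (C3 * X ^ ((2 * T : ℝ) - d + 1/8) * P) + P * X ^ ((s:ℝ) - 1 - d - 3/8) := by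
        refine add_le_add (mul_le_mul_of_nonneg_left hM (by positivity)) (mul_le_mul_of_nonneg_left ?_ hP0)
        rw [hY', hu, ← rpow_natCast, ← rpow_mul hX0.le, ← rpow_add hX0, hs2]
        exact rpow_le_rpow_of_exponent_le hX (by linarith)
    _ = C3 * (Y * u⁻¹ * X ^ ((2 * T : ℝ) - d + 1/8)) * P + P * X ^ ((s:ℝ) - 1 - d - 3/8) := by ring
    _ = _ := by
        have : Y * u⁻¹ * X ^ ((2 * T : ℝ) - d + 1/8) = X ^ ((s:ℝ) - 1 - d - 3/8) := by
          rw [hY', hu, ← rpow_neg hX0.le, ← rpow_add hX0, ← rpow_add hX0]; congr 1; ring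
        rw [this]; ring

/-- removing degenerate solutions -/
lemma nondegen {P : ℕ} [hP : Fact P.Prime] {s : ℕ} (S : Finset ℕ) (φ : ℕ → ℤ) (a : Fin s → ℤ) (M : ℤ)
    (hM : ∀ y ∈ S, 0 ≤ φ y ∧ φ y ≤ M) (haP : (∑ i, |a i|) * M < P) (D : ℝ) (hD0 : 0 ≤ D)
    (hD : ∀ i j : Fin s, i ≠ j → (#((Fintype.piFinset fun _ : Fin s => S).filter (fun y => y i = y j ∧ ∑ k, (a k : ZMod P) * ((φ (y k) : ℤ) : ZMod P) = 0)) : ℝ) ≤ D) :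
    (#((Fintype.piFinset fun _ : Fin s => S).filter (fun y => ∑ k, (a k : ZMod P) * ((φ (y k) : ℤ) : ZMod P) = 0)) : ℝ) ≤
      #((Fintype.piFinset fun _ : Fin s => S).filter (fun y => (∀ i j : Fin s, i ≠ j → y i ≠ y j) ∧ ∑ k, a k * φ (y k) = 0)) + s ^ 2 * D := by
  classical
  let Dg : Fin s × Fin s → Finset (Fin s → ℕ) := fun ij =>
    (Fintype.piFinset fun _ : Fin s => S).filter (fun y => y ij.1 = y ij.2 ∧ ∑ k, (a k : ZMod P) * ((φ (y k) : ℤ) : ZMod P) = 0)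
  have hsub : (Fintype.piFinset fun _ : Fin s => S).filter (fun y => ∑ k, (a k : ZMod P) * ((φ (y k) : ℤ) : ZMod P) = 0) ⊆
      (Fintype.piFinset fun _ : Fin s => S).filter (fun y => (∀ i j : Fin s, i ≠ j → y i ≠ y j) ∧ ∑ k, a k * φ (y k) = 0) ∪
      (univ.offDiag).biUnion Dg := by
    intro y hy
    rw [mem_filter, Fintype.mem_piFinset] at hy
    obtain ⟨hyS, hy0⟩ := hy
    rw [mem_union]
    by_cases hinj : ∀ i j : Fin s, i ≠ j → y i ≠ y j
    · left
      rw [mem_filter, Fintype.mem_piFinset]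
      refine ⟨hyS, hinj, ?_⟩
      have hc : ((∑ k, a k * φ (y k) : ℤ) : ZMod P) = 0 := by push_cast; exact hy0
      rw [ZMod.intCast_zmod_eq_zero_iff_dvd] at hc
      refine Int.eq_zero_of_abs_lt_dvd hc (lt_of_le_of_lt ?_ haP)
      refine (abs_sum_le_sum_abs _ _).trans ?_
      rw [sum_mul]
      refine sum_le_sum fun k _ => ?_
      rw [abs_mul, abs_of_nonneg (hM _ (hyS k)).1]
      exact mul_le_mul_of_nonneg_left (hM _ (hyS k)).2 (abs_nonneg _)
    · right
      push Not at hinj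
      obtain ⟨i, j, hij, he⟩ := hinj
      rw [mem_biUnion]
      refine ⟨(i, j), by simp [hij], ?_⟩
      simp only [Dg, mem_filter, Fintype.mem_piFinset]
      exact ⟨hyS, he, hy0⟩
  have h1 : (#((univ.offDiag).biUnion Dg) : ℝ) ≤ s ^ 2 * D := by
    calc (#((univ.offDiag).biUnion Dg) : ℝ) ≤ ((∑ ij ∈ (univ : Finset (Fin s)).offDiag, #(Dg ij) : ℕ) : ℝ) := by exact_mod_cast card_biUnion_le
      _ = ∑ ij ∈ (univ : Finset (Fin s)).offDiag, (#(Dg ij) : ℝ) := by push_cast; rfl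
      _ ≤ ∑ ij ∈ (univ : Finset (Fin s)).offDiag, D := sum_le_sum fun ij hij => hD ij.1 ij.2 (by simpa using hij)
      _ = #((univ : Finset (Fin s)).offDiag) * D := by rw [sum_const, nsmul_eq_mul]
      _ ≤ s ^ 2 * D := by
        refine mul_le_mul_of_nonneg_right ?_ hD0
        rw [offDiag_card, card_univ, Fintype.card_fin]
        exact_mod_cast (Nat.sub_le _ _).trans_eq (sq s).symm
  have h2 := card_le_card hsub
  have h3 := card_union_le ((Fintype.piFinset fun _ : Fin s => S).filter (fun y => (∀ i j : Fin s, i ≠ j → y i ≠ y j) ∧ ∑ k, a k * φ (y k) = 0)) ((univ.offDiag).biUnion Dg)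
  have h4 : (#((Fintype.piFinset fun _ : Fin s => S).filter (fun y => ∑ k, (a k : ZMod P) * ((φ (y k) : ℤ) : ZMod P) = 0)) : ℝ) ≤
    #((Fintype.piFinset fun _ : Fin s => S).filter (fun y => (∀ i j : Fin s, i ≠ j → y i ≠ y j) ∧ ∑ k, a k * φ (y k) = 0)) + #((univ.offDiag).biUnion Dg) := by
    exact_mod_cast h2.trans h3
  linarith

lemma mom_alg (X J e C3 P K Mo : ℝ) (T d : ℕ) (hT : 1 ≤ T) (hX : 1 ≤ X) (hJ0 : 0 ≤ J) (he : 0 < e) (hC3 : 0 ≤ C3)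
    (hM : Mo ≤ C3 * X ^ ((2 * T : ℝ) - d + e / 4) * P) (hP : P ≤ K * X ^ d)
    (hJ : J ≤ X ^ (e / (8 * T))) (hK : C3 * K ≤ X ^ (e/4)) :
    (X ^ (-e)) ^ (3/4:ℝ) * ((J / X) ^ (2 * T) * Mo) ≤ 1 := by
  have hX0 : 0 < X := by linarith
  have hT' : (1:ℝ) ≤ T := mod_cast hT
  have h1 : (J / X) ^ (2 * T) ≤ X ^ (e/4) * X ^ (-(2 * T : ℝ)) := by
    rw [div_pow]
    have a1 : J ^ (2 * T) ≤ X ^ (e/4) := by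
      refine (pow_le_pow_left₀ hJ0 hJ _).trans_eq ?_
      rw [← rpow_natCast, ← rpow_mul hX0.le]
      congr 1; push_cast; field_simp; ring
    have a2 : X ^ (-(2 * T : ℝ)) = (X ^ (2 * T))⁻¹ := by
      rw [rpow_neg hX0.le, ← rpow_natCast]; push_cast; rfl
    rw [a2, ← div_eq_mul_inv]
    gcongr
  have h2 : Mo ≤ X ^ (e/4) * X ^ ((2 * T : ℝ) + e / 4) := by
    calc Mo ≤ C3 * X ^ ((2 * T : ℝ) - d + e / 4) * (K * X ^ d) := hM.trans (by gcongr)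
      _ = (C3 * K) * (X ^ ((2 * T : ℝ) - d + e / 4) * X ^ (d:ℝ)) := by rw [rpow_natCast]; ring
      _ = (C3 * K) * X ^ ((2 * T : ℝ) + e / 4) := by rw [← rpow_add hX0]; congr 2; ring
      _ ≤ _ := by gcongr
  have h3 : (X ^ (-e)) ^ (3/4:ℝ) = X ^ (-(3 * e / 4)) := by rw [← rpow_mul hX0.le]; congr 1; ring
  rw [h3]
  calc X ^ (-(3 * e / 4)) * ((J / X) ^ (2 * T) * Mo) ≤ X ^ (-(3 * e / 4)) * ((J / X) ^ (2 * T) * (X ^ (e/4) * X ^ ((2 * T : ℝ) + e / 4))) := by gcongr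
    _ ≤ X ^ (-(3 * e / 4)) * ((X ^ (e/4) * X ^ (-(2 * T : ℝ))) * (X ^ (e/4) * X ^ ((2 * T : ℝ) + e / 4))) := by gcongr
    _ = 1 := by
      rw [← rpow_add hX0, ← rpow_add hX0, ← rpow_add hX0, ← rpow_add hX0]
      rw [show (-(3 * e / 4) + (e / 4 + -(2 * T:ℝ) + (e / 4 + (2 * T + e / 4)))) = 0 by ring, Real.rpow_zero]

lemma fin_alg (X J c1 C3 P K n D : ℝ) (s d : ℕ) (hs : 1 ≤ s) (hX : 1 ≤ X) (hJ0 : 0 < J) (hc : 0 < c1) (hC3 : 0 ≤ C3) (hP0 : 0 < P)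
    (hP : P ≤ K * X ^ d) (hJ : J ≤ X ^ (1 / (8 * s) : ℝ)) (hn : c1 * X ^ s / (P * J ^ s) ≤ n + s ^ 2 * D)
    (hD : D ≤ s * (C3 + 1) * X ^ ((s:ℝ) - d - 3/8)) (hK : 2 * s ^ 3 * (C3 + 1) * K / c1 ≤ X ^ (1/4:ℝ)) :
    c1 / 2 * X ^ s / (P * J ^ s) ≤ n := by
  have hX0 : 0 < X := by linarith
  have hs' : (1:ℝ) ≤ s := mod_cast hs
  have hJs : J ^ s ≤ X ^ (1/8:ℝ) := by
    refine (pow_le_pow_left₀ hJ0.le hJ _).trans_eq ?_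
    rw [← rpow_natCast, ← rpow_mul hX0.le]
    congr 1; field_simp
  rw [div_le_iff₀ hc] at hK
  have key : s ^ 2 * D ≤ c1 / 2 * X ^ s / (P * J ^ s) := by
    rw [le_div_iff₀ (by positivity)]
    have hPJ : P * J ^ s ≤ K * X ^ d * X ^ (1/8:ℝ) := mul_le_mul hP hJs (by positivity) (le_trans hP0.le hP)
    calc s ^ 2 * D * (P * J ^ s) ≤ s ^ 2 * (s * (C3 + 1) * X ^ ((s:ℝ) - d - 3/8)) * (P * J ^ s) := by gcongr
      _ ≤ s ^ 2 * (s * (C3 + 1) * X ^ ((s:ℝ) - d - 3/8)) * (K * X ^ d * X ^ (1/8:ℝ)) := by gcongr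
      _ = (s ^ 3 * (C3 + 1) * K) * (X ^ ((s:ℝ) - d - 3/8) * X ^ (d:ℝ) * X ^ (1/8:ℝ)) := by rw [rpow_natCast]; ring
      _ = (s ^ 3 * (C3 + 1) * K) * X ^ ((s:ℝ) - 1/4) := by
          rw [← rpow_add hX0, ← rpow_add hX0]; congr 2; ring
      _ ≤ (X ^ (1/4:ℝ) * c1 / 2) * X ^ ((s:ℝ) - 1/4) := by
          refine mul_le_mul_of_nonneg_right ?_ (by positivity)
          linarith
      _ = c1 / 2 * (X ^ (1/4:ℝ) * X ^ ((s:ℝ) - 1/4)) := by ring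
      _ = c1 / 2 * X ^ s := by
          rw [← rpow_add hX0, ← rpow_natCast]; congr 2; ring
  have e : c1 * X ^ s / (P * J ^ s) = c1 / 2 * X ^ s / (P * J ^ s) + c1 / 2 * X ^ s / (P * J ^ s) := by ring
  linarith

set_option maxHeartbeats 4000000 in
theorem local_count (d T s : ℕ) (hd : 1 ≤ d) (hdT : d ≤ T) (hs : 2 * T + 1 ≤ s) (a : Fin s → ℤ) (ha : ∀ i, a i ≠ 0) (hsum : ∑ i, a i = 0) :
    ∃ ρ : ℝ, 0 < ρ ∧ ρ ≤ 1/32 ∧ ∀ δ : ℝ, 0 < δ → ∀ B2 : ℝ, 1 ≤ B2 → ∃ c : ℝ, 0 < c ∧ ∃ w0 : ℕ, ∀ w : ℕ, w0 ≤ w →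
      DiagonalMomentProperty d T → ∀ h : ℤ[X], h.natDegree = d → ∀ B : ℝ, 1 ≤ B → ∀ CJ : ℝ, ∀ᶠ X : ℕ in atTop,
      ∀ (W b P : ℕ) (H : ℤ[X]) (κ cc : ℤ), NiceH d B X H → RoughH d w W H → H.eval 0 = 0 → P.Prime →
      ((∑ i, |a i|) + T) * H.eval (X:ℤ) < P → (P:ℝ) ≤ B2 * (X * (((H.eval 1 : ℤ):ℝ) - (H.eval 0 : ℤ))) → 1 ≤ W → κ ≠ 0 →
      (b + W * X : ℝ) ≤ B * X → (∀ y : ℕ, h.eval ((b + W * y : ℕ):ℤ) = cc + κ * H.eval (y:ℤ)) →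
      ∀ A0 : Finset ℕ, A0 ⊆ range X → (∀ y ∈ A0, (b + W * y).Prime ∧ ⌊(X:ℝ)^ρ⌋₊ < b + W * y) →
      δ ≤ JJ W ⌊(X:ℝ)^ρ⌋₊ * #A0 / X → JJ W ⌊(X:ℝ)^ρ⌋₊ ≤ CJ * log X →
      c * (X:ℝ) ^ s / (P * JJ W ⌊(X:ℝ)^ρ⌋₊ ^ s) ≤
        #((Fintype.piFinset fun _ : Fin s => A0).filter (fun y => (∀ i j : Fin s, i ≠ j → y i ≠ y j) ∧ ∑ k, a k * H.eval ((y k : ℕ):ℤ) = 0)) := by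
  obtain ⟨ρ, hρ0, hρ1, ⟨wA, hA⟩, hcl⟩ := analytic d hd
  obtain ⟨wR, hR⟩ := restr d T s hd hdT hs
  refine ⟨ρ, hρ0, hρ1, fun δ hδ B2 hB2 => ?_⟩
  obtain ⟨C', hC', hR⟩ := hR (2 * B2) (by linarith)
  set C0 := max C' B2 with hC0
  obtain ⟨ε, hε, c1, hc1, htr⟩ := transference s (by omega) δ C0 hδ (le_trans hC' (le_max_left _ _))
  obtain ⟨wC, hcl⟩ := hcl ε hε
  refine ⟨c1 / 2, by positivity, max wA (max wR wC), fun w hw hmom h hdeg B hB CJ => ?_⟩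
  have hd1 : (1:ℝ) ≤ d := mod_cast hd
  have hT1 : (1:ℝ) ≤ T := mod_cast hd.trans hdT
  have hdT' : (d:ℝ) ≤ T := mod_cast hdT
  have hs1 : (1:ℝ) ≤ s := mod_cast (by omega : 1 ≤ s)
  set E : ℝ := 2 * ((d:ℝ) + 1/16) + 1 with hE
  have hE0 : 0 < E := by positivity
  set e : ℝ := min (ρ / 8) (1 / (4 * E)) with he
  have he0 : 0 < e := lt_min (by positivity) (by positivity)
  have he1 : e ≤ ρ / 8 := min_le_left _ _
  have he2 : e * E ≤ 1 / 4 := by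
    have : e ≤ 1 / (4 * E) := min_le_right _ _
    rw [le_div_iff₀ (by positivity)] at this
    linarith
  obtain ⟨C2, hC2, hcount⟩ := dmp_count d T hmom h hdeg (e/4) (by positivity)
  set C3 : ℝ := C2 * B ^ ((2 * T : ℝ) - d + e/4) with hC3
  have hB0 : 0 < B := by linarith
  have hC30 : 0 ≤ C3 := by positivity
  filter_upwards [hA w (by omega) B hB B2 hB2, hcl w (by omega) B hB, eventually_ge_atTop 1,
    ev_log CJ (e / (8 * T)) (by positivity), ev_log CJ (1 / (8 * s)) (by positivity), ev_const (C3 * (B2 * B)) (e/4) (by positivity),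
    ev_const (2 * s ^ 3 * (C3 + 1) * (B2 * B) / c1) (1/4) (by norm_num), ev_const 2 (7/8) (by norm_num),
    ev_const 8 (ρ/4) (by positivity), ev_const (2 ^ 16 * (8 * (2 * B2)) ^ E) (1/2) (by norm_num)]
    with X hXA hXC hX1 hXJ hXJ2 hXK hXK2 hX2 hX8 hXP W b P H κ cc hN hRo h0 hPpr hPa hPB hW hκ hbW hh A0 hA0 hA0p hδA hJ
  haveI : Fact P.Prime := ⟨hPpr⟩
  have hX1' : (1:ℝ) ≤ X := mod_cast hX1
  have hX0 : (0:ℝ) < X := by linarith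
  obtain ⟨hR1, hRX, -⟩ := floor_rpow_facts X hX1 ρ hρ0
  set R := ⌊(X:ℝ)^ρ⌋₊ with hRdef
  have hJ1 := JJ_ge_one W R hR1
  set J := JJ W R with hJdef
  set φ : ℕ → ℤ := fun y => H.eval (y:ℤ) with hφ
  set M : ℤ := H.eval (X:ℤ) with hM
  have hPp := P_pos (P := P)
  have hφM : ∀ y ∈ A0, 0 ≤ φ y ∧ φ y ≤ M := by
    intro y hy
    have hyX := mem_range.1 (hA0 hy)
    have a1 := hN.le_of_le y hyX.le 0 (Nat.zero_le _)
    have a2 := hN.le_of_le X le_rfl y hyX.le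
    simp only [Nat.cast_zero, h0] at a1
    exact ⟨a1, a2⟩
  have hgap := hN.gap_pos hX1
  have hgapZ : 1 ≤ H.eval 1 - H.eval 0 := by
    have : (0:ℤ) < H.eval 1 - H.eval 0 := mod_cast hgap
    omega
  have hMX : (X:ℤ) ≤ M := by
    have := hN.gap_mul_le
    rw [h0] at this
    rw [h0] at hgapZ
    nlinarith
  have hM1 : 1 ≤ M := le_trans (mod_cast hX1) hMX
  have hMP : M < P := by
    have a1 : (0:ℤ) ≤ ∑ i, |a i| := sum_nonneg fun _ _ => abs_nonneg _
    have a2 : (1:ℤ) ≤ T := mod_cast hd.trans hdT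
    nlinarith
  have hXP' : (X:ℝ) ≤ P := by
    have : (X:ℤ) ≤ P := by omega
    exact_mod_cast this
  have hT0 : (0:ℤ) ≤ T := by positivity
  have hsa0 : (0:ℤ) ≤ ∑ i, |a i| := sum_nonneg fun _ _ => abs_nonneg _
  have hPa1 : (∑ i, |a i|) * M < P := by nlinarith
  have hPT : T * M < P := by nlinarith
  have hPK : (P:ℝ) ≤ (B2 * B) * (X:ℝ) ^ d := by
    have h1 := hN.gap_mul_le
    have h2 : (X:ℝ) * (((H.eval 1 : ℤ):ℝ) - (H.eval 0 : ℤ)) ≤ ((H.eval (X:ℤ) : ℤ):ℝ) - (H.eval 0 : ℤ) := mod_cast h1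
    have h3 := hN.top
    calc (P:ℝ) ≤ B2 * (B * X ^ d) := hPB.trans (mul_le_mul_of_nonneg_left (h2.trans h3) (by linarith))
      _ = _ := by ring
  -- functions
  set f : ZMod P → ℝ := pf X A0 (fun _ => J) φ with hf
  set ν : ZMod P → ℝ := pf X (range X) (fun y => nu W b R y) φ with hν
  set ψ : ZMod P → ℝ := pf X (spS H X) (spg H) (fun i => i.2) with hψ
  have hf0 : ∀ m, 0 ≤ f m := pf_nonneg X A0 _ φ fun _ _ => by linarith
  have hfν : ∀ m, f m ≤ ν m := pf_mono X A0 (range X) _ _ φ hA0 (fun y hy => by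
    rw [nu_prime W b R y hR1 (hA0p y hy).1 (hA0p y hy).2]) (fun y _ => nu_nonneg _ _ _ _)
  have hmass : (∑ m, ν m) / P ≤ 2 := by
    rw [hν, pf_sum, div_le_iff₀ hX0]
    have h1 := (abs_le.1 (nu_mass W b R X hR1)).2
    have h2 : (R:ℝ) ^ 4 ≤ (X:ℝ) ^ (1/8:ℝ) := by
      calc (R:ℝ) ^ 4 ≤ ((X:ℝ)^ρ) ^ 4 := by gcongr
        _ = (X:ℝ) ^ (ρ * 4) := by rw [← rpow_natCast, ← rpow_mul hX0.le]; norm_num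
        _ ≤ _ := rpow_le_rpow_of_exponent_le hX1' (by linarith)
    have h3 : 2 * (X:ℝ) ^ (1/8:ℝ) ≤ X := by
      calc 2 * (X:ℝ) ^ (1/8:ℝ) ≤ (X:ℝ) ^ (7/8:ℝ) * (X:ℝ) ^ (1/8:ℝ) := by gcongr
        _ = X := by rw [← rpow_add hX0]; norm_num
    linarith
  have hftν : ∀ ξ, ft ν ξ = Vs W b R H X ((ξ.val:ℝ)/P) / X := by
    intro ξ
    rw [hν, pf_ft, Vs]
    congr 1
    refine sum_congr rfl fun y _ => ?_
    rw [chi_ee]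
  have hclose : ∀ ξ, ‖ft ν ξ - ft ψ ξ‖ ≤ ε := by
    intro ξ
    rw [hftν, hψ, psi_ft, ← sub_div, norm_div, Complex.norm_natCast, div_le_iff₀ hX0]
    exact hXC W b H hN hRo _
  have hker : ∀ ζ : ZMod P, ∃ (a : ℤ) (q : ℕ), 1 ≤ q ∧ (∀ p, p.Prime → p ∣ q → w < p) ∧
      ‖ft ν ζ‖ ≤ 2 * B2 * (q:ℝ) ^ (-(c0 d)) / (1 + P * |(ζ.val:ℝ) / P - a / q|) + (X:ℝ) ^ (-(ρ/2)) := by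
    intro ζ
    obtain ⟨a', q, h1, h2, h3⟩ := hXA W b H hN hRo P hPp.le hPB ((ζ.val:ℝ)/P)
    refine ⟨a', q, h1, h2, ?_⟩
    rw [hftν, norm_div, Complex.norm_natCast, div_le_iff₀ hX0, mul_comm _ (X:ℝ)]
    exact h3
  have hψ0 : ∀ m, ψ m ≤ C0 := by
    intro m
    refine (psi_le hN h0 hX1 hMP.le m).trans (le_trans ?_ (le_max_right _ _))
    rw [div_mul_div_comm, mul_one, div_le_iff₀ (by positivity)]
    exact hPB
  have hMo : ∑ ξ : ZMod P, ‖GS A0 φ ξ‖ ^ (2 * T) ≤ C3 * (X:ℝ) ^ ((2 * T : ℝ) - d + e/4) * P := by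
    have := hcount (b + W * X) (le_trans (Nat.mul_pos hW hX1) (Nat.le_add_left _ _)) P A0 φ b W κ cc M hW hκ (fun y hy => ⟨(hA0p y hy).1.one_lt.le, by
      have := mem_range.1 (hA0 hy)
      have := Nat.mul_le_mul_left W this.le
      omega⟩) (fun y _ => hh y) hφM hPT
    refine this.trans (mul_le_mul_of_nonneg_right ?_ hPp.le)
    rw [hC3, mul_assoc, ← mul_rpow hB0.le hX0.le]
    refine mul_le_mul_of_nonneg_left ?_ (by linarith)
    refine rpow_le_rpow (by positivity) (by push_cast; exact hbW) (by linarith)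
  have hftf : ∀ ξ, ‖ft f ξ‖ = J / X * ‖GS A0 φ ξ‖ := by
    intro ξ
    rw [hf, pf_ft_const, norm_mul, norm_real, norm_of_nonneg (by positivity)]
  have hrestr : ∑ ξ, ‖ft f ξ‖ ^ ((s:ℝ) - 1/4) ≤ C' := by
    refine hR w (by omega) P f ν ((X:ℝ) ^ (-(ρ/2))) ((X:ℝ) ^ (-e)) hf0 hfν hmass hker (by positivity) ?_ ?_ ?_ ?_
    · exact (Real.rpow_le_one_of_one_le_of_nonpos hX1' (by linarith)).trans (by norm_num)
    · rw [le_div_iff₀ (by norm_num)]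
      calc (X:ℝ) ^ (-(ρ/2)) * 8 ≤ (X:ℝ) ^ (-(ρ/2)) * (X:ℝ) ^ (ρ/4) := by gcongr
        _ = (X:ℝ) ^ (-(ρ/4)) := by rw [← rpow_add hX0]; congr 1; ring
        _ ≤ (X:ℝ) ^ (-e * 2) := rpow_le_rpow_of_exponent_le hX1' (by linarith)
        _ = _ := by rw [rpow_mul hX0.le]; norm_num
    · have e1 : 8 * (2 * B2) / ((X:ℝ) ^ (-e)) ^ 2 = 8 * (2 * B2) * (X:ℝ) ^ (e * 2) := by
        rw [div_eq_mul_inv, ← rpow_natCast, ← rpow_mul hX0.le, ← rpow_neg hX0.le]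
        congr 2; push_cast; ring
      rw [e1, mul_rpow (by positivity) (by positivity), ← mul_assoc, ← rpow_mul hX0.le]
      calc 2 ^ 16 * (8 * (2 * B2)) ^ E * (X:ℝ) ^ (e * 2 * E) ≤ (X:ℝ) ^ (1/2:ℝ) * (X:ℝ) ^ (1/2:ℝ) := by
            refine mul_le_mul hXP (rpow_le_rpow_of_exponent_le hX1' (by linarith)) (by positivity) (by positivity)
        _ = X := by rw [← rpow_add hX0]; norm_num
        _ ≤ P := hXP'
    · simp only [hftf, mul_pow]
      rw [← mul_sum]
      exact mom_alg X J e C3 P (B2 * B) _ T d (hd.trans hdT) hX1' (by linarith) he0 hC30 hMo hPK (hJ.trans hXJ) hXK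
  have haP : ∀ i, ((a i : ℤ) : ZMod P) ≠ 0 := by
    intro i hi
    rw [ZMod.intCast_zmod_eq_zero_iff_dvd] at hi
    refine ha i (Int.eq_zero_of_abs_lt_dvd hi ?_)
    have : |a i| ≤ ∑ i, |a i| := single_le_sum (f := fun i => |a i|) (fun _ _ => abs_nonneg _) (mem_univ i)
    nlinarith
  have hmain := htr P (fun i => ((a i : ℤ) : ZMod P)) haP (by rw [← Int.cast_sum, hsum, Int.cast_zero]) f ν ψ hf0 hfν (by
    rw [hf, pf_sum]; simpa [mul_comm] using hδA) hψ0 hclose (hrestr.trans (le_max_left _ _))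
  rw [mul_comm (P:ℝ), hf, lam_pf] at hmain
  set n0 := #((Fintype.piFinset fun _ : Fin s => A0).filter (fun y => ∑ i, ((a i : ℤ) : ZMod P) * ((φ (y i) : ℤ) : ZMod P) = 0)) with hn0
  have hlow : c1 * (X:ℝ) ^ s / (P * J ^ s) ≤ n0 := by
    have hPs : (0:ℝ) < (P:ℝ) ^ s := by positivity
    have h1 : c1 ≤ (J / X) ^ s * (n0 * P) := by
      refine le_of_mul_le_mul_left ?_ hPs
      linarith
    rw [div_pow, div_mul_eq_mul_div, le_div_iff₀ (by positivity)] at h1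
    rw [div_le_iff₀ (by positivity)]
    linarith
  have hA0c : (#A0 : ℝ) ≤ X := by
    have := card_le_card hA0
    rw [card_range] at this
    exact_mod_cast this
  have hps := pow_sum (fun ξ : ZMod P => ‖GS A0 φ ξ‖) X hX1' (fun _ => norm_nonneg _) (fun ξ => (GS_le _ _ _).trans hA0c) s T d hd hdT hs C3 P hC30
    (by rw [ZMod.card]) (hMo.trans (by
      refine mul_le_mul_of_nonneg_right (mul_le_mul_of_nonneg_left (rpow_le_rpow_of_exponent_le hX1' (by linarith)) hC30) hPp.le))
  set D := s * (C3 + 1) * (X:ℝ) ^ ((s:ℝ) - d - 3/8) with hD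
  have hdeg' : ∀ i j : Fin s, i ≠ j → (#((Fintype.piFinset fun _ : Fin s => A0).filter (fun y => y i = y j ∧ ∑ k, ((a k : ℤ) : ZMod P) * ((φ (y k) : ℤ) : ZMod P) = 0)) : ℝ) ≤ D := by
    intro i j hij
    have h1 := degen A0 φ (fun i => ((a i : ℤ) : ZMod P)) haP i j hij
    refine le_of_mul_le_mul_right (h1.trans ?_) hPp
    calc (#A0 : ℝ) * (s * ∑ ξ : ZMod P, ‖GS A0 φ ξ‖ ^ (s - 2)) ≤ X * (s * ((C3 + 1) * (X:ℝ) ^ ((s:ℝ) - 1 - d - 3/8) * P)) := by gcongr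
      _ = s * (C3 + 1) * ((X:ℝ) ^ (1:ℝ) * (X:ℝ) ^ ((s:ℝ) - 1 - d - 3/8)) * P := by rw [rpow_one]; ring
      _ = D * P := by rw [← rpow_add hX0, hD]; congr 3; ring
  have hnd := nondegen A0 φ a M hφM hPa1 D (by positivity) hdeg'
  exact fin_alg X J c1 C3 P (B2 * B) _ D s d (by omega) hX1' (by linarith) hc1 hC30 hPp hPK (hJ.trans hXJ2) (hlow.trans hnd) le_rfl hXK2

lemma pow_split (p : ℤ) (hp : Prime p) (n k : ℕ) : ∀ a b : ℤ, p ^ (k + n) ∣ a * b → ¬ p ^ k ∣ a → p ^ n ∣ b := by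
  induction k with
  | zero => intro a b _ h; simp at h
  | succ k ih =>
    intro a b h h2
    by_cases hpa : p ∣ a
    · obtain ⟨a', rfl⟩ := hpa
      refine ih a' b ?_ fun h3 => h2 ?_
      · refine (mul_dvd_mul_iff_left hp.ne_zero).1 (?_ : p * _ ∣ p * _)
        convert h using 1 <;> ring
      · rw [pow_succ']; exact mul_dvd_mul_left p h3
    · exact (pow_dvd_pow p (by omega)).trans (hp.pow_dvd_of_dvd_mul_left _ hpa h)

/-- Integers `x` with `p^K ∣ f x` lie in at most `deg f` classes modulo `p^k`. -/
lemma bad_classes (p k : ℕ) (hp : p.Prime) (m : ℕ) : ∀ (f : ℤ[X]) (K : ℕ), f.natDegree = m → f ≠ 0 →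
    m * k + f.leadingCoeff.natAbs ≤ K → ∃ S : Finset ℤ, #S ≤ m ∧ ∀ x : ℤ, (p:ℤ) ^ K ∣ f.eval x → ∃ r ∈ S, (p:ℤ) ^ k ∣ x - r := by
  induction m with
  | zero =>
    intro f K hf hf0 hK
    refine ⟨∅, by simp, fun x hx => ?_⟩
    exfalso
    obtain ⟨c, rfl⟩ := Polynomial.natDegree_eq_zero.1 hf
    simp only [eval_C, Polynomial.leadingCoeff_C] at hx hK
    have hc : c ≠ 0 := by rintro rfl; simp at hf0
    have h1 : p ^ K ∣ c.natAbs := by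
      have := Int.natAbs_dvd_natAbs.2 hx
      simpa [Int.natAbs_pow] using this
    have h2 := le_of_dvd (Int.natAbs_pos.2 hc) h1
    have h3 := Nat.lt_pow_self (n := K) hp.one_lt
    omega
  | succ m ih =>
    intro f K hf hf0 hK
    by_cases hx : ∃ x : ℤ, (p:ℤ) ^ K ∣ f.eval x
    · obtain ⟨x0, hx0⟩ := hx
      obtain ⟨g, hg⟩ := Polynomial.X_sub_C_dvd_sub_C_eval (a := x0) (p := f)
      have hdf : f.degree = ((m+1:ℕ) : WithBot ℕ) := by rw [Polynomial.degree_eq_natDegree hf0, hf]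
      have hfe : f = (Polynomial.X - Polynomial.C x0) * g + Polynomial.C (f.eval x0) := by rw [← hg]; ring
      have hlt : (Polynomial.C (f.eval x0)).degree < f.degree := by
        rw [hdf]
        exact lt_of_le_of_lt Polynomial.degree_C_le (mod_cast Nat.succ_pos m)
      have hl1 : (f - Polynomial.C (f.eval x0)).leadingCoeff = f.leadingCoeff :=
        Polynomial.leadingCoeff_sub_of_degree_lt hlt
      have hn1 : (f - Polynomial.C (f.eval x0)).natDegree = m + 1 := by
        rw [Polynomial.natDegree_sub_C, hf]
      have hg0 : g ≠ 0 := by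
        rintro rfl
        rw [mul_zero] at hg
        rw [hg] at hn1
        simp at hn1
      rw [hg] at hl1 hn1
      rw [Polynomial.leadingCoeff_mul, Polynomial.leadingCoeff_X_sub_C, one_mul] at hl1
      rw [Polynomial.natDegree_mul (Polynomial.X_sub_C_ne_zero x0) hg0, Polynomial.natDegree_X_sub_C] at hn1
      have hkK : k ≤ K := by rw [Nat.succ_mul] at hK; omega
      obtain ⟨S, hS, hS2⟩ := ih g (K - k) (by omega) hg0 (by rw [hl1]; rw [Nat.succ_mul] at hK; omega)
      classical
      refine ⟨insert x0 S, (card_insert_le _ _).trans (by omega), fun x hx => ?_⟩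
      by_cases hxx : (p:ℤ) ^ k ∣ x - x0
      · exact ⟨x0, mem_insert_self _ _, hxx⟩
      · have h1 : (p:ℤ) ^ K ∣ (x - x0) * g.eval x := by
          have : (x - x0) * g.eval x = f.eval x - f.eval x0 := by
            conv_rhs => rw [hfe]
            simp
          rw [this]; exact dvd_sub hx hx0
        have hpp : Prime (p:ℤ) := Nat.prime_iff_prime_int.1 hp
        have h2 : (p:ℤ) ^ (K - k) ∣ g.eval x := by
          refine pow_split p hpp (K - k) k _ _ ?_ hxx
          rwa [Nat.add_sub_cancel' hkK]
        obtain ⟨r, hr, hr2⟩ := hS2 x h2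
        exact ⟨r, mem_insert_of_mem hr, hr2⟩
    · push Not at hx
      exact ⟨∅, by simp, fun x h => absurd h (hx x)⟩

open Polynomial in
/-- The normalised polynomial. -/
lemma H_exists (d w W b K : ℕ) (h : ℤ[X]) (hdeg : h.natDegree = d) (hd : 2 ≤ d) (hl : 0 < h.leadingCoeff)
    (hw1 : d ≤ w) (hw2 : h.leadingCoeff ≤ w) (hW0 : 1 ≤ W) (hW : ∀ p : ℕ, p.Prime → p ≤ w → p ^ K ∣ W) (hW2 : ∀ p : ℕ, p.Prime → w < p → ¬ p ∣ W)
    (hb : ∀ p : ℕ, p.Prime → p ≤ w → ¬ (p:ℤ) ^ K ∣ h.derivative.eval (b:ℤ)) :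
    ∃ (H : ℤ[X]) (κ : ℤ), 1 ≤ κ ∧ κ ≤ W ^ 2 ∧ (∀ y : ℤ, h.eval ((b:ℤ) + W * y) = h.eval (b:ℤ) + κ * H.eval y) ∧ H.eval 0 = 0 ∧
      H.natDegree = d ∧ 1 ≤ H.coeff d ∧ H.coeff d ≤ W ^ d * h.leadingCoeff ∧ RoughH d w W H := by
  set g : ℕ := Int.gcd (h.derivative.eval (b:ℤ)) W with hg
  have hgW : (g:ℤ) ∣ W := Int.gcd_dvd_right _ _
  have hgh : (g:ℤ) ∣ h.derivative.eval (b:ℤ) := Int.gcd_dvd_left _ _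
  have hg1 : 1 ≤ g := Nat.pos_of_ne_zero fun h0 => by rw [h0] at hgW; simp at hgW; omega
  have hgW' : g ∣ W := mod_cast hgW
  obtain ⟨V, hV⟩ := hgW'
  obtain ⟨u, hu⟩ := hgh
  have hV1 : 1 ≤ V := Nat.pos_of_ne_zero fun h0 => by rw [h0] at hV; omega
  have hWz : (W:ℤ) = g * V := mod_cast hV
  have hW0z : (1:ℤ) ≤ W := mod_cast hW0
  have hg1z : (1:ℤ) ≤ g := mod_cast hg1
  have hV1z : (1:ℤ) ≤ V := mod_cast hV1
  have hcop : IsCoprime u (V:ℤ) := by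
    rw [Int.isCoprime_iff_gcd_eq_one]
    have : g = g * Int.gcd u V := by
      conv_lhs => rw [hg, hu, hWz, Int.gcd_mul_left]
      simp
    nlinarith
  have hpV : ∀ p : ℕ, p.Prime → p ≤ w → p ∣ V := by
    intro p hp hpw
    by_contra hno
    have hc : Coprime (p ^ K) V := Coprime.pow_left _ ((Nat.Prime.coprime_iff_not_dvd hp).2 hno)
    have h1 : p ^ K ∣ g := hc.dvd_of_dvd_mul_right (by rw [← hV]; exact hW p hp hpw)
    refine hb p hp hpw (dvd_trans ?_ ⟨u, hu⟩)
    exact_mod_cast h1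
  set Q : ℤ[X] := (taylor (b:ℤ) h).comp (C (W:ℤ) * X) - C (h.eval (b:ℤ)) with hQ
  have hQc : ∀ j, 1 ≤ j → Q.coeff j = (taylor (b:ℤ) h).coeff j * W ^ j := by
    intro j hj
    rw [hQ, coeff_sub, comp_C_mul_X_coeff, coeff_C, if_neg (by omega), sub_zero]
  have hQ0 : Q.coeff 0 = 0 := by
    rw [hQ, coeff_sub, comp_C_mul_X_coeff, coeff_C]; simp [taylor_coeff_zero]
  have hdvd : C ((W:ℤ) * g) ∣ Q := by
    rw [C_dvd_iff_dvd_coeff]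
    intro j
    rcases j with _ | _ | j
    · rw [hQ0]; exact dvd_zero _
    · rw [hQc 1 le_rfl, taylor_coeff_one, hu]
      exact ⟨u, by ring⟩
    · rw [hQc _ (by omega)]
      exact ⟨(taylor (b:ℤ) h).coeff (j+1+1) * W ^ j * V, by rw [pow_add, pow_add]; conv_lhs => rw [pow_one, hWz]
                                                            rw [hWz]; ring⟩
  obtain ⟨H, hH⟩ := hdvd
  have hκ0 : (W:ℤ) * g ≠ 0 := by positivity
  have hHc : ∀ j, Q.coeff j = (W * g) * H.coeff j := fun j => by rw [hH, coeff_C_mul]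
  have hev : ∀ y : ℤ, h.eval ((b:ℤ) + W * y) = h.eval (b:ℤ) + (W * g) * H.eval y := by
    intro y
    have h1 : Q.eval y = (W * g) * H.eval y := by rw [hH, eval_mul, eval_C]
    rw [hQ, eval_sub, eval_comp, eval_C, eval_mul, eval_C, eval_X, taylor_eval] at h1
    rw [← h1, add_comm (b:ℤ)]; ring
  have hH1 : H.coeff 1 = u := by
    have := hHc 1
    rw [hQc 1 le_rfl, taylor_coeff_one, hu] at this
    refine mul_left_cancel₀ hκ0 ?_
    rw [← this]; ring
  have hHj : ∀ j, H.coeff (j+2) = (taylor (b:ℤ) h).coeff (j+2) * W ^ j * V := by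
    intro j
    have := hHc (j+2)
    rw [hQc _ (by omega)] at this
    refine mul_left_cancel₀ hκ0 ?_
    rw [← this, pow_add, hWz]; ring
  have hlead : (taylor (b:ℤ) h).coeff d = h.leadingCoeff := by rw [← hdeg, coeff_taylor_natDegree]
  obtain ⟨d', rfl⟩ : ∃ d', d = d' + 2 := ⟨d - 2, by omega⟩
  have hHd : H.coeff (d'+2) = h.leadingCoeff * W ^ d' * V := by rw [hHj, hlead]
  have hd1 : 1 ≤ H.coeff (d'+2) := by
    rw [hHd]
    have : 0 < h.leadingCoeff * (W:ℤ) ^ d' * V := by positivity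
    omega
  refine ⟨H, W * g, ?_, ?_, hev, ?_, ?_, hd1, ?_, ⟨hw1, ?_, ?_⟩⟩
  · nlinarith
  · have : (g:ℤ) ≤ W := by nlinarith
    nlinarith
  · have := hHc 0
    rw [hQ0] at this
    rw [← coeff_zero_eq_eval_zero]
    exact (mul_eq_zero.1 this.symm).resolve_left hκ0
  · refine le_antisymm ?_ (le_natDegree_of_ne_zero (by omega))
    refine natDegree_le_iff_coeff_eq_zero.2 fun j hj => ?_
    obtain ⟨j', rfl⟩ : ∃ j', j = j' + 2 := ⟨j - 2, by omega⟩
    rw [hHj, coeff_eq_zero_of_natDegree_lt (by rw [natDegree_taylor, hdeg]; omega)]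
    ring
  · rw [hHd]
    have h1 : (V:ℤ) ≤ W := by nlinarith
    have h2 : (V:ℤ) ≤ W ^ 2 := by nlinarith
    calc h.leadingCoeff * W ^ d' * V ≤ h.leadingCoeff * W ^ d' * W ^ 2 := by gcongr
      _ = _ := by ring
  · intro p hp hpw
    have h1 := hpV p hp hpw
    have h1z : (p:ℤ) ∣ V := mod_cast h1
    refine ⟨hV ▸ h1.mul_left g, ?_, ?_⟩
    · rw [hH1]
      intro hu'
      have := hcop.isUnit_of_dvd' hu' h1z
      exact (Nat.prime_iff_prime_int.1 hp).not_unit this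
    · intro j hj
      obtain ⟨j', rfl⟩ : ∃ j', j = j' + 2 := ⟨j - 2, by omega⟩
      rw [hHj]; exact h1z.mul_left _
  · intro p hp hpw
    have h2 := hW2 p hp hpw
    refine ⟨h2, ?_⟩
    rw [hHd]
    have hpp := Nat.prime_iff_prime_int.1 hp
    intro h3
    rcases hpp.dvd_or_dvd h3 with h3 | h3
    · rcases hpp.dvd_or_dvd h3 with h3 | h3
      · have := Int.le_of_dvd hl h3
        have : (w:ℤ) < p := mod_cast hpw
        omega
      · exact h2 (mod_cast hpp.dvd_of_dvd_pow h3)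
    · exact h2 (hV ▸ (Dvd.dvd.mul_left (mod_cast h3) g))

lemma ev_lead (p : Polynomial ℝ) (hl : 0 < p.leadingCoeff) :
    ∀ᶠ x : ℝ in atTop, p.leadingCoeff / 2 * x ^ p.natDegree ≤ p.eval x ∧ p.eval x ≤ 2 * p.leadingCoeff * x ^ p.natDegree := by
  have h := (Polynomial.isEquivalent_atTop_lead p).isLittleO.def (c := 1/2) (by norm_num)
  filter_upwards [h, eventually_ge_atTop 0] with x hx hx0
  have h1 : 0 ≤ p.leadingCoeff * x ^ p.natDegree := by positivity
  simp only [Pi.sub_apply, norm_eq_abs] at hx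
  rw [abs_of_nonneg h1] at hx
  have := abs_le.1 hx
  constructor <;> linarith [this.1, this.2]

lemma der_lead (p : Polynomial ℝ) (d : ℕ) (hd : p.natDegree = d + 1) :
    p.derivative.natDegree = d ∧ p.derivative.leadingCoeff = p.leadingCoeff * (d + 1) := by
  have h1 : p.derivative.natDegree = d := by
    have h0 : p.coeff (d+1) ≠ 0 := by
      rw [← hd]; intro h0
      rw [coeff_natDegree, Polynomial.leadingCoeff_eq_zero] at h0
      rw [h0] at hd; simp at hd
    refine le_antisymm ((Polynomial.natDegree_derivative_le p).trans (by omega)) (le_natDegree_of_ne_zero ?_)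
    rw [coeff_derivative]
    exact mul_ne_zero h0 (by positivity)
  refine ⟨h1, ?_⟩
  rw [leadingCoeff, h1, coeff_derivative, leadingCoeff, hd]

lemma poly_mvt (p : Polynomial ℝ) (u v : ℝ) (h : u < v) : ∃ c, u < c ∧ c < v ∧ p.eval v - p.eval u = p.derivative.eval c * (v - u) := by
  obtain ⟨c, hc, h2⟩ := exists_hasDerivAt_eq_slope (fun x => p.eval x) (fun x => p.derivative.eval x) h
    p.continuous.continuousOn (fun x _ => p.hasDerivAt x)
  refine ⟨c, hc.1, hc.2, ?_⟩
  rw [h2, div_mul_cancel₀ _ (by linarith)]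

/-- Size and convexity of a polynomial far to the right. -/
lemma poly_bounds (F : Polynomial ℝ) (d : ℕ) (hF : F.natDegree = d + 2) (hl : 0 < F.leadingCoeff) :
    ∃ x0 : ℝ, 1 ≤ x0 ∧ ∃ L : ℝ, 0 < L ∧ L ≤ F.leadingCoeff * (d + 2) ∧ F.leadingCoeff ≤ L ∧
      (∀ u v, x0 ≤ u → u < v → L / 2 * u ^ (d+1) * (v - u) ≤ F.eval v - F.eval u ∧ F.eval v - F.eval u ≤ 2 * L * v ^ (d+1) * (v - u)) ∧
      (∀ u t, x0 ≤ u → 0 < t → F.eval (u + t) - F.eval u ≤ F.eval (u + 2 * t) - F.eval (u + t)) := by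
  obtain ⟨h1, h2⟩ := der_lead F (d+1) hF
  obtain ⟨h3, h4⟩ := der_lead F.derivative d h1
  have hl1 : 0 < F.derivative.leadingCoeff := by rw [h2]; positivity
  have hl2 : 0 < F.derivative.derivative.leadingCoeff := by rw [h4]; positivity
  obtain ⟨x0, hx0⟩ := eventually_atTop.1 ((ev_lead _ hl1).and ((ev_lead _ hl2).and (eventually_ge_atTop 1)))
  have hd0 : (0:ℝ) ≤ d := by positivity
  refine ⟨max x0 1, le_max_right _ _, F.derivative.leadingCoeff, hl1, ?_, ?_, ?_, ?_⟩
  · rw [h2]; push_cast; linarith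
  · rw [h2]; push_cast; nlinarith
  · intro u v hu huv
    obtain ⟨c, hc1, hc2, hc⟩ := poly_mvt F u v huv
    have hu1 : 1 ≤ u := (le_max_right _ _).trans hu
    have := (hx0 c ((le_max_left _ _).trans (hu.trans hc1.le))).1
    rw [h1] at this
    rw [hc]
    constructor
    · refine mul_le_mul_of_nonneg_right (le_trans ?_ this.1) (by linarith)
      gcongr
    · refine mul_le_mul_of_nonneg_right (this.2.trans ?_) (by linarith)
      have : 0 ≤ c := by linarith
      gcongr
  · intro u t hu ht
    have hu1 : 1 ≤ u := (le_max_right _ _).trans hu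
    obtain ⟨c, hc1, hc2, hc⟩ := poly_mvt F u (u+t) (by linarith)
    obtain ⟨c', hc1', hc2', hc'⟩ := poly_mvt F (u+t) (u+2*t) (by linarith)
    obtain ⟨c'', hc1'', hc2'', hc''⟩ := poly_mvt F.derivative c c' (by linarith)
    have h5 := (hx0 c'' ((le_max_left _ _).trans (hu.trans (by linarith)))).2.1.1
    have hc0 : 0 ≤ c'' := by linarith
    have h6 : 0 ≤ F.derivative.derivative.eval c'' := le_trans (by positivity) h5
    have h7 : F.derivative.eval c ≤ F.derivative.eval c' := by nlinarith
    rw [hc, hc']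
    have e1 : u + t - u = t := by ring
    have e2 : u + 2 * t - (u + t) = t := by ring
    rw [e1, e2]
    exact mul_le_mul_of_nonneg_right h7 ht.le

set_option maxHeartbeats 1000000 in
/-- The normalised polynomial is well spaced. -/
lemma H_nice (d Q : ℕ) (hQ : 1 ≤ Q) (h : ℤ[X]) (hdeg : h.natDegree = d + 2) (hl : 0 < h.leadingCoeff) (W : ℕ) (hW : 1 ≤ W) :
    ∃ B : ℝ, 1 ≤ B ∧ ∃ N0 : ℕ, ∀ (N X b : ℕ) (H : ℤ[X]) (κ : ℤ), N0 ≤ N → N ≤ 2 * W * X → W * X ≤ N → N ≤ Q * b → b + W * X ≤ 2 * N →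
      1 ≤ κ → κ ≤ W ^ 2 → (∀ y : ℤ, h.eval ((b:ℤ) + W * y) = h.eval (b:ℤ) + κ * H.eval y) → H.eval 0 = 0 →
      H.natDegree = d + 2 → 1 ≤ H.coeff (d+2) → H.coeff (d+2) ≤ W ^ (d+2) * h.leadingCoeff →
      NiceH (d+2) B X H ∧ (b + W * X : ℝ) ≤ B * X ∧
      ((H.eval (X:ℤ) : ℤ) : ℝ) ≤ 4 * (2 * Q : ℝ) ^ (d+1) * (X * (((H.eval 1 : ℤ):ℝ) - (H.eval 0 : ℤ))) := by
  set F := h.map (castRingHom ℝ) with hF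
  have hinj : Function.Injective (castRingHom ℝ) := RingHom.injective_int _
  have hFl : F.leadingCoeff = (h.leadingCoeff : ℝ) := by
    rw [hF, Polynomial.leadingCoeff_map_of_injective hinj]; rfl
  have hFe : ∀ x : ℤ, F.eval (x:ℝ) = ((h.eval x : ℤ) : ℝ) := fun x => by
    rw [hF, eval_intCast_map]; rfl
  have hl' : (1:ℝ) ≤ h.leadingCoeff := mod_cast hl
  obtain ⟨x0, hx0, L, hL, hL2, hL3, hb1, hb2⟩ := poly_bounds F d (by rw [hF, Polynomial.natDegree_map_eq_of_injective hinj, hdeg]) (by rw [hFl]; linarith)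
  rw [hFl] at hL2 hL3
  have hW1 : (1:ℝ) ≤ W := mod_cast hW
  have hQ1 : (1:ℝ) ≤ Q := mod_cast hQ
  set l : ℝ := Int.cast h.leadingCoeff with hlr
  refine ⟨4 * W + 2 * W ^ 2 * Q ^ (d+1) + 2 * L * 4 ^ (d+1) * W ^ (d+2) + W ^ (d+2) * l, ?_, ⌈Q * x0⌉₊, ?_⟩
  · have : (0:ℝ) ≤ 2 * W ^ 2 * Q ^ (d+1) + 2 * L * 4 ^ (d+1) * W ^ (d+2) + W ^ (d+2) * l := by positivity
    linarith
  intro N X b H κ hN hNX hXN hNb hbN hκ1 hκ2 hev h0 hHd hH1 hH2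
  have p1 : (0:ℝ) ≤ 2 * W ^ 2 * Q ^ (d+1) := by positivity
  have p2 : (0:ℝ) ≤ 2 * L * 4 ^ (d+1) * W ^ (d+2) := by positivity
  have p3 : (0:ℝ) ≤ W ^ (d+2) * l := by positivity
  have hNr : Q * x0 ≤ N := (le_ceil _).trans (mod_cast hN)
  have hNXr : (N:ℝ) ≤ 2 * W * X := mod_cast hNX
  have hXNr : (W:ℝ) * X ≤ N := mod_cast hXN
  have hNbr : (N:ℝ) ≤ Q * b := mod_cast hNb
  have hbNr : (b:ℝ) + W * X ≤ 2 * N := mod_cast hbN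
  have hκ1r : (1:ℝ) ≤ κ := mod_cast hκ1
  have hκ2r : (κ:ℝ) ≤ W ^ 2 := mod_cast hκ2
  have hκ0 : (0:ℝ) < κ := by linarith
  have hxb : x0 ≤ b := by
    have : Q * x0 ≤ Q * b := hNr.trans hNbr
    exact le_of_mul_le_mul_left this (by linarith)
  have hb0 : (1:ℝ) ≤ b := hx0.trans hxb
  have hX0 : (0:ℝ) < X := by
    rcases Nat.eq_zero_or_pos X with h | h
    · have h1 : 1 ≤ Q * x0 := one_le_mul_of_one_le_of_one_le hQ1 hx0
      rw [h, Nat.cast_zero, mul_zero] at hNXr; linarith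
    · exact_mod_cast h
  have hX1 : (1:ℝ) ≤ X := by
    have : 0 < X := mod_cast hX0
    exact_mod_cast this
  have hevr : ∀ y : ℕ, (κ:ℝ) * ((H.eval (y:ℤ) : ℤ):ℝ) = F.eval ((b:ℝ) + W * y) - F.eval (b:ℝ) := by
    intro y
    have h1 := hFe ((b:ℤ) + W * y)
    have h2 := hFe (b:ℤ)
    push_cast at h1 h2
    rw [h1, h2, hev]; push_cast; ring
  have hup : ((H.eval (X:ℤ) : ℤ):ℝ) * κ ≤ 2 * L * (2 * N) ^ (d+1) * (W * X) := by
    have h1 := (hb1 b (b + W * X) hxb (by nlinarith)).2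
    rw [mul_comm, hevr]
    refine h1.trans ?_
    rw [show (b:ℝ) + W * X - b = W * X by ring]
    gcongr
  have hlo : L / 2 * b ^ (d+1) * W ≤ ((H.eval (1:ℤ) : ℤ):ℝ) * κ := by
    have h1 := (hb1 b (b + W) hxb (by linarith)).1
    have h2 := hevr 1
    simp only [Nat.cast_one, mul_one] at h2
    rw [mul_comm _ (κ:ℝ), h2]
    rwa [show (b:ℝ) + W - b = W by ring] at h1
  have hbN' : (N:ℝ) ^ (d+1) ≤ Q ^ (d+1) * b ^ (d+1) := by rw [← mul_pow]; gcongr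
  rw [h0]
  simp only [Int.cast_zero, sub_zero]
  refine ⟨⟨hHd, hH1, ?_, ?_, ?_, ?_, ?_⟩, ?_, ?_⟩
  · have : (H.coeff (d+2) : ℝ) ≤ W ^ (d+2) * l := by rw [hlr]; exact_mod_cast hH2
    linarith
  · intro y hy
    have h1 := (hb1 (b + W * y) (b + W * (y+1:ℕ)) (by nlinarith [(Nat.cast_nonneg y : (0:ℝ) ≤ y)]) (by push_cast; nlinarith)).1
    have h2 : 0 < L / 2 * ((b:ℝ) + W * y) ^ (d+1) * (b + W * (y+1:ℕ) - (b + W * y)) := by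
      have : (b:ℝ) + W * (y+1:ℕ) - (b + W * y) = W := by push_cast; ring
      rw [this]; positivity
    have h3 := hevr y
    have h4 := hevr (y+1)
    have h5 : ((H.eval (y:ℤ) : ℤ):ℝ) < ((H.eval ((y+1:ℕ):ℤ) : ℤ):ℝ) := by
      refine lt_of_mul_lt_mul_left ?_ hκ0.le
      linarith
    exact_mod_cast h5
  · intro y hy
    have h1 := hb2 (b + W * y) W (by nlinarith [(Nat.cast_nonneg y : (0:ℝ) ≤ y)]) (by linarith)
    have h3 := hevr y
    have h4 := hevr (y+1)
    have h5 := hevr (y+2)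
    rw [show (b:ℝ) + W * (y+1:ℕ) = b + W * y + W by push_cast; ring] at h4
    rw [show (b:ℝ) + W * (y+2:ℕ) = b + W * y + 2 * W by push_cast; ring] at h5
    have h6 : ((H.eval ((y+1:ℕ):ℤ) : ℤ):ℝ) - ((H.eval (y:ℤ) : ℤ):ℝ) ≤ ((H.eval ((y+2:ℕ):ℤ) : ℤ):ℝ) - ((H.eval ((y+1:ℕ):ℤ) : ℤ):ℝ) := by
      refine le_of_mul_le_mul_left ?_ hκ0
      linarith
    exact_mod_cast h6
  · rw [h0]
    simp only [Int.cast_zero, sub_zero]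
    rcases le_or_gt ((H.eval (X:ℤ) : ℤ):ℝ) 0 with hneg | hpos
    · exact hneg.trans (by positivity)
    calc ((H.eval (X:ℤ) : ℤ):ℝ) ≤ ((H.eval (X:ℤ) : ℤ):ℝ) * κ := le_mul_of_one_le_right hpos.le hκ1r
      _ ≤ 2 * L * (2 * N) ^ (d+1) * (W * X) := hup
      _ ≤ 2 * L * (2 * (2 * W * X)) ^ (d+1) * (W * X) := by gcongr
      _ = (2 * L * 4 ^ (d+1) * W ^ (d+2)) * X ^ (d+2) := by
        rw [show (2 * (2 * (W:ℝ) * X)) = 4 * (W * X) by ring, mul_pow, mul_pow]; ring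
      _ ≤ _ := by gcongr; linarith
  · rw [h0]
    simp only [Int.cast_zero, sub_zero]
    have hl1 : 1 ≤ L := hl'.trans hL3
    have h1 : (X:ℝ) ^ (d+1) ≤ N ^ (d+1) := by gcongr; nlinarith
    have hb0' : (0:ℝ) < (b:ℝ) ^ (d+1) := by positivity
    have hHp : 0 < ((H.eval 1 : ℤ):ℝ) := by
      have : 0 < ((H.eval (1:ℤ) : ℤ):ℝ) * κ := lt_of_lt_of_le (by positivity) hlo
      exact pos_of_mul_pos_left this hκ0.le
    have h2 : (b:ℝ) ^ (d+1) ≤ 2 * W ^ 2 * ((H.eval 1 : ℤ):ℝ) := by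
      have h3 : 1 / 2 * (b:ℝ) ^ (d+1) * 1 ≤ L / 2 * b ^ (d+1) * W := by gcongr
      have h4 : ((H.eval 1 : ℤ):ℝ) * κ ≤ ((H.eval 1 : ℤ):ℝ) * W ^ 2 := by gcongr
      linarith
    calc (X:ℝ) ^ (d+2) = X * X ^ (d+1) := by ring
      _ ≤ X * (Q ^ (d+1) * (2 * W ^ 2 * ((H.eval 1 : ℤ):ℝ))) := by
        gcongr
        exact h1.trans (hbN'.trans (by gcongr))
      _ = (2 * W ^ 2 * Q ^ (d+1)) * (X * ((H.eval 1 : ℤ):ℝ)) := by ring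
      _ ≤ _ := by gcongr; linarith
  · have : 0 ≤ (2 * W ^ 2 * Q ^ (d+1) + 2 * L * 4 ^ (d+1) * W ^ (d+2) + W ^ (d+2) * l) * X := by positivity
    nlinarith
  · refine le_of_mul_le_mul_right (hup.trans ?_) hκ0
    calc 2 * L * (2 * N) ^ (d+1) * (W * X) = 2 * L * 2 ^ (d+1) * N ^ (d+1) * (W * X) := by rw [mul_pow]; ring
      _ ≤ 2 * L * 2 ^ (d+1) * (Q ^ (d+1) * b ^ (d+1)) * (W * X) := by gcongr
      _ = 4 * (2 * Q) ^ (d+1) * X * (L / 2 * b ^ (d+1) * W) := by rw [mul_pow]; ring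
      _ ≤ 4 * (2 * Q) ^ (d+1) * X * (((H.eval (1:ℤ) : ℤ):ℝ) * κ) := by gcongr
      _ = _ := by ring

lemma primes_card (N : ℕ) : #(primesUpTo N) = Nat.primeCounting N := by
  rw [primesUpTo, Nat.primeCounting, Nat.primeCounting', Nat.count_eq_card_filter_range]

lemma pi_lower : ∀ᶠ N : ℕ in atTop, (N:ℝ) / (2 * log N) ≤ #(primesUpTo N) := by
  filter_upwards [ev_log 20 1 one_pos, eventually_ge_atTop 3] with N h1 hN
  rw [rpow_one] at h1
  have hN' : (3:ℝ) ≤ N := mod_cast hN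
  have hlog : 0 < log N := log_pos (by linarith)
  have h2 := Chebyshev.pi_ge N
  rw [primes_card]
  refine le_trans ?_ h2
  have h3 : log (N + 1) ≤ 2 * log N := by
    have : (2:ℝ) * log N = log ((N:ℝ)^2) := by rw [Real.log_pow]; norm_num
    rw [this]
    exact log_le_log (by positivity) (by nlinarith)
  rw [div_le_div_iff₀ (by positivity) hlog]
  have h4 := Real.log_two_gt_d9
  have h5 : (N:ℝ) ≤ 2 * (N * log 2 - log (N+1)) := by nlinarith
  nlinarith

lemma class_count (m : ℕ) (hm : 0 < m) : ∀ᶠ N : ℕ in atTop, ∀ r : ℤ,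
    (#((range (N+1)).filter (fun x : ℕ => x.Prime ∧ (m:ℤ) ∣ (x:ℤ) - r)) : ℝ) ≤ 33 * N / (totient m * log N) := by
  filter_upwards [bt m hm] with N hN r
  have hm' : (0:ℤ) < m := mod_cast hm
  have h1 := Int.emod_nonneg r hm'.ne'
  have h2 := Int.emod_lt_of_pos r hm'
  refine le_trans ?_ (hN (r % m).toNat (by omega))
  gcongr with x hx
  intro hd
  have h3 : (x:ℤ) % m = r % m := Int.emod_eq_emod_iff_emod_sub_eq_zero.2 (Int.emod_eq_zero_of_dvd hd)
  omega

lemma totient_ge (p k : ℕ) (hp : p.Prime) : 2 ^ k ≤ totient (p ^ (k+1)) := by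
  rw [Nat.totient_prime_pow_succ hp]
  calc 2 ^ k ≤ p ^ k * 1 := by rw [mul_one]; exact Nat.pow_le_pow_left hp.two_le _
    _ ≤ _ := Nat.mul_le_mul_left _ (by have := hp.two_le; omega)

lemma bad_count (f : ℤ[X]) (hf : f ≠ 0) (w : ℕ) (ε : ℝ) (hε : 0 < ε) : ∃ K : ℕ, ∀ᶠ N : ℕ in atTop,
    (#((range (N+1)).filter (fun x : ℕ => x.Prime ∧ ∃ p ∈ range (w+1), p.Prime ∧ (p:ℤ) ^ K ∣ f.eval (x:ℤ))) : ℝ) ≤ ε * (N / log N) := by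
  classical
  set m := f.natDegree with hm
  obtain ⟨k, hk⟩ := pow_unbounded_of_one_lt ((w+1) * m * 33 / ε) (one_lt_two (α := ℝ))
  refine ⟨m * (k+1) + f.leadingCoeff.natAbs, ?_⟩
  set K := m * (k+1) + f.leadingCoeff.natAbs with hK
  have hev : ∀ᶠ N : ℕ in atTop, ∀ p ∈ range (w+1), p.Prime → ∀ r : ℤ,
    (#((range (N+1)).filter (fun x : ℕ => x.Prime ∧ ((p^(k+1) : ℕ):ℤ) ∣ (x:ℤ) - r)) : ℝ) ≤ 33 * N / (totient (p^(k+1)) * log N) := by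
    rw [Filter.eventually_all_finset]
    intro p _
    by_cases hp : p.Prime
    · filter_upwards [class_count (p^(k+1)) (pow_pos hp.pos _)] with N hN _
      exact hN
    · exact Filter.Eventually.of_forall fun N h => absurd h hp
  filter_upwards [hev, eventually_ge_atTop 3] with N hN hN3
  have hN' : (3:ℝ) ≤ N := mod_cast hN3
  have hlog : 0 < log N := log_pos (by linarith)
  have hq : 0 ≤ (N:ℝ) / log N := by positivity
  have key : ∀ p ∈ range (w+1), (#((range (N+1)).filter (fun x : ℕ => x.Prime ∧ p.Prime ∧ (p:ℤ) ^ K ∣ f.eval (x:ℤ))) : ℝ) ≤ m * (33 / 2 ^ k * (N / log N)) := by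
    intro p hpw
    by_cases hp : p.Prime
    · obtain ⟨S, hS, hS2⟩ := bad_classes p (k+1) hp m f K rfl hf le_rfl
      have h1 : (range (N+1)).filter (fun x : ℕ => x.Prime ∧ p.Prime ∧ (p:ℤ) ^ K ∣ f.eval (x:ℤ)) ⊆
          S.biUnion fun r => (range (N+1)).filter (fun x : ℕ => x.Prime ∧ ((p^(k+1) : ℕ):ℤ) ∣ (x:ℤ) - r) := by
        intro x hx
        simp only [mem_filter] at hx
        obtain ⟨r, hr, hr2⟩ := hS2 x hx.2.2.2
        simp only [mem_biUnion, mem_filter]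
        exact ⟨r, hr, hx.1, hx.2.1, by push_cast; exact hr2⟩
      have h2 : (#((range (N+1)).filter (fun x : ℕ => x.Prime ∧ p.Prime ∧ (p:ℤ) ^ K ∣ f.eval (x:ℤ))) : ℝ) ≤ ∑ r ∈ S, (33 / 2 ^ k * (N / log N)) := by
        refine le_trans ((Nat.cast_le (α := ℝ)).2 ((card_le_card h1).trans card_biUnion_le)) ?_
        rw [Nat.cast_sum]
        refine sum_le_sum fun r _ => (hN p hpw hp r).trans ?_
        have h3 : ((2:ℝ)) ^ k ≤ totient (p^(k+1)) := mod_cast totient_ge p k hp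
        calc 33 * (N:ℝ) / (totient (p^(k+1)) * log N) ≤ 33 * N / (2 ^ k * log N) := by gcongr
          _ = _ := by field_simp
      refine h2.trans ?_
      rw [sum_const, nsmul_eq_mul]
      gcongr
    · have : (range (N+1)).filter (fun x : ℕ => x.Prime ∧ p.Prime ∧ (p:ℤ) ^ K ∣ f.eval (x:ℤ)) = ∅ := by
        ext x; simp [hp]
      rw [this, card_empty, Nat.cast_zero]
      positivity
  have h1 : (range (N+1)).filter (fun x : ℕ => x.Prime ∧ ∃ p ∈ range (w+1), p.Prime ∧ (p:ℤ) ^ K ∣ f.eval (x:ℤ)) ⊆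
      (range (w+1)).biUnion fun p => (range (N+1)).filter (fun x : ℕ => x.Prime ∧ p.Prime ∧ (p:ℤ) ^ K ∣ f.eval (x:ℤ)) := by
    intro x hx
    simp only [mem_filter] at hx
    obtain ⟨hx1, hx2, p, hp, hp2⟩ := hx
    simp only [mem_biUnion, mem_filter]
    exact ⟨p, hp, hx1, hx2, hp2⟩
  refine le_trans ((Nat.cast_le (α := ℝ)).2 ((card_le_card h1).trans card_biUnion_le)) ?_
  rw [Nat.cast_sum]
  refine (sum_le_sum key).trans ?_
  rw [sum_const, card_range, nsmul_eq_mul, ← mul_assoc, ← mul_assoc]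
  refine mul_le_mul_of_nonneg_right ?_ hq
  rw [div_lt_iff₀ hε] at hk
  push_cast
  rw [← mul_div_assoc, div_le_iff₀ (by positivity)]
  linarith

lemma small_count (W Q : ℕ) (hW : 1 ≤ W) (hQ : 1 ≤ Q) : ∀ᶠ N : ℕ in atTop,
    (#((range (W * (N / (W * Q) + 1))).filter Nat.Prime) : ℝ) ≤ 132 / Q * (N / log N) := by
  have ht : Tendsto (fun N : ℕ => W * (N / (W * Q) + 1)) atTop atTop := by
    refine Filter.tendsto_atTop_mono (fun N => ?_) (Nat.tendsto_div_const_atTop (Nat.mul_pos hW hQ).ne')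
    nlinarith [Nat.zero_le (N / (W * Q))]
  have hQ' : (1:ℝ) ≤ Q := mod_cast hQ
  have hW' : (1:ℝ) ≤ W := mod_cast hW
  filter_upwards [ht.eventually (bt 1 one_pos), ev_const (W * Q) (1/2) (by norm_num), eventually_ge_atTop (W * Q), eventually_ge_atTop 3] with N hN h1 h2 h3
  set M := W * (N / (W * Q) + 1) with hM
  have hN' : (3:ℝ) ≤ N := mod_cast h3
  have hN0 : (0:ℝ) < N := by linarith
  have hlog : 0 < log N := log_pos (by linarith)
  have hb := hN 0 (by norm_num)
  simp only [Nat.mod_one, and_true, Nat.totient_one, Nat.cast_one, one_mul] at hb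
  have hM1 : (M:ℝ) ≤ 2 * N / Q := by
    have a1 : M ≤ W * (N / (W * Q)) + W := by rw [hM]; ring_nf; rfl
    have a2 : ((N / (W * Q) : ℕ):ℝ) ≤ N / (W * Q) := by
      refine cast_div_le.trans ?_
      push_cast; rfl
    have a3 : (M:ℝ) ≤ W * ((N / (W * Q) : ℕ):ℝ) + W := mod_cast a1
    have a4 : (W:ℝ) * Q ≤ N := mod_cast h2
    calc (M:ℝ) ≤ W * (N / (W * Q)) + W := a3.trans (by gcongr)
      _ = N / Q + W := by field_simp
      _ ≤ N / Q + N / Q := by gcongr; rw [le_div_iff₀ (by linarith)]; exact a4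
      _ = _ := by ring
  have hM2 : (N:ℝ) ^ (1/2:ℝ) ≤ M := by
    have a1 : N ≤ Q * M := by
      have := Nat.lt_div_mul_add (a := N) (b := W * Q) (Nat.mul_pos hW hQ)
      rw [hM]; nlinarith
    have a2 : (N:ℝ) ≤ Q * M := mod_cast a1
    have a3 : (N:ℝ) = (N:ℝ) ^ (1/2:ℝ) * (N:ℝ) ^ (1/2:ℝ) := by rw [← rpow_add hN0]; norm_num
    have a4 : (0:ℝ) < (N:ℝ) ^ (1/2:ℝ) := by positivity
    have a5 : (Q:ℝ) ≤ (N:ℝ) ^ (1/2:ℝ) := le_trans (by nlinarith) h1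
    have a6 : (0:ℝ) ≤ M := by positivity
    have : (N:ℝ) ^ (1/2:ℝ) * (N:ℝ) ^ (1/2:ℝ) ≤ (N:ℝ) ^ (1/2:ℝ) * M := by rw [← a3]; exact a2.trans (by gcongr)
    exact le_of_mul_le_mul_left this a4
  have hlM : log N / 2 ≤ log M := by
    have := log_le_log (by positivity) hM2
    rw [Real.log_rpow hN0] at this
    linarith
  have hsub : (#((range M).filter Nat.Prime) : ℝ) ≤ #((range (M+1)).filter Nat.Prime) := by
    gcongr; omega
  refine hsub.trans (hb.trans ?_)
  calc 33 * (M:ℝ) / log M ≤ 33 * (2 * N / Q) / (log N / 2) := by gcongr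
    _ = _ := by field_simp; norm_num

/-- Pigeonhole over residue classes. -/
lemma pick (f : ℤ[X]) (hf : f ≠ 0) (δ : ℝ) (hδ : 0 < δ) (w : ℕ) : ∃ K W : ℕ, 1 ≤ W ∧ (∀ p : ℕ, p.Prime → p ≤ w → p ^ K ∣ W) ∧
    (∀ p : ℕ, p.Prime → w < p → ¬ p ∣ W) ∧ ∀ Q : ℕ, 1 ≤ Q → (1056:ℝ) / Q ≤ δ → ∀ᶠ N : ℕ in atTop,
    ∀ A : Finset ℕ, A ⊆ primesUpTo N → δ * (#(primesUpTo N) : ℝ) ≤ #A → ∃ b : ℕ, b < W ∧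
      (∀ p : ℕ, p.Prime → p ≤ w → ¬ (p:ℤ) ^ K ∣ f.eval (b:ℤ)) ∧
      δ / 16 * (N / log N) / totient W ≤ #(A.filter (fun x => x % W = b ∧ N / (W * Q) + 1 ≤ x / W)) := by
  classical
  obtain ⟨K, hK⟩ := bad_count f hf w (δ/8) (by positivity)
  have hPdvd : ∀ p : ℕ, p.Prime → (p ∣ primorial w ↔ p ≤ w) := fun p hp => hp.dvd_primorial_iff
  have hW1 : 1 ≤ primorial w ^ K := Nat.pow_pos (primorial_pos w)
  refine ⟨K, primorial w ^ K, hW1, fun p hp hpw => pow_dvd_pow_of_dvd ((hPdvd p hp).2 hpw) K, fun p hp hpw h => ?_, fun Q hQ hQ2 => ?_⟩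
  · have := (hPdvd p hp).1 (hp.dvd_of_dvd_pow h)
    omega
  set W := primorial w ^ K with hW
  have hφ : 0 < totient W := Nat.totient_pos.2 hW1
  filter_upwards [hK, pi_lower, small_count W Q hW1 hQ, ev_log (8 * (w+1) / δ) 1 one_pos, eventually_ge_atTop 3] with N h1 h2 h3 h4 hN A hA hAc
  have hN' : (3:ℝ) ≤ N := mod_cast hN
  have hlog : 0 < log N := log_pos (by linarith)
  set u := (N:ℝ) / log N with hu
  have hu0 : 0 < u := by positivity
  have h2' : u / 2 ≤ #(primesUpTo N) := by
    refine le_trans (le_of_eq ?_) h2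
    rw [hu, div_div, mul_comm 2]
  by_contra hcon
  push Not at hcon
  set 𝓑 := (range W).filter (fun b => W.Coprime b ∧ ∀ p : ℕ, p.Prime → p ≤ w → ¬ (p:ℤ) ^ K ∣ f.eval (b:ℤ)) with hB
  set S1 := (range (W * (N / (W * Q) + 1))).filter Nat.Prime with hS1
  set S2 := (range (N+1)).filter (fun x : ℕ => x.Prime ∧ ∃ p ∈ range (w+1), p.Prime ∧ (p:ℤ) ^ K ∣ f.eval (x:ℤ)) with hS2
  have hcov : A ⊆ S1 ∪ S2 ∪ range (w+1) ∪ 𝓑.biUnion fun b => A.filter (fun x => x % W = b ∧ N / (W * Q) + 1 ≤ x / W) := by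
    intro x hx
    have hx2 := hA hx
    simp only [primesUpTo, mem_filter] at hx2
    by_cases c1 : x ∈ S1
    · simp [c1]
    by_cases c2 : x ∈ S2
    · simp [c2]
    by_cases c3 : x ∈ range (w+1)
    · simp only [mem_union]; exact Or.inl (Or.inr c3)
    refine mem_union_right _ (mem_biUnion.2 ⟨x % W, ?_, ?_⟩)
    · refine mem_filter.2 ⟨mem_range.2 (mod_lt _ hW1), ?_, fun p hp hpw hd => c2 ?_⟩
      · have : W.Coprime x := by
          refine Coprime.symm ((Nat.Prime.coprime_iff_not_dvd hx2.2).2 fun hd => c3 ?_)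
          have := (hPdvd x hx2.2).1 (hx2.2.dvd_of_dvd_pow hd)
          exact mem_range.2 (by omega)
        rw [Coprime, Nat.gcd_comm, ← Nat.gcd_rec]
        exact this
      · refine mem_filter.2 ⟨hx2.1, hx2.2, p, mem_range.2 (by omega), hp, ?_⟩
        have e1 : (p:ℤ) ^ K ∣ (x:ℤ) - ((x % W : ℕ):ℤ) := by
          have e2 : (W:ℤ) ∣ (x:ℤ) - ((x % W : ℕ):ℤ) := by
            push_cast; exact Int.dvd_self_sub_emod
          refine dvd_trans ?_ e2
          exact_mod_cast pow_dvd_pow_of_dvd ((hPdvd p hp).2 hpw) K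
        have e3 := e1.trans (sub_dvd_eval_sub (x:ℤ) ((x % W : ℕ):ℤ) f)
        exact (dvd_iff_dvd_of_dvd_sub e3).2 hd
    · refine mem_filter.2 ⟨hx, rfl, ?_⟩
      by_contra hlt
      push Not at hlt
      refine c1 (mem_filter.2 ⟨mem_range.2 ?_, hx2.2⟩)
      rw [mul_comm]
      exact (Nat.div_lt_iff_lt_mul hW1).1 hlt
  have hc := card_le_card hcov
  have hc2 : #A ≤ #S1 + #S2 + (w+1) + ∑ b ∈ 𝓑, #(A.filter (fun x => x % W = b ∧ N / (W * Q) + 1 ≤ x / W)) := by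
    refine hc.trans ((card_union_le _ _).trans (Nat.add_le_add ((card_union_le _ _).trans (Nat.add_le_add (card_union_le _ _) ?_)) card_biUnion_le))
    rw [card_range]
  have hc3 : (#A : ℝ) ≤ #S1 + #S2 + (w+1) + ∑ b ∈ 𝓑, (#(A.filter (fun x => x % W = b ∧ N / (W * Q) + 1 ≤ x / W)) : ℝ) := by
    exact_mod_cast hc2
  have hBc : #𝓑 ≤ totient W := by
    rw [totient]
    refine card_le_card fun b hb => ?_
    rw [hB, mem_filter] at hb
    exact mem_filter.2 ⟨hb.1, hb.2.1⟩
  have hs : ∑ b ∈ 𝓑, (#(A.filter (fun x => x % W = b ∧ N / (W * Q) + 1 ≤ x / W)) : ℝ) ≤ δ / 16 * u := by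
    calc _ ≤ ∑ b ∈ 𝓑, δ / 16 * u / totient W := sum_le_sum fun b hb => by
            rw [hB, mem_filter] at hb
            exact (hcon b (mem_range.1 hb.1) hb.2.2).le
      _ = #𝓑 * (δ / 16 * u / totient W) := by rw [sum_const, nsmul_eq_mul]
      _ ≤ totient W * (δ / 16 * u / totient W) := by gcongr
      _ = _ := by field_simp
  have hw : (w:ℝ) + 1 ≤ δ / 8 * u := by
    rw [rpow_one] at h4
    rw [hu, ← mul_div_assoc, le_div_iff₀ hlog]
    have : 8 * ((w:ℝ)+1) / δ * log N = ((w+1) * log N) * (8 / δ) := by ring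
    rw [this, ← le_div_iff₀ (by positivity)] at h4
    refine h4.trans (le_of_eq ?_)
    field_simp
  have h3' : (#S1 : ℝ) ≤ δ / 8 * u := h3.trans (by
    refine mul_le_mul_of_nonneg_right ?_ hu0.le
    have : (132:ℝ) / Q = 1056 / Q / 8 := by ring
    rw [this]; linarith)
  have : δ * (u / 2) ≤ δ * #(primesUpTo N) := by gcongr
  nlinarith

lemma alg_dens (J a X N W φ ρ η lX lN : ℝ) (hX : 0 < X) (hW : 0 < W) (hN : 0 < N) (hφ : 0 < φ) (hρ : 0 < ρ) (hη : 0 < η) (hlN : 0 < lN)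
    (hJ : φ / W * (ρ * lX) / 2 ≤ J) (ha : η * (N / lN) / φ ≤ a) (hl : lN ≤ 2 * lX) (hWX : W * X ≤ N) :
    ρ * η / 4 ≤ J * a / X := by
  rw [le_div_iff₀ hX]
  have h1 : φ / W * (ρ * (lN / 2)) / 2 ≤ J := le_trans (by gcongr; linarith) hJ
  have h2 : 0 ≤ J := le_trans (by positivity) h1
  calc ρ * η / 4 * X ≤ ρ * η / 4 * (N / W) := by
        gcongr; rw [le_div_iff₀ hW]; linarith
    _ = (φ / W * (ρ * (lN / 2)) / 2) * (η * (N / lN) / φ) := by field_simp; norm_num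
    _ ≤ J * a := mul_le_mul h1 ha (by positivity) h2

lemma alg_J (J a X N W φ η lX lN : ℝ) (hX : 0 < X) (hW : 0 < W) (hN : 0 < N) (hφ : 0 < φ) (hη : 0 < η) (hlN : 0 < lN) (hJ0 : 0 ≤ J)
    (hJ : J * a ≤ 3 * X) (ha : η * (N / lN) / φ ≤ a) (hl : lN ≤ 2 * lX) (hWX : W * X ≤ N) (hφW : φ ≤ W) :
    J ≤ 6 / η * lX := by
  have h1 : J * (η * (N / lN) / φ) ≤ 3 * X := le_trans (by gcongr) hJ
  have h2 : J * (η * (N / lN) / φ) = J * (η * N) / (lN * φ) := by field_simp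
  rw [h2, div_le_iff₀ (by positivity)] at h1
  have h3 : 3 * X * (lN * φ) ≤ 3 * N * (2 * lX) := by
    have : X * φ ≤ N := le_trans (by rw [mul_comm]; gcongr) hWX
    calc 3 * X * (lN * φ) = 3 * (X * φ) * lN := by ring
      _ ≤ 3 * N * (2 * lX) := by gcongr
  have h4 : J * η ≤ 6 * lX := by
    refine le_of_mul_le_mul_right ?_ hN
    linarith
  rw [div_mul_eq_mul_div, le_div_iff₀ hη]; exact h4

lemma alg_fin (c X N W P J CJ lN B n : ℝ) (s d : ℕ) (hc : 0 < c) (hX : 0 < X) (hW : 0 < W) (hN : 0 < N) (hP : 0 < P) (hJ : 0 < J) (hlN : 0 < lN)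
    (hCJ : 0 < CJ) (hB : 0 < B)
    (hn : c * X ^ s / (P * J ^ s) ≤ n) (hNX : N ≤ 2 * W * X) (hXN : X ≤ N) (hPB : P ≤ B * X ^ d) (hJC : J ≤ CJ * lN) :
    c / ((2 * W) ^ s * B * CJ ^ s) * N ^ (-(d:ℝ)) * (N / lN) ^ s ≤ n := by
  refine le_trans ?_ hn
  rw [rpow_neg hN.le, rpow_natCast]
  have e : c / ((2 * W) ^ s * B * CJ ^ s) * (N ^ d)⁻¹ * (N / lN) ^ s = c * (N / (2 * W)) ^ s / ((B * N ^ d) * (CJ * lN) ^ s) := by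
    rw [div_pow, div_pow, mul_pow CJ]; field_simp
  rw [e]
  have h1 : N / (2 * W) ≤ X := by rw [div_le_iff₀ (by positivity)]; linarith
  have h2 : P ≤ B * N ^ d := hPB.trans (by gcongr)
  gcongr

lemma A0_card (A : Finset ℕ) (W n q b X : ℕ) (hb : b < W) (hX : X = n - q) (hA : ∀ x ∈ A, x / W ≤ n) :
    #(A.filter (fun x => x % W = b ∧ q + 1 ≤ x / W)) ≤ #((range X).filter (fun y => b + W * (q+1) + W * y ∈ A)) := by
  have key : ∀ x ∈ A.filter (fun x => x % W = b ∧ q + 1 ≤ x / W), b + W * (q+1) + W * (x / W - (q+1)) = x := by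
    intro x hx
    rw [mem_filter] at hx
    have h1 : W * (q+1) + W * (x / W - (q+1)) = W * (x / W) := by rw [← mul_add, Nat.add_sub_cancel' hx.2.2]
    have h2 := Nat.mod_add_div x W
    rw [hx.2.1] at h2
    omega
  refine card_le_card_of_injOn (fun x => x / W - (q+1)) (fun x hx => ?_) (fun x hx y hy hxy => ?_)
  · have h1 := key x hx
    have hx' := mem_filter.1 hx
    have h2 := hA x hx'.1
    have h3 := hx'.2.2
    refine mem_coe.2 (mem_filter.2 ⟨mem_range.2 (show x / W - (q+1) < X by omega), ?_⟩)
    simp only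
    rw [h1]; exact hx'.1
  · rw [← key x hx, ← key y hy]
    simp only at hxy
    rw [hxy]

lemma sol_inj (s : ℕ) (a : Fin s → ℤ) (hsum : ∑ i, a i = 0) (h H : ℤ[X]) (A A0 : Finset ℕ) (W b : ℕ) (κ cc : ℤ) (hW : 1 ≤ W)
    (hh : ∀ y : ℕ, h.eval ((b + W * y : ℕ):ℤ) = cc + κ * H.eval (y:ℤ)) (hA : ∀ y ∈ A0, b + W * y ∈ A) :
    #((Fintype.piFinset fun _ : Fin s => A0).filter (fun y => (∀ i j : Fin s, i ≠ j → y i ≠ y j) ∧ ∑ k, a k * H.eval ((y k : ℕ):ℤ) = 0)) ≤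
      #(solSet s a h A) := by
  have hinj : ∀ y z : ℕ, b + W * y = b + W * z → y = z := fun y z e => Nat.eq_of_mul_eq_mul_left hW (by omega)
  refine card_le_card_of_injOn (fun y i => b + W * y i) (fun y hy => ?_) (fun y hy z hz hyz => ?_)
  · have hy' := mem_filter.1 (mem_coe.1 hy)
    rw [Fintype.mem_piFinset] at hy'
    refine mem_coe.2 (mem_filter.2 ⟨Fintype.mem_piFinset.2 fun i => hA _ (hy'.1 i), fun i j hij e => hy'.2.1 i j hij (hinj _ _ e), ?_⟩)
    simp only [hh, mul_add, sum_add_distrib]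
    rw [← sum_mul, hsum, zero_mul, zero_add]
    calc ∑ i, a i * (κ * H.eval ((y i : ℕ):ℤ)) = κ * ∑ i, a i * H.eval ((y i : ℕ):ℤ) := by
          rw [mul_sum]; exact sum_congr rfl fun _ _ => by ring
      _ = 0 := by rw [hy'.2.2, mul_zero]
  · funext i
    exact hinj _ _ (congrFun hyz i)

set_option maxHeartbeats 2000000 in
theorem main_pos (d T : ℕ) (hd : 2 ≤ d) (hmoment : DiagonalMomentProperty d T)
    (s : ℕ) (hs : 2 * T + 1 ≤ s)
    (h : ℤ[X]) (hdeg : h.natDegree = d) (hl : 0 < h.leadingCoeff)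
    (a : Fin s → ℤ) (ha : ∀ i, a i ≠ 0) (hsum : ∑ i, a i = 0) :
    ∀ δ : ℝ, 0 < δ → ∃ c₂ : ℝ, 0 < c₂ ∧ ∃ N₂ : ℕ, 0 < N₂ ∧
      ∀ N : ℕ, N₂ ≤ N →
        ∀ A : Finset ℕ, A ⊆ primesUpTo N →
          δ * ((primesUpTo N).card : ℝ) ≤ (A.card : ℝ) →
          c₂ * (N : ℝ) ^ (-(d : ℝ)) * ((N : ℝ) / log N) ^ s ≤
            ((solSet s a h A).card : ℝ) := by
  intro δ hδ
  have hdT := dmp_le d T hmoment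
  obtain ⟨ρ, hρ0, hρ1, hloc⟩ := local_count d T s (by omega) hdT hs a ha hsum
  obtain ⟨d', rfl⟩ : ∃ d', d = d' + 2 := ⟨d - 2, by omega⟩
  set Q : ℕ := ⌈1056 / δ⌉₊ + 4 with hQ
  have hQ4 : 4 ≤ Q := by omega
  have hQδ : (1056:ℝ) / Q ≤ δ := by
    have h1 : (1056:ℝ) / δ ≤ Q := by
      rw [hQ]; push_cast
      have := le_ceil ((1056:ℝ) / δ)
      linarith
    rw [div_le_iff₀ hδ] at h1
    rw [div_le_iff₀ (by positivity)]; linarith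
  have hQ1 : (4:ℝ) ≤ Q := mod_cast hQ4
  set Ca : ℕ := (∑ i, (a i).natAbs) + T with hCa
  have hCaz : (∑ i, |a i|) + (T:ℤ) = Ca := by rw [hCa]; push_cast; rfl
  have hCa1 : 1 ≤ Ca := by omega
  have hCa1r : (1:ℝ) ≤ Ca := mod_cast hCa1
  set η := δ / 16 with hη
  have hη0 : 0 < η := by positivity
  set B2 : ℝ := 2 * Ca * (4 * (2 * Q) ^ (d'+1)) with hB2
  have hB21 : 1 ≤ B2 := by
    have : (1:ℝ) ≤ (2 * Q) ^ (d'+1) := one_le_pow₀ (by linarith)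
    nlinarith
  obtain ⟨c, hc, w0, hloc⟩ := hloc (ρ * η / 4) (by positivity) B2 hB21
  set w := max w0 (max (d'+2) h.leadingCoeff.toNat) with hw
  have hw1 : d' + 2 ≤ w := (le_max_left _ _).trans (le_max_right _ _)
  have hw2 : h.leadingCoeff ≤ w := by
    have : h.leadingCoeff.toNat ≤ w := (le_max_right _ _).trans (le_max_right _ _)
    omega
  have hder : h.derivative ≠ 0 := by
    intro h0
    have := congrArg (fun f : ℤ[X] => f.coeff (d'+1)) h0
    simp only [coeff_derivative, Polynomial.coeff_zero] at this
    have h1 : h.coeff (d'+2) ≠ 0 := by rw [← hdeg, coeff_natDegree]; exact hl.ne'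
    rcases mul_eq_zero.1 this with h2 | h2
    · exact h1 h2
    · norm_cast at h2
  obtain ⟨K, W, hW1, hWK, hWb, hpick⟩ := pick h.derivative hder δ hδ w
  have hpick := hpick Q (by omega) hQδ
  obtain ⟨B, hB1, N0, hnice⟩ := H_nice d' Q (by omega) h hdeg hl W hW1
  set CJ := 6 / η with hCJ
  have hCJ0 : 0 < CJ := by positivity
  have hloc := hloc w (le_max_left _ _) hmoment h hdeg B hB1 CJ
  have hW1r : (1:ℝ) ≤ W := mod_cast hW1
  have hXt : Tendsto (fun N : ℕ => N / W - N / W / Q) atTop atTop := by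
    refine Filter.tendsto_atTop_mono (fun N => ?_) (Nat.tendsto_div_const_atTop (show W * 2 ≠ 0 by omega))
    rw [← Nat.div_div_eq_div_mul]
    have : N / W / Q ≤ N / W / 4 := Nat.div_le_div_left hQ4 (by norm_num)
    omega
  refine ⟨c / ((2 * W) ^ s * (B2 * B) * CJ ^ s), by positivity, ?_⟩
  have hev := (hXt.eventually hloc).and (hpick.and ((ev_const (Q+1) (1/2) (by norm_num)).and
    (eventually_ge_atTop (N0 + 4 * W * W + 3))))
  obtain ⟨N2, hN2⟩ := eventually_atTop.1 hev
  refine ⟨N2 + 1, Nat.succ_pos _, fun N hN A hA hAc => ?_⟩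
  obtain ⟨hL, hP, hQN, hNbig⟩ := hN2 N (by omega)
  obtain ⟨b, hbW, hbp, hbc⟩ := hP A hA hAc
  rw [← Nat.div_div_eq_div_mul] at hbc
  clear hpick hN2 hXt hloc hP hev
  set n := N / W with hn
  set q := n / Q with hq
  set X := n - q with hX
  -- elementary size facts
  have hWn : W * n ≤ N := Nat.mul_div_le N W
  have hWn2 : N < W * (n + 1) := Nat.lt_mul_div_succ N hW1
  have hq4 : 4 * q ≤ n := by
    have : q * Q ≤ n := Nat.div_mul_le_self n Q
    nlinarith
  have hq2 : n < Q * (q + 1) := Nat.lt_mul_div_succ n (by omega)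
  have hn4 : 4 ≤ n := by
    by_contra hlt
    have : W * (n+1) ≤ W * 4 := Nat.mul_le_mul_left W (by omega)
    nlinarith
  have f1 : N ≤ 2 * W * X := by
    have : W * (n+1) ≤ W * (2 * X) := Nat.mul_le_mul_left W (by omega)
    nlinarith
  have f2 : W * X ≤ N := (Nat.mul_le_mul_left W (by omega)).trans hWn
  set b' := b + W * (q+1) with hb'
  have f3 : N ≤ Q * b' := by
    have h1 : W * (n+1) ≤ W * (Q * (q+1)) := Nat.mul_le_mul_left W (by omega)
    have h2 : Q * (W * (q+1)) ≤ Q * b' := Nat.mul_le_mul_left Q (by omega)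
    nlinarith
  have f4 : b' + W * X ≤ 2 * N := by
    have h1 : W * (q+1) + W * X = W * n + W := by rw [← mul_add, show q + 1 + X = n + 1 by omega]; ring
    nlinarith
  have hX1 : 1 ≤ X := by omega
  have hNr : (3:ℝ) ≤ N := mod_cast (by omega : 3 ≤ N)
  have hN0 : (0:ℝ) < N := by linarith
  have hX1r : (1:ℝ) ≤ X := mod_cast hX1
  have hX0 : (0:ℝ) < X := by linarith
  have hlN : 0 < log N := log_pos (by linarith)
  have f1r : (N:ℝ) ≤ 2 * W * X := mod_cast f1
  have f2r : (W:ℝ) * X ≤ N := mod_cast f2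
  have hXN : (X:ℝ) ≤ N := by nlinarith
  have hlX : log N ≤ 2 * log X := by
    have h1 : (2:ℝ) * log X = log ((X:ℝ)^2) := by rw [Real.log_pow]; norm_num
    rw [h1]
    refine log_le_log hN0 ?_
    have h2 : (4:ℝ) * W * W ≤ N := mod_cast (by omega : 4 * W * W ≤ N)
    have h3 : (N:ℝ) * N ≤ (2 * W * X) * (2 * W * X) := by gcongr
    have h4 : (2 * W * X) * (2 * W * X) ≤ (N:ℝ) * (X:ℝ)^2 := by
      calc (2 * (W:ℝ) * X) * (2 * W * X) = (4 * W * W) * X ^ 2 := by ring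
        _ ≤ _ := by gcongr
    exact le_of_mul_le_mul_left (h3.trans h4) hN0
  have hlXN : log X ≤ log N := log_le_log hX0 hXN
  have hbp' : ∀ p : ℕ, p.Prime → p ≤ w → ¬ (p:ℤ) ^ K ∣ h.derivative.eval (b':ℤ) := by
    intro p hp hpw hdv
    refine hbp p hp hpw ?_
    have e1 : (p:ℤ) ^ K ∣ (b':ℤ) - (b:ℤ) := by
      rw [hb']; push_cast
      rw [add_sub_cancel_left]
      exact Dvd.dvd.mul_right (mod_cast hWK p hp hpw) _
    exact (dvd_iff_dvd_of_dvd_sub (e1.trans (sub_dvd_eval_sub (b':ℤ) (b:ℤ) _))).1 hdv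
  obtain ⟨H, κ, hκ1, hκ2, hHev, hH0, hHd, hHl1, hHl2, hRough⟩ := H_exists (d'+2) w W b' K h hdeg hd hl hw1 hw2 hW1 hWK hWb hbp'
  obtain ⟨hNice, hBX, hHX⟩ := hnice N X b' H κ (by omega) f1 f2 f3 f4 hκ1 hκ2 hHev hH0 hHd hHl1 hHl2
  have hHX1 : 1 ≤ H.eval (X:ℤ) := by
    have h1 := hNice.mono 0 hX1
    have h2 := hNice.le_of_le X le_rfl 1 hX1
    simp only [Nat.cast_zero, hH0] at h1
    simp only [zero_add] at h1
    omega
  -- the prime P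
  obtain ⟨P, hPp, hPl, hPu⟩ := Nat.exists_prime_lt_and_le_two_mul (Ca * (H.eval (X:ℤ)).toNat) (by
    have : 1 ≤ (H.eval (X:ℤ)).toNat := by omega
    exact (Nat.mul_pos hCa1 this).ne')
  have hMz : (((H.eval (X:ℤ)).toNat : ℕ):ℤ) = H.eval (X:ℤ) := Int.toNat_of_nonneg (by omega)
  have hPlz : ((∑ i, |a i|) + (T:ℤ)) * H.eval (X:ℤ) < P := by
    rw [hCaz, ← hMz]; exact_mod_cast hPl
  have hPur : (P:ℝ) ≤ 2 * Ca * ((H.eval (X:ℤ) : ℤ):ℝ) := by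
    have : (P:ℤ) ≤ 2 * (Ca * H.eval (X:ℤ)) := by rw [← hMz]; exact_mod_cast hPu
    have : (P:ℝ) ≤ 2 * (Ca * ((H.eval (X:ℤ) : ℤ):ℝ)) := mod_cast this
    linarith
  have hPB : (P:ℝ) ≤ B2 * (X * (((H.eval 1 : ℤ):ℝ) - (H.eval 0 : ℤ))) := by
    refine hPur.trans ((mul_le_mul_of_nonneg_left hHX (by positivity)).trans (le_of_eq ?_))
    rw [hB2]; ring
  have hPX : (P:ℝ) ≤ B2 * B * (X:ℝ) ^ (d'+2) := by
    have h1 : (X:ℝ) * (((H.eval 1 : ℤ):ℝ) - (H.eval 0 : ℤ)) ≤ ((H.eval (X:ℤ) : ℤ):ℝ) - (H.eval 0 : ℤ) := mod_cast hNice.gap_mul_le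
    refine hPB.trans ((mul_le_mul_of_nonneg_left (h1.trans hNice.top) (by linarith)).trans (le_of_eq ?_))
    ring
  -- the set A0
  set A0 := (range X).filter (fun y => b' + W * y ∈ A) with hA0
  have hAp : ∀ x ∈ A, x.Prime ∧ x / W ≤ n := by
    intro x hx
    have := hA hx
    simp only [primesUpTo, mem_filter, mem_range] at this
    exact ⟨this.2, Nat.div_le_div_right (by omega)⟩
  have hA0c : η * (N / log N) / totient W ≤ (#A0 : ℝ) := by
    refine hbc.trans ?_
    exact_mod_cast A0_card A W n q b X hbW rfl (fun x hx => (hAp x hx).2)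
  obtain ⟨hR1, hRX, hRl⟩ := floor_rpow_facts X hX1 ρ hρ0
  set R := ⌊(X:ℝ)^ρ⌋₊ with hR
  have hRb : R < b' := by
    have h1 : (X:ℝ) ^ ρ ≤ (N:ℝ) ^ (1/2:ℝ) :=
      (rpow_le_rpow hX0.le hXN hρ0.le).trans (rpow_le_rpow_of_exponent_le (by linarith) (by linarith))
    have h2 : (N:ℝ) = (N:ℝ) ^ (1/2:ℝ) * (N:ℝ) ^ (1/2:ℝ) := by rw [← rpow_add hN0]; norm_num
    have h3 : (N:ℝ) ≤ Q * b' := mod_cast f3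
    have h4 : (0:ℝ) < (N:ℝ) ^ (1/2:ℝ) := by positivity
    have h5 : (Q:ℝ) * R < Q * b' := by
      calc (Q:ℝ) * R ≤ Q * (N:ℝ) ^ (1/2:ℝ) := by gcongr; exact hRX.trans h1
        _ < (Q+1) * (N:ℝ) ^ (1/2:ℝ) := by nlinarith
        _ ≤ (N:ℝ) ^ (1/2:ℝ) * (N:ℝ) ^ (1/2:ℝ) := by gcongr
        _ ≤ _ := by rw [← h2]; exact h3
    exact_mod_cast lt_of_mul_lt_mul_left h5 (by positivity)
  have hA0p : ∀ y ∈ A0, (b' + W * y).Prime ∧ R < b' + W * y := by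
    intro y hy
    exact ⟨(hAp _ (mem_filter.1 hy).2).1, by omega⟩
  have hφ0 : (0:ℝ) < totient W := mod_cast Nat.totient_pos.2 hW1
  have hφW : (totient W : ℝ) ≤ W := mod_cast Nat.totient_le W
  have hJ1 := JJ_ge_one W R hR1
  have hJl := JJ_lower W R (by omega)
  have hJa : JJ W R * #A0 ≤ 3 * X := by
    have h1 : ∑ y ∈ A0, nu W b' R y ≤ ∑ y ∈ range X, nu W b' R y :=
      sum_le_sum_of_subset_of_nonneg (filter_subset _ _) fun y _ _ => nu_nonneg _ _ _ _
    have h2 : ∑ y ∈ A0, nu W b' R y = JJ W R * #A0 := by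
      rw [sum_congr rfl fun y hy => nu_prime W b' R y hR1 (hA0p y hy).1 (hA0p y hy).2, sum_const, nsmul_eq_mul, mul_comm]
    have h3 := (abs_le.1 (nu_mass W b' R X hR1)).2
    have h4 : (R:ℝ) ^ 4 ≤ X := by
      calc (R:ℝ) ^ 4 ≤ ((X:ℝ)^ρ) ^ 4 := by gcongr
        _ = (X:ℝ) ^ (ρ * 4) := by rw [← rpow_natCast, ← rpow_mul hX0.le]; norm_num
        _ ≤ (X:ℝ) ^ (1:ℝ) := rpow_le_rpow_of_exponent_le hX1r (by linarith)
        _ = X := rpow_one _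
    linarith
  have hdens : ρ * η / 4 ≤ JJ W R * #A0 / X :=
    alg_dens (JJ W R) #A0 X N W (totient W) ρ η (log X) (log N) hX0 (by linarith) hN0 hφ0 hρ0 hη0 hlN
      (le_trans (by gcongr) hJl) hA0c hlX f2r
  have hJu : JJ W R ≤ CJ * log X :=
    alg_J (JJ W R) #A0 X N W (totient W) η (log X) (log N) hX0 (by linarith) hN0 hφ0 hη0 hlN (by linarith) hJa hA0c hlX f2r hφW
  have hh : ∀ y : ℕ, h.eval ((b' + W * y : ℕ):ℤ) = h.eval (b':ℤ) + κ * H.eval (y:ℤ) := by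
    intro y; rw [← hHev]; push_cast; rfl
  have hfinal := hL W b' P H κ (h.eval (b':ℤ)) hNice hRough hH0 hPp hPlz hPB hW1 (by omega) hBX hh A0 (filter_subset _ _) hA0p hdens hJu
  have hcard := sol_inj s a hsum h H A A0 W b' κ (h.eval (b':ℤ)) hW1 hh (fun y hy => (mem_filter.1 hy).2)
  refine alg_fin c X N W P (JJ W R) CJ (log N) (B2 * B) _ s (d'+2) hc hX0 (by linarith) hN0 (mod_cast hPp.pos) (by linarith) hlN hCJ0
    (by positivity) (hfinal.trans (mod_cast hcard)) f1r hXN hPX (hJu.trans (by gcongr))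

theorem solSet_neg (s : ℕ) (a : Fin s → ℤ) (h : ℤ[X]) (A : Finset ℕ) :
    solSet s a (-h) A = solSet s a h A := by
  unfold solSet
  refine filter_congr fun x _ => ?_
  simp only [Polynomial.eval_neg, mul_neg, sum_neg_distrib, neg_eq_zero]

end Proof

theorem dense_solution_count_in_primes
    (d T : ℕ) (hd : 2 ≤ d) (hT : 0 < T) (hmoment : DiagonalMomentProperty d T)
    (s : ℕ) (hs : 2 * T + 1 ≤ s)
    (h : Polynomial ℤ) (hdeg : h.natDegree = d)
    (a : Fin s → ℤ) (ha : ∀ i, a i ≠ 0) (hsum : ∑ i, a i = 0) :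
    ∀ δ : ℝ, 0 < δ → ∃ c₂ : ℝ, 0 < c₂ ∧ ∃ N₂ : ℕ, 0 < N₂ ∧
      ∀ N : ℕ, N₂ ≤ N →
        ∀ A : Finset ℕ, A ⊆ primesUpTo N →
          δ * ((primesUpTo N).card : ℝ) ≤ (A.card : ℝ) →
          c₂ * (N : ℝ) ^ (-(d : ℝ)) * ((N : ℝ) / Real.log N) ^ s ≤
            ((solSet s a h A).card : ℝ) := by
  have h0 : h ≠ 0 := by
    rintro rfl
    simp at hdeg
    omega
  rcases lt_or_gt_of_ne (Polynomial.leadingCoeff_ne_zero.2 h0) with hl | hl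
  · have := main_pos d T hd hmoment s hs (-h) (by rwa [Polynomial.natDegree_neg])
      (by rw [Polynomial.leadingCoeff_neg]; omega) a ha hsum
    simpa only [solSet_neg] using this
  · exact main_pos d T hd hmoment s hs h hdeg hl a ha hsum
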